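/- Let n ≥ 3 and p > (n−1)/2, and let the exponents satisfy q > 2, 2 ≤ r < ∞, 2/q + (n−1)/r ≤ (n−1)/2, and σ = 1/q + n/r − (n−1)/2. There is a constant C > 0, depending only on n, p, q, r, such that for every measurable V : ℝ^n → ℂ with ‖V‖_{F^p} < ∞ and every function G : ℝ^n × ℝ → ℂ such that G(·,s) is a Schwartz function for each s, (x,s) ↦ G(x,s) is continuous, and G is compactly supported in s, ‖ (√−Δ)^{σ−1} ∫_{−∞}^t sin((t−s)√−Δ) G(·,s) ds ‖_{L²_{x,t}(|V|)} ≤ C ‖V‖_{F^p}^{1/2} ‖G‖_{L^{q'}_t L^{r'}_x}, where q', r' are the conjugate exponents of q, r. -/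

import Mathlib

noncomputable section

open MeasureTheory Metric Complex
open scoped ENNReal FourierTransform SchwartzMap

/-- The Fourier multiplier operator `m(√−Δ)` on `ℝⁿ`:
`m(√−Δ)h = 𝓕⁻¹(m(|ξ|) 𝓕h(ξ))`. -/
def mOp (n : ℕ) (m : ℝ → ℂ) (h : EuclideanSpace ℝ (Fin n) → ℂ) :
    EuclideanSpace ℝ (Fin n) → ℂ :=
  fun x => 𝓕⁻ (fun ξ : EuclideanSpace ℝ (Fin n) => m ‖ξ‖ * 𝓕 h ξ) x

/-- The multiplier of `e^{it√−Δ}`, i.e. `ρ ↦ e^{itρ}`. -/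
def expMult (t : ℝ) : ℝ → ℂ := fun ρ => Complex.exp (Complex.I * t * ρ)

/-- The multiplier of `cos(t√−Δ)`, i.e. `ρ ↦ cos (tρ)`. -/
def cosMult (t : ℝ) : ℝ → ℂ := fun ρ => ((Real.cos (t * ρ) : ℝ) : ℂ)

/-- The multiplier of `sin(t√−Δ)/√−Δ`, i.e. `ρ ↦ sin (tρ)/ρ`. -/
def sincMult (t : ℝ) : ℝ → ℂ := fun ρ => ((Real.sin (t * ρ) / ρ : ℝ) : ℂ)

/-- The multiplier of `sin(t√−Δ)`, i.e. `ρ ↦ sin (tρ)`. -/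
def sinMult (t : ℝ) : ℝ → ℂ := fun ρ => ((Real.sin (t * ρ) : ℝ) : ℂ)

/-- The multiplier of `(√−Δ)^γ`, i.e. `ρ ↦ ρ^γ`. -/
def powMult (γ : ℝ) : ℝ → ℂ := fun ρ => ((ρ ^ γ : ℝ) : ℂ)

/-- A function is Schwartz if it agrees pointwise with some Schwartz map. -/
def IsSchwartz {n : ℕ} (h : EuclideanSpace ℝ (Fin n) → ℂ) : Prop :=
  ∃ φ : 𝓢(EuclideanSpace ℝ (Fin n), ℂ), ∀ x, h x = φ x

/-- The Fefferman–Phong norm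
`‖V‖_{𝓕^p} = sup_{x, r>0} r^(2-n/p) (∫_{B_r(x)} |V|^p)^(1/p)`. -/
def fpNorm (n : ℕ) (p : ℝ) (V : EuclideanSpace ℝ (Fin n) → ℂ) : ℝ≥0∞ :=
  ⨆ (x : EuclideanSpace ℝ (Fin n)) (r : ℝ) (_ : 0 < r),
    ENNReal.ofReal (r ^ (2 - n / p)) *
      (∫⁻ y in ball x r, ENNReal.ofReal (‖V y‖ ^ p)) ^ (1 / p)

/-- The weak `L^{n/2}` quasinorm `sup_{λ>0} λ · |{|V| > λ}|^{2/n}`. -/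
def wkNorm (n : ℕ) (V : EuclideanSpace ℝ (Fin n) → ℂ) : ℝ≥0∞ :=
  ⨆ (l : ℝ) (_ : 0 < l),
    ENNReal.ofReal l * (volume {x : EuclideanSpace ℝ (Fin n) | l < ‖V x‖}) ^ ((2 : ℝ) / n)

/-- The mixed norm `‖F‖_{L^q_t L^r_x}` for `F : ℝⁿ × ℝ → ℂ`, curried as `F x t`. -/
def mixedNorm (n : ℕ) (q r : ℝ) (F : EuclideanSpace ℝ (Fin n) → ℝ → ℂ) : ℝ≥0∞ :=
  (∫⁻ t : ℝ, (∫⁻ x : EuclideanSpace ℝ (Fin n), (‖F x t‖₊ : ℝ≥0∞) ^ r) ^ (q / r)) ^ (1 / q)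

/-- The weighted norm `‖h‖_{L²_{x,t}(w)}` with weight `w : ℝⁿ → [0,∞]`. -/
def wtNorm (n : ℕ) (w : EuclideanSpace ℝ (Fin n) → ℝ≥0∞)
    (h : EuclideanSpace ℝ (Fin n) → ℝ → ℂ) : ℝ≥0∞ :=
  (∫⁻ t : ℝ, ∫⁻ x : EuclideanSpace ℝ (Fin n), (‖h x t‖₊ : ℝ≥0∞) ^ (2 : ℝ) * w x) ^ ((1 : ℝ) / 2)

/-- The homogeneous Sobolev norm `‖h‖_{Ḣ^γ} = ‖(√−Δ)^γ h‖_{L²}`. -/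
def sobNorm (n : ℕ) (γ : ℝ) (h : EuclideanSpace ℝ (Fin n) → ℂ) : ℝ≥0∞ :=
  eLpNorm (mOp n (powMult γ) h) 2 volume

/-- The point `x/|x|` of the unit sphere, for `x ≠ 0`. -/
def sphMap (n : ℕ) (x : EuclideanSpace ℝ (Fin n)) (hx : x ≠ 0) :
    Metric.sphere (0 : EuclideanSpace ℝ (Fin n)) 1 :=
  ⟨‖x‖⁻¹ • x, by
    rw [mem_sphere_zero_iff_norm, norm_smul, norm_inv, norm_norm,
      inv_mul_cancel₀ (norm_ne_zero_iff.mpr hx)]⟩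

set_option linter.all false

local notation "ofR" => ENNReal.ofReal
local notation "dimR" => Module.finrank ℝ
open ENNReal (ofReal_ne_top mul_ne_top ofReal_le_ofReal mul_rpow_of_nonneg rpow_ne_top_of_nonneg ofReal_rpow_of_nonneg zero_rpow_of_pos rpow_le_rpow rpow_le_rpow_of_exponent_le lintegral_mul_norm_pow_le ofReal_rpow_of_pos ofReal_lt_top mul_lt_top rpow_mul)
open Filter.Eventually (of_forall)

variable {E : Type*} [NormedAddCommGroup E] [InnerProductSpace ℝ E] [FiniteDimensional ℝ E]
  [MeasurableSpace E] [BorelSpace E]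

section Kernel

theorem int_pow_exp (a : ℝ) (ha : 0 < a) (m : ℕ) :
    Integrable (fun ξ : E => ‖ξ‖ ^ m * Real.exp (-a * ‖ξ‖)) := by
  set d := dimR E
  have h1 : Integrable (fun ξ : E => (1 + ‖ξ‖) ^ (-((d + 1 : ℕ) : ℝ))) := by
    apply integrable_one_add_norm; push_cast; linarith
  set K := m + (d + 1)
  refine (h1.const_mul (K.factorial / a ^ K * Real.exp a)).mono' ?_ ?_
  · apply Continuous.aestronglyMeasurable; fun_prop
  · refine of_forall fun ξ => ?_
    have hr : 0 ≤ ‖ξ‖ := norm_nonneg _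
    set r := ‖ξ‖
    rw [Real.norm_of_nonneg (by positivity), Real.rpow_neg (by positivity), Real.rpow_natCast]
    have h2 := Real.pow_div_factorial_le_exp (a * (1 + r)) (by positivity) K
    rw [div_le_iff₀ (by positivity), mul_pow] at h2
    have h3 : (r : ℝ) ^ m ≤ (1 + r) ^ m := by gcongr; linarith
    rw [← div_eq_mul_inv, le_div_iff₀ (by positivity)]
    have h4 : (1 + r) ^ K ≤ K.factorial / a ^ K * Real.exp (a * (1 + r)) := by
      rw [div_mul_eq_mul_div, le_div_iff₀ (by positivity)]; nlinarith
    calc r ^ m * Real.exp (-a * r) * (1 + r) ^ (d + 1)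
        ≤ (1 + r) ^ m * Real.exp (-a * r) * (1 + r) ^ (d + 1) := by gcongr
      _ = (1 + r) ^ K * Real.exp (-a * r) := by rw [pow_add]; ring
      _ ≤ K.factorial / a ^ K * Real.exp (a * (1 + r)) * Real.exp (-a * r) := by gcongr
      _ = K.factorial / a ^ K * Real.exp a := by
        rw [mul_assoc, ← Real.exp_add]; congr 2; ring

theorem int_exp_norm (a : ℝ) (ha : 0 < a) :
    Integrable (fun ξ : E => Real.exp (-a * ‖ξ‖)) := by
  simpa using int_pow_exp (E := E) a ha 0

theorem cexp_lip (c : ℝ) (u v : ℂ) (hu : u.re ≤ c) (hv : v.re ≤ c) :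
    ‖cexp u - cexp v‖ ≤ Real.exp c * ‖u - v‖ := by
  refine Convex.norm_image_sub_le_of_norm_deriv_le (𝕜 := ℂ) (f := cexp) (s := {w : ℂ | w.re ≤ c})
    (fun w _ => Complex.differentiableAt_exp) ?_ ?_ hv hu
  · intro w hw
    simp only [Complex.deriv_exp, Complex.norm_exp]
    exact Real.exp_le_exp.mpr hw
  · exact convex_halfSpace_re_le c

/-- exponential phase -/
def ph (x ξ : E) : ℂ := cexp (((2 * Real.pi * inner ℝ x ξ : ℝ) : ℂ) * I)

theorem norm_ph (x ξ : E) : ‖ph x ξ‖ = 1 := by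
  rw [ph, Complex.norm_exp_ofReal_mul_I]

/-- integrand of the Poisson kernel -/
def ek (z : ℂ) (x ξ : E) : ℂ := cexp (((2 * Real.pi * inner ℝ x ξ : ℝ) : ℂ) * I - z * (‖ξ‖ : ℝ))

/-- the Poisson kernel with complex time -/
def ker (z : ℂ) (x : E) : ℂ := ∫ ξ : E, ek z x ξ

theorem norm_ek (z : ℂ) (x ξ : E) : ‖ek z x ξ‖ = Real.exp (-z.re * ‖ξ‖) := by
  rw [ek, Complex.norm_exp]; congr 1; simp

theorem cont_ek (z : ℂ) (x : E) : Continuous (fun ξ => ek z x ξ) := by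
  unfold ek; fun_prop

theorem int_ek (z : ℂ) (hz : 0 < z.re) (x : E) : Integrable (fun ξ => ek z x ξ) := by
  refine (int_exp_norm z.re hz).mono' (cont_ek z x).aestronglyMeasurable ?_
  exact of_forall fun ξ => (norm_ek z x ξ).le

theorem int_mul_ek (z : ℂ) (hz : 0 < z.re) (x : E) (m : ℕ) (g : E → ℂ) (hg : Measurable g)
    (C : ℝ) (hb : ∀ ξ, ‖g ξ‖ ≤ C * ‖ξ‖ ^ m) : Integrable (fun ξ => g ξ * ek z x ξ) := by
  refine ((int_pow_exp z.re hz m).const_mul C).mono'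
    (hg.aestronglyMeasurable.mul (cont_ek z x).aestronglyMeasurable) ?_
  refine of_forall fun ξ => ?_
  rw [norm_mul, norm_ek, ← mul_assoc]
  gcongr; exact hb ξ

/-- derivative in the real part of `z` -/
theorem deriv_R (z : ℂ) (hz : 0 < z.re) (x : E) (m : ℕ) (g : E → ℂ) (hg : Measurable g)
    (C : ℝ) (hb : ∀ ξ, ‖g ξ‖ ≤ C * ‖ξ‖ ^ m) (R : ℝ) (hR : 0 ≤ R) :
    HasDerivAt (fun R : ℝ => ∫ ξ, g ξ * ek (z + R) x ξ)
      (-∫ ξ, g ξ * (‖ξ‖ : ℝ) * ek (z + R) x ξ) R := by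
  have hre : ∀ R : ℝ, (z + (R : ℂ)).re = z.re + R := fun R => by simp
  have hs : Set.Ioi (-(z.re / 2)) ∈ nhds R := Ioi_mem_nhds (by linarith)
  rw [← integral_neg]
  refine (hasDerivAt_integral_of_dominated_loc_of_deriv_le (𝕜 := ℝ) (s := Set.Ioi (-(z.re / 2)))
    (F := fun (R : ℝ) ξ => g ξ * ek (z + R) x ξ)
    (F' := fun (R : ℝ) ξ => -(g ξ * (‖ξ‖ : ℝ) * ek (z + R) x ξ))
    (bound := fun ξ => C * (‖ξ‖ ^ (m+1) * Real.exp (-(z.re/2) * ‖ξ‖)))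
    hs ?_ ?_ ?_ ?_ ?_ ?_).2
  · exact of_forall fun R =>
      hg.aestronglyMeasurable.mul (cont_ek _ x).aestronglyMeasurable
  · exact int_mul_ek (z + R) (by rw [hre]; linarith) x m g hg C hb
  · apply AEStronglyMeasurable.neg
    refine AEStronglyMeasurable.mul ?_ (cont_ek _ x).aestronglyMeasurable
    refine hg.aestronglyMeasurable.mul ?_
    apply Continuous.aestronglyMeasurable; fun_prop
  · refine of_forall fun ξ R hR => ?_
    have hR' : -(z.re / 2) < R := hR
    rw [norm_neg, norm_mul, norm_mul, norm_ek, hre, pow_succ, Complex.norm_real, norm_norm,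
      ← mul_assoc, ← mul_assoc]
    have h0 := hb ξ
    have h00 := (norm_nonneg _).trans h0
    have h01 : -(z.re + R) * ‖ξ‖ ≤ -(z.re/2) * ‖ξ‖ := by
      apply mul_le_mul_of_nonneg_right _ (norm_nonneg _); linarith
    gcongr
  · exact (int_pow_exp _ (by linarith) _).const_mul C
  · refine of_forall fun ξ R hR => ?_
    unfold ek
    have h1 : HasDerivAt (fun R : ℝ => ((2 * Real.pi * inner ℝ x ξ : ℝ) : ℂ) * I -
        (z + (R : ℂ)) * (‖ξ‖ : ℝ)) (-((1 : ℂ) * (‖ξ‖ : ℝ))) R := by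
      refine HasDerivAt.const_sub _ ?_
      refine HasDerivAt.mul_const ?_ _
      exact (Complex.ofRealCLM.hasDerivAt (x := R)).const_add z
    have h2 := (h1.cexp).const_mul (g ξ)
    refine h2.congr_deriv ?_
    ring

theorem hasDerivAt_norm_add_smul (ξ x : E) (hξ : ξ ≠ 0) :
    HasDerivAt (fun τ : ℝ => ‖ξ + τ • x‖) (inner ℝ x ξ / ‖ξ‖) 0 := by
  have h1 : HasDerivAt (fun τ : ℝ => ξ + τ • x) x 0 := by
    simpa using ((hasDerivAt_id (0:ℝ)).smul_const x).const_add ξ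
  have h2 := (h1.norm_sq).sqrt (by simpa using hξ)
  simp only [Real.sqrt_sq (norm_nonneg _)] at h2
  convert h2 using 1
  simp only [zero_smul, add_zero]
  rw [real_inner_comm]
  have : ‖ξ‖ ≠ 0 := norm_ne_zero_iff.mpr hξ
  field_simp

/-- translation identity -/
theorem trans_id (z : ℂ) (hz : 0 < z.re) (x : E) (hd : 0 < dimR E) :
    ((2 * Real.pi * ‖x‖ ^ 2 : ℝ) : ℂ) * I * ker z x =
      z * ∫ ξ, ((inner ℝ x ξ / ‖ξ‖ : ℝ) : ℂ) * ek z x ξ := by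
  haveI : Nontrivial E := Module.finrank_pos_iff.mp hd
  have hms : Measurable fun ξ : E => ((inner ℝ x ξ / ‖ξ‖ : ℝ) : ℂ) := by fun_prop
  have hbd : ∀ ξ : E, ‖((inner ℝ x ξ / ‖ξ‖ : ℝ) : ℂ)‖ ≤ ‖x‖ * ‖ξ‖ ^ 0 := by
    intro ξ
    rw [Complex.norm_real, norm_div, norm_norm, pow_zero, mul_one]
    rcases eq_or_ne ξ 0 with rfl | h
    · simp
    · rw [div_le_iff₀ (norm_pos_iff.mpr h)]
      exact norm_inner_le_norm x ξ
  have key := (hasDerivAt_integral_of_dominated_loc_of_lip (𝕜 := ℝ) (s := Metric.ball (0:ℝ) 1)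
    (F := fun (τ : ℝ) ξ => ek z x (ξ + τ • x)) (x₀ := 0)
    (F' := fun ξ => (((2 * Real.pi * ‖x‖ ^ 2 : ℝ) : ℂ) * I
      - z * ((inner ℝ x ξ / ‖ξ‖ : ℝ) : ℂ)) * ek z x ξ)
    (bound := fun ξ => Real.exp (z.re * ‖x‖) * (2 * Real.pi * ‖x‖ ^ 2 + ‖z‖ * ‖x‖) *
      Real.exp (-z.re * ‖ξ‖))
    (μ := (volume : Measure E)) (ball_mem_nhds _ one_pos) ?_ ?_ ?_ ?_ ?_ ?_).2
  · have h0 : (fun τ : ℝ => ∫ ξ, ek z x (ξ + τ • x)) = fun _ => ker z x := by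
      ext τ
      exact integral_add_right_eq_self (fun ξ => ek z x ξ) (τ • x)
    rw [h0] at key
    have h1 := key.unique (hasDerivAt_const (0:ℝ) (ker z x))
    simp only [sub_mul] at h1
    rw [integral_sub] at h1
    · rw [sub_eq_zero, integral_const_mul] at h1
      rw [ker, h1, ← integral_const_mul]
      congr 1; ext ξ; ring
    · exact (int_ek z hz x).const_mul _
    · have := (int_mul_ek z hz x 0 _ hms ‖x‖ hbd).const_mul z
      refine this.congr (of_forall fun ξ => ?_)
      simp only; ring
  · exact of_forall fun τ => (by
      apply Continuous.aestronglyMeasurable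
      exact (cont_ek z x).comp (by fun_prop))
  · simpa using int_ek z hz x
  · refine AEStronglyMeasurable.mul ?_ (cont_ek z x).aestronglyMeasurable
    exact ((measurable_const.sub (hms.const_mul z))).aestronglyMeasurable
  · refine of_forall fun ξ => ?_
    refine LipschitzOnWith.of_dist_le_mul fun τ hτ τ' hτ' => ?_
    rw [mem_ball_zero_iff] at hτ hτ'
    rw [dist_eq_norm, Real.coe_nnabs, abs_of_nonneg (by positivity)]
    have hre : ∀ τ : ℝ, ‖τ‖ < 1 → (((2 * Real.pi * inner ℝ x (ξ + τ • x) : ℝ) : ℂ) * I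
        - z * (‖ξ + τ • x‖ : ℝ)).re ≤ z.re * ‖x‖ + -z.re * ‖ξ‖ := by
      intro τ hτ
      have h1 : ‖ξ‖ ≤ ‖ξ + τ • x‖ + ‖x‖ := by
        calc ‖ξ‖ = ‖(ξ + τ • x) - τ • x‖ := by simp
          _ ≤ ‖ξ + τ • x‖ + ‖τ • x‖ := norm_sub_le _ _
          _ ≤ _ := by rw [norm_smul]; gcongr; nlinarith [norm_nonneg x]
      simp
      nlinarith
    have := cexp_lip _ _ _ (hre τ hτ) (hre τ' hτ')
    refine this.trans ?_
    rw [Real.exp_add, dist_eq_norm]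
    have h2 : ‖(((2 * Real.pi * inner ℝ x (ξ + τ • x) : ℝ) : ℂ) * I
        - z * (‖ξ + τ • x‖ : ℝ)) - (((2 * Real.pi * inner ℝ x (ξ + τ' • x) : ℝ) : ℂ) * I
        - z * (‖ξ + τ' • x‖ : ℝ))‖ ≤ (2 * Real.pi * ‖x‖ ^ 2 + ‖z‖ * ‖x‖) * ‖τ - τ'‖ := by
      have e1 : (((2 * Real.pi * inner ℝ x (ξ + τ • x) : ℝ) : ℂ) * I
        - z * (‖ξ + τ • x‖ : ℝ)) - (((2 * Real.pi * inner ℝ x (ξ + τ' • x) : ℝ) : ℂ) * I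
        - z * (‖ξ + τ' • x‖ : ℝ)) = ((2 * Real.pi * ‖x‖^2 * (τ - τ') : ℝ) : ℂ) * I -
          z * ((‖ξ + τ • x‖ - ‖ξ + τ' • x‖ : ℝ) : ℂ) := by
        simp only [inner_add_right, inner_smul_right, real_inner_self_eq_norm_sq]
        push_cast; ring
      rw [e1]
      refine (norm_sub_le _ _).trans ?_
      rw [norm_mul, norm_mul, Complex.norm_I, mul_one, Complex.norm_real, Complex.norm_real,
        norm_mul, add_mul, Real.norm_of_nonneg (by positivity : 0 ≤ 2 * Real.pi * ‖x‖ ^ 2),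
        mul_assoc ‖z‖]
      gcongr
      calc ‖‖ξ + τ • x‖ - ‖ξ + τ' • x‖‖ ≤ ‖(ξ + τ • x) - (ξ + τ' • x)‖ := abs_norm_sub_norm_le _ _
        _ = ‖x‖ * ‖τ - τ'‖ := by
          rw [add_sub_add_left_eq_sub, ← sub_smul, norm_smul, mul_comm]
    calc _ ≤ Real.exp (z.re * ‖x‖) * Real.exp (-z.re * ‖ξ‖) * _ :=
          mul_le_mul_of_nonneg_left h2 (by positivity)
      _ = _ := by ring
  · exact (int_exp_norm _ hz).const_mul _
  · have : ∀ᵐ ξ : E, ξ ≠ 0 := by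
      rw [ae_iff]; simp
    filter_upwards [this] with ξ hξ
    have h1 := hasDerivAt_norm_add_smul ξ x hξ
    have h2 : HasDerivAt (fun τ : ℝ => (((2 * Real.pi * inner ℝ x (ξ + τ • x) : ℝ) : ℂ) * I
        - z * (‖ξ + τ • x‖ : ℝ))) (((2 * Real.pi * ‖x‖ ^ 2 : ℝ) : ℂ) * I
      - z * ((inner ℝ x ξ / ‖ξ‖ : ℝ) : ℂ)) 0 := by
      refine HasDerivAt.sub (HasDerivAt.mul_const ?_ _) (HasDerivAt.const_mul _ h1.ofReal_comp)
      refine HasDerivAt.ofReal_comp ?_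
      refine HasDerivAt.const_mul _ ?_
      simp only [inner_add_right, inner_smul_right, real_inner_self_eq_norm_sq]
      simpa using ((hasDerivAt_id (0:ℝ)).mul_const (‖x‖^2)).const_add (inner ℝ x ξ)
    have h3 := h2.cexp
    unfold ek
    refine h3.congr_deriv ?_
    rw [mul_comm]; simp

/-- dilation identity -/
theorem dil_id (z : ℂ) (hz : 0 < z.re) (x : E) :
    2 * Real.pi * I * (∫ ξ, ((inner ℝ x ξ : ℝ) : ℂ) * ek z x ξ) -
      z * (∫ ξ, ((‖ξ‖ : ℝ) : ℂ) * ek z x ξ) + dimR E * ker z x = 0 := by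
  set d := dimR E
  have hms : Measurable fun ξ : E => ((inner ℝ x ξ : ℝ) : ℂ) := by fun_prop
  have hbd : ∀ ξ : E, ‖((inner ℝ x ξ : ℝ) : ℂ)‖ ≤ ‖x‖ * ‖ξ‖ ^ 1 := by
    intro ξ
    rw [Complex.norm_real, pow_one]
    exact norm_inner_le_norm x ξ
  have hms' : Measurable fun ξ : E => ((‖ξ‖ : ℝ) : ℂ) := by fun_prop
  have hbd' : ∀ ξ : E, ‖((‖ξ‖ : ℝ) : ℂ)‖ ≤ 1 * ‖ξ‖ ^ 1 := by
    intro ξ; simp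
  have key := (hasDerivAt_integral_of_dominated_loc_of_deriv_le (𝕜 := ℝ)
    (s := Set.Ioi (1/2 : ℝ))
    (F := fun (τ : ℝ) ξ => cexp ((((2 * Real.pi * inner ℝ x ξ : ℝ) : ℂ) * I - z * (‖ξ‖ : ℝ)) * τ))
    (x₀ := 1)
    (F' := fun τ ξ => cexp ((((2 * Real.pi * inner ℝ x ξ : ℝ) : ℂ) * I - z * (‖ξ‖ : ℝ)) * τ) *
      ((((2 * Real.pi * inner ℝ x ξ : ℝ) : ℂ) * I - z * (‖ξ‖ : ℝ))))
    (bound := fun ξ => (2 * Real.pi * ‖x‖ + ‖z‖) * (‖ξ‖ ^ 1 *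
      Real.exp (-(z.re/2) * ‖ξ‖)))
    (μ := (volume : Measure E)) (Ioi_mem_nhds (by norm_num)) ?_ ?_ ?_ ?_ ?_ ?_).2
  · have h0 : ∀ᶠ τ : ℝ in nhds (1:ℝ), (∫ ξ, cexp ((((2 * Real.pi * inner ℝ x ξ : ℝ) : ℂ) * I - z * (‖ξ‖ : ℝ)) * (τ : ℝ))) =
        (((τ ^ d)⁻¹ : ℝ) : ℂ) * ker z x := by
      filter_upwards [Ioi_mem_nhds (show (0:ℝ) < 1 by norm_num)] with τ hτ
      have hτ' : 0 < τ := hτ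
      have := Measure.integral_comp_smul_of_nonneg (volume : Measure E) (fun ξ => ek z x ξ) τ (hR := hτ'.le)
      rw [ker, ← Complex.real_smul, ← this]
      congr 1; ext ξ
      unfold ek
      congr 1
      rw [inner_smul_right, norm_smul, Real.norm_of_nonneg hτ'.le]
      push_cast; ring
    have h1 := key.congr_of_eventuallyEq (Filter.EventuallyEq.symm h0)
    have h2 : HasDerivAt (fun τ : ℝ => (((τ ^ d)⁻¹ : ℝ) : ℂ) * ker z x)
        (((-(d:ℝ) : ℝ) : ℂ) * ker z x) 1 := by
      refine HasDerivAt.mul_const ?_ _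
      refine HasDerivAt.ofReal_comp ?_
      have := (hasDerivAt_pow d (1:ℝ)).inv (by simp)
      have h := this.congr_deriv (g' := -(d:ℝ)) (by simp)
      exact h
    have h3 := h1.unique h2
    have h4 : (∫ ξ, cexp ((((2 * Real.pi * inner ℝ x ξ : ℝ) : ℂ) * I - z * (‖ξ‖ : ℝ)) * (1:ℝ)) *
      ((((2 * Real.pi * inner ℝ x ξ : ℝ) : ℂ) * I - z * (‖ξ‖ : ℝ)))) =
       2 * Real.pi * I * (∫ ξ, ((inner ℝ x ξ : ℝ) : ℂ) * ek z x ξ) -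
      z * (∫ ξ, ((‖ξ‖ : ℝ) : ℂ) * ek z x ξ) := by
      rw [← integral_const_mul, ← integral_const_mul, ← integral_sub]
      · congr 1; ext ξ
        unfold ek
        push_cast; ring_nf
      · exact (int_mul_ek z hz x 1 _ hms ‖x‖ hbd).const_mul _
      · exact (int_mul_ek z hz x 1 _ hms' 1 hbd').const_mul _
    rw [h4] at h3
    rw [h3]; push_cast; ring
  · exact of_forall fun τ => (by
      apply Continuous.aestronglyMeasurable; fun_prop)
  · simpa [ek] using int_ek z hz x
  · apply Continuous.aestronglyMeasurable; fun_prop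
  · refine of_forall fun ξ τ hτ => ?_
    have hτ' : 1 / 2 < τ := hτ
    rw [norm_mul, Complex.norm_exp]
    have h1 : ‖((2 * Real.pi * inner ℝ x ξ : ℝ) : ℂ) * I - z * (‖ξ‖ : ℝ)‖ ≤
        (2 * Real.pi * ‖x‖ + ‖z‖) * ‖ξ‖ := by
      refine (norm_sub_le _ _).trans ?_
      rw [norm_mul, norm_mul, Complex.norm_I, mul_one, Complex.norm_real, Complex.norm_real,
        norm_norm, norm_mul, Real.norm_of_nonneg (by positivity : 0 ≤ 2 * Real.pi), add_mul,
        mul_assoc _ ‖x‖]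
      have := norm_inner_le_norm (𝕜 := ℝ) x ξ
      gcongr
    have h2 : ((((2 * Real.pi * inner ℝ x ξ : ℝ) : ℂ) * I - z * (‖ξ‖ : ℝ)) * τ).re ≤
        -(z.re/2) * ‖ξ‖ := by
      simp
      nlinarith [mul_nonneg hz.le (norm_nonneg ξ)]
    calc _ ≤ Real.exp (-(z.re/2) * ‖ξ‖) * ((2 * Real.pi * ‖x‖ + ‖z‖) * ‖ξ‖) := by gcongr
      _ = _ := by ring
  · exact (int_pow_exp _ (by linarith) _).const_mul _
  · refine of_forall fun ξ τ hτ => ?_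
    have : HasDerivAt (fun τ : ℝ => ((((2 * Real.pi * inner ℝ x ξ : ℝ) : ℂ) * I - z * (‖ξ‖ : ℝ)) * (τ:ℂ)))
       (((2 * Real.pi * inner ℝ x ξ : ℝ) : ℂ) * I - z * (‖ξ‖ : ℝ)) τ := by
      simpa using (Complex.ofRealCLM.hasDerivAt (x := τ)).const_mul (((2 * Real.pi * inner ℝ x ξ : ℝ) : ℂ) * I - z * (‖ξ‖ : ℝ))
    exact this.cexp

end Kernel
section Kernel2

theorem ker_ode (z : ℂ) (hz : 0 < z.re) (x : E) (hd : 0 < dimR E) :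
    z * (∫ ξ, ((‖ξ‖ : ℝ) : ℂ) * ek z x ξ) * (z ^ 2 + ((2 * Real.pi * ‖x‖ : ℝ) : ℂ) ^ 2) =
      (dimR E * z ^ 2 - ((2 * Real.pi * ‖x‖ : ℝ) : ℂ) ^ 2) * ker z x := by
  have hms : Measurable fun ξ : E => ((inner ℝ x ξ / ‖ξ‖ : ℝ) : ℂ) := by fun_prop
  have hbd : ∀ ξ : E, ‖((inner ℝ x ξ / ‖ξ‖ : ℝ) : ℂ)‖ ≤ ‖x‖ * ‖ξ‖ ^ 0 := by
    intro ξ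
    rw [Complex.norm_real, norm_div, norm_norm, pow_zero, mul_one]
    rcases eq_or_ne ξ 0 with rfl | h
    · simp
    · rw [div_le_iff₀ (norm_pos_iff.mpr h)]
      exact norm_inner_le_norm x ξ
  have hk : HasDerivAt (fun R : ℝ => ker (z + R) x) (-∫ ξ, ((‖ξ‖ : ℝ) : ℂ) * ek z x ξ) 0 := by
    simpa [ker] using deriv_R z hz x 0 (fun _ => 1) measurable_const 1 (by simp) 0 le_rfl
  have hP := deriv_R z hz x 0 _ hms ‖x‖ hbd 0 le_rfl
  have e1 : ∀ ξ : E, ((inner ℝ x ξ / ‖ξ‖ : ℝ) : ℂ) * (‖ξ‖ : ℝ) = ((inner ℝ x ξ : ℝ) : ℂ) := by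
    intro ξ
    rcases eq_or_ne ξ 0 with rfl | h
    · simp
    · have : (‖ξ‖ : ℂ) ≠ 0 := by exact_mod_cast norm_ne_zero_iff.mpr h
      push_cast; field_simp
  simp only [e1, ofReal_zero, add_zero] at hP
  have hev : ∀ᶠ R : ℝ in nhds 0, ((2 * Real.pi * ‖x‖ ^ 2 : ℝ) : ℂ) * I * ker (z + R) x =
      (z + R) * ∫ ξ, ((inner ℝ x ξ / ‖ξ‖ : ℝ) : ℂ) * ek (z + R) x ξ := by
    filter_upwards [Ioi_mem_nhds (show -z.re < 0 by linarith)] with R hR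
    have hR' : -z.re < R := hR
    exact trans_id _ (by simp; linarith) x hd
  have hz1 : HasDerivAt (fun R : ℝ => z + (R : ℂ)) 1 0 := by
    simpa using (Complex.ofRealCLM.hasDerivAt (x := (0:ℝ))).const_add z
  have hA := (hk.const_mul (((2 * Real.pi * ‖x‖ ^ 2 : ℝ) : ℂ) * I))
  have hB := (hz1.mul hP).congr_of_eventuallyEq hev
  have h2 := hA.unique hB
  have h1 := trans_id z hz x hd
  have h3 := dil_id z hz x
  simp only [ofReal_zero, add_zero] at h2
  set P := ∫ ξ, ((inner ℝ x ξ / ‖ξ‖ : ℝ) : ℂ) * ek z x ξ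
  set J := ∫ ξ, ((inner ℝ x ξ : ℝ) : ℂ) * ek z x ξ
  set M := ∫ ξ, ((‖ξ‖ : ℝ) : ℂ) * ek z x ξ
  set k := ker z x
  push_cast at *
  have hI : I ^ 2 = -1 := Complex.I_sq
  linear_combination (-2 * Real.pi * I) * h1 + (2 * Real.pi * I * z) * h2 - z ^ 2 * h3 +
    (4 * Real.pi ^ 2 * ‖x‖ ^ 2 * (z * M + k)) * hI

theorem ker_le (z : ℂ) (hz : 0 < z.re) (x : E) :
    ‖ker z x‖ ≤ z.re⁻¹ ^ dimR E * ∫ ξ : E, Real.exp (-‖ξ‖) := by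
  have h1 := Measure.integral_comp_smul_of_nonneg (volume : Measure E)
    (fun ξ => Real.exp (-‖ξ‖)) z.re (hR := hz.le)
  rw [inv_pow, ← smul_eq_mul, ← h1]
  refine (norm_integral_le_integral_norm _).trans (le_of_eq ?_)
  congr 1; ext ξ
  rw [norm_ek, norm_smul, Real.norm_of_nonneg hz.le]; ring_nf

/-- The main kernel bound. -/
theorem ker_bound (z : ℂ) (hz : 0 < z.re) (x : E) (hd : 0 < dimR E) :
    ‖ker z x‖ ^ 2 * ‖z ^ 2 + ((2 * Real.pi * ‖x‖ : ℝ) : ℂ) ^ 2‖ ^ (dimR E + 1) ≤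
      (∫ ξ : E, Real.exp (-‖ξ‖)) ^ 2 * ‖z‖ ^ 2 := by
  set d := dimR E
  set b : ℝ := 2 * Real.pi * ‖x‖
  set c := ∫ ξ : E, Real.exp (-‖ξ‖)
  set Φ : ℝ → ℂ := fun R => (ker (z + R) x) ^ 2 * ((z + R) ^ 2 + (b : ℂ) ^ 2) ^ (d + 1) / (z + R) ^ 2
  have hre : ∀ R : ℝ, (z + (R : ℂ)).re = z.re + R := fun R => by simp
  have hne : ∀ R : ℝ, 0 ≤ R → z + (R : ℂ) ≠ 0 := by
    intro R hR h
    have := hre R; rw [h] at this; simp at this; linarith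
  have hder : ∀ R : ℝ, 0 ≤ R → HasDerivAt Φ 0 R := by
    intro R hR
    have hz1 : HasDerivAt (fun R : ℝ => z + (R : ℂ)) 1 R := by
      simpa using (Complex.ofRealCLM.hasDerivAt (x := R)).const_add z
    have hk : HasDerivAt (fun R : ℝ => ker (z + R) x)
        (-∫ ξ, ((‖ξ‖ : ℝ) : ℂ) * ek (z + R) x ξ) R := by
      simpa [ker] using deriv_R z hz x 0 (fun _ => 1) measurable_const 1 (by simp) R hR
    have hode := ker_ode (z + R) (by rw [hre]; linarith) x hd
    have h0 := hne R hR
    have h1 := ((hk.pow 2).mul (((hz1.pow 2).add_const ((b:ℂ)^2)).pow (d+1))).div (hz1.pow 2)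
      (pow_ne_zero 2 h0)
    refine h1.congr_deriv ?_
    rw [div_eq_zero_iff]; left
    simp only [Pi.mul_apply, Pi.pow_apply, Nat.add_sub_cancel]
    set M := ∫ ξ, ((‖ξ‖ : ℝ) : ℂ) * ek (z + R) x ξ
    set k := ker (z + R) x
    set ζ := z + (R : ℂ)
    change ζ * M * (ζ ^ 2 + (b:ℂ) ^ 2) = (d * ζ ^ 2 - (b:ℂ) ^ 2) * k at hode
    push_cast
    rw [pow_succ _ d]
    linear_combination (-2 * k * (ζ ^ 2 + (b:ℂ) ^ 2) ^ d * ζ) * hode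
  have hconst : ∀ R : ℝ, 0 ≤ R → Φ R = Φ 0 := by
    intro R hR
    refine constant_of_derivWithin_zero (f := Φ) (a := 0) (b := R) ?_ ?_ R ⟨hR, le_rfl⟩
    · intro y hy
      exact (hder y hy.1).differentiableAt.differentiableWithinAt
    · intro y hy
      have hR' : 0 < R := lt_of_le_of_lt hy.1 hy.2
      exact (hder y hy.1).hasDerivWithinAt.derivWithin
        ((uniqueDiffOn_Icc hR') y ⟨hy.1, hy.2.le⟩)
  have hc : 0 ≤ c := integral_nonneg fun _ => by positivity
  have hbound : ∀ R : ℝ, 0 < R → ‖Φ 0‖ ≤ c ^ 2 * ((‖z‖ + R) ^ 2 + b ^ 2) ^ (d + 1) / R ^ (2 * (d + 1)) := by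
    intro R hR
    rw [← hconst R hR.le]
    have h1 := ker_le (z + R) (by rw [hre]; linarith) x
    rw [hre] at h1
    have h2 : ‖ker (z + R) x‖ ≤ R⁻¹ ^ d * c := by
      refine h1.trans ?_
      gcongr
      linarith
    have h3 : R ≤ ‖z + R‖ := by
      have := Complex.re_le_norm (z + R); rw [hre] at this; linarith
    have h4 : ‖z + R‖ ≤ ‖z‖ + R := by
      refine (norm_add_le _ _).trans ?_
      rw [Complex.norm_real, Real.norm_of_nonneg hR.le]
    have h5 : ‖(z + R) ^ 2 + (b : ℂ) ^ 2‖ ≤ (‖z‖ + R) ^ 2 + b ^ 2 := by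
      refine (norm_add_le _ _).trans ?_
      rw [norm_pow, norm_pow, Complex.norm_real, Real.norm_eq_abs, sq_abs]
      gcongr
    simp only [Φ]
    rw [norm_div, norm_mul, norm_pow, norm_pow, norm_pow]
    calc _ ≤ (R⁻¹ ^ d * c) ^ 2 * ((‖z‖ + R) ^ 2 + b ^ 2) ^ (d + 1) / R ^ 2 := by
          gcongr
      _ = _ := by rw [inv_pow]; field_simp; ring
  have hlim : Filter.Tendsto (fun R : ℝ => c ^ 2 * ((‖z‖ + R) ^ 2 + b ^ 2) ^ (d + 1) / R ^ (2 * (d + 1)))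
      Filter.atTop (nhds (c ^ 2)) := by
    have h1 : Filter.Tendsto (fun R : ℝ => c ^ 2 * ((‖z‖ * R⁻¹ + 1) ^ 2 + b ^ 2 * R⁻¹ ^ 2) ^ (d + 1))
      Filter.atTop (nhds (c ^ 2 * ((‖z‖ * 0 + 1) ^ 2 + b ^ 2 * 0 ^ 2) ^ (d + 1))) := by
      have := tendsto_inv_atTop_zero (𝕜 := ℝ)
      exact (((((this.const_mul _).add_const 1).pow 2).add ((this.pow 2).const_mul _)).pow _).const_mul _
    simp only [mul_zero, zero_add, one_pow, ne_eq, OfNat.ofNat_ne_zero, not_false_eq_true, zero_pow,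
      add_zero, mul_one] at h1
    refine h1.congr' ?_
    filter_upwards [Filter.eventually_gt_atTop 0] with R hR
    rw [pow_mul, mul_div_assoc, ← div_pow]
    congr 2
    field_simp
  have hfin : ‖Φ 0‖ ≤ c ^ 2 := by
    refine ge_of_tendsto hlim ?_
    filter_upwards [Filter.eventually_gt_atTop 0] with R hR using hbound R hR
  have hz0 : z ≠ 0 := by simpa using hne 0 le_rfl
  simp only [Φ, ofReal_zero, add_zero] at hfin
  rw [norm_div, norm_mul, norm_pow, norm_pow, norm_pow, div_le_iff₀ (by positivity)] at hfin
  exact hfin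

end Kernel2
section Forms
variable {Ω₁ Ω₂ : Type*} [MeasurableSpace Ω₁] [MeasurableSpace Ω₂]

/-- space-time phase -/
def pw (x : E) (t : ℝ) (ξ : E) : ℂ :=
  cexp (((2 * Real.pi * inner ℝ x ξ + t * ‖ξ‖ : ℝ) : ℂ) * I)

theorem norm_pw (x : E) (t : ℝ) (ξ : E) : ‖pw x t ξ‖ = 1 := by
  rw [pw, Complex.norm_exp_ofReal_mul_I]

theorem cont_pw : Continuous (fun p : E × ℝ × E => pw p.1 p.2.1 p.2.2) := by
  unfold pw; fun_prop

theorem meas_pw {α : Type*} [MeasurableSpace α] {X : α → E} {T : α → ℝ} {Z : α → E}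
    (hX : Measurable X) (hT : Measurable T) (hZ : Measurable Z) :
    Measurable (fun a => pw (X a) (T a) (Z a)) := by
  have := (cont_pw (E := E)).measurable.comp (hX.prodMk (hT.prodMk hZ))
  exact this

theorem pw_mul_conj (x y ξ : E) (t s : ℝ) :
    pw x t ξ * (starRingEnd ℂ) (pw y s ξ) = pw (x - y) (t - s) ξ := by
  unfold pw
  rw [← Complex.exp_conj, ← Complex.exp_add]
  congr 1
  simp only [map_mul, Complex.conj_ofReal, Complex.conj_I, inner_sub_left]
  push_cast; ring

/-- space-time amplitude: Fourier transform of `F dμ` pushed forward by `(X,T)` on the cone -/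
def amp (μ : Measure Ω₁) (F : Ω₁ → ℂ) (X : Ω₁ → E) (T : Ω₁ → ℝ) (ξ : E) : ℂ :=
  ∫ ω, F ω * pw (X ω) (T ω) ξ ∂μ

theorem norm_amp_le (μ : Measure Ω₁) (F : Ω₁ → ℂ) (X : Ω₁ → E) (T : Ω₁ → ℝ) (ξ : E) :
    ‖amp μ F X T ξ‖ ≤ ∫ ω, ‖F ω‖ ∂μ := by
  refine (norm_integral_le_integral_norm _).trans (le_of_eq ?_)
  congr 1; ext ω; rw [norm_mul, norm_pw, mul_one]

theorem meas_amp (μ : Measure Ω₁) [SFinite μ] (F : Ω₁ → ℂ) (hF : AEStronglyMeasurable F μ) (X : Ω₁ → E) (T : Ω₁ → ℝ)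
    (hX : Measurable X) (hT : Measurable T) : Measurable (amp μ F X T) := by
  have h1 : amp μ F X T = amp μ (hF.mk F) X T := by
    ext ξ; unfold amp
    refine integral_congr_ae ?_
    filter_upwards [hF.ae_eq_mk] with ω h
    rw [h]
  rw [h1]
  refine StronglyMeasurable.measurable ?_
  refine StronglyMeasurable.integral_prod_right (f := fun ξ ω => hF.mk F ω * pw (X ω) (T ω) ξ) ?_
  exact ((hF.stronglyMeasurable_mk.measurable.comp measurable_snd).mul
    (meas_pw (hX.comp measurable_snd) (hT.comp measurable_snd) measurable_fst)).stronglyMeasurable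

theorem form_gen (μ₁ : Measure Ω₁) (μ₂ : Measure Ω₂) [SFinite μ₁] [SFinite μ₂]
    (F₁ : Ω₁ → ℂ) (F₂ : Ω₂ → ℂ) (h₁ : Integrable F₁ μ₁) (h₂ : Integrable F₂ μ₂)
    (X₁ : Ω₁ → E) (X₂ : Ω₂ → E) (T₁ : Ω₁ → ℝ) (T₂ : Ω₂ → ℝ) (hX₁ : Measurable X₁)
    (hX₂ : Measurable X₂) (hT₁ : Measurable T₁) (hT₂ : Measurable T₂)
    (φ : E → ℂ) (hφ : Integrable φ) :
    ∫ ξ, φ ξ * (amp μ₁ F₁ X₁ T₁ ξ * (starRingEnd ℂ) (amp μ₂ F₂ X₂ T₂ ξ)) =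
      ∫ p, F₁ p.1 * (starRingEnd ℂ) (F₂ p.2) *
        (∫ ξ, φ ξ * pw (X₁ p.1 - X₂ p.2) (T₁ p.1 - T₂ p.2) ξ) ∂(μ₁.prod μ₂) := by
  have hc : Integrable (fun ω => (starRingEnd ℂ) (F₂ ω)) μ₂ := by
    refine (integrable_norm_iff ?_).mp ?_
    · exact Complex.continuous_conj.comp_aestronglyMeasurable h₂.1
    · simpa using h₂.norm
  have hIntg : Integrable (Function.uncurry fun (ξ : E) (p : Ω₁ × Ω₂) =>
      φ ξ * (F₁ p.1 * (starRingEnd ℂ) (F₂ p.2)) *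
        pw (X₁ p.1 - X₂ p.2) (T₁ p.1 - T₂ p.2) ξ) (volume.prod (μ₁.prod μ₂)) := by
    have h3 := hφ.mul_prod (h₁.mul_prod hc)
    refine h3.norm.mono' (h3.1.mul ?_) (of_forall fun q => ?_)
    · refine (meas_pw ?_ ?_ ?_).aestronglyMeasurable <;> fun_prop
    · simp only [Function.uncurry]
      rw [norm_mul, norm_pw, mul_one]
  calc _ = ∫ ξ, ∫ p, φ ξ * (F₁ p.1 * (starRingEnd ℂ) (F₂ p.2)) *
        pw (X₁ p.1 - X₂ p.2) (T₁ p.1 - T₂ p.2) ξ ∂(μ₁.prod μ₂) := by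
        congr 1; ext ξ
        rw [amp, amp, ← integral_conj, ← integral_prod_mul, ← integral_const_mul]
        congr 1; ext p
        rw [← pw_mul_conj, map_mul]; ring
    _ = _ := by
        rw [integral_integral_swap hIntg]
        congr 1; ext p
        rw [← integral_const_mul]
        congr 1; ext ξ; ring

theorem form_ker (μ₁ : Measure Ω₁) (μ₂ : Measure Ω₂) [SFinite μ₁] [SFinite μ₂]
    (F₁ : Ω₁ → ℂ) (F₂ : Ω₂ → ℂ) (h₁ : Integrable F₁ μ₁) (h₂ : Integrable F₂ μ₂)
    (X₁ : Ω₁ → E) (X₂ : Ω₂ → E) (T₁ : Ω₁ → ℝ) (T₂ : Ω₂ → ℝ) (hX₁ : Measurable X₁)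
    (hX₂ : Measurable X₂) (hT₁ : Measurable T₁) (hT₂ : Measurable T₂)
    (z : ℂ) (hz : 0 < z.re) :
    ∫ ξ : E, cexp (-z * (‖ξ‖ : ℝ)) * (amp μ₁ F₁ X₁ T₁ ξ * (starRingEnd ℂ) (amp μ₂ F₂ X₂ T₂ ξ)) =
      ∫ p, F₁ p.1 * (starRingEnd ℂ) (F₂ p.2) *
        ker (z - (T₁ p.1 - T₂ p.2 : ℝ) * I) (X₁ p.1 - X₂ p.2) ∂(μ₁.prod μ₂) := by
  rw [form_gen μ₁ μ₂ F₁ F₂ h₁ h₂ X₁ X₂ T₁ T₂ hX₁ hX₂ hT₁ hT₂]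
  · congr 1; ext p
    congr 1
    rw [ker]
    congr 1; ext ξ
    rw [pw, ek, ← Complex.exp_add]
    congr 1; push_cast; ring
  · refine (int_exp_norm z.re hz).mono' ?_ ?_
    · apply Continuous.aestronglyMeasurable; fun_prop
    · exact of_forall fun ξ => by rw [Complex.norm_exp]; simp

theorem gauss_int (b : ℝ) (hb : 0 < b) : Integrable (fun v : E => Real.exp (-b * ‖v‖ ^ 2)) := by
  by_contra h
  have h1 := GaussianFourier.integral_rexp_neg_mul_sq_norm (V := E) hb
  rw [integral_undef h] at h1
  have : 0 < (Real.pi / b) ^ (dimR E / 2 : ℝ) := by positivity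
  linarith

/-- normalised Gaussian -/
def gk (s : ℝ) (x : E) : ℝ :=
  s ^ (-(dimR E : ℝ) / 2) * Real.exp (-(Real.pi / s) * ‖x‖ ^ 2)

theorem gk_nonneg (s : ℝ) (hs : 0 < s) (x : E) : 0 ≤ gk s x := by unfold gk; positivity

theorem gk_cont (s : ℝ) : Continuous (fun x : E => gk s x) := by unfold gk; fun_prop

theorem gk_int (s : ℝ) (hs : 0 < s) : Integrable (fun x : E => gk s x) :=
  (gauss_int _ (by positivity)).const_mul _

theorem gk_integral (s : ℝ) (hs : 0 < s) : ∫ x : E, gk s x = 1 := by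
  unfold gk
  rw [integral_const_mul, GaussianFourier.integral_rexp_neg_mul_sq_norm (by positivity)]
  rw [show Real.pi / (Real.pi / s) = s by field_simp, ← Real.rpow_add hs]
  ring_nf; simp

theorem gk_lintegral (s : ℝ) (hs : 0 < s) : ∫⁻ x : E, ofR (gk s x) = 1 := by
  rw [← ofReal_integral_eq_lintegral_ofReal (gk_int s hs)
    (of_forall fun x => gk_nonneg s hs x), gk_integral s hs, ENNReal.ofReal_one]

theorem ft_exp (s : ℝ) (hs : 0 < s) (x : E) :
    ∫ ξ : E, ((Real.exp (-(Real.pi * s) * ‖ξ‖ ^ 2) : ℝ) : ℂ) * ph x ξ = ((gk s x : ℝ) : ℂ) := by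
  have hre : 0 < ((Real.pi * s : ℝ) : ℂ).re := by simp; positivity
  have h := GaussianFourier.integral_cexp_neg_mul_sq_norm_add hre (2 * Real.pi * I) x
  have e : ∀ ξ : E, ((Real.exp (-(Real.pi * s) * ‖ξ‖ ^ 2) : ℝ) : ℂ) * ph x ξ =
      cexp (-((Real.pi * s : ℝ) : ℂ) * (‖ξ‖ : ℂ) ^ 2 + 2 * Real.pi * I * (inner ℝ x ξ : ℝ)) := by
    intro ξ
    rw [ph, Complex.ofReal_exp, ← Complex.exp_add]
    congr 1; push_cast; ring
  simp only [e]
  rw [h, gk]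
  have hpi : (Real.pi : ℂ) ≠ 0 := by exact_mod_cast Real.pi_ne_zero
  have hs' : (s : ℂ) ≠ 0 := by exact_mod_cast hs.ne'
  push_cast
  congr 1
  · rw [show (Real.pi : ℂ) / (Real.pi * s) = ((s⁻¹ : ℝ) : ℂ) by push_cast; field_simp,
      show ((dimR E : ℂ) / 2) = (((dimR E : ℝ) / 2 : ℝ) : ℂ) by push_cast; rfl,
      ← Complex.ofReal_cpow (by positivity)]
    congr 1
    rw [Real.inv_rpow hs.le, ← Real.rpow_neg hs.le]; congr 1; ring
  · congr 1
    have := Complex.I_sq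
    field_simp
    linear_combination (4 * (‖x‖:ℂ)^2) * this

/-- Fourier transform with positive sign -/
def ft (F : E → ℂ) (ξ : E) : ℂ := ∫ x, F x * ph x ξ

theorem ft_eq_amp (F : E → ℂ) : ft F = amp volume F id (fun _ => 0) := by
  ext ξ; unfold ft amp pw ph; simp

theorem ft_gk (s : ℝ) (hs : 0 < s) (ξ : E) :
    ft (fun x => ((gk s x : ℝ) : ℂ)) ξ = ((Real.exp (-(Real.pi * s) * ‖ξ‖ ^ 2) : ℝ) : ℂ) := by
  have h := ft_exp (E := E) s⁻¹ (by positivity) ξ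
  have hh : gk s⁻¹ ξ = s ^ ((dimR E : ℝ) / 2) * Real.exp (-(Real.pi * s) * ‖ξ‖ ^ 2) := by
    unfold gk
    rw [Real.inv_rpow hs.le, ← Real.rpow_neg hs.le]
    congr 2
    · ring
    · rw [div_inv_eq_mul]
  rw [hh] at h
  have hsp : (0:ℝ) < s ^ ((dimR E : ℝ) / 2) := by positivity
  have e2 : ∀ x : E, ((gk s x : ℝ) : ℂ) * ph x ξ = ((s ^ (-(dimR E : ℝ) / 2) : ℝ) : ℂ) *
      (((Real.exp (-(Real.pi * s⁻¹) * ‖x‖ ^ 2) : ℝ) : ℂ) * ph ξ x) := by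
    intro x
    rw [gk, ph, ph, real_inner_comm, div_eq_mul_inv Real.pi]; push_cast; ring
  unfold ft
  simp only [e2]
  rw [integral_const_mul, h, ← Complex.ofReal_mul]
  congr 1
  rw [← mul_assoc, ← Real.rpow_add hs]
  ring_nf; simp

end Forms
section KCor

/-- normalising constant -/
def c0 (E : Type*) [NormedAddCommGroup E] [InnerProductSpace ℝ E] [FiniteDimensional ℝ E]
    [MeasurableSpace E] [BorelSpace E] : ℝ := ∫ ξ : E, Real.exp (-‖ξ‖)

theorem c0_nonneg : 0 ≤ c0 E := integral_nonneg fun _ => (Real.exp_pos _).le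

theorem sq_add_sq_lower (z : ℂ) (b : ℝ) (hb : 0 ≤ b) :
    ‖z‖ ^ 2 * (z.re ^ 2 + (|z.im| - b) ^ 2) ≤ ‖z ^ 2 + (b : ℂ) ^ 2‖ ^ 2 := by
  rw [show z ^ 2 + (b : ℂ) ^ 2 = (z + b * I) * (z - b * I) by
    ring_nf; simp, norm_mul, mul_pow]
  rw [Complex.sq_norm, Complex.sq_norm, Complex.sq_norm, Complex.normSq_apply,
    Complex.normSq_apply, Complex.normSq_apply]
  simp only [add_re, mul_re, ofReal_re, I_re, mul_zero, ofReal_im, I_im, mul_one, sub_self,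
    add_zero, add_im, mul_im, sub_re, sub_zero, sub_im]
  rcases le_total 0 z.im with h | h
  · rw [abs_of_nonneg h]
    have : z.re * z.re + z.im * z.im ≤ z.re * z.re + (z.im + b) * (z.im + b) := by nlinarith
    calc _ ≤ (z.re * z.re + (z.im + b) * (z.im + b)) * (z.re ^ 2 + (z.im - b) ^ 2) := by gcongr
      _ = _ := by ring
  · rw [abs_of_nonpos h]
    have : z.re * z.re + z.im * z.im ≤ z.re * z.re + (z.im - b) * (z.im - b) := by nlinarith
    calc _ ≤ (z.re * z.re + (z.im - b) * (z.im - b)) * (z.re ^ 2 + (-z.im - b) ^ 2) := by gcongr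
      _ = _ := by ring

theorem ker_K2 (z : ℂ) (hz : 0 < z.re) (x : E) (hn : 3 ≤ dimR E) :
    ‖ker z x‖ ≤ c0 E * ‖z‖ ^ (-((dimR E : ℝ) - 1) / 2) *
      z.re ^ (-((dimR E : ℝ) - 3) / 2) *
      (z.re ^ 2 + (|z.im| - 2 * Real.pi * ‖x‖) ^ 2)⁻¹ := by
  set d := dimR E
  set D := z.re ^ 2 + (|z.im| - 2 * Real.pi * ‖x‖) ^ 2
  have hD : z.re ^ 2 ≤ D := by simp only [D]; nlinarith [sq_nonneg (|z.im| - 2 * Real.pi * ‖x‖)]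
  have hD0 : 0 < D := lt_of_lt_of_le (by positivity) hD
  have hz0 : 0 < ‖z‖ := by
    have := Complex.re_le_norm z; linarith
  have h := ker_bound z hz x (by omega)
  have h1 := sq_add_sq_lower z (2 * Real.pi * ‖x‖) (by positivity)
  set M := ‖z ^ 2 + ((2 * Real.pi * ‖x‖ : ℝ) : ℂ) ^ 2‖
  have hM : ‖z‖ * D ^ (1 / 2 : ℝ) ≤ M := by
    refine le_of_sq_le_sq ?_ (norm_nonneg _)
    rw [mul_pow, ← Real.rpow_natCast (D ^ (1/2:ℝ)), ← Real.rpow_mul hD0.le]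
    norm_num; exact h1
  have h2 : ‖ker z x‖ ^ 2 * (‖z‖ * D ^ (1 / 2 : ℝ)) ^ (d + 1) ≤ (c0 E) ^ 2 * ‖z‖ ^ 2 :=
    le_trans (by gcongr) h
  refine le_of_sq_le_sq ?_ (by have := c0_nonneg (E := E); positivity)
  have hpos : 0 < (‖z‖ * D ^ (1 / 2 : ℝ)) ^ (d + 1) := by positivity
  refine le_of_mul_le_mul_right (h2.trans ?_) hpos
  have e1 : (‖z‖ ^ (-((d : ℝ) - 1) / 2)) ^ 2 * ‖z‖ ^ (d + 1) = ‖z‖ ^ 2 := by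
    rw [← Real.rpow_natCast, ← Real.rpow_natCast, ← Real.rpow_natCast, ← Real.rpow_mul hz0.le,
      ← Real.rpow_add hz0]
    congr 1; push_cast; ring
  have e2 : 1 ≤ (z.re ^ (-((d : ℝ) - 3) / 2)) ^ 2 * D⁻¹ ^ 2 * (D ^ (1 / 2 : ℝ)) ^ (d + 1) := by
    have : D⁻¹ ^ 2 * (D ^ (1 / 2 : ℝ)) ^ (d + 1) = (D ^ (1/2 : ℝ)) ^ ((d : ℝ) - 3) := by
      rw [← Real.rpow_natCast (D⁻¹), ← Real.rpow_natCast, ← Real.rpow_mul hD0.le,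
        ← Real.rpow_mul hD0.le, Real.inv_rpow hD0.le, ← Real.rpow_neg hD0.le, ← Real.rpow_add hD0]
      congr 1; push_cast; ring
    rw [mul_assoc, this, ← Real.rpow_natCast, ← Real.rpow_mul hz.le]
    have h3 : z.re ≤ D ^ (1/2 : ℝ) := by
      rw [← Real.sqrt_eq_rpow]; exact Real.le_sqrt_of_sq_le hD
    have hd3 : (0:ℝ) ≤ (d : ℝ) - 3 := by
      have : (3:ℝ) ≤ d := by exact_mod_cast hn
      linarith
    calc 1 = z.re ^ (-((d : ℝ) - 3) / 2 * ((2:ℕ) : ℝ)) * z.re ^ ((d : ℝ) - 3) := by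
          rw [← Real.rpow_add hz]
          rw [show -((d : ℝ) - 3) / 2 * ((2:ℕ) : ℝ) + ((d : ℝ) - 3) = 0 by push_cast; ring,
            Real.rpow_zero]
      _ ≤ _ := by gcongr
  calc (c0 E) ^ 2 * ‖z‖ ^ 2 ≤ (c0 E) ^ 2 * ‖z‖ ^ 2 * ((z.re ^ (-((d : ℝ) - 3) / 2)) ^ 2 * D⁻¹ ^ 2 *
        (D ^ (1 / 2 : ℝ)) ^ (d + 1)) := le_mul_of_one_le_right (by positivity) e2
    _ = _ := by rw [← e1]; ring

theorem ker_K1 (z : ℂ) (hz : 0 < z.re) (x : E) (hn : 3 ≤ dimR E) :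
    ‖ker z x‖ ≤ c0 E * ‖z‖ ^ (-((dimR E : ℝ) - 1) / 2) *
      z.re ^ (-((dimR E : ℝ) + 1) / 2) := by
  refine (ker_K2 z hz x hn).trans ?_
  have h1 : (z.re ^ 2 + (|z.im| - 2 * Real.pi * ‖x‖) ^ 2)⁻¹ ≤ z.re ^ (-2 : ℝ) := by
    rw [Real.rpow_neg hz.le]
    refine inv_anti₀ (by positivity) ?_
    norm_num
    positivity
  have := c0_nonneg (E := E)
  calc _ ≤ c0 E * ‖z‖ ^ (-((dimR E : ℝ) - 1) / 2) *
      z.re ^ (-((dimR E : ℝ) - 3) / 2) * z.re ^ (-2 : ℝ) := by gcongr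
    _ = _ := by
      rw [mul_assoc, ← Real.rpow_add hz]
      congr 2; ring

theorem ker_K3 (z : ℂ) (hz : 0 < z.re) (x : E) (hn : 0 < dimR E)
    (hb : ‖z‖ ≤ Real.pi * ‖x‖) :
    ‖ker z x‖ ≤ c0 E * ‖z‖ * ‖x‖⁻¹ ^ (dimR E + 1) := by
  have hz0 : 0 < ‖z‖ := by
    have := Complex.re_le_norm z; linarith
  have hx : 0 < ‖x‖ := by
    have : 0 < Real.pi * ‖x‖ := by linarith
    exact (pos_iff_pos_of_mul_pos this).mp Real.pi_pos
  have h := ker_bound z hz x hn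
  have h1 : ‖x‖ ^ 2 ≤ ‖z ^ 2 + ((2 * Real.pi * ‖x‖ : ℝ) : ℂ) ^ 2‖ := by
    have h2 := norm_sub_norm_le (((2 * Real.pi * ‖x‖ : ℝ) : ℂ) ^ 2) (-z ^ 2)
    rw [sub_neg_eq_add, norm_neg, norm_pow, norm_pow, Complex.norm_real,
      Real.norm_of_nonneg (by positivity), add_comm] at h2
    refine le_trans ?_ h2
    have : ‖z‖ ^ 2 ≤ (Real.pi * ‖x‖) ^ 2 := by gcongr
    have h3 : 1 ≤ Real.pi ^ 2 := by nlinarith [Real.pi_gt_three]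
    nlinarith [sq_nonneg ‖x‖]
  have h2 : ‖ker z x‖ ^ 2 * (‖x‖ ^ 2) ^ (dimR E + 1) ≤ (c0 E) ^ 2 * ‖z‖ ^ 2 :=
    le_trans (by gcongr) h
  have hc := c0_nonneg (E := E)
  refine le_of_sq_le_sq ?_ (by positivity)
  refine le_of_mul_le_mul_right (h2.trans (le_of_eq ?_)) (show 0 < (‖x‖ ^ 2) ^ (dimR E + 1) by positivity)
  rw [mul_pow, mul_pow, ← pow_mul, mul_comm (dimR E + 1) 2, pow_mul, mul_assoc _ ((‖x‖⁻¹^2)^_), ← mul_pow,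
    ← mul_pow, ← mul_pow, inv_mul_cancel₀ hx.ne']
  simp

end KCor
section Schur
variable {X Y : Type*} [MeasurableSpace X] [MeasurableSpace Y]

theorem ennreal_sq_mul_sqrt (a b : ℝ≥0∞) : (a ^ 2 * b) ^ (1 / 2 : ℝ) = a * b ^ (1 / 2 : ℝ) := by
  rw [mul_rpow_of_nonneg _ _ (by norm_num), ← ENNReal.rpow_natCast, ← rpow_mul]
  norm_num

theorem ennreal_sqrt_mul_self (b : ℝ≥0∞) : b ^ (1 / 2 : ℝ) * b ^ (1 / 2 : ℝ) = b := by
  rw [← ENNReal.rpow_add_of_nonneg _ _ (by norm_num) (by norm_num)]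
  norm_num

theorem ennreal_sqrt_sq (b : ℝ≥0∞) : (b ^ (1 / 2 : ℝ)) ^ 2 = b := by
  rw [sq, ennreal_sqrt_mul_self]

/-- Cauchy-Schwarz -/
theorem lcs (μ : Measure X) (f g : X → ℝ≥0∞) (hf : AEMeasurable f μ) (hg : AEMeasurable g μ) :
    ∫⁻ x, f x * g x ∂μ ≤ (∫⁻ x, f x ^ 2 ∂μ) ^ (1 / 2 : ℝ) * (∫⁻ x, g x ^ 2 ∂μ) ^ (1 / 2 : ℝ) := by
  have := lintegral_mul_norm_pow_le (μ := μ) (f := fun x => f x ^ 2)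
    (g := fun x => g x ^ 2) (p := 1 / 2) (q := 1 / 2)
    (by fun_prop) (by fun_prop) (by norm_num) (by norm_num) (by norm_num)
  refine le_trans (le_of_eq ?_) this
  refine lintegral_congr fun x => ?_
  have := ennreal_sq_mul_sqrt (f x) 1
  have := ennreal_sq_mul_sqrt (g x) 1
  simp_all

theorem schur (μ : Measure X) (ν : Measure Y) [SFinite μ] [SFinite ν] (k : X × Y → ℝ≥0∞)
    (f : X → ℝ≥0∞) (g : Y → ℝ≥0∞) (hk : Measurable k) (hf : Measurable f) (hg : Measurable g)
    (A B : ℝ≥0∞) (hA : ∀ x, ∫⁻ y, k (x, y) ∂ν ≤ A) (hB : ∀ y, ∫⁻ x, k (x, y) ∂μ ≤ B) :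
    ∫⁻ p, f p.1 * g p.2 * k p ∂(μ.prod ν) ≤
      A ^ (1 / 2 : ℝ) * B ^ (1 / 2 : ℝ) * (∫⁻ x, f x ^ 2 ∂μ) ^ (1 / 2 : ℝ) *
        (∫⁻ y, g y ^ 2 ∂ν) ^ (1 / 2 : ℝ) := by
  have h := lintegral_mul_norm_pow_le (μ := μ.prod ν) (f := fun p => f p.1 ^ 2 * k p)
    (g := fun p => g p.2 ^ 2 * k p) (p := 1 / 2) (q := 1 / 2)
    (by fun_prop) (by fun_prop) (by norm_num) (by norm_num) (by norm_num)
  have h1 : ∫⁻ p, f p.1 ^ 2 * k p ∂(μ.prod ν) ≤ A * ∫⁻ x, f x ^ 2 ∂μ := by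
    rw [lintegral_prod _ (by fun_prop)]
    rw [← lintegral_const_mul _ (by fun_prop)]
    refine lintegral_mono fun x => ?_
    simp only
    rw [lintegral_const_mul _ (by fun_prop), mul_comm]
    gcongr; exact hA x
  have h2 : ∫⁻ p, g p.2 ^ 2 * k p ∂(μ.prod ν) ≤ B * ∫⁻ y, g y ^ 2 ∂ν := by
    rw [lintegral_prod_symm _ (by fun_prop)]
    rw [← lintegral_const_mul _ (by fun_prop)]
    refine lintegral_mono fun x => ?_
    simp only
    rw [lintegral_const_mul _ (by fun_prop), mul_comm]
    gcongr; exact hB x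
  calc _ = ∫⁻ p, (f p.1 ^ 2 * k p) ^ (1 / 2 : ℝ) * (g p.2 ^ 2 * k p) ^ (1 / 2 : ℝ) ∂(μ.prod ν) := by
        refine lintegral_congr fun p => ?_
        rw [ennreal_sq_mul_sqrt, ennreal_sq_mul_sqrt]
        conv_lhs => rw [← ennreal_sqrt_mul_self (k p)]
        ring
    _ ≤ _ := h
    _ ≤ (A * ∫⁻ x, f x ^ 2 ∂μ) ^ (1 / 2 : ℝ) * (B * ∫⁻ y, g y ^ 2 ∂ν) ^ (1 / 2 : ℝ) := by gcongr
    _ = _ := by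
      rw [mul_rpow_of_nonneg _ _ (by norm_num), mul_rpow_of_nonneg _ _ (by norm_num)]
      ring

end Schur
section Bessel

theorem meas_ft (F : E → ℂ) (hF : Measurable F) : Measurable (ft F) := by
  rw [ft_eq_amp]
  exact meas_amp _ _ hF.aestronglyMeasurable _ _ measurable_id measurable_const

theorem norm_ft_le (F : E → ℂ) (ξ : E) : ‖ft F ξ‖ ≤ ∫ x, ‖F x‖ := by
  rw [ft_eq_amp]; exact norm_amp_le _ _ _ _ _

theorem bessel_eps (F : E → ℂ) (hF : Measurable F) (hi : Integrable F) (s : ℝ) (hs : 0 < s) :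
    ∫⁻ ξ, ofR (Real.exp (-(Real.pi * s) * ‖ξ‖ ^ 2)) * ‖ft F ξ‖ₑ ^ 2 ≤
      ∫⁻ x, ‖F x‖ₑ ^ 2 := by
  have hφ : Integrable (fun ξ : E => ((Real.exp (-(Real.pi * s) * ‖ξ‖ ^ 2) : ℝ) : ℂ)) :=
    (gauss_int _ (by positivity)).ofReal
  have h := form_gen volume volume F F hi hi id id (fun _ => 0) (fun _ => 0) measurable_id
    measurable_id measurable_const measurable_const _ hφ
  rw [← ft_eq_amp] at h
  have e1 : ∀ p : E × E, ∫ ξ : E, ((Real.exp (-(Real.pi * s) * ‖ξ‖ ^ 2) : ℝ) : ℂ) *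
      pw (id p.1 - id p.2) ((0:ℝ) - 0) ξ = ((gk s (p.1 - p.2) : ℝ) : ℂ) := by
    intro p
    rw [← ft_exp s hs]
    refine integral_congr_ae (of_forall fun ξ => ?_)
    simp [pw, ph]
  simp_rw [e1] at h
  have hIntg : Integrable (fun ξ : E => Real.exp (-(Real.pi * s) * ‖ξ‖ ^ 2) * ‖ft F ξ‖ ^ 2) := by
    refine (gauss_int (E := E) (Real.pi * s) (by positivity)).mul_bdd (c := (∫ x, ‖F x‖) ^ 2) ?_ ?_
    · exact ((meas_ft F hF).norm.pow_const 2).aestronglyMeasurable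
    · refine of_forall fun ξ => ?_
      rw [Real.norm_of_nonneg (by positivity)]
      gcongr; exact norm_ft_le F ξ
  have e2 : ∫⁻ ξ, ofR (Real.exp (-(Real.pi * s) * ‖ξ‖ ^ 2)) * ‖ft F ξ‖ₑ ^ 2 =
      ‖∫ ξ : E, ((Real.exp (-(Real.pi * s) * ‖ξ‖ ^ 2) : ℝ) : ℂ) *
        (ft F ξ * (starRingEnd ℂ) (ft F ξ))‖ₑ := by
    have : ∀ ξ : E, ((Real.exp (-(Real.pi * s) * ‖ξ‖ ^ 2) : ℝ) : ℂ) *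
        (ft F ξ * (starRingEnd ℂ) (ft F ξ)) =
        ((Real.exp (-(Real.pi * s) * ‖ξ‖ ^ 2) * ‖ft F ξ‖ ^ 2 : ℝ) : ℂ) := by
      intro ξ; rw [Complex.mul_conj, Complex.normSq_eq_norm_sq]; push_cast; rfl
    simp_rw [this]
    rw [integral_complex_ofReal, ← ofReal_norm, Complex.norm_real, Real.norm_of_nonneg
      (integral_nonneg fun ξ => by positivity), ofReal_integral_eq_lintegral_ofReal hIntg
      (of_forall fun ξ => by positivity)]
    refine lintegral_congr fun ξ => ?_
    rw [ENNReal.ofReal_mul (by positivity), ENNReal.ofReal_pow (by positivity), ofReal_norm]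
  rw [e2, h]
  refine (enorm_integral_le_lintegral_enorm _).trans ?_
  have e3 : ∀ p : E × E, ‖F p.1 * (starRingEnd ℂ) (F p.2) * ((gk s (p.1 - p.2) : ℝ) : ℂ)‖ₑ =
      ‖F p.1‖ₑ * ‖F p.2‖ₑ * ofR (gk s (p.1 - p.2)) := by
    intro p
    rw [enorm_mul, enorm_mul, RCLike.enorm_conj]
    congr 1
    rw [← ofReal_norm, Complex.norm_real, Real.norm_of_nonneg (gk_nonneg s hs _)]
  simp_rw [e3]
  have hgm : Measurable fun p : E × E => ofR (gk s (p.1 - p.2)) :=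
    ((gk_cont s).measurable.comp (measurable_fst.sub measurable_snd)).ennreal_ofReal
  refine (schur volume volume _ _ _ hgm hF.enorm hF.enorm 1 1 ?_ ?_).trans (le_of_eq ?_)
  · intro x
    simp only
    rw [lintegral_sub_left_eq_self (fun y : E => ofR (gk s y)) x, gk_lintegral s hs]
  · intro x
    simp only
    rw [lintegral_sub_right_eq_self (fun y : E => ofR (gk s y)) x, gk_lintegral s hs]
  · simp only [ENNReal.one_rpow, one_mul]
    exact ennreal_sqrt_mul_self _

theorem bessel (F : E → ℂ) (hF : Measurable F) (hi : Integrable F) :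
    ∫⁻ ξ, ‖ft F ξ‖ₑ ^ 2 ≤ ∫⁻ x, ‖F x‖ₑ ^ 2 := by
  have hm := meas_ft F hF
  have h1 : ∀ ξ : E, ‖ft F ξ‖ₑ ^ 2 = Filter.liminf (fun k : ℕ =>
      ofR (Real.exp (-(Real.pi * (1 / ((k : ℝ) + 1))) * ‖ξ‖ ^ 2)) * ‖ft F ξ‖ₑ ^ 2)
        Filter.atTop := by
    intro ξ
    refine (Filter.Tendsto.liminf_eq ?_).symm
    have : Filter.Tendsto (fun k : ℕ => Real.exp (-(Real.pi * (1 / ((k : ℝ) + 1))) * ‖ξ‖ ^ 2))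
        Filter.atTop (nhds (Real.exp (-(Real.pi * 0) * ‖ξ‖ ^ 2))) :=
      (Real.continuous_exp.tendsto _).comp
        ((tendsto_one_div_add_atTop_nhds_zero_nat.const_mul Real.pi).neg.mul_const _)
    have h2 := ENNReal.Tendsto.mul_const (b := ‖ft F ξ‖ₑ ^ 2)
      (ENNReal.tendsto_ofReal this) (Or.inr (by finiteness))
    simpa using h2
  rw [lintegral_congr h1]
  refine (lintegral_liminf_le (fun k => ?_)).trans ?_
  · have : Measurable fun ξ : E => ofR (Real.exp (-(Real.pi * (1 / ((k : ℝ) + 1))) * ‖ξ‖ ^ 2)) := by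
      fun_prop
    exact this.mul (hm.enorm.pow_const 2)
  · refine Filter.liminf_le_of_le (by isBoundedDefault) fun b hb => ?_
    obtain ⟨k, hk⟩ := hb.exists
    exact hk.trans (bessel_eps F hF hi _ (by positivity))

/-- quadratic form with complex Poisson kernel -/
theorem form_L2 (z : ℂ) (hz : 0 < z.re) (F G : E → ℂ) (hF : Measurable F) (hG : Measurable G)
    (hFi : Integrable F) (hGi : Integrable G) :
    ‖∫ p : E × E, F p.1 * (starRingEnd ℂ) (G p.2) * ker z (p.1 - p.2)‖ₑ ≤
      (∫⁻ x, ‖F x‖ₑ ^ 2) ^ (1 / 2 : ℝ) * (∫⁻ x, ‖G x‖ₑ ^ 2) ^ (1 / 2 : ℝ) := by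
  have h := form_ker volume volume F G hFi hGi id id (fun _ => 0) (fun _ => 0) measurable_id
    measurable_id measurable_const measurable_const z hz
  simp only [sub_self, ofReal_zero, zero_mul, sub_zero, id] at h
  rw [Measure.volume_eq_prod, ← h]
  rw [← ft_eq_amp, ← ft_eq_amp]
  refine (enorm_integral_le_lintegral_enorm _).trans ?_
  calc _ ≤ ∫⁻ ξ, ‖ft F ξ‖ₑ * ‖ft G ξ‖ₑ := by
        refine lintegral_mono fun ξ => ?_
        rw [enorm_mul, enorm_mul, RCLike.enorm_conj]
        have : ‖cexp (-z * (‖ξ‖ : ℝ))‖ₑ ≤ 1 := by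
          rw [← ofReal_norm, Complex.norm_exp]
          simp only [neg_mul, neg_re, mul_re, ofReal_re, ofReal_im, mul_zero, sub_zero]
          rw [← ENNReal.ofReal_one]
          refine ofReal_le_ofReal (Real.exp_le_one_iff.mpr ?_)
          have := mul_nonneg hz.le (norm_nonneg ξ); linarith
        calc _ ≤ 1 * (‖ft F ξ‖ₑ * ‖ft G ξ‖ₑ) := by gcongr
          _ = _ := one_mul _
    _ ≤ _ := lcs _ _ _ (meas_ft F hF).enorm.aemeasurable (meas_ft G hG).enorm.aemeasurable
    _ ≤ _ := mul_le_mul' (rpow_le_rpow (bessel F hF hFi) (by norm_num))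
      (rpow_le_rpow (bessel G hG hGi) (by norm_num))

end Bessel
section Interp

/-- dyadic sum with two-sided geometric decay -/
def CI (θ : ℝ) : ℝ≥0∞ := 4 * ∑' j : ℤ, (2 : ℝ≥0∞) ^ (-(min θ (1 - θ)) * |(j : ℝ)|)

theorem geo_ne_top (δ : ℝ) (hδ : 0 < δ) : ∑' j : ℤ, (2 : ℝ≥0∞) ^ (-δ * |(j : ℝ)|) ≠ ⊤ := by
  have h1 : Summable fun n : ℕ => ((2:ℝ) ^ (-δ)) ^ n :=
    summable_geometric_of_lt_one (by positivity)
      (Real.rpow_lt_one_of_one_lt_of_neg (by norm_num) (by linarith))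
  have h2 : Summable fun j : ℤ => (2:ℝ) ^ (-δ * |(j : ℝ)|) := by
    refine Summable.of_nat_of_neg ?_ ?_
    · refine h1.congr fun n => ?_
      rw [Int.cast_natCast, Nat.abs_cast]
      rw [Real.rpow_mul (by norm_num), Real.rpow_natCast]
    · refine h1.congr fun n => ?_
      rw [Int.cast_neg, Int.cast_natCast, abs_neg, Nat.abs_cast]
      rw [Real.rpow_mul (by norm_num), Real.rpow_natCast]
  have h3 := h2.tsum_ofReal_ne_top
  convert h3 using 3 with j
  rw [← ofReal_rpow_of_pos (by norm_num)]
  norm_num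

theorem CI_ne_top (θ : ℝ) (h0 : 0 < θ) (h1 : θ < 1) : CI θ ≠ ⊤ :=
  mul_ne_top (by norm_num) (geo_ne_top _ (lt_min h0 (by linarith)))

theorem CI_ne_zero (θ : ℝ) : CI θ ≠ 0 := by
  unfold CI
  refine mul_ne_zero (by norm_num) ?_
  intro h
  rw [ENNReal.tsum_eq_zero] at h
  have := h 0
  simp at this

theorem two_rpow_ne_zero (x : ℝ) : (2 : ℝ≥0∞) ^ x ≠ 0 := by
  rw [Ne, ENNReal.rpow_eq_zero_iff]; simp

theorem two_rpow_add (x y : ℝ) : (2 : ℝ≥0∞) ^ (x + y) = 2 ^ x * 2 ^ y :=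
  ENNReal.rpow_add _ _ (by norm_num) (by norm_num)

theorem exists_dyadic (a : ℝ≥0∞) (h0 : a ≠ 0) (h1 : a ≠ ⊤) :
    ∃ i : ℤ, (2 : ℝ≥0∞) ^ (i : ℝ) ≤ a ∧ a < (2 : ℝ≥0∞) ^ ((i : ℝ) + 1) := by
  obtain ⟨i, hi⟩ := ENNReal.exists_mem_Ico_zpow (y := 2) h0 h1 (by norm_num) (by norm_num)
  refine ⟨i, ?_, ?_⟩
  · rw [ENNReal.rpow_intCast]; exact hi.1
  · have := hi.2
    rw [← ENNReal.rpow_intCast] at this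
    simpa using this

theorem dyadic_sum (θ : ℝ) (h0 : 0 < θ) (h1 : θ < 1) (A B : ℝ≥0∞) (hA0 : A ≠ 0) (hA : A ≠ ⊤)
    (c : ℤ → ℝ≥0∞) (hc1 : ∀ m, c m ≤ 4 ^ θ * A * 2 ^ (θ * m))
    (hc2 : ∀ m, c m ≤ B * 2 ^ (-(1 - θ) * m)) :
    ∑' m, c m ≤ CI θ * (A ^ (1 - θ) * B ^ θ) := by
  by_cases hB : B = ⊤
  · rw [hB, ENNReal.top_rpow_of_pos h0, ENNReal.mul_top, ENNReal.mul_top (CI_ne_zero θ)]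
    · exact le_top
    · simp [ENNReal.rpow_eq_zero_iff, hA0, hA]
  by_cases hB0 : B = 0
  · have : ∀ m, c m = 0 := fun m => by simpa [hB0] using hc2 m
    simp [this]
  obtain ⟨m0, hm1, hm2⟩ := exists_dyadic (B / A) (by simp [hB0, hA]) (ENNReal.div_ne_top hB hA0)
  have hBA : B = B / A * A := (ENNReal.div_mul_cancel hA0 hA).symm
  set R := B / A
  have hR0 : R ≠ 0 := by simp [R, hB0, hA]
  have hR : R ≠ ⊤ := ENNReal.div_ne_top hB hA0
  have hAB : A ^ (1 - θ) * B ^ θ = A * R ^ θ := by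
    rw [hBA, mul_rpow_of_nonneg _ _ h0.le, mul_comm (R ^ θ), ← mul_assoc,
      ← ENNReal.rpow_add _ _ hA0 hA]
    simp
  rw [hAB, ← (Equiv.addLeft m0).tsum_eq, CI, mul_assoc, ← ENNReal.tsum_mul_right,
    ← ENNReal.tsum_mul_left]
  refine ENNReal.tsum_le_tsum fun j => ?_
  simp only [Equiv.coe_addLeft]
  rcases le_total j 0 with hj | hj
  · refine (hc1 _).trans ?_
    have hj' : (j : ℝ) ≤ 0 := by exact_mod_cast hj
    rw [abs_of_nonpos hj']
    have e1 : (2 : ℝ≥0∞) ^ (θ * ((m0 + j : ℤ) : ℝ)) = (2 ^ (m0 : ℝ)) ^ θ * 2 ^ (θ * j) := by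
      rw [← rpow_mul, ← two_rpow_add]; congr 1; push_cast; ring
    have e2 : (2 : ℝ≥0∞) ^ (θ * (j : ℝ)) ≤ 2 ^ (-(min θ (1 - θ)) * -(j : ℝ)) := by
      refine rpow_le_rpow_of_exponent_le (by norm_num) ?_
      have := min_le_left θ (1 - θ)
      nlinarith
    have e3 : (4 : ℝ≥0∞) ^ θ ≤ 4 := by
      conv_rhs => rw [← ENNReal.rpow_one 4]
      exact rpow_le_rpow_of_exponent_le (by norm_num) h1.le
    rw [e1]
    calc _ ≤ 4 * A * (R ^ θ * 2 ^ (-(min θ (1 - θ)) * -(j : ℝ))) := by gcongr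
      _ = _ := by ring
  · refine (hc2 _).trans ?_
    have hj' : (0 : ℝ) ≤ j := by exact_mod_cast hj
    rw [abs_of_nonneg hj']
    have e1 : (2 : ℝ≥0∞) ^ (-(1 - θ) * ((m0 + j : ℤ) : ℝ)) =
        2 ^ (1 - θ) * ((2 ^ ((m0 : ℝ) + 1)) ^ (1 - θ))⁻¹ * 2 ^ (-(1 - θ) * j) := by
      rw [← rpow_mul, ← ENNReal.rpow_neg, ← two_rpow_add, ← two_rpow_add]
      congr 1; push_cast; ring
    have e2 : (2 : ℝ≥0∞) ^ (-(1 - θ) * (j : ℝ)) ≤ 2 ^ (-(min θ (1 - θ)) * (j : ℝ)) := by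
      refine rpow_le_rpow_of_exponent_le (by norm_num) ?_
      have := min_le_right θ (1 - θ)
      nlinarith
    have e3 : (2 : ℝ≥0∞) ^ (1 - θ) ≤ 4 := by
      calc (2 : ℝ≥0∞) ^ (1 - θ) ≤ 2 ^ (1 : ℝ) :=
            rpow_le_rpow_of_exponent_le (by norm_num) (by linarith)
        _ ≤ 4 := by norm_num
    have e4 : ((2 ^ ((m0 : ℝ) + 1)) ^ (1 - θ))⁻¹ ≤ (R ^ (1 - θ))⁻¹ := by
      refine ENNReal.inv_le_inv.mpr (rpow_le_rpow hm2.le (by linarith))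
    have e5 : R * (R ^ (1 - θ))⁻¹ = R ^ θ := by
      conv_lhs => rw [← ENNReal.rpow_neg, ← ENNReal.rpow_one R, ← rpow_mul,
        ← ENNReal.rpow_add _ _ hR0 hR]
      congr 1; ring
    rw [e1]
    calc _ ≤ B * (4 * (R ^ (1 - θ))⁻¹ * 2 ^ (-(min θ (1 - θ)) * (j : ℝ))) := by gcongr
      _ = 4 * (2 ^ (-(min θ (1 - θ)) * (j : ℝ)) * (A * (R * (R ^ (1 - θ))⁻¹))) := by
        rw [hBA]; ring
      _ = _ := by rw [e5]

variable {X Y : Type*} [MeasurableSpace X] [MeasurableSpace Y]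

/-- dyadic level set -/
def lev (W : X → ℝ≥0∞) (i : ℤ) : Set X := {x | (2 : ℝ≥0∞) ^ (i : ℝ) ≤ W x ∧ W x < 2 ^ ((i : ℝ) + 1)}

theorem lev_meas (W : X → ℝ≥0∞) (hW : Measurable W) (i : ℤ) : MeasurableSet (lev W i) :=
  (measurableSet_le measurable_const hW).inter (measurableSet_lt hW measurable_const)

theorem lev_disj (W : X → ℝ≥0∞) : Pairwise (Function.onFun Disjoint (lev W)) := by
  intro i j hij
  rw [Function.onFun, Set.disjoint_left]
  rintro x ⟨h1, h2⟩ ⟨h3, h4⟩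
  have key : ∀ i j : ℤ, (2 : ℝ≥0∞) ^ (i : ℝ) ≤ W x → W x < 2 ^ ((j : ℝ) + 1) → i ≤ j := by
    intro i j h1 h2
    by_contra h
    push Not at h
    have : (j : ℝ) + 1 ≤ i := by exact_mod_cast h
    have := rpow_le_rpow_of_exponent_le (x := 2) (by norm_num) this
    exact absurd (lt_of_le_of_lt (this.trans h1) h2) (lt_irrefl _)
  exact hij (le_antisymm (key i j h1 h4) (key j i h3 h2))

theorem lev_union (W : X → ℝ≥0∞) (x : X) (h0 : W x ≠ 0) (h1 : W x ≠ ⊤) : ∃ i, x ∈ lev W i :=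
  exists_dyadic _ h0 h1

theorem lev_N2 (μ : Measure X) (θ : ℝ) (h0 : 0 < θ) (W H : X → ℝ≥0∞) (hW : Measurable W)
    (hH : Measurable H) (i : ℤ) :
    (∫⁻ x in lev W i, (H x * W x ^ θ) ^ 2 ∂μ) ^ (1 / 2 : ℝ) ≤
      2 ^ (θ * (i + 1)) * (∫⁻ x in lev W i, H x ^ 2 ∂μ) ^ (1 / 2 : ℝ) := by
  have : ∫⁻ x in lev W i, (H x * W x ^ θ) ^ 2 ∂μ ≤
      (2 ^ (θ * ((i : ℝ) + 1))) ^ 2 * ∫⁻ x in lev W i, H x ^ 2 ∂μ := by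
    rw [← lintegral_const_mul _ (by fun_prop)]
    refine setLIntegral_mono (by fun_prop) fun x hx => ?_
    rw [mul_pow, mul_comm]
    gcongr
    rw [mul_comm θ, rpow_mul]
    exact rpow_le_rpow hx.2.le h0.le
  refine (rpow_le_rpow this (by norm_num)).trans (le_of_eq ?_)
  rw [ennreal_sq_mul_sqrt]

theorem lev_N1 (μ : Measure X) (θ : ℝ) (h0 : 0 < θ) (h1 : θ < 1) (W H : X → ℝ≥0∞)
    (hW : Measurable W) (hH : Measurable H) (i : ℤ) :
    ∫⁻ x in lev W i, H x * W x ^ θ ∂μ ≤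
      2 ^ (-(1 - θ) * i) * (∫⁻ x, W x ^ 2 ∂μ) ^ (1 / 2 : ℝ) *
        (∫⁻ x in lev W i, H x ^ 2 ∂μ) ^ (1 / 2 : ℝ) := by
  refine (lcs _ _ _ hH.aemeasurable (hW.pow_const θ).aemeasurable).trans ?_
  rw [mul_comm]
  gcongr
  have : ∫⁻ x in lev W i, (W x ^ θ) ^ 2 ∂μ ≤
      (2 ^ (-(1 - θ) * (i : ℝ))) ^ 2 * ∫⁻ x, W x ^ 2 ∂μ := by
    calc _ ≤ ∫⁻ x in lev W i, (2 ^ (-(1 - θ) * (i : ℝ))) ^ 2 * W x ^ 2 ∂μ := by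
          refine setLIntegral_mono (by fun_prop) fun x hx => ?_
          rw [← mul_pow]
          gcongr
          have hx0 : W x ≠ 0 := fun h => by
            have := hx.1; rw [h] at this; exact two_rpow_ne_zero _ (le_antisymm this bot_le)
          have hxt : W x ≠ ⊤ := (lt_of_lt_of_le hx.2 le_top).ne
          have e : W x ^ θ = (W x ^ (1 - θ))⁻¹ * W x := by
            rw [← ENNReal.rpow_neg]
            conv_rhs => rw [← ENNReal.rpow_one (W x), ← rpow_mul,
              ← ENNReal.rpow_add _ _ hx0 hxt]
            congr 1; ring
          rw [e]
          gcongr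
          rw [neg_mul, ENNReal.rpow_neg]
          refine ENNReal.inv_le_inv.mpr ?_
          rw [mul_comm, rpow_mul]
          exact rpow_le_rpow hx.1 (by linarith)
      _ ≤ ∫⁻ x, (2 ^ (-(1 - θ) * (i : ℝ))) ^ 2 * W x ^ 2 ∂μ := setLIntegral_le_lintegral _ _
      _ = _ := lintegral_const_mul _ (by fun_prop)
  refine (rpow_le_rpow this (by norm_num)).trans (le_of_eq ?_)
  rw [ennreal_sq_mul_sqrt]

theorem sum_conv (a b c : ℤ → ℝ≥0∞) :
    ∑' p : ℤ × ℤ, a p.1 * b p.2 * c (p.1 + p.2) ≤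
      (∑' m, c m) * (∑' i, a i ^ 2) ^ (1 / 2 : ℝ) * (∑' i, b i ^ 2) ^ (1 / 2 : ℝ) := by
  have h := schur (Measure.count : Measure ℤ) (Measure.count : Measure ℤ)
    (fun p => c (p.1 + p.2)) a b (measurable_of_countable _) (measurable_of_countable _)
    (measurable_of_countable _) (∑' m, c m) (∑' m, c m)
    (fun x => by
      rw [lintegral_count]
      exact ((Equiv.addLeft x).tsum_eq c).le)
    (fun x => by
      rw [lintegral_count]
      exact ((Equiv.addRight x).tsum_eq c).le)
  rw [ennreal_sqrt_mul_self, lintegral_prod _ (measurable_of_countable _).aemeasurable] at h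
  simp only [lintegral_count] at h
  rw [ENNReal.tsum_prod']
  exact h

/-- Bilinear real interpolation. -/
theorem lemI (μ : Measure X) (ν : Measure Y) [SFinite μ] [SFinite ν] (θ : ℝ) (h0 : 0 < θ)
    (h1 : θ < 1) (Ψ : X × Y → ℂ) (hΨ : Integrable Ψ (μ.prod ν))
    (H₁ W₁ : X → ℝ≥0∞) (H₂ W₂ : Y → ℝ≥0∞) (hH₁ : Measurable H₁) (hW₁ : Measurable W₁)
    (hH₂ : Measurable H₂) (hW₂ : Measurable W₂) (hf₁ : ∀ x, W₁ x ≠ ⊤) (hf₂ : ∀ x, W₂ x ≠ ⊤)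
    (A B : ℝ≥0∞) (hA0 : A ≠ 0) (hA : A ≠ ⊤)
    (hS : ∀ S S', MeasurableSet S → MeasurableSet S' → ‖∫ p in S ×ˢ S', Ψ p ∂(μ.prod ν)‖ₑ ≤
      A * (∫⁻ x in S, (H₁ x * W₁ x ^ θ) ^ 2 ∂μ) ^ (1 / 2 : ℝ) *
        (∫⁻ x in S', (H₂ x * W₂ x ^ θ) ^ 2 ∂ν) ^ (1 / 2 : ℝ))
    (hP : ∀ p, ‖Ψ p‖ₑ ≤ B * ((H₁ p.1 * W₁ p.1 ^ θ) * (H₂ p.2 * W₂ p.2 ^ θ))) :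
    ‖∫ p, Ψ p ∂(μ.prod ν)‖ₑ ≤ CI θ * (A ^ (1 - θ) * (B * (∫⁻ x, W₁ x ^ 2 ∂μ) ^ (1 / 2 : ℝ) *
      (∫⁻ x, W₂ x ^ 2 ∂ν) ^ (1 / 2 : ℝ)) ^ θ) * (∫⁻ x, H₁ x ^ 2 ∂μ) ^ (1 / 2 : ℝ) *
      (∫⁻ x, H₂ x ^ 2 ∂ν) ^ (1 / 2 : ℝ) := by
  set B' := B * (∫⁻ x, W₁ x ^ 2 ∂μ) ^ (1 / 2 : ℝ) * (∫⁻ x, W₂ x ^ 2 ∂ν) ^ (1 / 2 : ℝ) with hB'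
  set S : ℤ × ℤ → Set (X × Y) := fun p => lev W₁ p.1 ×ˢ lev W₂ p.2 with hSdef
  set α : ℤ → ℝ≥0∞ := fun i => (∫⁻ x in lev W₁ i, H₁ x ^ 2 ∂μ) ^ (1 / 2 : ℝ) with hα
  set β : ℤ → ℝ≥0∞ := fun i => (∫⁻ x in lev W₂ i, H₂ x ^ 2 ∂ν) ^ (1 / 2 : ℝ) with hβ
  set c : ℤ → ℝ≥0∞ := fun m => min (4 ^ θ * A * 2 ^ (θ * m)) (B' * 2 ^ (-(1 - θ) * m)) with hc
  have hSm : ∀ p, MeasurableSet (S p) := fun p => (lev_meas _ hW₁ _).prod (lev_meas _ hW₂ _)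
  have hSd : Pairwise (Function.onFun Disjoint S) := by
    intro p q hpq
    rw [Function.onFun, Set.disjoint_prod]
    by_cases h : p.1 = q.1
    · right; exact lev_disj _ fun h' => hpq (Prod.ext h h')
    · left; exact lev_disj _ h
  have hcompl : ∀ p, p ∉ ⋃ m, S m → Ψ p = 0 := by
    intro p hp
    have hz : ∀ x y : ℝ≥0∞, x = 0 → y * x ^ θ = 0 := fun x y h => by
      rw [h, zero_rpow_of_pos h0, mul_zero]
    have := hP p
    by_cases h1 : W₁ p.1 = 0
    · rw [hz _ _ h1] at this; simpa using this
    by_cases h2 : W₂ p.2 = 0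
    · rw [hz _ _ h2] at this; simpa using this
    obtain ⟨i, hi⟩ := lev_union W₁ p.1 h1 (hf₁ _)
    obtain ⟨l, hl⟩ := lev_union W₂ p.2 h2 (hf₂ _)
    exact absurd (Set.mem_iUnion.mpr ⟨(i, l), Set.mk_mem_prod hi hl⟩) hp
  have hsum := hasSum_integral_iUnion hSm hSd (hΨ.integrableOn)
  rw [setIntegral_eq_integral_of_forall_compl_eq_zero hcompl] at hsum
  rw [← hsum.tsum_eq]
  have hblock : ∀ m, ‖∫ p in S m, Ψ p ∂(μ.prod ν)‖ₑ ≤ α m.1 * β m.2 * c (m.1 + m.2) := by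
    rintro ⟨i, l⟩
    simp only
    have hmin : ∀ x y z w : ℝ≥0∞, w ≤ x * y → w ≤ x * z → w ≤ x * min y z := by
      intro x y z w h1 h2
      rcases le_total y z with h | h
      · rwa [min_eq_left h]
      · rwa [min_eq_right h]
    refine hmin _ _ _ _ ?_ ?_
    · refine (hS _ _ (lev_meas _ hW₁ _) (lev_meas _ hW₂ _)).trans ?_
      refine (mul_le_mul' (mul_le_mul' le_rfl (lev_N2 μ θ h0 W₁ H₁ hW₁ hH₁ i))
        (lev_N2 ν θ h0 W₂ H₂ hW₂ hH₂ l)).trans (le_of_eq ?_)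
      have : (4 : ℝ≥0∞) ^ θ * 2 ^ (θ * ((i + l : ℤ) : ℝ)) =
          2 ^ (θ * ((i:ℝ) + 1)) * 2 ^ (θ * ((l:ℝ) + 1)) := by
        rw [show (4 : ℝ≥0∞) = 2 ^ (2 : ℝ) by norm_num, ← rpow_mul, ← two_rpow_add,
          ← two_rpow_add]
        congr 1; push_cast; ring
      calc _ = A * α i * β l * (2 ^ (θ * ((i:ℝ) + 1)) * 2 ^ (θ * ((l:ℝ) + 1))) := by ring
        _ = _ := by rw [← this]; ring
    · refine (enorm_integral_le_lintegral_enorm _).trans ?_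
      refine (lintegral_mono fun p => hP p).trans ?_
      rw [← Measure.prod_restrict, lintegral_const_mul _ (by fun_prop),
        lintegral_prod_mul (f := fun x => H₁ x * W₁ x ^ θ) (g := fun y => H₂ y * W₂ y ^ θ)
          (by fun_prop) (by fun_prop)]
      refine (mul_le_mul' le_rfl (mul_le_mul' (lev_N1 μ θ h0 h1 W₁ H₁ hW₁ hH₁ i)
        (lev_N1 ν θ h0 h1 W₂ H₂ hW₂ hH₂ l))).trans (le_of_eq ?_)
      have : (2 : ℝ≥0∞) ^ (-(1 - θ) * ((i + l : ℤ) : ℝ)) =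
          2 ^ (-(1 - θ) * (i:ℝ)) * 2 ^ (-(1 - θ) * (l:ℝ)) := by
        rw [← two_rpow_add]
        congr 1; push_cast; ring
      rw [this, hB', hα, hβ]
      ring
  have hα2 : ∑' i, α i ^ 2 ≤ ∫⁻ x, H₁ x ^ 2 ∂μ := by
    simp only [hα, ennreal_sqrt_sq]
    rw [← lintegral_iUnion (lev_meas _ hW₁) (lev_disj W₁)]
    exact setLIntegral_le_lintegral _ _
  have hβ2 : ∑' i, β i ^ 2 ≤ ∫⁻ x, H₂ x ^ 2 ∂ν := by
    simp only [hβ, ennreal_sqrt_sq]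
    rw [← lintegral_iUnion (lev_meas _ hW₂) (lev_disj W₂)]
    exact setLIntegral_le_lintegral _ _
  calc _ ≤ ∑' m, ‖∫ p in S m, Ψ p ∂(μ.prod ν)‖ₑ := enorm_tsum_le_tsum_enorm
    _ ≤ ∑' m : ℤ × ℤ, α m.1 * β m.2 * c (m.1 + m.2) := ENNReal.tsum_le_tsum hblock
    _ ≤ _ := sum_conv α β c
    _ ≤ _ := by
      refine mul_le_mul' (mul_le_mul' (dyadic_sum θ h0 h1 A B' hA0 hA c (fun m => min_le_left _ _)
        (fun m => min_le_right _ _)) ?_) ?_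
      · exact rpow_le_rpow hα2 (by norm_num)
      · exact rpow_le_rpow hβ2 (by norm_num)

end Interp
section HLS

theorem lint_abs (g : ℝ → ℝ≥0∞) : ∫⁻ x, g |x| = 2 * ∫⁻ x in Set.Ioi 0, g x := by
  rw [← lintegral_add_compl (fun x => g |x|) (measurableSet_Ioi (a := (0:ℝ))), two_mul]
  congr 1
  · refine setLIntegral_congr_fun measurableSet_Ioi fun x hx => ?_
    simp only [abs_of_pos (show 0 < x from hx)]
  · rw [Set.compl_Ioi, ← setLIntegral_congr (Iio_ae_eq_Iic (a := (0:ℝ)) (μ := volume))]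
    have h := (Measure.measurePreserving_neg (volume : Measure ℝ)).setLIntegral_comp_preimage_emb
      (MeasurableEquiv.neg ℝ).measurableEmbedding g (Set.Ioi 0)
    rw [← h]
    have : (Neg.neg ⁻¹' Set.Ioi (0:ℝ)) = Set.Iio 0 := by ext x; simp
    rw [this]
    refine setLIntegral_congr_fun measurableSet_Iio fun x hx => ?_
    simp only [abs_of_neg (show x < 0 from hx)]

theorem near_int (l δ : ℝ) (hl1 : l < 1) (hδ : 0 < δ) :
    ∫⁻ x : ℝ, (if |x| < δ then ofR (|x| ^ (-l)) else 0) =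
      ofR (2 / (1 - l) * δ ^ (1 - l)) := by
  rw [lint_abs (fun x => if x < δ then ofR (x ^ (-l)) else 0)]
  have h1 : ∫⁻ x in Set.Ioi 0, (if x < δ then ofR (x ^ (-l)) else 0) =
      ∫⁻ x in Set.Ioc 0 δ, ofR (x ^ (-l)) := by
    rw [← setLIntegral_congr (Ioo_ae_eq_Ioc (a := (0:ℝ)) (b := δ) (μ := volume)),
      ← lintegral_indicator measurableSet_Ioi, ← lintegral_indicator measurableSet_Ioo]
    refine lintegral_congr fun x => ?_
    by_cases h : 0 < x <;> by_cases h' : x < δ <;> simp [Set.indicator, h, h']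
  have hIntg : IntervalIntegrable (fun x : ℝ => x ^ (-l)) volume 0 δ :=
    intervalIntegral.intervalIntegrable_rpow' (by linarith)
  have h2 : ∫⁻ x in Set.Ioc 0 δ, ofR (x ^ (-l)) =
      ofR (∫ x in (0:ℝ)..δ, x ^ (-l)) := by
    rw [intervalIntegral.integral_of_le hδ.le, ofReal_integral_eq_lintegral_ofReal]
    · exact (intervalIntegrable_iff_integrableOn_Ioc_of_le hδ.le).mp hIntg
    · refine (ae_restrict_mem measurableSet_Ioc).mono fun x hx => ?_
      exact Real.rpow_nonneg hx.1.le _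
  rw [h1, h2, integral_rpow (Or.inl (by linarith)), Real.zero_rpow (by linarith), sub_zero,
    show (2 : ℝ≥0∞) = ofR 2 by norm_num, ← ENNReal.ofReal_mul (by norm_num)]
  congr 1
  rw [show -l + 1 = 1 - l by ring]; ring

theorem far_int (δ : ℝ) (hδ : 0 < δ) :
    ∫⁻ x : ℝ, (if |x| < δ then 0 else ofR (|x| ^ (-2 : ℝ))) = ofR (2 * δ⁻¹) := by
  rw [lint_abs (fun x => if x < δ then 0 else ofR (x ^ (-2 : ℝ)))]
  have h1 : ∫⁻ x in Set.Ioi 0, (if x < δ then 0 else ofR (x ^ (-2 : ℝ))) =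
      ∫⁻ x in Set.Ioi δ, ofR (x ^ (-2 : ℝ)) := by
    rw [setLIntegral_congr (Ioi_ae_eq_Ici (a := δ) (μ := volume)),
      ← lintegral_indicator measurableSet_Ioi, ← lintegral_indicator measurableSet_Ici]
    refine lintegral_congr fun x => ?_
    by_cases h : 0 < x <;> by_cases h' : x < δ <;> simp only [Set.indicator, Set.mem_Ioi, h, h', Set.mem_Ici, if_true, if_false]
    · rw [if_neg (by linarith)]
    · rw [if_pos (by linarith)]
    · rw [if_neg (by linarith)]
    · exfalso; linarith
  rw [h1, ← ofReal_integral_eq_lintegral_ofReal (integrableOn_Ioi_rpow_of_lt (by norm_num) hδ)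
    ((ae_restrict_mem measurableSet_Ioi).mono fun x hx => Real.rpow_nonneg (hδ.le.trans (le_of_lt hx)) _),
    integral_Ioi_rpow_of_lt (by norm_num) hδ, show (2 : ℝ≥0∞) = ofR 2 by norm_num,
    ← ENNReal.ofReal_mul (by norm_num)]
  congr 1
  norm_num
  rw [Real.rpow_neg_one]

/-- HLS constant -/
def CH (l : ℝ) : ℝ := 2 / (1 - l) + 2

theorem hls_inner (l : ℝ) (h0 : 0 < l) (h1 : l < 1) (f : ℝ → ℝ≥0∞) (hf : Measurable f)
    (t : ℝ) (a b : ℝ) (ha : 0 < a) (hb : 0 < b) (hfa : f t = ofR a)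
    (hfb : (∫⁻ u, f u ^ (2 / (2 - l))) ^ ((2 - l) / 2) = ofR b) :
    ∫⁻ u, (if f u ≤ f t then f u * ofR (|t - u| ^ (-l)) else 0) ≤
      ofR (CH l * a ^ (2 / (2 - l) - 1) * b ^ (2 - 2 / (2 - l))) := by
  set s := 2 / (2 - l) with hs
  have hl2 : 0 < 2 - l := by linarith
  have hs0 : 0 < s := by positivity
  have hsl : s * (2 - l) = 2 := by rw [hs]; exact div_mul_cancel₀ _ hl2.ne'
  set δ := (b / a) ^ s
  have hδ : 0 < δ := by positivity
  have hκ : Measurable fun x : ℝ => ofR (|x| ^ (-l)) := by fun_prop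
  have hset : MeasurableSet {x : ℝ | |x| < δ} := measurableSet_lt (by fun_prop) (by fun_prop)
  set kn : ℝ → ℝ≥0∞ := fun x => if |x| < δ then ofR (|x| ^ (-l)) else 0 with hkn
  set kf : ℝ → ℝ≥0∞ := fun x => if |x| < δ then 0 else ofR (|x| ^ (-l)) with hkf
  have hknm : Measurable kn := Measurable.ite hset hκ measurable_const
  have hkfm : Measurable kf := Measurable.ite hset measurable_const hκ
  have hpt : ∀ u, (if f u ≤ f t then f u * ofR (|t - u| ^ (-l)) else 0) ≤
      f t * kn (t - u) + f u * kf (t - u) := by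
    intro u
    simp only [hkn, hkf]
    split_ifs with h2 h3
    · simp only [mul_zero, add_zero]; gcongr
    · simp
    · simp
    · simp
  have hn : ∫⁻ u, f t * kn (t - u) = ofR (a * (2 / (1 - l) * δ ^ (1 - l))) := by
    rw [lintegral_const_mul _ (by fun_prop), lintegral_sub_left_eq_self kn t, hkn,
      near_int l δ h1 hδ, hfa, ← ENNReal.ofReal_mul ha.le]
  have hfar : ∫⁻ u, f u * kf (t - u) ≤ ofR (b * (2 * δ⁻¹) ^ (l / 2)) := by
    have h := lintegral_mul_norm_pow_le (μ := (volume : Measure ℝ)) (f := fun u => f u ^ s)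
      (g := fun u => kf (t - u) ^ (2 / l)) (p := (2 - l) / 2) (q := l / 2)
      (by fun_prop) (by fun_prop) (by linarith) (by linarith) (by ring)
    rw [lintegral_sub_left_eq_self (fun x => kf x ^ (2 / l)) t] at h
    have e : ∀ x, kf x ^ (2 / l) = if |x| < δ then 0 else ofR (|x| ^ (-2 : ℝ)) := by
      intro x
      simp only [hkf]
      split_ifs with h
      · exact zero_rpow_of_pos (by positivity)
      · have hx : 0 < |x| := by push Not at h; linarith
        rw [ofReal_rpow_of_pos (by positivity), ← Real.rpow_mul hx.le]
        congr 2; field_simp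
    simp_rw [e] at h
    rw [far_int δ hδ, hfb, ofReal_rpow_of_pos (by positivity), ← ENNReal.ofReal_mul hb.le] at h
    refine le_trans (le_of_eq ?_) h
    refine lintegral_congr fun u => ?_
    rw [← e, ← rpow_mul, ← rpow_mul, show s * ((2 - l) / 2) = 1 by linarith,
      show 2 / l * (l / 2) = 1 by field_simp, ENNReal.rpow_one, ENNReal.rpow_one]
  calc _ ≤ ∫⁻ u, (f t * kn (t - u) + f u * kf (t - u)) := lintegral_mono hpt
    _ = (∫⁻ u, f t * kn (t - u)) + ∫⁻ u, f u * kf (t - u) := lintegral_add_left (by fun_prop) _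
    _ ≤ ofR (a * (2 / (1 - l) * δ ^ (1 - l))) +
        ofR (b * (2 * δ⁻¹) ^ (l / 2)) := by rw [hn]; gcongr
    _ ≤ _ := by
      rw [← ENNReal.ofReal_add (by have : 0 < 1 - l := by linarith
                                   positivity) (by positivity)]
      refine ofReal_le_ofReal ?_
      have e1 : a * δ ^ (1 - l) = a ^ (s - 1) * b ^ (2 - s) := by
        simp only [δ]
        rw [← Real.rpow_mul (by positivity), Real.div_rpow hb.le ha.le]
        rw [show s * (1 - l) = 2 - s by linarith]
        rw [show a ^ (s - 1) = a * (a ^ (2 - s))⁻¹ by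
          rw [← Real.rpow_neg ha.le]; nth_rewrite 2 [← Real.rpow_one a]
          rw [← Real.rpow_add ha]; congr 1; ring]
        ring
      have e2 : b * (2 * δ⁻¹) ^ (l / 2) ≤ 2 * (a ^ (s - 1) * b ^ (2 - s)) := by
        rw [Real.mul_rpow (by norm_num) (by positivity)]
        have e3 : (2:ℝ) ^ (l / 2) ≤ 2 := by
          calc (2:ℝ) ^ (l / 2) ≤ 2 ^ (1:ℝ) := by
                apply Real.rpow_le_rpow_of_exponent_le (by norm_num); linarith
            _ = 2 := by norm_num
        have e4 : b * (δ⁻¹) ^ (l / 2) = a ^ (s - 1) * b ^ (2 - s) := by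
          simp only [δ]
          rw [← Real.rpow_neg (by positivity), ← Real.rpow_mul (by positivity),
            show -s * (l / 2) = -(s - 1) by linarith, Real.rpow_neg (by positivity),
            Real.div_rpow hb.le ha.le, inv_div]
          rw [show b ^ (2 - s) = b * (b ^ (s - 1))⁻¹ by
            rw [← Real.rpow_neg hb.le]; nth_rewrite 2 [← Real.rpow_one b]
            rw [← Real.rpow_add hb]; congr 1; ring]
          ring
        calc _ = 2 ^ (l / 2) * (b * (δ⁻¹) ^ (l / 2)) := by ring
          _ ≤ 2 * (b * (δ⁻¹) ^ (l / 2)) := by gcongr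
          _ = _ := by rw [e4]
      unfold CH
      calc _ = 2 / (1 - l) * (a * δ ^ (1 - l)) + b * (2 * δ⁻¹) ^ (l / 2) := by ring
        _ ≤ 2 / (1 - l) * (a ^ (s - 1) * b ^ (2 - s)) + 2 * (a ^ (s - 1) * b ^ (2 - s)) := by
          rw [e1]; gcongr
        _ = _ := by ring

theorem hls (l : ℝ) (h0 : 0 < l) (h1 : l < 1) (f : ℝ → ℝ≥0∞) (hf : Measurable f)
    (hfin : ∀ t, f t ≠ ⊤) :
    ∫⁻ p : ℝ × ℝ, f p.1 * f p.2 * ofR (|p.1 - p.2| ^ (-l)) ≤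
      ofR (2 * CH l) * (∫⁻ u, f u ^ (2 / (2 - l))) ^ (2 - l) := by
  set s := 2 / (2 - l) with hs
  have hs0 : 0 < s := by have : 0 < 2 - l := by linarith
                         positivity
  have hsl : s * (2 - l) = 2 := by rw [hs]; exact div_mul_cancel₀ _ (by linarith)
  have hs2 : s < 2 := by nlinarith
  have hs1 : 1 < s := by nlinarith
  have hCH : 0 < CH l := by unfold CH; have : 0 < 1 - l := by linarith
                            positivity
  by_cases hT : ∫⁻ u, f u ^ s = ⊤
  · rw [hT, ENNReal.top_rpow_of_pos (by linarith), ENNReal.mul_top]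
    · exact le_top
    · simpa using hCH
  by_cases hZ : ∫⁻ u, f u ^ s = 0
  · rw [lintegral_eq_zero_iff (by fun_prop)] at hZ
    have h0 : ∀ᵐ u, f u = 0 := by
      filter_upwards [hZ] with u hu
      simpa [ENNReal.rpow_eq_zero_iff, hs0, hs0.not_gt] using hu
    refine le_trans (le_of_eq ?_) (bot_le (α := ℝ≥0∞))
    rw [Measure.volume_eq_prod, lintegral_prod _ (by fun_prop), bot_eq_zero]
    rw [← lintegral_zero (α := ℝ) (μ := volume)]
    refine lintegral_congr_ae ?_
    filter_upwards [h0] with u hu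
    simp [hu]
  set b := ((∫⁻ u, f u ^ s) ^ ((2 - l) / 2)).toReal with hbdef
  have hl2 : 0 < (2 - l) / 2 := by linarith
  have hbt : (∫⁻ u, f u ^ s) ^ ((2 - l) / 2) ≠ ⊤ := rpow_ne_top_of_nonneg hl2.le hT
  have hb : (∫⁻ u, f u ^ s) ^ ((2 - l) / 2) = ofR b := (ENNReal.ofReal_toReal hbt).symm
  have hb0 : 0 < b := ENNReal.toReal_pos (by simp [ENNReal.rpow_eq_zero_iff, hZ, hT]) hbt
  have hbs : ∫⁻ u, f u ^ s = ofR (b ^ s) := by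
    rw [← ofReal_rpow_of_pos hb0, ← hb, ← rpow_mul]
    rw [show (2 - l) / 2 * s = 1 by linarith, ENNReal.rpow_one]
  set J : ℝ → ℝ≥0∞ := fun t =>
    ∫⁻ u, (if f u ≤ f t then f u * ofR (|t - u| ^ (-l)) else 0) with hJ
  have hmj : Measurable fun p : ℝ × ℝ =>
      (if f p.2 ≤ f p.1 then f p.2 * ofR (|p.1 - p.2| ^ (-l)) else 0) :=
    Measurable.ite (measurableSet_le (by fun_prop) (by fun_prop)) (by fun_prop) measurable_const
  have hJb : ∀ t, f t * J t ≤ ofR (CH l * b ^ (2 - s)) * f t ^ s := by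
    intro t
    by_cases hz : f t = 0
    · simp [hz]
    set a := (f t).toReal with hadef
    have ha : f t = ofR a := (ENNReal.ofReal_toReal (hfin t)).symm
    have ha0 : 0 < a := ENNReal.toReal_pos hz (hfin t)
    have h := hls_inner l h0 h1 f hf t a b ha0 hb0 ha hb
    calc f t * J t ≤ ofR a * ofR (CH l * a ^ (s - 1) * b ^ (2 - s)) := by
          rw [← ha]; gcongr
      _ = _ := by
        rw [ha, ← ENNReal.ofReal_mul ha0.le, ofReal_rpow_of_pos ha0,
          ← ENNReal.ofReal_mul (by positivity)]
        congr 1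
        rw [show a ^ s = a * a ^ (s - 1) by
          nth_rewrite 2 [← Real.rpow_one a]; rw [← Real.rpow_add ha0]; congr 1; ring]
        ring
  have hJs : ∫⁻ p : ℝ × ℝ, f p.1 *
      (if f p.2 ≤ f p.1 then f p.2 * ofR (|p.1 - p.2| ^ (-l)) else 0) ≤
        ofR (CH l) * (∫⁻ u, f u ^ s) ^ (2 - l) := by
    rw [Measure.volume_eq_prod, lintegral_prod _ (by exact ((hf.comp measurable_fst).mul hmj).aemeasurable)]
    calc _ = ∫⁻ t, f t * J t := by
          refine lintegral_congr fun t => ?_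
          simp only
          rw [lintegral_const_mul]
          exact hmj.comp measurable_prodMk_left
      _ ≤ ∫⁻ t, ofR (CH l * b ^ (2 - s)) * f t ^ s := lintegral_mono hJb
      _ = ofR (CH l * b ^ (2 - s)) * ofR (b ^ s) := by
          rw [lintegral_const_mul _ (by fun_prop), hbs]
      _ = _ := by
        rw [hbs, ofReal_rpow_of_pos (by positivity), ← ENNReal.ofReal_mul (by positivity),
          ← ENNReal.ofReal_mul (by positivity), ← Real.rpow_mul hb0.le, hsl, mul_assoc,
          ← Real.rpow_add hb0]
        congr 3; ring
  calc _ ≤ ∫⁻ p : ℝ × ℝ, (f p.1 *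
        (if f p.2 ≤ f p.1 then f p.2 * ofR (|p.1 - p.2| ^ (-l)) else 0) +
        f p.2 * (if f p.1 ≤ f p.2 then f p.1 * ofR (|p.2 - p.1| ^ (-l)) else 0)) := by
        refine lintegral_mono fun p => ?_
        simp only
        rcases le_total (f p.2) (f p.1) with h | h
        · rw [if_pos h, mul_assoc]; exact le_self_add
        · rw [if_pos h, abs_sub_comm p.2 p.1, mul_comm (f p.1), mul_assoc]; exact le_add_self
    _ = (∫⁻ p : ℝ × ℝ, f p.1 *
        (if f p.2 ≤ f p.1 then f p.2 * ofR (|p.1 - p.2| ^ (-l)) else 0)) +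
        ∫⁻ p : ℝ × ℝ, f p.2 * (if f p.1 ≤ f p.2 then f p.1 * ofR (|p.2 - p.1| ^ (-l)) else 0) :=
        lintegral_add_left ((hf.comp measurable_fst).mul hmj) _
    _ = 2 * (∫⁻ p : ℝ × ℝ, f p.1 *
        (if f p.2 ≤ f p.1 then f p.2 * ofR (|p.1 - p.2| ^ (-l)) else 0)) := by
        rw [two_mul]; congr 1
        rw [Measure.volume_eq_prod]
        exact lintegral_prod_swap (μ := (volume : Measure ℝ)) (ν := (volume : Measure ℝ)) (fun p : ℝ × ℝ => f p.1 *
          (if f p.2 ≤ f p.1 then f p.2 * ofR (|p.1 - p.2| ^ (-l)) else 0))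
    _ ≤ 2 * (ofR (CH l) * (∫⁻ u, f u ^ s) ^ (2 - l)) := by gcongr
    _ = _ := by
      rw [ENNReal.ofReal_mul (by norm_num), mul_assoc]; norm_num

end HLS
section COT

theorem gk_mul (s t : ℝ) (hs : 0 < s) (ht : 0 < t) (x y : E) :
    gk s y * gk t (x - y) = gk (s + t) x * gk (s * t / (s + t)) (y - (s / (s + t)) • x) := by
  unfold gk
  have hst : 0 < s + t := by linarith
  have e1 : s ^ (-(dimR E : ℝ) / 2) * t ^ (-(dimR E : ℝ) / 2) =
      (s + t) ^ (-(dimR E : ℝ) / 2) *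
        (s * t / (s + t)) ^ (-(dimR E : ℝ) / 2) := by
    rw [← Real.mul_rpow hs.le ht.le, ← Real.mul_rpow hst.le (by positivity)]
    congr 1; field_simp
  have e2 : -(Real.pi / s) * ‖y‖ ^ 2 + -(Real.pi / t) * ‖x - y‖ ^ 2 =
      -(Real.pi / (s + t)) * ‖x‖ ^ 2 +
        -(Real.pi / (s * t / (s + t))) * ‖y - (s / (s + t)) • x‖ ^ 2 := by
    rw [norm_sub_sq_real, norm_sub_sq_real, norm_smul, inner_smul_right,
      Real.norm_of_nonneg (by positivity), real_inner_comm y x]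
    field_simp
    ring
  calc _ = (s ^ (-(dimR E : ℝ) / 2) * t ^ (-(dimR E : ℝ) / 2)) *
        Real.exp (-(Real.pi / s) * ‖y‖ ^ 2 + -(Real.pi / t) * ‖x - y‖ ^ 2) := by
        rw [Real.exp_add]; ring
    _ = _ := by rw [e1, e2, Real.exp_add]; ring

theorem gk_conv (s t : ℝ) (hs : 0 < s) (ht : 0 < t) (x : E) :
    ∫ y, gk s y * gk t (x - y) = gk (s + t) x := by
  simp_rw [gk_mul s t hs ht x]
  rw [integral_const_mul, integral_sub_right_eq_self (fun y : E => gk (s * t / (s + t)) y),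
    gk_integral _ (by positivity), mul_one]

/-- heat semigroup -/
def PP (s : ℝ) (g : E → ℝ) (x : E) : ℝ := ∫ y, gk s y * g (x - y)

theorem gk_meas (s : ℝ) : Measurable fun y : E => gk s y := (gk_cont s).measurable

theorem PP_int (s : ℝ) (hs : 0 < s) (g : E → ℝ) (hg : Measurable g) (B : ℝ) (hB : ∀ x, |g x| ≤ B) (x : E) :
    Integrable fun y => gk s y * g (x - y) := by
  refine (gk_int s hs).mul_bdd (c := B)
    (hg.comp (measurable_const.sub measurable_id)).aestronglyMeasurable ?_
  exact of_forall fun y => hB _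

theorem PP_meas (s : ℝ) (g : E → ℝ) (hg : Measurable g) : Measurable (PP s g) := by
  have h : Measurable fun p : E × E => gk s p.2 * g (p.1 - p.2) :=
    ((gk_meas s).comp measurable_snd).mul (hg.comp (measurable_fst.sub measurable_snd))
  exact (h.stronglyMeasurable.integral_prod_right).measurable

theorem PP_nonneg (s : ℝ) (hs : 0 < s) (g : E → ℝ) (h0 : ∀ x, 0 ≤ g x) (x : E) : 0 ≤ PP s g x :=
  integral_nonneg fun y => mul_nonneg (gk_nonneg s hs y) (h0 _)

theorem PP_abs_le (s : ℝ) (hs : 0 < s) (g : E → ℝ) (B : ℝ) (hB : ∀ x, |g x| ≤ B)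
    (x : E) : |PP s g x| ≤ B := by
  have := norm_integral_le_of_norm_le (f := fun y => gk s y * g (x - y)) ((gk_int (E := E) s hs).mul_const B)
    (of_forall fun y => by
      rw [norm_mul, Real.norm_of_nonneg (gk_nonneg s hs y)]
      exact mul_le_mul_of_nonneg_left (hB _) (gk_nonneg s hs y))
  rwa [integral_mul_const, gk_integral s hs, one_mul] at this

theorem PP_semi (s t : ℝ) (hs : 0 < s) (ht : 0 < t) (g : E → ℝ) (hg : Measurable g) (B : ℝ)
    (hB : ∀ x, |g x| ≤ B) (x : E) : PP s (PP t g) x = PP (s + t) g x := by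
  unfold PP
  have h1 : ∀ y, gk s y * ∫ z, gk t z * g (x - y - z) =
      ∫ z, (gk s y * gk t (z - y)) * g (x - z) := by
    intro y
    rw [← integral_sub_right_eq_self (fun z => gk t z * g (x - y - z)) y, ← integral_const_mul]
    refine integral_congr_ae (of_forall fun z => ?_)
    simp only [sub_sub_sub_cancel_right, sub_sub, add_sub_cancel]
    ring
  simp_rw [h1]
  rw [integral_integral_swap]
  · refine integral_congr_ae (of_forall fun z => ?_)
    simp only
    rw [integral_mul_const, gk_conv s t hs ht]
  · have h2 := (gk_int (E := E) s hs).convolution_integrand (ContinuousLinearMap.mul ℝ ℝ) (gk_int (E := E) t ht)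
    have h3 : Integrable (fun p : E × E => gk s p.1 * gk t (p.2 - p.1)) (volume.prod volume) := by
      have := h2.swap
      exact this
    refine h3.mul_bdd (c := B) ?_ ?_
    · exact (hg.comp (measurable_const.sub measurable_snd)).aestronglyMeasurable
    · exact of_forall fun y => hB _

theorem scalar_conv (p : ℝ) (hp1 : 1 < p) (hp2 : p ≤ 2) (a b : ℝ) (ha : 0 ≤ a) (hb : 0 ≤ b) :
    a ^ p + p * a ^ (p - 1) * (b - a) + p * (p - 1) / 2 * ((b - a) ^ 2 * (a + b) ^ (p - 2)) ≤ b ^ p := by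
  have hmulp : ∀ x : ℝ, 0 < x → x ^ 2 * x ^ (p - 2) = x ^ p := fun x hx => by
    rw [← Real.rpow_natCast, ← Real.rpow_add hx]; congr 1; push_cast; ring
  have hmul1 : ∀ x : ℝ, 0 < x → x ^ (p - 1) * x = x ^ p := fun x hx => by
    nth_rewrite 2 [← Real.rpow_one x]; rw [← Real.rpow_add hx]; congr 1; ring
  rcases ha.eq_or_lt with h | ha'
  · subst h
    rcases hb.eq_or_lt with h | hb'
    · subst h; simp
    · rw [Real.zero_rpow (by linarith), Real.zero_rpow (by linarith), sub_zero]
      simp only [zero_add, mul_zero, zero_mul]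
      rw [hmulp b hb']
      have : 0 < b ^ p := by positivity
      have h5 : p * (p - 1) / 2 ≤ 1 := by nlinarith
      have h6 := mul_le_mul_of_nonneg_right h5 this.le
      linarith
  rcases hb.eq_or_lt with h | hb'
  · subst h
    rw [Real.zero_rpow (by linarith), add_zero, zero_sub, neg_sq, hmulp a ha',
      mul_assoc, mul_neg, hmul1 a ha']
    have : 0 < a ^ p := by positivity
    have h5 : (p - 1) * (p / 2 - 1) ≤ 0 := mul_nonpos_of_nonneg_of_nonpos (by linarith) (by linarith)
    have h6 := mul_nonpos_of_nonneg_of_nonpos this.le h5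
    nlinarith
  set s := a + b with hs
  have hs0 : 0 < s := by linarith
  set c := p * (p - 1) / 2 * s ^ (p - 2) with hc
  set φ : ℝ → ℝ := fun x => x ^ p - c * x ^ 2 with hφ
  have hd : ∀ x, 0 < x → HasDerivAt φ (p * x ^ (p - 1) - c * (2 * x)) x := by
    intro x hx
    have h1 := Real.hasDerivAt_rpow_const (x := x) (p := p) (Or.inl hx.ne')
    have h2 := ((hasDerivAt_pow 2 x).const_mul c)
    exact (h1.sub h2).congr_deriv (by simp)
  have hconv : ConvexOn ℝ (Set.Ioc 0 s) φ := by
    refine MonotoneOn.convexOn_of_deriv (convex_Ioc 0 s) ?_ ?_ ?_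
    · exact fun x hx => (hd x hx.1).continuousAt.continuousWithinAt
    · intro x hx
      rw [interior_Ioc] at hx
      exact (hd x hx.1).differentiableAt.differentiableWithinAt
    · rw [interior_Ioc]
      have hd2 : ∀ x, 0 < x → HasDerivAt (fun x => p * x ^ (p - 1) - c * (2 * x))
          (p * ((p - 1) * x ^ (p - 2)) - c * 2) x := by
        intro x hx
        have h1 := (Real.hasDerivAt_rpow_const (x := x) (p := p - 1) (Or.inl hx.ne')).const_mul p
        have h2 := (((hasDerivAt_id x).const_mul 2).const_mul c)
        refine (h1.sub h2).congr_deriv ?_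
        rw [show p - 1 - 1 = p - 2 by ring]; ring
      have hm : MonotoneOn (fun x => p * x ^ (p - 1) - c * (2 * x)) (Set.Ioo 0 s) := by
        refine monotoneOn_of_deriv_nonneg (convex_Ioo 0 s) ?_ ?_ ?_
        · exact fun x hx => (hd2 x hx.1).continuousAt.continuousWithinAt
        · intro x hx
          rw [interior_Ioo] at hx
          exact (hd2 x hx.1).differentiableAt.differentiableWithinAt
        · intro x hx
          rw [interior_Ioo] at hx
          rw [(hd2 x hx.1).deriv, hc]
          have : s ^ (p - 2) ≤ x ^ (p - 2) :=
            Real.rpow_le_rpow_of_nonpos hx.1 hx.2.le (by linarith)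
          have h3 : 0 < p * (p - 1) := by nlinarith
          nlinarith
      intro x hx y hy hxy
      rw [(hd x hx.1).deriv, (hd y hy.1).deriv]
      exact hm hx hy hxy
  have hA : a ∈ Set.Ioc 0 s := ⟨ha', by linarith⟩
  have hB : b ∈ Set.Ioc 0 s := ⟨hb', by linarith⟩
  have key : φ a + (p * a ^ (p - 1) - c * (2 * a)) * (b - a) ≤ φ b := by
    rcases lt_trichotomy a b with h | h | h
    · have := hconv.le_slope_of_hasDerivAt hA hB h (hd a ha')
      rw [slope_def_field, le_div_iff₀ (by linarith)] at this
      linarith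
    · subst h; simp
    · have := hconv.slope_le_of_hasDerivAt hB hA h (hd a ha')
      rw [slope_def_field, div_le_iff₀ (by linarith)] at this
      linarith
  simp only [hφ] at key
  have : p * (p - 1) / 2 * ((b - a) ^ 2 * s ^ (p - 2)) = c * (b - a) ^ 2 := by rw [hc]; ring
  rw [this]
  nlinarith

end COT
section COT2

/-- the convexity defect -/
def dfc (p a b : ℝ) : ℝ := (b - a) ^ 2 * (a + b) ^ (p - 2)

theorem dfc_nonneg (p a b : ℝ) (ha : 0 ≤ a) (hb : 0 ≤ b) : 0 ≤ dfc p a b := by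
  unfold dfc; have : 0 ≤ (a + b) ^ (p - 2) := Real.rpow_nonneg (by linarith) _
  positivity

theorem pp_point (p : ℝ) (hp1 : 1 < p) (hp2 : p ≤ 2) (s : ℝ) (hs : 0 < s) (w : E → ℝ)
    (hw : Measurable w) (h0 : ∀ x, 0 ≤ w x) (B : ℝ) (hB : ∀ x, |w x| ≤ B) (x : E) :
    ofR (PP s w x) ^ p + ofR (p * (p - 1) / 2) *
      ∫⁻ h, ofR (gk s h) * ofR (dfc p (PP s w x) (w (x - h))) ≤
    ∫⁻ h, ofR (gk s h) * ofR (w (x - h)) ^ p := by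
  set a := PP s w x with ha
  have ha0 : 0 ≤ a := PP_nonneg s hs w h0 x
  have hc : 0 ≤ p * (p - 1) / 2 := by nlinarith
  have hB0 : 0 ≤ B := (abs_nonneg _).trans (hB x)
  have hwB : ∀ x, w x ≤ B := fun x => (le_abs_self _).trans (hB x)
  have mwx : Measurable fun h => w (x - h) := hw.comp (measurable_const.sub measurable_id)
  set R : E → ℝ := fun h => w (x - h) ^ p - a ^ p - p * a ^ (p - 1) * (w (x - h) - a) with hR
  have hRge : ∀ h, p * (p - 1) / 2 * dfc p a (w (x - h)) ≤ R h := fun h => by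
    have := scalar_conv p hp1 hp2 a (w (x - h)) ha0 (h0 _)
    simp only [hR, dfc]; linarith
  have hR0 : ∀ h, 0 ≤ R h := fun h =>
    (mul_nonneg hc (dfc_nonneg p a _ ha0 (h0 _))).trans (hRge h)
  have i1 : Integrable fun h => gk s h * w (x - h) ^ p := by
    refine (gk_int s hs).mul_bdd (c := B ^ p) (mwx.pow_const p).aestronglyMeasurable ?_
    refine of_forall fun h => ?_
    rw [Real.norm_of_nonneg (Real.rpow_nonneg (h0 _) _)]
    exact Real.rpow_le_rpow (h0 _) (hwB _) (by linarith)
  have i2 : Integrable fun h => gk s h * w (x - h) := PP_int s hs w hw B hB x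
  have i3 : Integrable fun h : E => gk s h := gk_int s hs
  have hRe : ∀ h, gk s h * R h = gk s h * w (x - h) ^ p - gk s h * (a ^ p) -
      (p * a ^ (p - 1)) * (gk s h * w (x - h) - gk s h * a) := fun h => by simp only [hR]; ring
  have iR : Integrable fun h => gk s h * R h := by
    simp_rw [hRe]
    exact (i1.sub (i3.mul_const _)).sub ((i2.sub (i3.mul_const _)).const_mul _)
  have hRI : ∫ h, gk s h * R h = (∫ h, gk s h * w (x - h) ^ p) - a ^ p := by
    simp_rw [hRe]
    have j1 : Integrable fun h => gk s h * w (x - h) ^ p - gk s h * a ^ p := i1.sub (i3.mul_const _)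
    have j2 : Integrable fun h => p * a ^ (p - 1) * (gk s h * w (x - h) - gk s h * a) :=
      (i2.sub (i3.mul_const _)).const_mul _
    rw [integral_sub j1 j2, integral_sub i1 (i3.mul_const _), integral_const_mul, integral_sub i2 (i3.mul_const _),
      integral_mul_const, integral_mul_const, gk_integral s hs]
    have : ∫ h, gk s h * w (x - h) = a := rfl
    rw [this]; ring
  have e1 : ofR (p * (p - 1) / 2) *
      ∫⁻ h, ofR (gk s h) * ofR (dfc p a (w (x - h))) ≤
      ofR ((∫ h, gk s h * w (x - h) ^ p) - a ^ p) := by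
    rw [← hRI, ofReal_integral_eq_lintegral_ofReal iR
      (of_forall fun h => mul_nonneg (gk_nonneg s hs h) (hR0 h)),
      ← lintegral_const_mul' _ _ ofReal_ne_top]
    refine lintegral_mono fun h => ?_
    rw [← ENNReal.ofReal_mul (gk_nonneg s hs h), ← ENNReal.ofReal_mul hc]
    refine ofReal_le_ofReal ?_
    calc _ = gk s h * (p * (p - 1) / 2 * dfc p a (w (x - h))) := by ring
      _ ≤ _ := mul_le_mul_of_nonneg_left (hRge h) (gk_nonneg s hs h)
  have e2 : ∫⁻ h, ofR (gk s h) * ofR (w (x - h)) ^ p =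
      ofR (∫ h, gk s h * w (x - h) ^ p) := by
    rw [ofReal_integral_eq_lintegral_ofReal i1
      (of_forall fun h => mul_nonneg (gk_nonneg s hs h) (Real.rpow_nonneg (h0 _) _))]
    refine lintegral_congr fun h => ?_
    rw [ENNReal.ofReal_mul (gk_nonneg s hs h), ofReal_rpow_of_nonneg (h0 _) (by linarith)]
  rw [e2]
  have hRI0 : 0 ≤ (∫ h, gk s h * w (x - h) ^ p) - a ^ p := by
    rw [← hRI]; exact integral_nonneg fun h => mul_nonneg (gk_nonneg s hs h) (hR0 h)
  calc _ ≤ ofR (a ^ p) + ofR ((∫ h, gk s h * w (x - h) ^ p) - a ^ p) := by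
        rw [ofReal_rpow_of_nonneg ha0 (by linarith)]; exact add_le_add le_rfl e1
    _ = _ := by rw [← ENNReal.ofReal_add (by positivity) hRI0]; congr 1; ring

theorem gk_avg (s : ℝ) (hs : 0 < s) (f : E → ℝ≥0∞) (hf : Measurable f) :
    ∫⁻ x : E, ∫⁻ h : E, ofR (gk s h) * f (x - h) = ∫⁻ x, f x := by
  have hm : Measurable fun z : E × E => ofR (gk s z.2) * f (z.1 - z.2) :=
    ((gk_meas s).comp measurable_snd).ennreal_ofReal.mul
      (hf.comp (measurable_fst.sub measurable_snd))
  rw [lintegral_lintegral_swap hm.aemeasurable]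
  have : ∀ h : E, ∫⁻ x, ofR (gk s h) * f (x - h) =
      ofR (gk s h) * ∫⁻ x, f x := fun h => by
    rw [lintegral_const_mul' _ _ ofReal_ne_top, lintegral_sub_right_eq_self f h]
  simp_rw [this]
  rw [lintegral_mul_const _ (gk_meas s).ennreal_ofReal, gk_lintegral s hs, one_mul]

/-- total defect -/
def DF (p s : ℝ) (w : E → ℝ) : ℝ≥0∞ :=
  ∫⁻ x, ∫⁻ h, ofR (gk s h) * ofR (dfc p (PP s w x) (w (x - h)))

theorem dfc_meas (p s : ℝ) (w : E → ℝ) (hw : Measurable w) :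
    Measurable fun z : E × E => ofR (gk s z.2) *
      ofR (dfc p (PP s w z.1) (w (z.1 - z.2))) := by
  have h1 : Measurable fun z : E × E => PP s w z.1 := (PP_meas s w hw).comp measurable_fst
  have h2 : Measurable fun z : E × E => w (z.1 - z.2) := hw.comp (measurable_fst.sub measurable_snd)
  refine ((gk_meas s).comp measurable_snd).ennreal_ofReal.mul ?_
  unfold dfc
  exact (((h2.sub h1).pow_const 2).mul ((h1.add h2).pow_const _)).ennreal_ofReal

theorem pp_conv (p : ℝ) (hp1 : 1 < p) (hp2 : p ≤ 2) (s : ℝ) (hs : 0 < s) (w : E → ℝ)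
    (hw : Measurable w) (h0 : ∀ x, 0 ≤ w x) (B : ℝ) (hB : ∀ x, |w x| ≤ B) :
    (∫⁻ x, ofR (PP s w x) ^ p) + ofR (p * (p - 1) / 2) * DF p s w ≤
    ∫⁻ x, ofR (w x) ^ p := by
  rw [← gk_avg s hs (fun x => ofR (w x) ^ p) (hw.ennreal_ofReal.pow_const p), DF,
    ← lintegral_const_mul' _ _ ofReal_ne_top,
    ← lintegral_add_left ((PP_meas s w hw).ennreal_ofReal.pow_const p)]
  exact lintegral_mono fun x => pp_point p hp1 hp2 s hs w hw h0 B hB x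

theorem tsum_DF (p : ℝ) (hp1 : 1 < p) (hp2 : p ≤ 2) (g : E → ℝ)
    (hg : Measurable g) (h0 : ∀ x, 0 ≤ g x) (B : ℝ) (hB : ∀ x, |g x| ≤ B) :
    ∑' k : ℤ, ofR (p * (p - 1) / 2) * DF p (3 * 4 ^ k) (PP (4 ^ k) g) ≤
      ∫⁻ x, ofR (g x) ^ p := by
  have h4 : ∀ k : ℤ, (0 : ℝ) < 4 ^ k := fun k => by positivity
  have step : ∀ k : ℤ, (∫⁻ x, ofR (PP (4 ^ (k + 1)) g x) ^ p) +
      ofR (p * (p - 1) / 2) * DF p (3 * 4 ^ k) (PP (4 ^ k) g) ≤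
      ∫⁻ x, ofR (PP (4 ^ k) g x) ^ p := by
    intro k
    have := pp_conv p hp1 hp2 (3 * 4 ^ k) (by have := h4 k; linarith) (PP (4 ^ k) g)
      (PP_meas _ g hg) (PP_nonneg _ (h4 k) g h0) B (PP_abs_le _ (h4 k) g B hB)
    simp_rw [PP_semi (3 * 4 ^ k) (4 ^ k) (by have := h4 k; linarith) (h4 k) g hg B hB] at this
    rwa [show (3 * 4 ^ k + 4 ^ k : ℝ) = 4 ^ (k + 1) by
      rw [zpow_add₀ (by norm_num)]; ring] at this
  have ind : ∀ (K : ℤ) (m : ℕ), (∫⁻ x, ofR (PP (4 ^ (K + m)) g x) ^ p) +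
      ∑ j ∈ Finset.range m, ofR (p * (p - 1) / 2) *
        DF p (3 * 4 ^ (K + j)) (PP (4 ^ (K + j)) g) ≤
      ∫⁻ x, ofR (PP (4 ^ K) g x) ^ p := by
    intro K m
    induction m with
    | zero => simp
    | succ m ih =>
      rw [Finset.sum_range_succ]
      have := step (K + m)
      calc _ = ((∫⁻ x, ofR (PP (4 ^ (K + m + 1)) g x) ^ p) +
          ofR (p * (p - 1) / 2) * DF p (3 * 4 ^ (K + m)) (PP (4 ^ (K + m)) g)) +
          ∑ j ∈ Finset.range m, ofR (p * (p - 1) / 2) *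
            DF p (3 * 4 ^ (K + j)) (PP (4 ^ (K + j)) g) := by
            push_cast; rw [← add_assoc K]; ring
        _ ≤ _ := (add_le_add_left this _).trans ih
  have top : ∀ k : ℤ, ∫⁻ x, ofR (PP (4 ^ k) g x) ^ p ≤ ∫⁻ x, ofR (g x) ^ p :=
    fun k => le_trans (by exact le_self_add) (pp_conv p hp1 hp2 (4 ^ k) (h4 k) g hg h0 B hB)
  rw [ENNReal.tsum_eq_iSup_sum]
  refine iSup_le fun s => ?_
  obtain ⟨N, hN⟩ : ∃ N : ℕ, ∀ k ∈ s, |k| ≤ N := by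
    refine ⟨∑ k ∈ s, k.natAbs, fun k hk => ?_⟩
    rw [Int.abs_eq_natAbs]
    exact_mod_cast Finset.single_le_sum (f := fun k : ℤ => k.natAbs) (fun _ _ => Nat.zero_le _) hk
  have hsub : s ⊆ (Finset.range (2 * N + 1)).image fun j : ℕ => (-(N : ℤ) + j) := by
    intro k hk
    have := abs_le.1 (hN k hk)
    rw [Finset.mem_image]
    refine ⟨(k + N).toNat, ?_, ?_⟩
    · rw [Finset.mem_range]; omega
    · omega
  refine (Finset.sum_le_sum_of_subset hsub).trans ?_
  rw [Finset.sum_image (by intro a _ b _ h; simpa using h)]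
  exact (le_trans (by exact le_add_self) (ind (-(N : ℤ)) (2 * N + 1))).trans (top _)

end COT2
section COT3

/-- comparison constant -/
def kap (E : Type*) [NormedAddCommGroup E] [InnerProductSpace ℝ E] : ℝ :=
  1 + (3 / 2 : ℝ) ^ ((dimR E : ℝ) / 2)

theorem kap_pos : 0 < kap E := by unfold kap; positivity

theorem gk_comp (t : ℝ) (ht : 0 < t) (h : E) : |gk (3 * t) h - gk (2 * t) h| ≤ kap E * gk (3 * t) h := by
  have h2 : gk (2 * t) h ≤ (3 / 2 : ℝ) ^ ((dimR E : ℝ) / 2) * gk (3 * t) h := by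
    unfold gk
    rw [← mul_assoc]
    refine mul_le_mul (le_of_eq ?_) (Real.exp_le_exp.2 ?_) (Real.exp_pos _).le (by positivity)
    · rw [Real.mul_rpow (by norm_num) ht.le, Real.mul_rpow (by norm_num) ht.le,
        Real.div_rpow (by norm_num) (by norm_num), neg_div, Real.rpow_neg (by norm_num),
        Real.rpow_neg (by norm_num : (0 : ℝ) ≤ 3)]
      have : (3 : ℝ) ^ ((dimR E : ℝ) / 2) ≠ 0 := by positivity
      field_simp
    · rw [neg_mul, neg_mul, neg_le_neg_iff]
      refine mul_le_mul_of_nonneg_right ?_ (by positivity)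
      exact div_le_div_of_nonneg_left Real.pi_pos.le (by positivity) (by linarith)
  have g3 := gk_nonneg (3 * t) (by positivity) h
  have g2 := gk_nonneg (2 * t) (by positivity) h
  unfold kap
  rw [abs_le]
  have : 0 ≤ (3 / 2 : ℝ) ^ ((dimR E : ℝ) / 2) * gk (3 * t) h := by positivity
  constructor <;> linarith

theorem dfc_rpow (p : ℝ) (hp1 : 1 < p) (hp2 : p ≤ 2) (a b : ℝ) (ha : 0 ≤ a) (hb : 0 ≤ b) :
    |b - a| ^ p = (dfc p a b) ^ (p / 2) * ((a + b) ^ p) ^ (1 - p / 2) := by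
  rcases (add_nonneg ha hb).eq_or_lt with h | h
  · have h1 : a = 0 := by linarith
    have h2 : b = 0 := by linarith
    subst h1 h2
    simp only [dfc, sub_self, abs_zero]
    rw [Real.zero_rpow (by linarith)]
    simp
    left
    rw [Real.zero_rpow (by linarith)]
  unfold dfc
  rw [Real.mul_rpow (by positivity) (Real.rpow_nonneg h.le _), ← Real.rpow_mul h.le,
    ← Real.rpow_mul h.le, mul_assoc, ← Real.rpow_add h, ← sq_abs, ← Real.rpow_natCast,
    ← Real.rpow_mul (abs_nonneg _)]
  rw [show (p - 2) * (p / 2) + p * (1 - p / 2) = 0 by ring, Real.rpow_zero, mul_one]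
  congr 1; push_cast; ring

theorem PP_lp (p : ℝ) (hp1 : 1 < p) (hp2 : p ≤ 2) (s : ℝ) (hs : 0 < s) (w : E → ℝ)
    (hw : Measurable w) (h0 : ∀ x, 0 ≤ w x) (B : ℝ) (hB : ∀ x, |w x| ≤ B) :
    (∫⁻ x, ofR (PP s w x) ^ p) ≤ ∫⁻ x, ofR (w x) ^ p :=
  le_trans (by exact le_self_add) (pp_conv p hp1 hp2 s hs w hw h0 B hB)

theorem gk_jensen (p : ℝ) (hp1 : 1 < p) (s : ℝ) (hs : 0 < s) (f : E → ℝ≥0∞) (hf : Measurable f) :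
    (∫⁻ h, ofR (gk s h) * f h) ^ p ≤ ∫⁻ h, ofR (gk s h) * f h ^ p := by
  have hp0 : 0 < p := by linarith
  have mg : Measurable fun h : E => ofR (gk s h) := (gk_meas s).ennreal_ofReal
  have h1 := lintegral_mul_norm_pow_le (μ := (volume : Measure E))
    (f := fun h => ofR (gk s h)) (g := fun h => ofR (gk s h) * f h ^ p)
    mg.aemeasurable (mg.mul (hf.pow_const p)).aemeasurable (p := 1 - 1 / p) (q := 1 / p)
    (by rw [sub_nonneg, div_le_one hp0]; linarith) (by positivity) (by ring)
  have h2 : ∀ h : E, ofR (gk s h) ^ (1 - 1 / p) *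
      (ofR (gk s h) * f h ^ p) ^ (1 / p) = ofR (gk s h) * f h := fun h => by
    rw [mul_rpow_of_nonneg _ _ (by positivity), ← rpow_mul,
      mul_one_div_cancel hp0.ne', ENNReal.rpow_one, ← mul_assoc,
      ← ENNReal.rpow_add_of_nonneg _ _ (by rw [sub_nonneg, div_le_one hp0]; linarith) (by positivity)]
    simp
  simp_rw [h2] at h1
  rw [gk_lintegral s hs, ENNReal.one_rpow, one_mul] at h1
  calc _ ≤ ((∫⁻ h, ofR (gk s h) * f h ^ p) ^ (1 / p)) ^ p := rpow_le_rpow h1 hp0.le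
    _ = _ := by rw [← rpow_mul, one_div_mul_cancel hp0.ne', ENNReal.rpow_one]

/-- real square-function pieces -/
def AR (t : ℝ) (g : E → ℝ) (x : E) : ℝ := PP (4 * t) g x - PP (3 * t) g x

theorem AR_point (t : ℝ) (ht : 0 < t) (g : E → ℝ) (hg : Measurable g) (B : ℝ) (hB : ∀ x, |g x| ≤ B)
    (x : E) : ofR |AR t g x| ≤ ofR (kap E) *
      ∫⁻ h, ofR (gk (3 * t) h) *
        ofR |PP t g (x - h) - PP (3 * t) (PP t g) x| := by
  set u := PP t g with hu
  have mu : Measurable u := PP_meas t g hg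
  have bu : ∀ x, |u x| ≤ B := PP_abs_le t ht g B hB
  set a := PP (3 * t) u x with ha
  have e1 : PP (4 * t) g x = a := by
    rw [ha, hu, PP_semi (3 * t) t (by linarith) ht g hg B hB]; congr 1; ring
  have e2 : PP (3 * t) g x = PP (2 * t) u x := by
    rw [hu, PP_semi (2 * t) t (by linarith) ht g hg B hB]; congr 1; ring
  have i3 := PP_int (3 * t) (by linarith) u mu B bu x
  have i2 := PP_int (2 * t) (by linarith) u mu B bu x
  have g3 := (gk_int (E := E) (3 * t) (by linarith)).mul_const a
  have g2 := (gk_int (E := E) (2 * t) (by linarith)).mul_const a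
  have e3 : AR t g x = ∫ h, (gk (3 * t) h - gk (2 * t) h) * (u (x - h) - a) := by
    have : ∀ h, (gk (3 * t) h - gk (2 * t) h) * (u (x - h) - a) =
        (gk (3 * t) h * u (x - h) - gk (2 * t) h * u (x - h)) - (gk (3 * t) h * a - gk (2 * t) h * a) :=
      fun h => by ring
    simp_rw [this]
    have j1 : Integrable fun h => gk (3 * t) h * u (x - h) - gk (2 * t) h * u (x - h) := i3.sub i2
    have j2 : Integrable fun h : E => gk (3 * t) h * a - gk (2 * t) h * a := g3.sub g2
    rw [integral_sub j1 j2, integral_sub i3 i2, integral_sub g3 g2, integral_mul_const,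
      integral_mul_const, gk_integral _ (by linarith), gk_integral _ (by linarith), sub_self, sub_zero]
    unfold AR; rw [e1, e2]; rfl
  rw [e3, ← Real.norm_eq_abs, ofReal_norm]
  refine (enorm_integral_le_lintegral_enorm _).trans ?_
  rw [← lintegral_const_mul' _ _ ofReal_ne_top]
  refine lintegral_mono fun h => ?_
  simp only
  rw [← ofReal_norm, ← ENNReal.ofReal_mul (gk_nonneg _ (by linarith) _),
    ← ENNReal.ofReal_mul kap_pos.le, norm_mul, ← mul_assoc]
  exact ofReal_le_ofReal (mul_le_mul_of_nonneg_right (gk_comp t ht h) (abs_nonneg _))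

theorem AR_lp (p : ℝ) (hp1 : 1 < p) (hp2 : p ≤ 2) (t : ℝ) (ht : 0 < t) (g : E → ℝ)
    (hg : Measurable g) (h0 : ∀ x, 0 ≤ g x) (B : ℝ) (hB : ∀ x, |g x| ≤ B) :
    (∫⁻ x, ofR |AR t g x| ^ p) ^ (2 / p) ≤
      ofR (kap E) ^ (2 : ℝ) * (DF p (3 * t) (PP t g) *
        (8 * ∫⁻ x, ofR (g x) ^ p) ^ (2 / p - 1)) := by
  have hp0 : 0 < p := by linarith
  set u := PP t g with hu
  have mu : Measurable u := PP_meas t g hg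
  have bu : ∀ x, |u x| ≤ B := PP_abs_le t ht g B hB
  have u0 : ∀ x, 0 ≤ u x := PP_nonneg t ht g h0
  set a := PP (3 * t) u with ha
  have ma : Measurable a := PP_meas _ u mu
  have a0 : ∀ x, 0 ≤ a x := PP_nonneg _ (by linarith) u u0
  set Mg := ∫⁻ x, ofR (g x) ^ p with hMg
  have Mu : ∫⁻ x, ofR (u x) ^ p ≤ Mg := PP_lp p hp1 hp2 t ht g hg h0 B hB
  have Ma : ∫⁻ x, ofR (a x) ^ p ≤ Mg :=
    (PP_lp p hp1 hp2 _ (by linarith) u mu u0 B bu).trans Mu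
  have mz1 : Measurable fun z : E × E => u (z.1 - z.2) := mu.comp (measurable_fst.sub measurable_snd)
  have mz2 : Measurable fun z : E × E => a z.1 := ma.comp measurable_fst
  have mzg : Measurable fun z : E × E => ofR (gk (3 * t) z.2) :=
    ((gk_meas (3 * t)).comp measurable_snd).ennreal_ofReal
  set P1 : E × E → ℝ≥0∞ := fun z => ofR (gk (3 * t) z.2) *
      ofR (dfc p (a z.1) (u (z.1 - z.2))) with hP1
  set P2 : E × E → ℝ≥0∞ := fun z => ofR (gk (3 * t) z.2) *
      ofR ((a z.1 + u (z.1 - z.2)) ^ p) with hP2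
  have mP1 : Measurable P1 := dfc_meas p (3 * t) u mu
  have mP2 : Measurable P2 := mzg.mul ((mz2.add mz1).pow_const p).ennreal_ofReal
  have I1 : ∫⁻ z, P1 z ∂(volume.prod volume) = DF p (3 * t) u :=
    lintegral_prod _ mP1.aemeasurable
  have I2 : ∫⁻ z, P2 z ∂(volume.prod volume) ≤ 8 * Mg := by
    have hle : ∀ z, P2 z ≤ 4 * (ofR (gk (3 * t) z.2) * ofR (a z.1) ^ p) +
        4 * (ofR (gk (3 * t) z.2) * ofR (u (z.1 - z.2)) ^ p) := by
      intro z
      have h1 : (ofR (a z.1) + ofR (u (z.1 - z.2))) ^ p ≤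
          4 * (ofR (a z.1) ^ p + ofR (u (z.1 - z.2)) ^ p) := by
        refine (ENNReal.rpow_add_le_mul_rpow_add_rpow _ _ hp1.le).trans ?_
        refine mul_le_mul' ?_ le_rfl
        calc (2 : ℝ≥0∞) ^ (p - 1) ≤ 2 ^ (2 : ℝ) :=
              rpow_le_rpow_of_exponent_le (by norm_num) (by linarith)
          _ = 4 := by norm_num
      simp only [hP2]
      rw [← ofReal_rpow_of_nonneg (add_nonneg (a0 _) (u0 _)) hp0.le,
        ENNReal.ofReal_add (a0 _) (u0 _)]
      refine (mul_le_mul' le_rfl h1).trans (le_of_eq ?_)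
      ring
    refine (lintegral_mono hle).trans ?_
    have m1 : Measurable fun z : E × E => ofR (gk (3 * t) z.2) * ofR (a z.1) ^ p :=
      mzg.mul (mz2.ennreal_ofReal.pow_const p)
    have m2 : Measurable fun z : E × E => ofR (gk (3 * t) z.2) * ofR (u (z.1 - z.2)) ^ p :=
      mzg.mul (mz1.ennreal_ofReal.pow_const p)
    rw [lintegral_add_left (m1.const_mul _), lintegral_const_mul _ m1, lintegral_const_mul _ m2,
      lintegral_prod _ m1.aemeasurable, lintegral_prod _ m2.aemeasurable]
    simp only
    rw [gk_avg (3 * t) (by linarith) (fun x => ofR (u x) ^ p) (mu.ennreal_ofReal.pow_const p)]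
    have : ∀ x, ∫⁻ h : E, ofR (gk (3 * t) h) * ofR (a x) ^ p =
        ofR (a x) ^ p := fun x => by
      rw [lintegral_mul_const _ (gk_meas (3 * t)).ennreal_ofReal, gk_lintegral _ (by linarith), one_mul]
    simp_rw [this]
    calc _ ≤ 4 * Mg + 4 * Mg := add_le_add (mul_le_mul' le_rfl Ma) (mul_le_mul' le_rfl Mu)
      _ = 8 * Mg := by ring
  have H := lintegral_mul_norm_pow_le (μ := (volume.prod volume : Measure (E × E)))
    mP1.aemeasurable mP2.aemeasurable (p := p / 2) (q := 1 - p / 2) (by linarith) (by linarith) (by ring)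
  have hpt : ∀ z, P1 z ^ (p / 2) * P2 z ^ (1 - p / 2) =
      ofR (gk (3 * t) z.2) * ofR |u (z.1 - z.2) - a z.1| ^ p := by
    intro z
    simp only [hP1, hP2]
    rw [mul_rpow_of_nonneg _ _ (by linarith), mul_rpow_of_nonneg _ _ (by linarith),
      mul_mul_mul_comm, ← ENNReal.rpow_add_of_nonneg _ _ (by linarith) (by linarith),
      ofReal_rpow_of_nonneg (dfc_nonneg p _ _ (a0 _) (u0 _)) (by linarith),
      ofReal_rpow_of_nonneg (Real.rpow_nonneg (add_nonneg (a0 _) (u0 _)) _) (by linarith),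
      ← ENNReal.ofReal_mul (Real.rpow_nonneg (dfc_nonneg p _ _ (a0 _) (u0 _)) _),
      ← dfc_rpow p hp1 hp2 _ _ (a0 _) (u0 _), ofReal_rpow_of_nonneg (abs_nonneg _) hp0.le]
    simp
  simp_rw [hpt] at H
  rw [lintegral_prod _ (by
    exact (mzg.mul ((mz1.sub mz2).abs.ennreal_ofReal.pow_const p)).aemeasurable), I1] at H
  have K1 : ∫⁻ x, ofR |AR t g x| ^ p ≤ ofR (kap E) ^ p *
      (DF p (3 * t) u ^ (p / 2) * (8 * Mg) ^ (1 - p / 2)) := by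
    calc _ ≤ ∫⁻ x, ofR (kap E) ^ p * ∫⁻ h, ofR (gk (3 * t) h) *
          ofR |u (x - h) - a x| ^ p := by
          refine lintegral_mono fun x => ?_
          refine (rpow_le_rpow (AR_point t ht g hg B hB x) hp0.le).trans ?_
          rw [mul_rpow_of_nonneg _ _ hp0.le]
          refine mul_le_mul' le_rfl (gk_jensen p hp1 _ (by linarith) _ ?_)
          exact ((mu.comp (measurable_const.sub measurable_id)).sub measurable_const).abs.ennreal_ofReal
      _ ≤ _ := by
          rw [lintegral_const_mul' _ _ (rpow_ne_top_of_nonneg hp0.le ofReal_ne_top)]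
          refine mul_le_mul' le_rfl (H.trans ?_)
          exact mul_le_mul' le_rfl (rpow_le_rpow I2 (by linarith))
  refine (rpow_le_rpow K1 (by positivity)).trans (le_of_eq ?_)
  rw [mul_rpow_of_nonneg _ _ (by positivity), mul_rpow_of_nonneg _ _ (by positivity),
    ← rpow_mul, ← rpow_mul, ← rpow_mul]
  rw [show p * (2 / p) = 2 by field_simp, show p / 2 * (2 / p) = 1 by field_simp,
    show (1 - p / 2) * (2 / p) = 2 / p - 1 by field_simp, ENNReal.rpow_one]

/-- constant in the real nonnegative square function bound -/
def C4 (E : Type*) [NormedAddCommGroup E] [InnerProductSpace ℝ E] (p : ℝ) : ℝ≥0∞ :=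
  ofR (kap E) ^ (2 : ℝ) * (8 ^ (2 / p - 1) * (ofR (p * (p - 1) / 2))⁻¹)

theorem C4_ne_top (p : ℝ) (hp1 : 1 < p) (hp2 : p ≤ 2) : C4 E p ≠ ⊤ := by
  unfold C4
  refine mul_ne_top (rpow_ne_top_of_nonneg (by norm_num) ofReal_ne_top) ?_
  refine mul_ne_top (rpow_ne_top_of_nonneg ?_ (by norm_num)) ?_
  · rw [sub_nonneg, le_div_iff₀ (by linarith)]; linarith
  · rw [Ne, ENNReal.inv_eq_top, ENNReal.ofReal_eq_zero, not_le]
    nlinarith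

theorem cot_nonneg (p : ℝ) (hp1 : 1 < p) (hp2 : p ≤ 2) (g : E → ℝ)
    (hg : Measurable g) (h0 : ∀ x, 0 ≤ g x) (B : ℝ) (hB : ∀ x, |g x| ≤ B) :
    ∑' k : ℤ, (∫⁻ x, ofR |AR (4 ^ k) g x| ^ p) ^ (2 / p) ≤
      C4 E p * (∫⁻ x, ofR (g x) ^ p) ^ (2 / p) := by
  have hp0 : 0 < p := by linarith
  have h2p : 0 ≤ 2 / p - 1 := by rw [sub_nonneg, le_div_iff₀ hp0]; linarith
  set Mg := ∫⁻ x, ofR (g x) ^ p with hMg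
  set c := ofR (p * (p - 1) / 2) with hc
  have hc0 : c ≠ 0 := by
    rw [hc, Ne, ENNReal.ofReal_eq_zero, not_le]; nlinarith
  have hct : c ≠ ⊤ := ofReal_ne_top
  have hs := tsum_DF p hp1 hp2 g hg h0 B hB
  rw [ENNReal.tsum_mul_left] at hs
  have hs' : ∑' k : ℤ, DF p (3 * 4 ^ k) (PP (4 ^ k) g) ≤ c⁻¹ * Mg := by
    rw [← ENNReal.div_eq_inv_mul, ENNReal.le_div_iff_mul_le (Or.inl hc0) (Or.inl hct), mul_comm]
    exact hs
  calc _ ≤ ∑' k : ℤ, ofR (kap E) ^ (2 : ℝ) * (DF p (3 * 4 ^ k) (PP (4 ^ k) g) *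
        (8 * Mg) ^ (2 / p - 1)) :=
        ENNReal.tsum_le_tsum fun k => AR_lp p hp1 hp2 (4 ^ k) (by positivity) g hg h0 B hB
    _ = ofR (kap E) ^ (2 : ℝ) * ((∑' k : ℤ, DF p (3 * 4 ^ k) (PP (4 ^ k) g)) *
        (8 * Mg) ^ (2 / p - 1)) := by rw [ENNReal.tsum_mul_left, ENNReal.tsum_mul_right]
    _ ≤ ofR (kap E) ^ (2 : ℝ) * ((c⁻¹ * Mg) * (8 * Mg) ^ (2 / p - 1)) :=
        mul_le_mul' le_rfl (mul_le_mul' hs' le_rfl)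
    _ = _ := by
        rw [mul_rpow_of_nonneg _ _ h2p]
        have : Mg ^ (2 / p) = Mg * Mg ^ (2 / p - 1) := by
          nth_rewrite 2 [← ENNReal.rpow_one Mg]
          rw [← ENNReal.rpow_add_of_nonneg _ _ zero_le_one h2p]; congr 1; ring
        rw [this]; unfold C4; ring

/-- complex heat semigroup -/
def PC (s : ℝ) (g : E → ℂ) (x : E) : ℂ := ∫ y, (gk s y : ℂ) * g (x - y)

/-- complex square-function pieces -/
def AK (k : ℤ) (g : E → ℂ) (x : E) : ℂ := PC (4 * 4 ^ k) g x - PC (3 * 4 ^ k) g x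

theorem PC_split (s : ℝ) (hs : 0 < s) (g : E → ℂ) (hg : Measurable g) (B : ℝ) (hB : ∀ x, ‖g x‖ ≤ B)
    (x : E) : PC s g x = PP s (fun x => (g x).re) x + PP s (fun x => (g x).im) x * I := by
  have i1 := PP_int s hs (fun x => (g x).re) (measurable_re.comp hg) B
    (fun x => (abs_re_le_norm _).trans (hB x)) x
  have i2 := PP_int s hs (fun x => (g x).im) (measurable_im.comp hg) B
    (fun x => (abs_im_le_norm _).trans (hB x)) x
  unfold PC PP
  rw [← integral_complex_ofReal, ← integral_complex_ofReal, ← integral_mul_const]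
  beta_reduce
  have j1 : Integrable fun y => ((gk s y * (g (x - y)).re : ℝ) : ℂ) := i1.ofReal
  have j2 : Integrable fun y => ((gk s y * (g (x - y)).im : ℝ) : ℂ) * I := i2.ofReal.mul_const I
  rw [← integral_add j1 j2]
  refine integral_congr_ae (of_forall fun y => ?_)
  simp only
  nth_rewrite 1 [← re_add_im (g (x - y))]
  push_cast; ring

theorem PP_pm (s : ℝ) (hs : 0 < s) (g : E → ℝ) (hg : Measurable g) (B : ℝ) (hB : ∀ x, |g x| ≤ B)
    (x : E) : PP s g x = PP s (fun x => max (g x) 0) x - PP s (fun x => max (-g x) 0) x := by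
  have i1 := PP_int s hs (fun x => max (g x) 0) (hg.max measurable_const) B
    (fun x => by
      refine le_trans ?_ (hB x); rw [abs_of_nonneg (le_max_right _ _)]
      exact max_le (le_abs_self _) (abs_nonneg _)) x
  have i2 := PP_int s hs (fun x => max (-g x) 0) (hg.neg.max measurable_const) B
    (fun x => by
      refine le_trans ?_ (hB x); rw [abs_of_nonneg (le_max_right _ _)]
      exact max_le (neg_le_abs _) (abs_nonneg _)) x
  unfold PP
  rw [← integral_sub i1 i2]
  refine integral_congr_ae (of_forall fun y => ?_)
  simp only
  rw [← mul_sub]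
  congr 1
  rcases le_total 0 (g (x - y)) with h | h
  · rw [max_eq_left h, max_eq_right (by linarith)]; ring
  · rw [max_eq_right h, max_eq_left (by linarith)]; ring

theorem lp_split (p : ℝ) (hp1 : 1 < p) (hp2 : p ≤ 2) (f f₁ f₂ : E → ℝ≥0∞) (h : ∀ x, f x ≤ f₁ x + f₂ x)
    (hf₁ : Measurable f₁) :
    (∫⁻ x, f x ^ p) ^ (2 / p) ≤ 64 * ((∫⁻ x, f₁ x ^ p) ^ (2 / p) + (∫⁻ x, f₂ x ^ p) ^ (2 / p)) := by
  have hp0 : 0 < p := by linarith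
  have h1 : ∫⁻ x, f x ^ p ≤ 2 * ((∫⁻ x, f₁ x ^ p) + ∫⁻ x, f₂ x ^ p) := by
    rw [← lintegral_add_left (hf₁.pow_const p), ← lintegral_const_mul' _ _ (by norm_num)]
    refine lintegral_mono fun x => (rpow_le_rpow (h x) hp0.le).trans ?_
    refine (ENNReal.rpow_add_le_mul_rpow_add_rpow _ _ hp1.le).trans (mul_le_mul' ?_ le_rfl)
    calc (2 : ℝ≥0∞) ^ (p - 1) ≤ 2 ^ (1 : ℝ) :=
          rpow_le_rpow_of_exponent_le (by norm_num) (by linarith)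
      _ = 2 := by norm_num
  have h2p : 1 ≤ 2 / p := by rw [le_div_iff₀ hp0]; linarith
  have h2p' : 2 / p ≤ 2 := by rw [div_le_iff₀ hp0]; linarith
  have h2 : (2 : ℝ≥0∞) ^ (2 / p) ≤ 4 := by
    calc (2 : ℝ≥0∞) ^ (2 / p) ≤ 2 ^ (2 : ℝ) :=
          rpow_le_rpow_of_exponent_le (by norm_num) h2p'
      _ = 4 := by norm_num
  have h3 : (2 : ℝ≥0∞) ^ (2 / p - 1) ≤ 16 := by
    calc (2 : ℝ≥0∞) ^ (2 / p - 1) ≤ 2 ^ (2 : ℝ) :=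
          rpow_le_rpow_of_exponent_le (by norm_num) (by linarith)
      _ = 4 := by norm_num
      _ ≤ 16 := by norm_num
  refine (rpow_le_rpow h1 (by positivity)).trans ?_
  rw [mul_rpow_of_nonneg _ _ (by positivity)]
  calc _ ≤ 4 * (16 * _) := mul_le_mul' h2 ((ENNReal.rpow_add_le_mul_rpow_add_rpow _ _ h2p).trans
        (mul_le_mul' h3 le_rfl))
    _ = _ := by rw [← mul_assoc]; norm_num

theorem AR_meas (t : ℝ) (g : E → ℝ) (hg : Measurable g) : Measurable (AR t g) :=
  (PP_meas _ g hg).sub (PP_meas _ g hg)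

theorem cot_real (p : ℝ) (hp1 : 1 < p) (hp2 : p ≤ 2) (g : E → ℝ)
    (hg : Measurable g) (B : ℝ) (hB : ∀ x, |g x| ≤ B) :
    ∑' k : ℤ, (∫⁻ x, ofR |AR (4 ^ k) g x| ^ p) ^ (2 / p) ≤
      128 * C4 E p * (∫⁻ x, ofR |g x| ^ p) ^ (2 / p) := by
  have hp0 : 0 < p := by linarith
  set g1 : E → ℝ := fun x => max (g x) 0
  set g2 : E → ℝ := fun x => max (-g x) 0
  have m1 : Measurable g1 := hg.max measurable_const
  have m2 : Measurable g2 := hg.neg.max measurable_const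
  have n1 : ∀ x, 0 ≤ g1 x := fun x => le_max_right _ _
  have n2 : ∀ x, 0 ≤ g2 x := fun x => le_max_right _ _
  have l1 : ∀ x, g1 x ≤ |g x| := fun x => max_le (le_abs_self _) (abs_nonneg _)
  have l2 : ∀ x, g2 x ≤ |g x| := fun x => max_le (neg_le_abs _) (abs_nonneg _)
  have b1 : ∀ x, |g1 x| ≤ B := fun x => by rw [abs_of_nonneg (n1 x)]; exact (l1 x).trans (hB x)
  have b2 : ∀ x, |g2 x| ≤ B := fun x => by rw [abs_of_nonneg (n2 x)]; exact (l2 x).trans (hB x)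
  have c1 := cot_nonneg p hp1 hp2 g1 m1 n1 B b1
  have c2 := cot_nonneg p hp1 hp2 g2 m2 n2 B b2
  have d1 : (∫⁻ x, ofR (g1 x) ^ p) ^ (2 / p) ≤ (∫⁻ x, ofR |g x| ^ p) ^ (2 / p) :=
    rpow_le_rpow (lintegral_mono fun x => rpow_le_rpow (ofReal_le_ofReal (l1 x))
      hp0.le) (by positivity)
  have d2 : (∫⁻ x, ofR (g2 x) ^ p) ^ (2 / p) ≤ (∫⁻ x, ofR |g x| ^ p) ^ (2 / p) :=
    rpow_le_rpow (lintegral_mono fun x => rpow_le_rpow (ofReal_le_ofReal (l2 x))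
      hp0.le) (by positivity)
  calc _ ≤ ∑' k : ℤ, 64 * ((∫⁻ x, ofR |AR (4 ^ k) g1 x| ^ p) ^ (2 / p) +
        (∫⁻ x, ofR |AR (4 ^ k) g2 x| ^ p) ^ (2 / p)) := by
        refine ENNReal.tsum_le_tsum fun k => ?_
        have h4 : (0 : ℝ) < 4 ^ k := by positivity
        refine lp_split p hp1 hp2 _ _ _ (fun x => ?_) (AR_meas _ g1 m1).abs.ennreal_ofReal
        rw [← ENNReal.ofReal_add (abs_nonneg _) (abs_nonneg _)]
        refine ofReal_le_ofReal ?_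
        have : AR (4 ^ k) g x = AR (4 ^ k) g1 x - AR (4 ^ k) g2 x := by
          unfold AR
          rw [PP_pm _ (by positivity) g hg B hB, PP_pm (3 * 4 ^ k) (by positivity) g hg B hB]; ring
        rw [this]; exact abs_sub _ _
    _ = 64 * (∑' k : ℤ, (∫⁻ x, ofR |AR (4 ^ k) g1 x| ^ p) ^ (2 / p) +
        ∑' k : ℤ, (∫⁻ x, ofR |AR (4 ^ k) g2 x| ^ p) ^ (2 / p)) := by
        rw [ENNReal.tsum_mul_left, ENNReal.tsum_add]
    _ ≤ 64 * (C4 E p * (∫⁻ x, ofR |g x| ^ p) ^ (2 / p) +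
        C4 E p * (∫⁻ x, ofR |g x| ^ p) ^ (2 / p)) :=
        mul_le_mul' le_rfl (add_le_add (c1.trans (mul_le_mul' le_rfl d1)) (c2.trans (mul_le_mul' le_rfl d2)))
    _ = _ := by ring

/-- square function constant -/
def CC (E : Type*) [NormedAddCommGroup E] [InnerProductSpace ℝ E] (p : ℝ) : ℝ≥0∞ := 16384 * C4 E p

theorem CC_ne_top (p : ℝ) (hp1 : 1 < p) (hp2 : p ≤ 2) : CC E p ≠ ⊤ :=
  mul_ne_top (by norm_num) (C4_ne_top p hp1 hp2)

theorem cot (p : ℝ) (hp1 : 1 < p) (hp2 : p ≤ 2) (g : E → ℂ)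
    (hg : Measurable g) (B : ℝ) (hB : ∀ x, ‖g x‖ ≤ B) :
    ∑' k : ℤ, (∫⁻ x, ‖AK k g x‖ₑ ^ p) ^ (2 / p) ≤ CC E p * (∫⁻ x, ‖g x‖ₑ ^ p) ^ (2 / p) := by
  have hp0 : 0 < p := by linarith
  set g1 : E → ℝ := fun x => (g x).re
  set g2 : E → ℝ := fun x => (g x).im
  have m1 : Measurable g1 := measurable_re.comp hg
  have m2 : Measurable g2 := measurable_im.comp hg
  have l1 : ∀ x, |g1 x| ≤ ‖g x‖ := fun x => abs_re_le_norm _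
  have l2 : ∀ x, |g2 x| ≤ ‖g x‖ := fun x => abs_im_le_norm _
  have b1 : ∀ x, |g1 x| ≤ B := fun x => (l1 x).trans (hB x)
  have b2 : ∀ x, |g2 x| ≤ B := fun x => (l2 x).trans (hB x)
  have c1 := cot_real p hp1 hp2 g1 m1 B b1
  have c2 := cot_real p hp1 hp2 g2 m2 B b2
  have d : ∀ f : E → ℝ, (∀ x, |f x| ≤ ‖g x‖) → (∫⁻ x, ofR |f x| ^ p) ^ (2 / p) ≤
      (∫⁻ x, ‖g x‖ₑ ^ p) ^ (2 / p) := fun f hf =>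
    rpow_le_rpow (lintegral_mono fun x => rpow_le_rpow (by
      rw [← ofReal_norm]; exact ofReal_le_ofReal (hf x)) hp0.le) (by positivity)
  calc _ ≤ ∑' k : ℤ, 64 * ((∫⁻ x, ofR |AR (4 ^ k) g1 x| ^ p) ^ (2 / p) +
        (∫⁻ x, ofR |AR (4 ^ k) g2 x| ^ p) ^ (2 / p)) := by
        refine ENNReal.tsum_le_tsum fun k => ?_
        have h4 : (0 : ℝ) < 4 ^ k := by positivity
        refine lp_split p hp1 hp2 _ _ _ (fun x => ?_) (AR_meas _ g1 m1).abs.ennreal_ofReal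
        rw [← ENNReal.ofReal_add (abs_nonneg _) (abs_nonneg _), ← ofReal_norm]
        refine ofReal_le_ofReal ?_
        have : AK k g x = AR (4 ^ k) g1 x + AR (4 ^ k) g2 x * I := by
          unfold AK AR
          rw [PC_split _ (by positivity) g hg B hB, PC_split (3 * 4 ^ k) (by positivity) g hg B hB]
          push_cast; ring
        rw [this]
        refine (norm_add_le _ _).trans (le_of_eq ?_)
        rw [norm_mul, norm_I, mul_one, norm_real, norm_real]; rfl
    _ = 64 * (∑' k : ℤ, (∫⁻ x, ofR |AR (4 ^ k) g1 x| ^ p) ^ (2 / p) +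
        ∑' k : ℤ, (∫⁻ x, ofR |AR (4 ^ k) g2 x| ^ p) ^ (2 / p)) := by
        rw [ENNReal.tsum_mul_left, ENNReal.tsum_add]
    _ ≤ 64 * (128 * C4 E p * (∫⁻ x, ‖g x‖ₑ ^ p) ^ (2 / p) +
        128 * C4 E p * (∫⁻ x, ‖g x‖ₑ ^ p) ^ (2 / p)) :=
        mul_le_mul' le_rfl (add_le_add (c1.trans (mul_le_mul' le_rfl (d g1 l1)))
          (c2.trans (mul_le_mul' le_rfl (d g2 l2))))
    _ = _ := by unfold CC; ring

end COT3
section reord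
variable {α β γ δ : Type*} [MeasurableSpace α] [MeasurableSpace β] [MeasurableSpace γ] [MeasurableSpace δ]

/-- reordering -/
def reord : (β × δ) × (α × γ) ≃ᵐ (α × β) × (γ × δ) where
  toFun q := ((q.2.1, q.1.1), (q.2.2, q.1.2))
  invFun q := ((q.1.2, q.2.2), (q.1.1, q.2.1))
  left_inv q := rfl
  right_inv q := rfl
  measurable_toFun := by simp only [Equiv.coe_fn_mk]; fun_prop
  measurable_invFun := by simp only [Equiv.coe_fn_symm_mk]; fun_prop

theorem reord_mp (μ : Measure α) (ν : Measure β) (ρ : Measure γ) (τ : Measure δ) [SFinite μ] [SFinite ν]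
    [SFinite ρ] [SFinite τ] :
    MeasurePreserving (reord (α := α) (β := β) (γ := γ) (δ := δ)) ((ν.prod τ).prod (μ.prod ρ))
      ((μ.prod ν).prod (ρ.prod τ)) := by
  refine ⟨reord.measurable, ?_⟩
  refine Measure.ext_of_lintegral _ fun f hf => ?_
  rw [lintegral_map hf reord.measurable]
  have h1 : Measurable fun q : (β × δ) × (α × γ) => f ((q.2.1, q.1.1), (q.2.2, q.1.2)) := by fun_prop
  have e1 : ∫⁻ q, f (reord q) ∂((ν.prod τ).prod (μ.prod ρ)) =
      ∫⁻ s, ∫⁻ t, ∫⁻ x, ∫⁻ y, f ((x, s), (y, t)) ∂ρ ∂μ ∂τ ∂ν := by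
    change ∫⁻ q : (β × δ) × (α × γ), f ((q.2.1, q.1.1), (q.2.2, q.1.2)) ∂((ν.prod τ).prod (μ.prod ρ)) = _
    rw [lintegral_prod _ h1.aemeasurable, lintegral_prod]
    · refine lintegral_congr fun s => lintegral_congr fun t => ?_
      simp only
      rw [lintegral_prod]
      exact Measurable.aemeasurable (by fun_prop)
    · exact (h1.lintegral_prod_right').aemeasurable
  have e2 : ∫⁻ q, f q ∂((μ.prod ν).prod (ρ.prod τ)) =
      ∫⁻ x, ∫⁻ s, ∫⁻ y, ∫⁻ t, f ((x, s), (y, t)) ∂τ ∂ρ ∂ν ∂μ := by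
    rw [lintegral_prod _ hf.aemeasurable, lintegral_prod]
    · refine lintegral_congr fun s => lintegral_congr fun t => ?_
      rw [lintegral_prod]
      exact Measurable.aemeasurable (by fun_prop)
    · exact (hf.lintegral_prod_right').aemeasurable
  rw [e1, e2]
  have m3 : Measurable fun w : (β × α) × γ × δ => f ((w.1.2, w.1.1), (w.2.1, w.2.2)) := by fun_prop
  have e3 : ∀ s, ∫⁻ t, ∫⁻ x, ∫⁻ y, f ((x, s), (y, t)) ∂ρ ∂μ ∂τ =
      ∫⁻ x, ∫⁻ y, ∫⁻ t, f ((x, s), (y, t)) ∂τ ∂ρ ∂μ := by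
    intro s
    rw [lintegral_lintegral_swap]
    · refine lintegral_congr fun x => ?_
      rw [lintegral_lintegral_swap]
      exact Measurable.aemeasurable (by fun_prop)
    · have : Measurable fun w : (δ × α) × γ => f ((w.1.2, s), (w.2, w.1.1)) := by fun_prop
      exact (this.lintegral_prod_right').aemeasurable
  simp_rw [e3]
  rw [lintegral_lintegral_swap]
  have m4 : Measurable fun w : ((β × α) × γ) × δ => f ((w.1.1.2, w.1.1.1), (w.1.2, w.2)) := by fun_prop
  exact (m4.lintegral_prod_right'.lintegral_prod_right').aemeasurable

theorem enorm_reord_le (μ : Measure α) (ν : Measure β) (ρ : Measure γ) (τ : Measure δ) [SFinite μ] [SFinite ν]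
    [SFinite ρ] [SFinite τ] (Ψ : (α × β) × (γ × δ) → ℂ) (hΨ : Integrable Ψ ((μ.prod ν).prod (ρ.prod τ))) :
    ‖∫ p, Ψ p ∂((μ.prod ν).prod (ρ.prod τ))‖ₑ ≤
      ∫⁻ w, ‖∫ q, Ψ ((q.1, w.1), (q.2, w.2)) ∂(μ.prod ρ)‖ₑ ∂(ν.prod τ) := by
  rw [← (reord_mp μ ν ρ τ).integral_comp reord.measurableEmbedding]
  have hi : Integrable (fun q => Ψ (reord q)) ((ν.prod τ).prod (μ.prod ρ)) :=
    ((reord_mp μ ν ρ τ).integrable_comp_emb reord.measurableEmbedding).2 hΨ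
  rw [integral_prod _ hi]
  exact enorm_integral_le_lintegral_enorm _
end reord
section FL

theorem meas_ker : Measurable fun p : ℂ × E => ker p.1 p.2 := by
  have h : Continuous fun q : (ℂ × E) × E => ek q.1.1 q.1.2 q.2 := by unfold ek; fun_prop
  exact (h.stronglyMeasurable.integral_prod_right (ν := (volume : Measure E))).measurable

theorem form_int (z : ℂ) (hz : 0 < z.re) (F G : E → ℂ) (hFi : Integrable F) (hGi : Integrable G) :
    Integrable (fun p : E × E => F p.1 * (starRingEnd ℂ) (G p.2) * ker z (p.1 - p.2)) (volume.prod volume) := by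
  have h1 : Integrable (fun p : E × E => F p.1 * (starRingEnd ℂ) (G p.2)) (volume.prod volume) := by
    refine hFi.mul_prod (g := fun y => (starRingEnd ℂ) (G y)) ?_
    exact (Complex.conjLIE.toContinuousLinearEquiv.integrable_comp_iff).2 hGi
  refine h1.mul_bdd (c := z.re⁻¹ ^ dimR E * ∫ ξ : E, Real.exp (-‖ξ‖)) ?_ ?_
  · exact (meas_ker.comp (measurable_const.prodMk (measurable_fst.sub measurable_snd))).aestronglyMeasurable
  · exact of_forall fun p => ker_le z hz _

/-- L^p form bound by real interpolation -/
theorem form_Lp (z : ℂ) (hz : 0 < z.re) (F G : E → ℂ) (hF : Measurable F) (hG : Measurable G)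
    (hFi : Integrable F) (hGi : Integrable G) (r θ : ℝ) (h0 : 0 < θ) (h1 : θ < 1) (hr : 2 / r - 1 = θ)
    (hr0 : 0 < r)
    (S : ℝ≥0∞) (hS : ∀ x : E, ‖ker z x‖ₑ ≤ S) :
    ‖∫ p : E × E, F p.1 * (starRingEnd ℂ) (G p.2) * ker z (p.1 - p.2)‖ₑ ≤
      CI θ * S ^ θ * (∫⁻ x, ‖F x‖ₑ ^ r) ^ (1 / r) * (∫⁻ x, ‖G x‖ₑ ^ r) ^ (1 / r) := by
  have key : ∀ a : ℝ≥0∞, a ^ (r / 2) * (a ^ (r / 2)) ^ θ = a := fun a => by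
    rw [← rpow_mul, ← ENNReal.rpow_add_of_nonneg _ _ (by positivity) (by positivity), ← hr]
    rw [show r / 2 + r / 2 * (2 / r - 1) = 1 by field_simp; ring, ENNReal.rpow_one]
  have key2 : ∀ a : ℝ≥0∞, (a ^ (r / 2)) ^ 2 = a ^ r := fun a => by
    rw [← ENNReal.rpow_natCast, ← rpow_mul]; congr 1; push_cast; ring
  have hb : ∀ (S : Set E), ∀ K : E → ℂ, ∀ x, S.indicator K x = S.indicator 1 x * K x := fun S K x => by
    by_cases h : x ∈ S <;> simp [h]
  have := lemI (volume : Measure E) (volume : Measure E) θ h0 h1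
    (fun p : E × E => F p.1 * (starRingEnd ℂ) (G p.2) * ker z (p.1 - p.2)) (form_int z hz F G hFi hGi)
    (fun x => ‖F x‖ₑ ^ (r / 2)) (fun x => ‖F x‖ₑ ^ (r / 2)) (fun x => ‖G x‖ₑ ^ (r / 2))
    (fun x => ‖G x‖ₑ ^ (r / 2)) (hF.enorm.pow_const _) (hF.enorm.pow_const _) (hG.enorm.pow_const _)
    (hG.enorm.pow_const _) (fun x => rpow_ne_top_of_nonneg (by positivity) enorm_ne_top)
    (fun x => rpow_ne_top_of_nonneg (by positivity) enorm_ne_top) 1 S one_ne_zero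
    ENNReal.one_ne_top ?_ ?_
  · refine this.trans (le_of_eq ?_)
    simp_rw [key2]
    rw [ENNReal.one_rpow, one_mul, mul_rpow_of_nonneg _ _ h0.le,
      mul_rpow_of_nonneg _ _ h0.le]
    have key3 : ∀ a : ℝ≥0∞, a ^ (1 / r) = (a ^ (1 / 2 : ℝ)) ^ θ * a ^ (1 / 2 : ℝ) := fun a => by
      rw [← rpow_mul, ← ENNReal.rpow_add_of_nonneg _ _ (by positivity) (by positivity), ← hr]
      congr 1; field_simp; ring
    rw [key3, key3]; ring
  · intro S S' mS mS'
    simp_rw [key, one_mul]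
    have e : ∫ p in S ×ˢ S', F p.1 * (starRingEnd ℂ) (G p.2) * ker z (p.1 - p.2) ∂(volume.prod volume) =
        ∫ p : E × E, S.indicator F p.1 * (starRingEnd ℂ) (S'.indicator G p.2) * ker z (p.1 - p.2) := by
      rw [← integral_indicator (mS.prod mS')]
      refine integral_congr_ae (of_forall fun p => ?_)
      by_cases h1 : p.1 ∈ S <;> by_cases h2 : p.2 ∈ S' <;> simp [Set.indicator, h1, h2]
    rw [e]
    refine (form_L2 z hz _ _ (hF.indicator mS) (hG.indicator mS') (hFi.indicator mS)
      (hGi.indicator mS')).trans (le_of_eq ?_)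
    have e2 : ∀ (S : Set E) (K : E → ℂ), MeasurableSet S →
        ∫⁻ x, ‖S.indicator K x‖ₑ ^ 2 = ∫⁻ x in S, ‖K x‖ₑ ^ 2 := fun S K mS => by
      rw [← lintegral_indicator mS]
      refine lintegral_congr fun x => ?_
      by_cases h1 : x ∈ S <;> simp [Set.indicator, h1]
    rw [e2 S F mS, e2 S' G mS']
  · intro p
    rw [key, key, enorm_mul, enorm_mul, RCLike.enorm_conj, mul_comm]
    exact mul_le_mul' (hS _) le_rfl

theorem PC_ft (s : ℝ) (hs : 0 < s) (g : E → ℂ) (hg : Measurable g) (hi : Integrable g) (ξ : E) :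
    ft (PC s g) ξ = ((Real.exp (-(Real.pi * s) * ‖ξ‖ ^ 2) : ℝ) : ℂ) * ft g ξ := by
  rw [← ft_gk s hs]
  unfold ft PC
  have hph : ∀ x y : E, ph x ξ = ph y ξ * ph (x - y) ξ := fun x y => by
    unfold ph; rw [← Complex.exp_add]; congr 1
    rw [inner_sub_left]; push_cast; ring
  have e1 : ∀ x, (∫ y, (gk s y : ℂ) * g (x - y)) * ph x ξ =
      ∫ y, ((gk s y : ℂ) * ph y ξ) * (g (x - y) * ph (x - y) ξ) := fun x => by
    rw [← integral_mul_const]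
    refine integral_congr_ae (of_forall fun y => ?_)
    simp only
    rw [hph x y]; ring
  simp_rw [e1]
  have cph : Continuous fun x : E => ph x ξ := by unfold ph; fun_prop
  have ig : Integrable fun y : E => (gk s y : ℂ) * ph y ξ :=
    (gk_int s hs).ofReal.mul_bdd (c := 1) cph.aestronglyMeasurable
      (of_forall fun y => (norm_ph _ _).le)
  have ih : Integrable fun y : E => g y * ph y ξ :=
    hi.mul_bdd (c := 1) cph.aestronglyMeasurable
      (of_forall fun y => (norm_ph _ _).le)
  rw [integral_integral_swap]
  · have e2 : ∀ y, ∫ x, ((gk s y : ℂ) * ph y ξ) * (g (x - y) * ph (x - y) ξ) =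
        ((gk s y : ℂ) * ph y ξ) * ∫ x, g x * ph x ξ := fun y => by
      rw [integral_const_mul, integral_sub_right_eq_self (fun x => g x * ph x ξ)]
    simp_rw [e2]
    rw [integral_mul_const]
  · exact ig.convolution_integrand (ContinuousLinearMap.mul ℝ ℂ) ih

/-- multiplier of AK -/
def mlt (k : ℤ) (ξ : E) : ℝ :=
  Real.exp (-(Real.pi * (4 * 4 ^ k)) * ‖ξ‖ ^ 2) - Real.exp (-(Real.pi * (3 * 4 ^ k)) * ‖ξ‖ ^ 2)

theorem PC_int (s : ℝ) (hs : 0 < s) (g : E → ℂ) (hi : Integrable g) : Integrable (PC s g) := by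
  have h : Integrable fun y : E => (gk s y : ℂ) := (gk_int s hs).ofReal
  exact (h.convolution_integrand (ContinuousLinearMap.mul ℝ ℂ) hi).integral_prod_left

theorem AK_ft (k : ℤ) (g : E → ℂ) (hg : Measurable g) (hi : Integrable g) (ξ : E) :
    ft (AK k g) ξ = (mlt k ξ : ℂ) * ft g ξ := by
  have h1 := PC_ft (4 * 4 ^ k) (by positivity) g hg hi ξ
  have h2 := PC_ft (3 * 4 ^ k) (by positivity) g hg hi ξ
  have cph : Continuous fun x : E => ph x ξ := by unfold ph; fun_prop
  have ih : ∀ g : E → ℂ, Integrable g → Integrable fun y : E => g y * ph y ξ := fun g hi =>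
    hi.mul_bdd (c := 1) cph.aestronglyMeasurable
      (of_forall fun y => (norm_ph _ _).le)
  have : ft (AK k g) ξ = ft (PC (4 * 4 ^ k) g) ξ - ft (PC (3 * 4 ^ k) g) ξ := by
    unfold ft
    rw [← integral_sub (ih _ (PC_int _ (by positivity) g hi)) (ih _ (PC_int _ (by positivity) g hi))]
    refine integral_congr_ae (of_forall fun y => ?_)
    simp only [AK]; ring
  rw [this, h1, h2]; unfold mlt; push_cast; ring

theorem mlt_lower (k : ℤ) (ξ : E) (h1 : 1 ≤ 2 ^ k * ‖ξ‖) (h2 : 2 ^ k * ‖ξ‖ ≤ 2) :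
    Real.exp (-(12 * Real.pi)) * (1 - Real.exp (-Real.pi)) ≤ |mlt k ξ| := by
  set y := (2 ^ k * ‖ξ‖) ^ 2 with hy
  have hy1 : 1 ≤ y := by rw [hy]; nlinarith
  have hy4 : y ≤ 4 := by rw [hy]; nlinarith
  have e4 : (4 : ℝ) ^ k * ‖ξ‖ ^ 2 = y := by
    rw [hy, mul_pow, ← zpow_natCast ((2 : ℝ) ^ k), ← zpow_mul, mul_comm k, zpow_mul]; norm_num
  unfold mlt
  rw [show -(Real.pi * (4 * 4 ^ k)) * ‖ξ‖ ^ 2 = -(4 * Real.pi * y) by rw [← e4]; ring,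
    show -(Real.pi * (3 * 4 ^ k)) * ‖ξ‖ ^ 2 = -(3 * Real.pi * y) by rw [← e4]; ring]
  rw [show -(4 * Real.pi * y) = -(3 * Real.pi * y) + -(Real.pi * y) by ring, Real.exp_add, abs_sub_comm]
  have h5 : Real.exp (-(Real.pi * y)) ≤ Real.exp (-Real.pi) := Real.exp_le_exp.2 (by
    have := Real.pi_pos; nlinarith)
  have h6 : Real.exp (-(12 * Real.pi)) ≤ Real.exp (-(3 * Real.pi * y)) := Real.exp_le_exp.2 (by
    have := Real.pi_pos; nlinarith)
  have h7 : Real.exp (-Real.pi) ≤ 1 := Real.exp_le_one_iff.2 (by have := Real.pi_pos; linarith)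
  refine le_trans ?_ (le_abs_self _)
  calc _ ≤ Real.exp (-(3 * Real.pi * y)) * (1 - Real.exp (-(Real.pi * y))) :=
        mul_le_mul h6 (by linarith) (by linarith) (Real.exp_pos _).le
    _ = _ := by ring

end FL
section NI

/-- bounded measurable with bounded support -/
def Nice {X : Type*} [NormedAddCommGroup X] [MeasurableSpace X] (g : X → ℂ) : Prop :=
  Measurable g ∧ (∃ B, ∀ z, ‖g z‖ ≤ B) ∧ ∃ R, ∀ z, R < ‖z‖ → g z = 0

theorem Nice.intOn {X : Type*} [NormedAddCommGroup X] [MeasurableSpace X] [BorelSpace X]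
    [ProperSpace X] (μ : Measure X) [IsFiniteMeasureOnCompacts μ] {g : X → ℂ} (h : Nice g) : Integrable g μ := by
  obtain ⟨hm, ⟨B, hB⟩, R, hR⟩ := h
  have h1 : IntegrableOn g (closedBall 0 R) μ :=
    IntegrableOn.of_bound (isCompact_closedBall 0 R).measure_lt_top hm.aestronglyMeasurable B
      (of_forall hB)
  refine (integrableOn_iff_integrable_of_support_subset ?_).1 h1
  intro z hz
  rw [mem_closedBall_zero_iff]
  by_contra hc
  exact hz (hR z (not_le.1 hc))

theorem Nice.slice {g : E × ℝ → ℂ} (h : Nice g) (s : ℝ) : Nice fun x => g (x, s) := by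
  obtain ⟨hm, ⟨B, hB⟩, R, hR⟩ := h
  exact ⟨hm.comp (measurable_id.prodMk measurable_const), ⟨B, fun z => hB _⟩, R,
    fun z hz => hR _ (hz.trans_le (le_max_left _ _))⟩

theorem Nice.slice' {g : E × ℝ → ℂ} (h : Nice g) (x : E) : Nice fun s => g (x, s) := by
  obtain ⟨hm, ⟨B, hB⟩, R, hR⟩ := h
  exact ⟨hm.comp (measurable_const.prodMk measurable_id), ⟨B, fun z => hB _⟩, R,
    fun z hz => hR _ (hz.trans_le (le_max_right _ _))⟩

theorem Nice.indicator {X : Type*} [NormedAddCommGroup X] [MeasurableSpace X] {g : X → ℂ} (h : Nice g)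
    {S : Set X} (hS : MeasurableSet S) : Nice (S.indicator g) := by
  obtain ⟨hm, ⟨B, hB⟩, R, hR⟩ := h
  refine ⟨hm.indicator hS, ⟨B, fun z => ?_⟩, R, fun z hz => ?_⟩
  · by_cases h : z ∈ S
    · simp [h, hB]
    · simp [h, (norm_nonneg _).trans (hB z)]
  · by_cases h : z ∈ S
    · simp [h, hR z hz]
    · simp [h]

/-- slice-wise square function piece -/
def AKs (k : ℤ) (g : E × ℝ → ℂ) (z : E × ℝ) : ℂ := AK k (fun x => g (x, z.2)) z.1

theorem AKs_meas (k : ℤ) (g : E × ℝ → ℂ) (hg : Measurable g) : Measurable (AKs k g) := by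
  have h : ∀ s : ℝ, Measurable fun z : E × ℝ => PC s (fun x => g (x, z.2)) z.1 := fun s => by
    have h1 : Measurable fun q : (E × ℝ) × E => (gk s q.2 : ℂ) * g (q.1.1 - q.2, q.1.2) := by
      refine (measurable_ofReal.comp ((gk_meas s).comp measurable_snd)).mul (hg.comp ?_)
      exact ((measurable_fst.comp measurable_fst).sub measurable_snd).prodMk
        (measurable_snd.comp measurable_fst)
    exact (h1.stronglyMeasurable.integral_prod_right (ν := (volume : Measure E))).measurable
  exact (h _).sub (h _)

theorem PC_l1 (s : ℝ) (hs : 0 < s) (g : E → ℂ) (hg : Measurable g) :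
    ∫⁻ x, ‖PC s g x‖ₑ ≤ ∫⁻ x, ‖g x‖ₑ := by
  rw [← gk_avg s hs (fun x => ‖g x‖ₑ) hg.enorm]
  refine lintegral_mono fun x => (enorm_integral_le_lintegral_enorm _).trans (le_of_eq ?_)
  refine lintegral_congr fun h => ?_
  rw [enorm_mul]; congr 1
  rw [← ofReal_norm, norm_real, Real.norm_of_nonneg (gk_nonneg s hs h)]

theorem AK_l1 (k : ℤ) (g : E → ℂ) (hg : Measurable g) :
    ∫⁻ x, ‖AK k g x‖ₑ ≤ 2 * ∫⁻ x, ‖g x‖ₑ := by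
  have hm : Measurable fun x => PC (4 * 4 ^ k) g x := by
    have h1 : Measurable fun q : E × E => (gk (4 * 4 ^ k) q.2 : ℂ) * g (q.1 - q.2) :=
      (measurable_ofReal.comp ((gk_meas _).comp measurable_snd)).mul
        (hg.comp (measurable_fst.sub measurable_snd))
    exact (h1.stronglyMeasurable.integral_prod_right (ν := (volume : Measure E))).measurable
  calc _ ≤ ∫⁻ x, (‖PC (4 * 4 ^ k) g x‖ₑ + ‖PC (3 * 4 ^ k) g x‖ₑ) :=
        lintegral_mono fun x => by unfold AK; exact enorm_sub_le
    _ ≤ _ := by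
        rw [lintegral_add_left hm.enorm, two_mul]
        exact add_le_add (PC_l1 _ (by positivity) g hg) (PC_l1 _ (by positivity) g hg)

theorem AKs_int (k : ℤ) (g : E × ℝ → ℂ) (hg : Nice g) : Integrable (AKs k g) := by
  refine ⟨(AKs_meas k g hg.1).aestronglyMeasurable, ?_⟩
  rw [hasFiniteIntegral_iff_enorm, Measure.volume_eq_prod,
    lintegral_prod_symm _ (AKs_meas k g hg.1).enorm.aemeasurable]
  calc _ ≤ ∫⁻ s, 2 * ∫⁻ x, ‖g (x, s)‖ₑ := lintegral_mono fun s =>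
        AK_l1 k (fun x => g (x, s)) (hg.slice s).1
    _ = 2 * ∫⁻ z : E × ℝ, ‖g z‖ₑ := by
        rw [lintegral_const_mul' _ _ (by norm_num), Measure.volume_eq_prod,
          lintegral_prod_symm _ hg.1.enorm.aemeasurable]
    _ < ⊤ := mul_lt_top (by norm_num)
        (hasFiniteIntegral_iff_enorm.1 (hg.intOn (volume : Measure (E × ℝ))).2)

/-- space-time amplitude -/
def am (e : ℝ) (g : E × ℝ → ℂ) (ξ : E) : ℂ :=
  amp (volume : Measure (E × ℝ)) g Prod.fst (fun z => e * z.2) ξ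

theorem pw_split (x : E) (t : ℝ) (ξ : E) : pw x t ξ = ph x ξ * cexp ((t * ‖ξ‖ : ℝ) * I) := by
  unfold pw ph; rw [← Complex.exp_add]; congr 1; push_cast; ring

theorem am_eq (e : ℝ) (g : E × ℝ → ℂ) (hi : Integrable g) (ξ : E) :
    am e g ξ = ∫ s : ℝ, ft (fun x => g (x, s)) ξ * cexp ((e * s * ‖ξ‖ : ℝ) * I) := by
  unfold am amp
  have hi2 : Integrable (fun z : E × ℝ => g z * pw z.1 (e * z.2) ξ) := by
    refine hi.mul_bdd (c := 1) ?_ (of_forall fun z => (norm_pw _ _ _).le)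
    exact (meas_pw measurable_fst (measurable_const.mul measurable_snd) measurable_const).aestronglyMeasurable
  rw [Measure.volume_eq_prod] at hi2 ⊢
  rw [integral_prod_symm _ hi2]
  refine integral_congr_ae (of_forall fun s => ?_)
  simp only [ft]
  rw [← integral_mul_const]
  refine integral_congr_ae (of_forall fun x => ?_)
  simp only [pw_split]; ring

theorem am_AKs (e : ℝ) (k : ℤ) (g : E × ℝ → ℂ) (hg : Nice g) (ξ : E) :
    am e (AKs k g) ξ = (mlt k ξ : ℂ) * am e g ξ := by
  rw [am_eq e _ (AKs_int k g hg), am_eq e _ (hg.intOn _), ← integral_const_mul]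
  refine integral_congr_ae (of_forall fun s => ?_)
  have := AK_ft k (fun x => g (x, s)) (hg.slice s).1 ((hg.slice s).intOn _) ξ
  simp only [AKs]
  rw [show (fun x => AK k (fun x => g (x, s)) x) = AK k (fun x => g (x, s)) from rfl, this]
  ring

theorem am_meas (e : ℝ) (g : E × ℝ → ℂ) (hg : Measurable g) : Measurable (am e g) :=
  meas_amp _ _ hg.aestronglyMeasurable _ _ measurable_fst (measurable_const.mul measurable_snd)

/-- lower bound for frequency decomposition -/
def cm : ℝ := Real.exp (-2) * (Real.exp (-(12 * Real.pi)) * (1 - Real.exp (-Real.pi))) ^ 2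

theorem cm_pos : 0 < cm := by
  unfold cm
  have : Real.exp (-Real.pi) < 1 := Real.exp_lt_one_iff.2 (by have := Real.pi_pos; linarith)
  have h : 0 < 1 - Real.exp (-Real.pi) := by linarith
  positivity

theorem freq_dec (α : ℝ) (hα : 0 ≤ α) (ξ : E) (hξ : ξ ≠ 0) :
    ∃ k : ℤ, cm * ‖ξ‖ ^ (-α) ≤ ((2 : ℝ) ^ k) ^ α * Real.exp (-(2 ^ k) * ‖ξ‖) * (mlt k ξ) ^ 2 := by
  have hx : 0 < ‖ξ‖ := norm_pos_iff.2 hξ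
  obtain ⟨i, hi1, hi2⟩ := exists_mem_Ico_zpow (x := ‖ξ‖⁻¹) (y := (2 : ℝ)) (by positivity) (by norm_num)
  refine ⟨i + 1, ?_⟩
  have e1 : (2 : ℝ) ^ (i + 1) = 2 * 2 ^ i := by rw [zpow_add₀ (by norm_num)]; ring
  have h2i : (0 : ℝ) < 2 ^ i := by positivity
  have h1 : 1 ≤ 2 ^ (i + 1) * ‖ξ‖ := by
    rw [inv_lt_iff_one_lt_mul₀ hx] at hi2; linarith
  have h2 : 2 ^ (i + 1) * ‖ξ‖ ≤ 2 := by
    rw [le_inv_comm₀ h2i hx] at hi1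
    have := mul_le_mul_of_nonneg_left hi1 h2i.le
    rw [mul_inv_cancel₀ h2i.ne'] at this
    rw [e1]; linarith
  set a : ℝ := 2 ^ (i + 1)
  have ha : 0 < a := by positivity
  have hm := mlt_lower (i + 1) ξ h1 h2
  have h7 : Real.exp (-Real.pi) ≤ 1 := Real.exp_le_one_iff.2 (by have := Real.pi_pos; linarith)
  have hm2 : (Real.exp (-(12 * Real.pi)) * (1 - Real.exp (-Real.pi))) ^ 2 ≤ (mlt (i + 1) ξ) ^ 2 := by
    rw [← sq_abs (mlt (i + 1) ξ)]
    refine pow_le_pow_left₀ (mul_nonneg (Real.exp_pos _).le (by linarith)) hm 2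
  have h3 : ‖ξ‖ ^ (-α) ≤ a ^ α := by
    rw [Real.rpow_neg hx.le, ← Real.inv_rpow hx.le]
    refine Real.rpow_le_rpow (by positivity) ?_ hα
    rw [inv_le_iff_one_le_mul₀ hx]; exact h1
  have h4 : Real.exp (-2) ≤ Real.exp (-a * ‖ξ‖) := Real.exp_le_exp.2 (by linarith)
  unfold cm
  calc _ = ‖ξ‖ ^ (-α) * Real.exp (-2) *
        (Real.exp (-(12 * Real.pi)) * (1 - Real.exp (-Real.pi))) ^ 2 := by ring
    _ ≤ _ := by
        refine mul_le_mul (mul_le_mul h3 h4 (Real.exp_pos _).le (by positivity)) hm2 (by positivity)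
          (by positivity)

/-- quadratic form with damping -/
def Qf (e a : ℝ) (g : E × ℝ → ℂ) : ℝ≥0∞ :=
  ∫⁻ ξ : E, ofR (Real.exp (-a * ‖ξ‖)) * ‖am e g ξ‖ₑ ^ 2

theorem am_sum (e α : ℝ) (hα : 0 ≤ α) (hn : 0 < dimR E) (g : E × ℝ → ℂ) (hg : Nice g) :
    ofR cm * ∫⁻ ξ : E, ofR (‖ξ‖ ^ (-α)) * ‖am e g ξ‖ₑ ^ 2 ≤
      ∑' k : ℤ, ofR (((2 : ℝ) ^ k) ^ α) * Qf e (2 ^ k) (AKs k g) := by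
  haveI : Nontrivial E := Module.finrank_pos_iff.1 hn
  simp_rw [Qf, ← lintegral_const_mul' _ _ ofReal_ne_top]
  rw [← lintegral_tsum]
  · refine lintegral_mono_ae ?_
    have : ∀ᵐ ξ : E, ξ ≠ 0 := by
      rw [ae_iff]; simp
    filter_upwards [this] with ξ hξ
    obtain ⟨k, hk⟩ := freq_dec α hα ξ hξ
    refine le_trans ?_ (ENNReal.le_tsum k)
    rw [am_AKs e k g hg, enorm_mul, mul_pow, ← mul_assoc, ← mul_assoc, ← mul_assoc,
      ← ENNReal.ofReal_mul cm_pos.le, ← ENNReal.ofReal_mul (by positivity)]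
    refine mul_le_mul' ?_ le_rfl
    have : ‖(mlt k ξ : ℂ)‖ₑ ^ 2 = ofR (mlt k ξ ^ 2) := by
      rw [← ofReal_norm, ← ENNReal.ofReal_pow (norm_nonneg _), norm_real, Real.norm_eq_abs, sq_abs]
    rw [this, ← ENNReal.ofReal_mul (by positivity)]
    exact ofReal_le_ofReal hk
  · intro k
    refine Measurable.aemeasurable ?_
    have := (am_meas e _ (AKs_meas k g hg.1)).enorm.pow_const 2
    have h2 : Measurable fun ξ : E => ofR (Real.exp (-2 ^ k * ‖ξ‖)) := by fun_prop
    exact (h2.mul this).const_mul _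

theorem Qf_eq (e a : ℝ) (ha : 0 < a) (g : E × ℝ → ℂ) (hi : Integrable g) (hm : Measurable g) :
    Qf e a g = ‖∫ p, g p.1 * (starRingEnd ℂ) (g p.2) *
        ker (a - (e * p.1.2 - e * p.2.2 : ℝ) * I) (p.1.1 - p.2.1)
          ∂((volume : Measure (E × ℝ)).prod (volume : Measure (E × ℝ)))‖ₑ := by
  have h := form_ker (E := E) (volume : Measure (E × ℝ)) (volume : Measure (E × ℝ)) g g hi hi Prod.fst Prod.fst
    (fun z => e * z.2) (fun z => e * z.2) measurable_fst measurable_fst (measurable_const.mul measurable_snd)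
    (measurable_const.mul measurable_snd) (a : ℂ) (by simpa using ha)
  rw [← h]
  have e1 : ∀ ξ : E, cexp (-(a : ℂ) * (‖ξ‖ : ℝ)) *
      (amp (volume : Measure (E × ℝ)) g Prod.fst (fun z => e * z.2) ξ *
        (starRingEnd ℂ) (amp (volume : Measure (E × ℝ)) g Prod.fst (fun z => e * z.2) ξ)) =
      ((Real.exp (-a * ‖ξ‖) * ‖am e g ξ‖ ^ 2 : ℝ) : ℂ) := fun ξ => by
    rw [mul_conj, normSq_eq_norm_sq]; unfold am; push_cast; rfl
  simp_rw [e1]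
  rw [integral_complex_ofReal]
  have h0 : ∀ ξ : E, 0 ≤ Real.exp (-a * ‖ξ‖) * ‖am e g ξ‖ ^ 2 := fun ξ => by positivity
  have hIntg : Integrable fun ξ : E => Real.exp (-a * ‖ξ‖) * ‖am e g ξ‖ ^ 2 := by
    refine (int_exp_norm a ha).mul_bdd (c := (∫ z, ‖g z‖) ^ 2) ?_ (of_forall fun ξ => ?_)
    · exact ((am_meas e g hm).norm.pow_const 2).aestronglyMeasurable
    · rw [Real.norm_of_nonneg (by positivity)]
      exact pow_le_pow_left₀ (norm_nonneg _) (norm_amp_le _ _ _ _ _) 2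
  rw [← ofReal_norm, norm_real, Real.norm_of_nonneg (integral_nonneg h0),
    ofReal_integral_eq_lintegral_ofReal hIntg (of_forall h0)]
  unfold Qf
  refine lintegral_congr fun ξ => ?_
  rw [ENNReal.ofReal_mul (Real.exp_pos _).le, ENNReal.ofReal_pow (norm_nonneg _), ofReal_norm]

theorem big_int (e a : ℝ) (ha : 0 < a) (g : E × ℝ → ℂ) (hi : Integrable g) :
    Integrable (fun p : (E × ℝ) × (E × ℝ) => g p.1 * (starRingEnd ℂ) (g p.2) *
        ker (a - (e * p.1.2 - e * p.2.2 : ℝ) * I) (p.1.1 - p.2.1))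
      ((volume : Measure (E × ℝ)).prod (volume : Measure (E × ℝ))) := by
  have h1 : Integrable (fun p : (E × ℝ) × (E × ℝ) => g p.1 * (starRingEnd ℂ) (g p.2))
      ((volume : Measure (E × ℝ)).prod (volume : Measure (E × ℝ))) := by
    refine hi.mul_prod (g := fun y => (starRingEnd ℂ) (g y)) ?_
    exact (Complex.conjLIE.toContinuousLinearEquiv.integrable_comp_iff).2 hi
  refine h1.mul_bdd (c := a⁻¹ ^ dimR E * ∫ ξ : E, Real.exp (-‖ξ‖)) ?_ ?_
  · have : Measurable fun p : (E × ℝ) × (E × ℝ) =>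
      ((a - (e * p.1.2 - e * p.2.2 : ℝ) * I : ℂ), p.1.1 - p.2.1) := by fun_prop
    exact (meas_ker.comp this).aestronglyMeasurable
  · refine of_forall fun p => ?_
    have := ker_le (E := E) (a - (e * p.1.2 - e * p.2.2 : ℝ) * I) (by simpa using ha) (p.1.1 - p.2.1)
    simpa using this

end NI
section DS

theorem mink_sum {α : Type*} [MeasurableSpace α] (μ : Measure α) (F : ℤ → α → ℝ≥0∞) (hF : ∀ k, Measurable (F k))
    (a : ℝ) (h0 : 0 < a) (h2 : a ≤ 2) (hS : ∀ s, ∑' k, F k s ^ 2 ≠ ⊤) :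
    ∑' k, (∫⁻ s, F k s ^ a ∂μ) ^ (2 / a) ≤ (∫⁻ s, (∑' k, F k s ^ 2) ^ (a / 2) ∂μ) ^ (2 / a) := by
  set S : α → ℝ≥0∞ := fun s => ∑' k, F k s ^ 2 with hSd
  have hSm : Measurable S := Measurable.tsum fun k => (hF k).pow_const 2
  set T := ∫⁻ s, S s ^ (a / 2) ∂μ with hT
  have hFS : ∀ k, Measurable fun s => F k s ^ 2 * S s ^ (a / 2 - 1) := fun k =>
    ((hF k).pow_const 2).mul (hSm.pow_const _)
  have h1 : ∀ k, (∫⁻ s, F k s ^ a ∂μ) ^ (2 / a) ≤ (∫⁻ s, F k s ^ 2 * S s ^ (a / 2 - 1) ∂μ) * T ^ (2 / a - 1) := by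
    intro k
    have h3 : ∫⁻ s, F k s ^ a ∂μ ≤ (∫⁻ s, F k s ^ 2 * S s ^ (a / 2 - 1) ∂μ) ^ (a / 2) * T ^ (1 - a / 2) := by
      refine le_trans ?_ (lintegral_mul_norm_pow_le (hFS k).aemeasurable
        (hSm.pow_const _).aemeasurable (by positivity) (by linarith) (by ring))
      refine lintegral_mono fun s => ?_
      have hle : F k s ^ 2 ≤ S s := ENNReal.le_tsum k
      by_cases hs0 : S s = 0
      · have : F k s = 0 := by rw [hs0] at hle; simpa using hle
        simp [this, h0]
      · rw [mul_rpow_of_nonneg _ _ (by positivity), ← ENNReal.rpow_natCast, ← rpow_mul,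
          ← rpow_mul, ← rpow_mul, mul_assoc, ← ENNReal.rpow_add _ _ hs0 (hS s)]
        rw [show (a / 2 - 1) * (a / 2) + a / 2 * (1 - a / 2) = 0 by ring, ENNReal.rpow_zero, mul_one]
        apply le_of_eq; congr 1; push_cast; ring
    refine (rpow_le_rpow h3 (by positivity)).trans (le_of_eq ?_)
    rw [mul_rpow_of_nonneg _ _ (by positivity), ← rpow_mul, ← rpow_mul,
      show a / 2 * (2 / a) = 1 by field_simp, ENNReal.rpow_one]
    congr 2; field_simp
  refine (ENNReal.tsum_le_tsum h1).trans ?_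
  rw [ENNReal.tsum_mul_right, ← lintegral_tsum fun k => (hFS k).aemeasurable]
  have h4 : ∫⁻ s, ∑' k, F k s ^ 2 * S s ^ (a / 2 - 1) ∂μ = T := by
    refine lintegral_congr fun s => ?_
    rw [ENNReal.tsum_mul_right]
    change S s * _ = _
    by_cases hs0 : S s = 0
    · rw [hs0, zero_mul, zero_rpow_of_pos (by positivity)]
    · nth_rw 1 [← ENNReal.rpow_one (S s)]
      rw [← ENNReal.rpow_add _ _ hs0 (hS s)]; congr 1; ring
  rw [h4]
  have h5 : 0 ≤ 2 / a - 1 := by rw [sub_nonneg, le_div_iff₀ h0]; linarith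
  nth_rw 1 [← ENNReal.rpow_one T]
  rw [← ENNReal.rpow_add_of_nonneg _ _ (by norm_num) h5]
  apply le_of_eq; congr 1; ring

theorem diag_ae : ∀ᵐ p : ℝ × ℝ, p.1 ≠ p.2 := by
  have hm : MeasurableSet {p : ℝ × ℝ | p.1 = p.2} := measurableSet_eq_fun measurable_fst measurable_snd
  have : (volume : Measure (ℝ × ℝ)) {p : ℝ × ℝ | p.1 = p.2} = 0 := by
    rw [Measure.volume_eq_prod, Measure.measure_prod_null hm]
    refine of_forall fun x => ?_
    have : (Prod.mk x ⁻¹' {p : ℝ × ℝ | p.1 = p.2}) = {x} := by ext y; simp [eq_comm]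
    simp only [this]; simp
  rw [ae_iff]; simpa using this

theorem pow_bd (d θ l a τ Z : ℝ) (ha : 0 < a) (hτ : 0 < τ) (hZa : a ≤ Z) (hZt : τ ≤ Z) (hl0 : 0 < l)
    (hθ : 0 < θ) (hl : l ≤ (d - 1) * θ / 2) (c : ℝ) (hc : 0 ≤ c) :
    a ^ (d * θ - l) * (c * Z ^ (-(d - 1) / 2) * a ^ (-(d + 1) / 2)) ^ θ ≤ c ^ θ * τ ^ (-l) := by
  have hZ : 0 < Z := ha.trans_le hZa
  rw [Real.mul_rpow (by positivity) (by positivity), Real.mul_rpow (by positivity) (by positivity),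
    ← Real.rpow_mul hZ.le, ← Real.rpow_mul ha.le]
  have e1 : a ^ (d * θ - l) * (c ^ θ * Z ^ (-(d - 1) / 2 * θ) * a ^ (-(d + 1) / 2 * θ)) =
      c ^ θ * (Z ^ (-((d - 1) * θ / 2)) * a ^ ((d - 1) * θ / 2 - l)) := by
    rw [show (d - 1) * θ / 2 - l = (d * θ - l) + (-(d + 1) / 2 * θ) by ring, Real.rpow_add ha,
      show -(d - 1) / 2 * θ = -((d - 1) * θ / 2) by ring]; ring
  rw [e1]
  refine mul_le_mul_of_nonneg_left ?_ (by positivity)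
  have h1 : a ^ ((d - 1) * θ / 2 - l) ≤ Z ^ ((d - 1) * θ / 2 - l) :=
    Real.rpow_le_rpow ha.le hZa (by linarith)
  calc _ ≤ Z ^ (-((d - 1) * θ / 2)) * Z ^ ((d - 1) * θ / 2 - l) := mul_le_mul_of_nonneg_left h1 (by positivity)
    _ = Z ^ (-l) := by rw [← Real.rpow_add hZ]; congr 1; ring
    _ ≤ τ ^ (-l) := Real.rpow_le_rpow_of_nonpos hτ hZt (by linarith)

theorem Qf_bound (e : ℝ) (he : |e| = 1) (a : ℝ) (ha : 0 < a) (hn : 3 ≤ dimR E)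
    (ρ θ l : ℝ) (hρ : 0 < ρ) (h0 : 0 < θ) (h1 : θ < 1)
    (hr : 2 / ρ - 1 = θ) (hl0 : 0 < l) (hl : l ≤ ((dimR E : ℝ) - 1) * θ / 2)
    (g : E × ℝ → ℂ) (hm : Measurable g) (hi : Integrable g) (hs : ∀ s, Integrable fun x => g (x, s)) :
    ofR (a ^ ((dimR E : ℝ) * θ - l)) * Qf e a g ≤
      CI θ * ofR (c0 E ^ θ) * ∫⁻ p : ℝ × ℝ, (∫⁻ x, ‖g (x, p.1)‖ₑ ^ ρ) ^ (1 / ρ) *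
        (∫⁻ x, ‖g (x, p.2)‖ₑ ^ ρ) ^ (1 / ρ) * ofR (|p.1 - p.2| ^ (-l)) := by
  rw [Qf_eq e a ha g hi hm]
  have h2 := enorm_reord_le (volume : Measure E) (volume : Measure ℝ) (volume : Measure E) (volume : Measure ℝ)
    _ (big_int e a ha g hi)
  refine (mul_le_mul' le_rfl h2).trans ?_
  rw [← lintegral_const_mul' _ _ ofReal_ne_top, ← lintegral_const_mul' _ _
    (mul_ne_top (CI_ne_top θ h0 h1) ofReal_ne_top)]
  refine lintegral_mono_ae ?_
  filter_upwards [diag_ae] with w hw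
  set z : ℂ := a - (e * w.1 - e * w.2 : ℝ) * I with hz
  have hzre : z.re = a := by simp [hz]
  have hzim : z.im = -(e * w.1 - e * w.2) := by simp [hz]
  have hZa : a ≤ ‖z‖ := by rw [← hzre]; exact (le_abs_self _).trans (abs_re_le_norm z)
  have hZt : |w.1 - w.2| ≤ ‖z‖ := by
    refine le_trans (le_of_eq ?_) (abs_im_le_norm z)
    rw [hzim, abs_neg, ← mul_sub, abs_mul, he, one_mul]
  have hτ : 0 < |w.1 - w.2| := abs_pos.2 (sub_ne_zero.2 hw)
  have hk := pow_bd (dimR E) θ l a _ _ ha hτ hZa hZt hl0 h0 hl (c0 E) c0_nonneg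
  have hf := form_Lp z (by rw [hzre]; exact ha) (fun x => g (x, w.1)) (fun x => g (x, w.2))
    (hm.comp (measurable_id.prodMk measurable_const)) (hm.comp (measurable_id.prodMk measurable_const))
    (hs _) (hs _) ρ θ h0 h1 hr hρ (ofR (c0 E * ‖z‖ ^ (-((dimR E : ℝ) - 1) / 2) *
      a ^ (-((dimR E : ℝ) + 1) / 2))) (fun x => by
        rw [← ofReal_norm]
        have := ker_K1 z (by rw [hzre]; exact ha) x hn
        rw [hzre] at this
        exact ofReal_le_ofReal this)
  rw [Measure.volume_eq_prod] at hf
  refine (mul_le_mul' le_rfl hf).trans ?_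
  have hc := c0_nonneg (E := E)
  rw [ofReal_rpow_of_nonneg (by positivity) h0.le]
  have hk2 := ofReal_le_ofReal hk
  rw [ENNReal.ofReal_mul (by positivity), ENNReal.ofReal_mul (by positivity)] at hk2
  calc _ = (ofR (a ^ ((dimR E : ℝ) * θ - l)) * ofR ((c0 E *
        ‖z‖ ^ (-((dimR E : ℝ) - 1) / 2) * a ^ (-((dimR E : ℝ) + 1) / 2)) ^ θ)) *
        (CI θ * ((∫⁻ x, ‖g (x, w.1)‖ₑ ^ ρ) ^ (1 / ρ) * (∫⁻ x, ‖g (x, w.2)‖ₑ ^ ρ) ^ (1 / ρ))) := by ring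
    _ ≤ _ := mul_le_mul' hk2 le_rfl
    _ = _ := by ring

/-- The slice norm. -/
def sl (ρ : ℝ) (g : E × ℝ → ℂ) (s : ℝ) : ℝ≥0∞ := (∫⁻ x, ‖g (x, s)‖ₑ ^ ρ) ^ (1 / ρ)

theorem sl_meas (ρ : ℝ) (g : E × ℝ → ℂ) (hm : Measurable g) : Measurable (sl ρ g) :=
  (Measurable.lintegral_prod_left' (f := fun z : E × ℝ => ‖g z‖ₑ ^ ρ) (hm.enorm.pow_const _)).pow_const _

theorem Nice.lp {X : Type*} [NormedAddCommGroup X] [MeasurableSpace X] [BorelSpace X]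
    [ProperSpace X] (μ : Measure X) [IsFiniteMeasureOnCompacts μ] {g : X → ℂ} (h : Nice g) (ρ : ℝ) (hρ : 0 < ρ) :
    ∫⁻ x, ‖g x‖ₑ ^ ρ ∂μ ≠ ⊤ := by
  obtain ⟨hm, ⟨B, hB⟩, R, hR⟩ := h
  refine ne_top_of_le_ne_top (b := ∫⁻ x, (closedBall (0 : X) R).indicator (fun _ => ofR B ^ ρ) x ∂μ) ?_ ?_
  · rw [lintegral_indicator isClosed_closedBall.measurableSet, lintegral_const]
    refine mul_ne_top (rpow_ne_top_of_nonneg hρ.le ofReal_ne_top) ?_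
    simpa using (isCompact_closedBall (0 : X) R).measure_lt_top.ne
  · refine lintegral_mono fun x => ?_
    by_cases hx : x ∈ closedBall (0 : X) R
    · rw [Set.indicator_of_mem hx, ← ofReal_norm]
      exact rpow_le_rpow (ofReal_le_ofReal (hB x)) hρ.le
    · rw [hR x (by simpa using hx)]; simp [hρ]

theorem sl_fin (ρ : ℝ) (hρ : 0 < ρ) (g : E × ℝ → ℂ) (hg : Nice g) (s : ℝ) : sl ρ g s ≠ ⊤ :=
  rpow_ne_top_of_nonneg (by positivity) ((hg.slice s).lp _ ρ hρ)

theorem sl_cot (ρ : ℝ) (h1 : 1 < ρ) (h2 : ρ ≤ 2) (g : E × ℝ → ℂ) (hg : Nice g) (s : ℝ) :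
    ∑' k : ℤ, sl ρ (AKs k g) s ^ 2 ≤ CC E ρ * sl ρ g s ^ 2 := by
  obtain ⟨hm, ⟨B, hB⟩, -⟩ := hg.slice s
  have := cot ρ h1 h2 _ hm B hB
  have e : ∀ a : ℝ≥0∞, (a ^ (1 / ρ)) ^ 2 = a ^ (2 / ρ) := fun a => by
    rw [← ENNReal.rpow_natCast, ← rpow_mul]; congr 1; push_cast; ring
  simp only [sl, e, AKs]
  exact this

/-- constant for the dual Strichartz estimate -/
def CS (E : Type*) [NormedAddCommGroup E] [InnerProductSpace ℝ E] [FiniteDimensional ℝ E]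
  [MeasurableSpace E] [BorelSpace E] (ρ l : ℝ) : ℝ≥0∞ :=
  ofR (cm⁻¹) * (CI (2 / ρ - 1) * ofR (c0 E ^ (2 / ρ - 1)) * ofR (2 * CH l) * CC E ρ)

theorem CS_ne_top (ρ l : ℝ) (h1 : 1 < ρ) (h2 : ρ < 2) : CS E ρ l ≠ ⊤ := by
  have a1 : 0 < 2 / ρ - 1 := by rw [sub_pos, lt_div_iff₀ (by linarith)]; linarith
  have a2 : 2 / ρ - 1 < 1 := by rw [sub_lt_iff_lt_add, div_lt_iff₀ (by linarith)]; linarith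
  have h3 := CI_ne_top _ a1 a2
  have h4 := CC_ne_top (E := E) ρ h1 h2.le
  unfold CS
  exact mul_ne_top ofReal_ne_top (mul_ne_top (mul_ne_top (mul_ne_top h3
    ofReal_ne_top) ofReal_ne_top) h4)

theorem AKs_slice_int (k : ℤ) (g : E × ℝ → ℂ) (hg : Nice g) (s : ℝ) : Integrable fun x => AKs k g (x, s) := by
  refine ⟨((AKs_meas k g hg.1).comp (measurable_id.prodMk measurable_const)).aestronglyMeasurable, ?_⟩
  rw [hasFiniteIntegral_iff_enorm]
  refine (AK_l1 k (fun x => g (x, s)) (hg.slice s).1).trans_lt ?_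
  exact mul_lt_top (by norm_num) ((hg.slice s).intOn volume).2

/-- dual Strichartz estimate -/
theorem dual_str (e : ℝ) (he : |e| = 1) (hn : 3 ≤ dimR E) (ρ l : ℝ) (hρ1 : 1 < ρ) (hρ2 : ρ < 2)
    (hl0 : 0 < l) (hl1 : l < 1) (hl : l ≤ ((dimR E : ℝ) - 1) * (2 / ρ - 1) / 2)
    (g : E × ℝ → ℂ) (hg : Nice g) :
    ∫⁻ ξ : E, ofR (‖ξ‖ ^ (-((dimR E : ℝ) * (2 / ρ - 1) - l))) * ‖am e g ξ‖ₑ ^ 2 ≤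
      CS E ρ l * (∫⁻ s, sl ρ g s ^ (2 / (2 - l))) ^ (2 - l) := by
  have h0 : 0 < 2 / ρ - 1 := by rw [sub_pos, lt_div_iff₀ (by linarith)]; linarith
  have h1 : 2 / ρ - 1 < 1 := by rw [sub_lt_iff_lt_add, div_lt_iff₀ (by linarith)]; linarith
  set θ := 2 / ρ - 1 with hθ
  set d : ℝ := (dimR E : ℝ) with hd
  have hd3 : (3 : ℝ) ≤ d := by rw [hd]; exact_mod_cast hn
  have hα : 0 ≤ d * θ - l := by nlinarith
  have h2l : 0 < 2 - l := by linarith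
  set a := 2 / (2 - l) with ha
  have ha0 : 0 < a := by positivity
  have ha2 : a ≤ 2 := by rw [ha, div_le_iff₀ h2l]; linarith
  have hs := am_sum e (d * θ - l) hα (by omega) g hg
  have hfin : ∀ s, ∑' k : ℤ, sl ρ (AKs k g) s ^ 2 ≠ ⊤ := fun s =>
    ne_top_of_le_ne_top (mul_ne_top (CC_ne_top ρ hρ1 hρ2.le) (ENNReal.pow_ne_top (sl_fin ρ (by linarith) g hg s)))
      (sl_cot ρ hρ1 hρ2.le g hg s)
  have hsf : ∀ k s, sl ρ (AKs k g) s ≠ ⊤ := fun k s h => by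
    have h3 := ENNReal.le_tsum (f := fun k => sl ρ (AKs k g) s ^ 2) k
    have := ne_top_of_le_ne_top (hfin s) h3
    rw [h] at this; simp at this
  set Kc := CI θ * ofR (c0 E ^ θ) * ofR (2 * CH l) with hK
  have hk : ∀ k : ℤ, ofR (((2 : ℝ) ^ k) ^ (d * θ - l)) * Qf e (2 ^ k) (AKs k g) ≤
      Kc * (∫⁻ s, sl ρ (AKs k g) s ^ a) ^ (2 / a) := fun k => by
    refine (Qf_bound e he (2 ^ k) (by positivity) hn ρ θ l (by linarith) h0 h1 rfl hl0 hl _ (AKs_meas k g hg.1)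
      (AKs_int k g hg) (AKs_slice_int k g hg)).trans ?_
    rw [hK, mul_assoc (CI θ * _)]
    refine mul_le_mul' le_rfl ?_
    have := hls l hl0 hl1 (sl ρ (AKs k g)) (sl_meas ρ _ (AKs_meas k g hg.1)) (hsf k)
    rw [show 2 / a = 2 - l by rw [ha]; field_simp]
    exact this
  have h5 := hs.trans (ENNReal.tsum_le_tsum hk)
  rw [ENNReal.tsum_mul_left] at h5
  have h6 := mink_sum volume (fun k => sl ρ (AKs k g)) (fun k => sl_meas ρ _ (AKs_meas k g hg.1)) a ha0 ha2 hfin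
  have h7 : (∫⁻ s, (∑' k, sl ρ (AKs k g) s ^ 2) ^ (a / 2)) ^ (2 / a) ≤
      CC E ρ * (∫⁻ s, sl ρ g s ^ a) ^ (2 / a) := by
    have : ∫⁻ s, (∑' k, sl ρ (AKs k g) s ^ 2) ^ (a / 2) ≤ CC E ρ ^ (a / 2) * ∫⁻ s, sl ρ g s ^ a := by
      rw [← lintegral_const_mul' _ _ (rpow_ne_top_of_nonneg (by positivity) (CC_ne_top ρ hρ1 hρ2.le))]
      refine lintegral_mono fun s => (rpow_le_rpow (sl_cot ρ hρ1 hρ2.le g hg s) (by positivity)).trans ?_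
      rw [mul_rpow_of_nonneg _ _ (by positivity), ← ENNReal.rpow_natCast, ← rpow_mul]
      apply le_of_eq; congr 2; push_cast; ring
    refine (rpow_le_rpow this (by positivity)).trans (le_of_eq ?_)
    rw [mul_rpow_of_nonneg _ _ (by positivity), ← rpow_mul,
      show a / 2 * (2 / a) = 1 by field_simp, ENNReal.rpow_one]
  have h8 := h5.trans (mul_le_mul' le_rfl (h6.trans h7))
  have hc : ofR cm⁻¹ * ofR cm = 1 := by
    rw [← ENNReal.ofReal_mul (by have := cm_pos; positivity), inv_mul_cancel₀ cm_pos.ne', ENNReal.ofReal_one]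
  calc _ = ofR cm⁻¹ * (ofR cm * ∫⁻ ξ : E, ofR (‖ξ‖ ^ (-(d * θ - l))) * ‖am e g ξ‖ₑ ^ 2) := by
        rw [← mul_assoc, hc, one_mul]
    _ ≤ _ := mul_le_mul' le_rfl h8
    _ = _ := by
      rw [CS, ← hθ, show 2 / a = 2 - l by rw [ha]; field_simp, hK]; ring
end DS
section SH

/-- admissible densities -/
def Gd (J : E × ℝ → ℂ) : Prop := Measurable J ∧ Integrable J ∧ ∀ t, Integrable fun x => J (x, t)

theorem Gd.indicator {J : E × ℝ → ℂ} (h : Gd J) {S : Set E} (hS : MeasurableSet S) :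
    Gd fun z => S.indicator (fun x => J (x, z.2)) z.1 := by
  have e1 : (fun z : E × ℝ => S.indicator (fun x => J (x, z.2)) z.1) = (S ×ˢ Set.univ).indicator J := by
    ext z; by_cases hz : z.1 ∈ S
    · rw [Set.indicator_of_mem hz, Set.indicator_of_mem (by simpa using hz)]
    · rw [Set.indicator_of_notMem hz, Set.indicator_of_notMem (by simpa using hz)]
  refine ⟨?_, ?_, fun t => (h.2.2 t).indicator hS⟩
  · rw [e1]; exact h.1.indicator (hS.prod MeasurableSet.univ)
  · rw [e1]; exact h.2.1.indicator (hS.prod MeasurableSet.univ)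

/-- the bilinear integrand -/
def bg (e a : ℝ) (J₁ J₂ : E × ℝ → ℂ) (p : (E × ℝ) × (E × ℝ)) : ℂ :=
  J₁ p.1 * (starRingEnd ℂ) (J₂ p.2) * ker (a - (e * (p.1.2 - p.2.2) : ℝ) * I) (p.1.1 - p.2.1)

theorem bg_int (e a : ℝ) (ha : 0 < a) (J₁ J₂ : E × ℝ → ℂ) (h₁ : Gd J₁) (h₂ : Gd J₂) :
    Integrable (bg e a J₁ J₂) ((volume : Measure (E × ℝ)).prod (volume : Measure (E × ℝ))) := by
  have h1 : Integrable (fun p : (E × ℝ) × (E × ℝ) => J₁ p.1 * (starRingEnd ℂ) (J₂ p.2))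
      ((volume : Measure (E × ℝ)).prod (volume : Measure (E × ℝ))) := by
    refine h₁.2.1.mul_prod (g := fun y => (starRingEnd ℂ) (J₂ y)) ?_
    exact Complex.conjLIE.toContinuousLinearEquiv.integrable_comp_iff.2 h₂.2.1
  refine h1.mul_bdd (c := a⁻¹ ^ dimR E * ∫ ξ : E, Real.exp (-‖ξ‖)) ?_
    (of_forall fun p => ?_)
  · refine (meas_ker.comp (Measurable.prodMk ?_ ?_)).aestronglyMeasurable
    · exact Continuous.measurable (by fun_prop)
    · exact Continuous.measurable (by fun_prop)
  · have := ker_le (a - (e * (p.1.2 - p.2.2) : ℝ) * I) (by simpa using ha) (p.1.1 - p.2.1)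
    simpa using this

/-- time-shell integrand -/
def bs (e a : ℝ) (U : Set ℝ) (J₁ J₂ : E × ℝ → ℂ) (p : (ℝ × ℝ) × (E × E)) : ℂ :=
  U.indicator (fun _ => bg e a J₁ J₂ ((p.2.1, p.1.1), (p.2.2, p.1.2))) (p.1.1 - p.1.2)

theorem bs_int (e a : ℝ) (ha : 0 < a) (U : Set ℝ) (hU : MeasurableSet U) (J₁ J₂ : E × ℝ → ℂ) (h₁ : Gd J₁) (h₂ : Gd J₂) :
    Integrable (bs e a U J₁ J₂) (((volume : Measure ℝ).prod (volume : Measure ℝ)).prod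
      ((volume : Measure E).prod (volume : Measure E))) := by
  have hi := ((reord_mp (volume : Measure E) (volume : Measure ℝ) (volume : Measure E) (volume : Measure ℝ)).integrable_comp_emb
    reord.measurableEmbedding).2 (bg_int e a ha J₁ J₂ h₁ h₂)
  have hS : MeasurableSet {p : (ℝ × ℝ) × (E × E) | p.1.1 - p.1.2 ∈ U} :=
    hU.preimage (f := fun p : (ℝ × ℝ) × (E × E) => p.1.1 - p.1.2) (by fun_prop)
  have := hi.indicator hS
  refine this.congr (of_forall fun p => ?_)
  by_cases hp : p.1.1 - p.1.2 ∈ U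
  · rw [Set.indicator_of_mem (by exact hp), bs, Set.indicator_of_mem hp]; rfl
  · rw [Set.indicator_of_notMem (by exact hp), bs, Set.indicator_of_notMem hp]

/-- spatial density of a shell -/
def PS (e a : ℝ) (U : Set ℝ) (J₁ J₂ : E × ℝ → ℂ) (q : E × E) : ℂ :=
  ∫ w : ℝ × ℝ, bs e a U J₁ J₂ (w, q)

theorem PS_int (e a : ℝ) (ha : 0 < a) (U : Set ℝ) (hU : MeasurableSet U) (J₁ J₂ : E × ℝ → ℂ) (h₁ : Gd J₁) (h₂ : Gd J₂) :
    Integrable (PS e a U J₁ J₂) ((volume : Measure E).prod (volume : Measure E)) :=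
  (bs_int e a ha U hU J₁ J₂ h₁ h₂).integral_prod_right

theorem PS_ind (e a : ℝ) (U : Set ℝ) (J₁ J₂ : E × ℝ → ℂ) (S S' : Set E) (q : E × E) :
    (S ×ˢ S').indicator (PS e a U J₁ J₂) q =
      PS e a U (fun z => S.indicator (fun x => J₁ (x, z.2)) z.1) (fun z => S'.indicator (fun x => J₂ (x, z.2)) z.1) q := by
  unfold PS bs bg
  by_cases h1 : q.1 ∈ S
  · by_cases h2 : q.2 ∈ S'
    · rw [Set.indicator_of_mem (Set.mk_mem_prod h1 h2)]; simp [h1, h2]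
    · rw [Set.indicator_of_notMem (fun h => h2 h.2)]; simp [h2]
  · rw [Set.indicator_of_notMem (fun h => h1 h.1)]; simp [h1]

/-- column norm -/
def cn (J : E × ℝ → ℂ) (x : E) : ℝ≥0∞ := (∫⁻ t, ‖J (x, t)‖ₑ ^ 2) ^ (1 / 2 : ℝ)

theorem cn_meas (J : E × ℝ → ℂ) (hJ : Measurable J) : Measurable (cn J) :=
  (Measurable.lintegral_prod_right' (f := fun z : E × ℝ => ‖J z‖ₑ ^ 2) (hJ.enorm.pow_const _)).pow_const _

theorem shell_schur (τ : ℝ) (U : Set ℝ) (hU : MeasurableSet U) (hτ : ∀ u ∈ U, |u| < τ) (f g : ℝ → ℝ≥0∞)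
    (k : ℝ → ℝ≥0∞) (hk : Measurable k) (hf : Measurable f) (hg : Measurable g) :
    ∫⁻ w : ℝ × ℝ, f w.1 * g w.2 * U.indicator k (w.1 - w.2) ≤
      (∫⁻ u in U, k u) * ((∫⁻ t, f t ^ 2) ^ (1 / 2 : ℝ) * (∫⁻ t, g t ^ 2) ^ (1 / 2 : ℝ)) := by
  have h := schur (volume : Measure ℝ) (volume : Measure ℝ) (fun w => U.indicator k (w.1 - w.2)) f g
    ((hk.indicator hU).comp (measurable_fst.sub measurable_snd)) hf hg (∫⁻ u in U, k u) (∫⁻ u in U, k u)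
    (fun x => by
      simp only
      rw [lintegral_sub_left_eq_self (fun u => U.indicator k u) x, lintegral_indicator hU])
    (fun y => by
      simp only
      rw [lintegral_sub_right_eq_self (fun u => U.indicator k u) y, lintegral_indicator hU])
  rw [Measure.volume_eq_prod]
  refine h.trans (le_of_eq ?_)
  rw [ennreal_sqrt_mul_self, mul_assoc]

theorem PS_block (e a τ : ℝ) (ha : 0 < a) (U : Set ℝ) (hU : MeasurableSet U) (hτ : ∀ u ∈ U, |u| < τ)
    (J₁ J₂ : E × ℝ → ℂ) (h₁ : Gd J₁) (h₂ : Gd J₂) :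
    ‖∫ q, PS e a U J₁ J₂ q ∂((volume : Measure E).prod (volume : Measure E))‖ₑ ≤
      ofR (2 * τ) * (∫⁻ x, cn J₁ x ^ 2) ^ (1 / 2 : ℝ) * (∫⁻ x, cn J₂ x ^ 2) ^ (1 / 2 : ℝ) := by
  have hi := bs_int e a ha U hU J₁ J₂ h₁ h₂
  have e1 : ∫ q, PS e a U J₁ J₂ q ∂((volume : Measure E).prod (volume : Measure E)) =
      ∫ w : ℝ × ℝ, ∫ q : E × E, bs e a U J₁ J₂ (w, q) := by
    unfold PS
    exact (integral_integral_swap (f := fun w q => bs e a U J₁ J₂ (w, q)) hi).symm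
  rw [e1]
  refine (enorm_integral_le_lintegral_enorm _).trans ?_
  have e2 : ∀ J : E × ℝ → ℂ, Measurable J → ∫⁻ x, cn J x ^ 2 = ∫⁻ t, ((∫⁻ x, ‖J (x, t)‖ₑ ^ 2) ^ (1 / 2 : ℝ)) ^ 2 := by
    intro J hJ
    unfold cn
    simp only [ennreal_sqrt_sq]
    rw [lintegral_lintegral_swap]
    exact (hJ.enorm.pow_const _).aemeasurable
  have hm : ∀ J : E × ℝ → ℂ, Measurable J → Measurable fun t => (∫⁻ x, ‖J (x, t)‖ₑ ^ 2) ^ (1 / 2 : ℝ) := fun J hJ =>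
    (Measurable.lintegral_prod_left' (f := fun z : E × ℝ => ‖J z‖ₑ ^ 2) (hJ.enorm.pow_const _)).pow_const _
  rw [e2 J₁ h₁.1, e2 J₂ h₂.1]
  have h3 := shell_schur τ U hU hτ _ _ (fun _ => 1) measurable_const (hm J₁ h₁.1) (hm J₂ h₂.1)
  have h4 : ∫⁻ u in U, 1 ≤ ofR (2 * τ) := by
    rw [setLIntegral_one]
    refine (measure_mono (t := ball (0 : ℝ) τ) fun u hu => by simpa using hτ u hu).trans ?_
    rw [Real.volume_ball]
  rw [mul_assoc]
  refine le_trans (lintegral_mono fun w => ?_) (h3.trans (mul_le_mul' h4 le_rfl))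
  by_cases hw : w.1 - w.2 ∈ U
  · have := form_L2 (a - (e * (w.1 - w.2) : ℝ) * I) (by simpa using ha) (fun x => J₁ (x, w.1)) (fun x => J₂ (x, w.2))
      (h₁.1.comp (measurable_id.prodMk measurable_const)) (h₂.1.comp (measurable_id.prodMk measurable_const))
      (h₁.2.2 _) (h₂.2.2 _)
    simp only [bs, Set.indicator_of_mem hw, bg, mul_one]
    exact this
  · simp [bs, Set.indicator_of_notMem hw]

/-- time integral of the kernel -/
def KT (e a : ℝ) (U : Set ℝ) (x : E) : ℝ≥0∞ := ∫⁻ u in U, ‖ker (a - (e * u : ℝ) * I) x‖ₑ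

theorem meas_ker_u (e a : ℝ) (x : E) : Measurable fun u : ℝ => ker (a - (e * u : ℝ) * I) x :=
  meas_ker.comp (Measurable.prodMk (Continuous.measurable (by fun_prop)) measurable_const)

theorem PS_point (e a τ : ℝ) (U : Set ℝ) (hU : MeasurableSet U) (hτ : ∀ u ∈ U, |u| < τ)
    (J₁ J₂ : E × ℝ → ℂ) (h₁ : Measurable J₁) (h₂ : Measurable J₂) (q : E × E) :
    ‖PS e a U J₁ J₂ q‖ₑ ≤ KT e a U (q.1 - q.2) * (cn J₁ q.1 * cn J₂ q.2) := by
  unfold PS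
  refine (enorm_integral_le_lintegral_enorm _).trans ?_
  have h3 := shell_schur τ U hU hτ (fun t => ‖J₁ (q.1, t)‖ₑ) (fun t => ‖J₂ (q.2, t)‖ₑ) _
    (meas_ker_u e a (q.1 - q.2)).enorm (h₁.comp (measurable_const.prodMk measurable_id)).enorm
    (h₂.comp (measurable_const.prodMk measurable_id)).enorm
  refine le_trans (lintegral_mono fun w => ?_) h3
  by_cases hw : w.1 - w.2 ∈ U
  · simp only [bs, Set.indicator_of_mem hw, bg, enorm_mul, RCLike.enorm_conj]; rfl
  · simp [bs, Set.indicator_of_notMem hw]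

theorem int_cauchy (a : ℝ) (ha : 0 < a) (b : ℝ) :
    ∫⁻ u : ℝ, ofR ((a ^ 2 + (u - b) ^ 2)⁻¹) ≤ ofR (Real.pi / a) := by
  rw [lintegral_sub_right_eq_self (fun u : ℝ => ofR ((a ^ 2 + u ^ 2)⁻¹)) b]
  have h1 : ∀ u : ℝ, (a ^ 2 + u ^ 2)⁻¹ = a⁻¹ ^ 2 * (1 + (a⁻¹ * u) ^ 2)⁻¹ := fun u => by field_simp
  have hi : Integrable fun u : ℝ => (a ^ 2 + u ^ 2)⁻¹ := by
    simp_rw [h1]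
    exact (integrable_inv_one_add_sq.comp_mul_left' (inv_ne_zero ha.ne')).const_mul _
  rw [← ofReal_integral_eq_lintegral_ofReal hi (of_forall fun u => by positivity)]
  apply ofReal_le_ofReal
  simp_rw [h1]
  rw [integral_const_mul, Measure.integral_comp_mul_left (fun x : ℝ => (1 + x ^ 2)⁻¹) a⁻¹, integral_univ_inv_one_add_sq]
  rw [abs_of_pos (by positivity), smul_eq_mul]
  apply le_of_eq; field_simp

theorem KT_near (e a τ : ℝ) (he : |e| = 1) (ha : 0 < a) (hτ0 : 0 < τ) (U : Set ℝ) (hU : MeasurableSet U)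
    (hlo : ∀ u ∈ U, τ / 2 ≤ max a |u|) (hn : 3 ≤ dimR E) (x : E) :
    KT e a U x ≤ ofR (2 * Real.pi * c0 E * (τ / 2) ^ (-((dimR E : ℝ) - 1) / 2) *
      a ^ (-((dimR E : ℝ) - 1) / 2)) := by
  have hc := c0_nonneg (E := E)
  set d : ℝ := (dimR E : ℝ) with hd
  have hd3 : (3 : ℝ) ≤ d := by rw [hd]; exact_mod_cast hn
  set b := 2 * Real.pi * ‖x‖ with hb
  set M := c0 E * (τ / 2) ^ (-(d - 1) / 2) * a ^ (-(d - 3) / 2) with hM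
  have hM0 : 0 ≤ M := by positivity
  have h1 : ∀ u ∈ U, ‖ker (a - (e * u : ℝ) * I) x‖ₑ ≤ ofR M *
      (ofR ((a ^ 2 + (u - b) ^ 2)⁻¹) + ofR ((a ^ 2 + (u - (-b)) ^ 2)⁻¹)) := by
    intro u hu
    set z : ℂ := a - (e * u : ℝ) * I with hz
    have hzre : z.re = a := by simp [hz]
    have hzim : |z.im| = |u| := by simp [hz, abs_mul, he]
    have hzn : τ / 2 ≤ ‖z‖ := by
      refine (hlo u hu).trans (max_le ?_ ?_)
      · rw [← hzre]; exact (le_abs_self _).trans (abs_re_le_norm z)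
      · rw [← hzim]; exact abs_im_le_norm z
    have hK := ker_K2 z (by rw [hzre]; exact ha) x hn
    rw [hzre, hzim] at hK
    rw [← ofReal_norm, ← ENNReal.ofReal_add (by positivity) (by positivity), ← ENNReal.ofReal_mul hM0]
    apply ofReal_le_ofReal
    refine hK.trans ?_
    have h2 : ‖z‖ ^ (-(d - 1) / 2) ≤ (τ / 2) ^ (-(d - 1) / 2) :=
      Real.rpow_le_rpow_of_nonpos (by positivity) hzn (by linarith)
    have h3 : (a ^ 2 + (|u| - b) ^ 2)⁻¹ ≤ (a ^ 2 + (u - b) ^ 2)⁻¹ + (a ^ 2 + (u - (-b)) ^ 2)⁻¹ := by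
      rcases abs_cases u with ⟨h, _⟩ | ⟨h, _⟩ <;> rw [h]
      · exact le_add_of_nonneg_right (by positivity)
      · rw [show (-u - b) ^ 2 = (u - (-b)) ^ 2 by ring]; exact le_add_of_nonneg_left (by positivity)
    refine mul_le_mul ?_ h3 (by positivity) hM0
    exact mul_le_mul_of_nonneg_right (mul_le_mul_of_nonneg_left h2 hc) (by positivity)
  unfold KT
  refine (setLIntegral_mono_ae' hU (of_forall h1)).trans ?_
  refine (setLIntegral_le_lintegral _ _).trans ?_
  rw [lintegral_const_mul' _ _ ofReal_ne_top, lintegral_add_left (by fun_prop)]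
  refine (mul_le_mul' le_rfl (add_le_add (int_cauchy a ha b) (int_cauchy a ha (-b)))).trans ?_
  rw [← ENNReal.ofReal_add (by positivity) (by positivity), ← ENNReal.ofReal_mul hM0]
  apply ofReal_le_ofReal
  apply le_of_eq
  rw [hM, show -(d - 1) / 2 = -(d - 3) / 2 + (-1) by ring, Real.rpow_add ha, Real.rpow_neg_one]
  field_simp; ring

theorem KT_far (e a τ : ℝ) (he : |e| = 1) (ha : 0 < a) (haτ : a ≤ τ) (U : Set ℝ) (hU : MeasurableSet U)
    (hτ : ∀ u ∈ U, |u| < τ) (hn : 3 ≤ dimR E) (x : E) (hx : τ ≤ ‖x‖) :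
    KT e a U x ≤ ofR (4 * c0 E * τ ^ 2 * ‖x‖⁻¹ ^ (dimR E + 1)) := by
  have hc := c0_nonneg (E := E)
  have hτ0 : 0 < τ := ha.trans_le haτ
  have h1 : ∀ u ∈ U, ‖ker (a - (e * u : ℝ) * I) x‖ₑ ≤ ofR (c0 E * (2 * τ) * ‖x‖⁻¹ ^ (dimR E + 1)) := by
    intro u hu
    have hz : ‖(a : ℂ) - (e * u : ℝ) * I‖ ≤ 2 * τ := by
      refine (norm_sub_le _ _).trans ?_
      rw [norm_mul, norm_real, norm_real, norm_I, mul_one, Real.norm_of_nonneg ha.le, Real.norm_eq_abs, abs_mul, he]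
      have := hτ u hu; linarith
    have := ker_K3 (a - (e * u : ℝ) * I) (by simpa using ha) x (by omega) (hz.trans (by
      have := Real.pi_gt_three; nlinarith))
    rw [← ofReal_norm]
    refine ofReal_le_ofReal (this.trans ?_)
    gcongr
  unfold KT
  refine (setLIntegral_mono_ae' hU (of_forall h1)).trans ?_
  rw [setLIntegral_const]
  have h4 : volume U ≤ ofR (2 * τ) := by
    refine (measure_mono (t := ball (0 : ℝ) τ) fun u hu => by simpa using hτ u hu).trans ?_
    rw [Real.volume_ball]
  refine (mul_le_mul' le_rfl h4).trans ?_
  rw [← ENNReal.ofReal_mul (by positivity)]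
  apply ofReal_le_ofReal (le_of_eq (by ring))
end SH
section NF

theorem near_far (Ψ : E × E → ℂ) (hΨ : Integrable Ψ ((volume : Measure E).prod (volume : Measure E))) (τ : ℝ) (hτ : 0 < τ) :
    ‖∫ q, Ψ q ∂((volume : Measure E).prod (volume : Measure E))‖ₑ ≤
      (volume (ball (0 : E) τ))⁻¹ * (∫⁻ c : E, ‖∫ q in ball c τ ×ˢ ball c (2 * τ), Ψ q ∂(volume.prod volume)‖ₑ) +
        ∫⁻ q in {q : E × E | τ ≤ ‖q.1 - q.2‖}, ‖Ψ q‖ₑ ∂(volume.prod volume) := by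
  set V := volume.real (ball (0 : E) τ) with hV
  have hV0 : 0 < V := by
    rw [hV, measureReal_def, ENNReal.toReal_pos_iff]
    exact ⟨measure_ball_pos _ _ hτ, measure_ball_lt_top⟩
  set φ : E × E → ℝ := fun q => V⁻¹ * volume.real (ball q.1 τ ∩ ball q.2 (2 * τ)) with hφ
  have hb : ∀ x : E, volume.real (ball x τ) = V := fun x => by
    rw [hV, measureReal_def, measureReal_def, Measure.addHaar_ball_center]
  have hφ0 : ∀ q, 0 ≤ φ q := fun q => by positivity
  have hφ1 : ∀ q, φ q ≤ 1 := fun q => by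
    have : volume.real (ball q.1 τ ∩ ball q.2 (2 * τ)) ≤ V := by
      rw [← hb q.1]; exact measureReal_mono Set.inter_subset_left measure_ball_lt_top.ne
    calc φ q ≤ V⁻¹ * V := mul_le_mul_of_nonneg_left this (by positivity)
      _ = 1 := inv_mul_cancel₀ hV0.ne'
  have hφn : ∀ q : E × E, ¬ τ ≤ ‖q.1 - q.2‖ → φ q = 1 := fun q hq => by
    have h2 : ball q.1 τ ∩ ball q.2 (2 * τ) = ball q.1 τ := by
      refine Set.inter_eq_left.2 (ball_subset_ball' ?_)
      rw [dist_eq_norm]; linarith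
    simp only [hφ]
    rw [h2, hb, inv_mul_cancel₀ hV0.ne']
  set S : Set ((E × E) × E) := {w | w.2 ∈ ball w.1.1 τ ∩ ball w.1.2 (2 * τ)} with hS
  have hSm : MeasurableSet S := by
    have h1 : MeasurableSet {w : (E × E) × E | dist w.2 w.1.1 < τ} :=
      measurableSet_lt (by fun_prop) measurable_const
    have h2 : MeasurableSet {w : (E × E) × E | dist w.2 w.1.2 < 2 * τ} :=
      measurableSet_lt (by fun_prop) measurable_const
    exact h1.inter h2
  have hφm : Measurable φ := by
    have := measurable_measure_prodMk_left (ν := (volume : Measure E)) hSm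
    exact (this.ennreal_toReal).const_mul _
  set F : E × E → E → ℂ := fun q c => S.indicator (fun _ => Ψ q) (q, c) with hF
  have hFi : ∀ q, ∫ c, F q c = (volume.real (ball q.1 τ ∩ ball q.2 (2 * τ)) : ℂ) * Ψ q := fun q => by
    have : (F q) = (ball q.1 τ ∩ ball q.2 (2 * τ)).indicator (fun _ => Ψ q) := rfl
    rw [this, integral_indicator (measurableSet_ball.inter measurableSet_ball), setIntegral_const]
    simp
  have hIntg : Integrable (Function.uncurry F) (((volume : Measure E).prod (volume : Measure E)).prod (volume : Measure E)) := by
    have hm : AEStronglyMeasurable (Function.uncurry F) (((volume : Measure E).prod (volume : Measure E)).prod (volume : Measure E)) := by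
      have : (Function.uncurry F) = S.indicator (fun w => Ψ w.1) := by
        ext w; rfl
      rw [this]
      exact (hΨ.1.comp_fst).indicator hSm
    rw [integrable_prod_iff hm]
    constructor
    · refine of_forall fun q => ?_
      have : (fun c => Function.uncurry F (q, c)) = (ball q.1 τ ∩ ball q.2 (2 * τ)).indicator (fun _ => Ψ q) := rfl
      rw [this, integrable_indicator_iff (measurableSet_ball.inter measurableSet_ball)]
      exact integrableOn_const (ne_top_of_le_ne_top measure_ball_lt_top.ne (measure_mono Set.inter_subset_left))
    · have e : ∀ q, ∫ c, ‖Function.uncurry F (q, c)‖ = V * (φ q * ‖Ψ q‖) := fun q => by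
        have : (fun c => ‖Function.uncurry F (q, c)‖) = (ball q.1 τ ∩ ball q.2 (2 * τ)).indicator (fun _ => ‖Ψ q‖) := by
          ext c
          change ‖(ball q.1 τ ∩ ball q.2 (2 * τ)).indicator (fun _ => Ψ q) c‖ = _
          rw [norm_indicator_eq_indicator_norm]
        rw [this, integral_indicator (measurableSet_ball.inter measurableSet_ball), setIntegral_const, smul_eq_mul]
        simp only [hφ]; field_simp
      simp_rw [e]
      refine Integrable.const_mul ?_ V
      have := hΨ.norm.mul_bdd (g := φ) (c := 1) hφm.aestronglyMeasurable (of_forall fun q => by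
        rw [Real.norm_of_nonneg (hφ0 q)]; exact hφ1 q)
      refine this.congr (of_forall fun q => mul_comm _ _)
  have i1 : Integrable (fun q => (φ q : ℂ) * Ψ q) ((volume : Measure E).prod (volume : Measure E)) := by
    have := hΨ.mul_bdd (g := fun q => (φ q : ℂ)) (c := 1) (measurable_ofReal.comp hφm).aestronglyMeasurable (of_forall fun q => by
        rw [norm_real, Real.norm_of_nonneg (hφ0 q)]; exact hφ1 q)
    refine this.congr (of_forall fun q => mul_comm _ _)
  have i2 : Integrable (fun q => (1 - (φ q : ℂ)) * Ψ q) ((volume : Measure E).prod (volume : Measure E)) := by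
    refine (hΨ.sub i1).congr (of_forall fun q => ?_)
    simp only [Pi.sub_apply]; ring
  have e0 : ∫ q, Ψ q ∂((volume : Measure E).prod (volume : Measure E)) =
      (∫ q, (φ q : ℂ) * Ψ q ∂(volume.prod volume)) + ∫ q, (1 - (φ q : ℂ)) * Ψ q ∂(volume.prod volume) := by
    rw [← integral_add i1 i2]; congr 1; ext q; ring
  have e1 : ∫ q, (φ q : ℂ) * Ψ q ∂((volume : Measure E).prod (volume : Measure E)) =
      ((V⁻¹ : ℝ) : ℂ) * ∫ c : E, ∫ q in ball c τ ×ˢ ball c (2 * τ), Ψ q ∂(volume.prod volume) := by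
    have e2 : ∀ c : E, ∫ q in ball c τ ×ˢ ball c (2 * τ), Ψ q ∂((volume : Measure E).prod volume) =
        ∫ q, F q c ∂((volume : Measure E).prod volume) := fun c => by
      rw [← integral_indicator (measurableSet_ball.prod measurableSet_ball)]
      refine integral_congr_ae (of_forall fun q => ?_)
      have hiff : (q ∈ ball c τ ×ˢ ball c (2 * τ)) ↔ (q, c) ∈ S := by
        simp only [hS, Set.mem_prod, mem_ball, Set.mem_ofPred_eq, Set.mem_inter_iff, dist_comm c]
      simp only [hF]
      by_cases h : (q, c) ∈ S
      · rw [Set.indicator_of_mem (hiff.2 h), Set.indicator_of_mem h]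
      · rw [Set.indicator_of_notMem (fun h' => h (hiff.1 h')), Set.indicator_of_notMem h]
    simp_rw [e2]
    rw [← integral_integral_swap hIntg]
    simp_rw [hFi]
    rw [← integral_const_mul]
    congr 1; ext q; simp only [hφ]; push_cast; ring
  rw [e0]
  refine (enorm_add_le _ _).trans (add_le_add ?_ ?_)
  · rw [e1, enorm_mul]
    refine mul_le_mul' (le_of_eq ?_) (enorm_integral_le_lintegral_enorm _)
    rw [← ofReal_norm, norm_real, Real.norm_of_nonneg (by positivity), ENNReal.ofReal_inv_of_pos hV0, hV, measureReal_def,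
      ENNReal.ofReal_toReal measure_ball_lt_top.ne]
  · refine (enorm_integral_le_lintegral_enorm _).trans ?_
    have hms : MeasurableSet {q : E × E | τ ≤ ‖q.1 - q.2‖} := measurableSet_le measurable_const (by fun_prop)
    rw [← lintegral_indicator hms]
    refine lintegral_mono fun q => ?_
    by_cases hq : τ ≤ ‖q.1 - q.2‖
    · rw [Set.indicator_of_mem (by exact hq), enorm_mul]
      refine mul_le_of_le_one_left' ?_
      rw [← ofReal_one, ← ofReal_sub, ← ofReal_norm, norm_real, Real.norm_of_nonneg (by linarith [hφ1 q])]
      rw [← ENNReal.ofReal_one]; exact ofReal_le_ofReal (by linarith [hφ0 q])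
    · simp [hφn q hq]

theorem ball_avg (m : E → ℝ≥0∞) (hm : Measurable m) (ρ : ℝ) :
    ∫⁻ c : E, ∫⁻ x in ball c ρ, m x = volume (ball (0 : E) ρ) * ∫⁻ x, m x := by
  have h1 : ∀ c : E, ∫⁻ x in ball c ρ, m x = ∫⁻ x, (ball x ρ).indicator (fun _ => m x) c := fun c => by
    rw [← lintegral_indicator measurableSet_ball]
    refine lintegral_congr fun x => ?_
    by_cases h : x ∈ ball c ρ
    · rw [Set.indicator_of_mem h, Set.indicator_of_mem (by rwa [mem_ball_comm])]
    · rw [Set.indicator_of_notMem h, Set.indicator_of_notMem (by rwa [mem_ball_comm])]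
  simp_rw [h1]
  rw [lintegral_lintegral_swap]
  · rw [← lintegral_const_mul _ hm]
    refine lintegral_congr fun x => ?_
    rw [lintegral_indicator measurableSet_ball, setLIntegral_const, Measure.addHaar_ball_center, mul_comm]
  · have hS : MeasurableSet {w : E × E | dist w.1 w.2 < ρ} := measurableSet_lt (by fun_prop) measurable_const
    exact ((hm.comp measurable_snd).indicator hS).aemeasurable

/-- Fefferman-Phong type condition -/
def FP (p : ℝ) (N : ℝ≥0∞) (v : E → ℝ≥0∞) : Prop :=
  ∀ (x : E) (r : ℝ), 0 < r → (∫⁻ y in ball x r, v y ^ p) ^ (1 / p) ≤ N * ofR (r ^ ((dimR E : ℝ) / p - 2))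

/-- volume constant -/
def wd (E : Type*) [NormedAddCommGroup E] [InnerProductSpace ℝ E] [FiniteDimensional ℝ E]
  [MeasurableSpace E] [BorelSpace E] : ℝ≥0∞ := volume (ball (0 : E) 1)

theorem wd_ne_top : wd E ≠ ⊤ := measure_ball_lt_top.ne

theorem vol_ball (hn : 0 < dimR E) (x : E) (r : ℝ) (hr : 0 < r) :
    volume (ball x r) = ofR (r ^ (dimR E : ℝ)) * wd E := by
  rw [wd, Measure.addHaar_ball_of_pos _ _ hr, Real.rpow_natCast]

theorem FP_one (hn : 0 < dimR E) (p : ℝ) (hp : 1 < p) (N : ℝ≥0∞) (v : E → ℝ≥0∞) (hv : Measurable v) (h : FP p N v) (x : E) (r : ℝ)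
    (hr : 0 < r) : ∫⁻ y in ball x r, v y ≤ wd E ^ (1 - 1 / p) * N * ofR (r ^ ((dimR E : ℝ) - 2)) := by
  have hp0 : 0 < p := by linarith
  have hq : 0 ≤ 1 - 1 / p := by rw [sub_nonneg, div_le_one hp0]; exact hp.le
  have h1 := lintegral_mul_norm_pow_le (μ := volume.restrict (ball x r)) (f := fun y => v y ^ p) (g := fun _ => 1)
    (p := 1 / p) (q := 1 - 1 / p) (hv.pow_const _).aemeasurable aemeasurable_const (by positivity) hq (by ring)
  have e1 : ∀ y, (v y ^ p) ^ (1 / p) * (1 : ℝ≥0∞) ^ (1 - 1 / p) = v y := fun y => by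
    rw [← rpow_mul, mul_one_div_cancel hp0.ne', ENNReal.rpow_one, ENNReal.one_rpow, mul_one]
  simp only [e1] at h1
  refine h1.trans ?_
  rw [setLIntegral_one, vol_ball hn x r hr, mul_rpow_of_nonneg _ _ hq,
    ofReal_rpow_of_nonneg (by positivity) hq, ← Real.rpow_mul hr.le]
  refine (mul_le_mul' (h x r hr) le_rfl).trans (le_of_eq ?_)
  have e2 : r ^ ((dimR E : ℝ) - 2) = r ^ ((dimR E : ℝ) / p - 2) *
      r ^ ((dimR E : ℝ) * (1 - 1 / p)) := by
    rw [← Real.rpow_add hr]; congr 1; ring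
  rw [e2, ENNReal.ofReal_mul (by positivity)]; ring
end NF
section SB

/-- far kernel -/
def kf (τ : ℝ) (x : E) : ℝ≥0∞ :=
  {x : E | τ ≤ ‖x‖}.indicator (fun x => ofR (‖x‖⁻¹ ^ (dimR E + 1))) x

theorem kf_meas (τ : ℝ) : Measurable (kf (E := E) τ) := by
  unfold kf
  refine Measurable.indicator (by fun_prop) (measurableSet_le measurable_const measurable_norm)

theorem geo_half : ∑' i : ℕ, ofR ((1 / 2 : ℝ) ^ i) = 2 := by
  rw [← ENNReal.ofReal_tsum_of_nonneg (fun i => by positivity) summable_geometric_two, tsum_geometric_two]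
  simp

theorem kf_sum (hn : 3 ≤ dimR E) (p : ℝ) (hp : 1 < p) (N : ℝ≥0∞) (v : E → ℝ≥0∞) (hv : Measurable v)
    (h : FP p N v) (τ : ℝ) (hτ : 0 < τ) (x : E) :
    ∫⁻ y, kf τ (x - y) * v y ≤ wd E ^ (1 - 1 / p) * N * ofR (2 ^ ((dimR E : ℝ) - 2) * τ ^ (-3 : ℝ)) * 2 := by
  set d := dimR E with hd
  have h1 : ∀ y, kf τ (x - y) * v y ≤ ∑' i : ℕ, ofR ((2 ^ i * τ)⁻¹ ^ (d + 1)) *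
      (ball x (2 ^ (i + 1) * τ)).indicator v y := by
    intro y
    by_cases hy : τ ≤ ‖x - y‖
    · obtain ⟨i, hi1, hi2⟩ := exists_nat_pow_near (x := ‖x - y‖ / τ) (y := 2) (by rwa [le_div_iff₀ hτ, one_mul]) (by norm_num)
      rw [le_div_iff₀ hτ] at hi1
      rw [div_lt_iff₀ hτ] at hi2
      refine le_trans ?_ (ENNReal.le_tsum i)
      rw [Set.indicator_of_mem (by rwa [mem_ball, dist_comm, dist_eq_norm])]
      refine mul_le_mul' ?_ le_rfl
      rw [kf, Set.indicator_of_mem (by exact hy)]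
      apply ofReal_le_ofReal
      have : 0 < 2 ^ i * τ := by positivity
      gcongr
    · rw [kf, Set.indicator_of_notMem (by exact hy), zero_mul]; exact bot_le
  refine (lintegral_mono h1).trans ?_
  rw [lintegral_tsum fun i => ((hv.indicator measurableSet_ball).const_mul _).aemeasurable]
  have h2 : ∀ i : ℕ, ∫⁻ y, ofR ((2 ^ i * τ)⁻¹ ^ (d + 1)) * (ball x (2 ^ (i + 1) * τ)).indicator v y ≤
      wd E ^ (1 - 1 / p) * N * ofR (2 ^ ((d : ℝ) - 2) * τ ^ (-3 : ℝ)) * ofR ((1 / 2) ^ i) := by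
    intro i
    rw [lintegral_const_mul' _ _ ofReal_ne_top, lintegral_indicator measurableSet_ball]
    refine (mul_le_mul' le_rfl (FP_one (by omega) p hp N v hv h x (2 ^ (i + 1) * τ) (by positivity))).trans ?_
    have e1 : (2 ^ i * τ)⁻¹ ^ (d + 1) * (2 ^ (i + 1) * τ) ^ ((d : ℝ) - 2) ≤ 2 ^ ((d : ℝ) - 2) * τ ^ (-3 : ℝ) * (1 / 2) ^ i := by
      have hy : (0 : ℝ) < 2 ^ i * τ := by positivity
      rw [show (2 : ℝ) ^ (i + 1) * τ = 2 * (2 ^ i * τ) by ring, Real.mul_rpow (by norm_num) hy.le]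
      have e2 : (2 ^ i * τ)⁻¹ ^ (d + 1) = (2 ^ i * τ) ^ (-((d : ℝ) + 1)) := by
        rw [Real.rpow_neg hy.le, inv_pow]; congr 1
        rw [← Real.rpow_natCast]; push_cast; rfl
      have e3 : (2 ^ i * τ)⁻¹ ^ (d + 1) * (2 ^ ((d : ℝ) - 2) * (2 ^ i * τ) ^ ((d : ℝ) - 2)) =
          2 ^ ((d : ℝ) - 2) * (2 ^ i * τ) ^ (-3 : ℝ) := by
        rw [e2, mul_left_comm, ← Real.rpow_add hy]; congr 2; ring
      rw [e3, Real.mul_rpow (by positivity) hτ.le, mul_assoc, mul_comm (τ ^ (-3 : ℝ))]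
      have e4 : ((2 : ℝ) ^ i) ^ (-3 : ℝ) ≤ (1 / 2) ^ i := by
        rw [one_div, inv_pow, ← Real.rpow_neg_one]
        exact Real.rpow_le_rpow_of_exponent_le (one_le_pow₀ (by norm_num)) (by norm_num)
      gcongr
    calc _ = wd E ^ (1 - 1 / p) * N * (ofR ((2 ^ i * τ)⁻¹ ^ (d + 1)) *
          ofR ((2 ^ (i + 1) * τ) ^ ((d : ℝ) - 2))) := by ring
      _ = wd E ^ (1 - 1 / p) * N * ofR ((2 ^ i * τ)⁻¹ ^ (d + 1) * (2 ^ (i + 1) * τ) ^ ((d : ℝ) - 2)) := by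
          rw [← ENNReal.ofReal_mul (by positivity)]
      _ ≤ wd E ^ (1 - 1 / p) * N * ofR (2 ^ ((d : ℝ) - 2) * τ ^ (-3 : ℝ) * (1 / 2) ^ i) :=
          mul_le_mul' le_rfl (ofReal_le_ofReal e1)
      _ = _ := by rw [ENNReal.ofReal_mul (by positivity)]; ring
  refine (ENNReal.tsum_le_tsum h2).trans ?_
  rw [ENNReal.tsum_mul_left, geo_half]

/-- far constant -/
def Cf (E : Type*) [NormedAddCommGroup E] [InnerProductSpace ℝ E] [FiniteDimensional ℝ E]
  [MeasurableSpace E] [BorelSpace E] (p : ℝ) : ℝ≥0∞ :=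
  ofR (4 * c0 E * 2 ^ ((dimR E : ℝ) - 2)) * wd E ^ (1 - 1 / p) * 2

theorem far_bound (e a τ : ℝ) (he : |e| = 1) (ha : 0 < a) (haτ : a ≤ τ) (U : Set ℝ) (hU : MeasurableSet U)
    (hτ : ∀ u ∈ U, |u| < τ) (hn : 3 ≤ dimR E) (p : ℝ) (hp : 1 < p) (N : ℝ≥0∞)
    (v κ : E → ℝ≥0∞) (hv : Measurable v) (hκ : Measurable κ) (h : FP p N v) (J : E × ℝ → ℂ) (hJ : Gd J)
    (hc : ∀ x, cn J x = v x * κ x) :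
    ∫⁻ q in {q : E × E | τ ≤ ‖q.1 - q.2‖}, ‖PS e a U J J q‖ₑ ∂(volume.prod volume) ≤
      Cf E p * ofR (τ ^ (-1 : ℝ)) * N * ∫⁻ x, v x * κ x ^ 2 := by
  have hτ0 : 0 < τ := ha.trans_le haτ
  have hc0 := c0_nonneg (E := E)
  have hms : MeasurableSet {q : E × E | τ ≤ ‖q.1 - q.2‖} := measurableSet_le measurable_const (by fun_prop)
  have hkm : Measurable fun q : E × E => kf τ (q.1 - q.2) := (kf_meas τ).comp (measurable_fst.sub measurable_snd)
  set D := wd E ^ (1 - 1 / p) * N * ofR (2 ^ ((dimR E : ℝ) - 2) * τ ^ (-3 : ℝ)) * 2 with hD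
  have hsym : ∀ x : E, kf τ (-x) = kf τ x := fun x => by simp [kf, Set.indicator]
  have hsch := schur (volume.withDensity v) (volume.withDensity v) (fun q : E × E => kf τ (q.1 - q.2)) κ κ hkm hκ hκ D D
    (fun x => by
      have hk1 : Measurable fun y : E => kf τ (x - y) := (kf_meas τ).comp (measurable_const.sub measurable_id)
      change ∫⁻ y, kf τ (x - y) ∂(volume.withDensity v) ≤ D
      rw [lintegral_withDensity_eq_lintegral_mul _ hv hk1]
      refine le_trans (le_of_eq ?_) (kf_sum hn p hp N v hv h τ hτ0 x)
      exact lintegral_congr fun y => mul_comm _ _)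
    (fun y => by
      have hk1 : Measurable fun x : E => kf τ (x - y) := (kf_meas τ).comp (measurable_id.sub measurable_const)
      change ∫⁻ x, kf τ (x - y) ∂(volume.withDensity v) ≤ D
      rw [lintegral_withDensity_eq_lintegral_mul _ hv hk1]
      refine le_trans (le_of_eq ?_) (kf_sum hn p hp N v hv h τ hτ0 y)
      refine lintegral_congr fun x => ?_
      rw [← hsym (y - x), neg_sub]; exact mul_comm _ _)
  rw [prod_withDensity hv hv, lintegral_withDensity_eq_lintegral_mul _ (by fun_prop) (by fun_prop),
    lintegral_withDensity_eq_lintegral_mul _ hv (hκ.pow_const 2), ennreal_sqrt_mul_self, mul_assoc,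
    ennreal_sqrt_mul_self] at hsch
  rw [← lintegral_indicator hms]
  have hpt : ∀ q : E × E, {q : E × E | τ ≤ ‖q.1 - q.2‖}.indicator (fun q => ‖PS e a U J J q‖ₑ) q ≤
      ofR (4 * c0 E * τ ^ 2) * ((fun z : E × E => v z.1 * v z.2) * fun q : E × E => κ q.1 * κ q.2 * kf τ (q.1 - q.2)) q := by
    intro q
    by_cases hq : τ ≤ ‖q.1 - q.2‖
    · rw [Set.indicator_of_mem (by exact hq)]
      refine (PS_point e a τ U hU hτ J J hJ.1 hJ.1 q).trans ?_
      refine (mul_le_mul' (KT_far e a τ he ha haτ U hU hτ hn _ hq) le_rfl).trans (le_of_eq ?_)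
      rw [hc, hc, ENNReal.ofReal_mul (by positivity)]
      simp only [Pi.mul_apply, kf]
      rw [Set.indicator_of_mem (by exact hq)]; ring
    · rw [Set.indicator_of_notMem (by exact hq)]; exact bot_le
  refine (lintegral_mono hpt).trans ?_
  rw [lintegral_const_mul' _ _ ofReal_ne_top]
  refine (mul_le_mul' le_rfl hsch).trans (le_of_eq ?_)
  have e1 : ofR (4 * c0 E * τ ^ 2) * ofR (2 ^ ((dimR E : ℝ) - 2) * τ ^ (-3 : ℝ)) =
      ofR (4 * c0 E * 2 ^ ((dimR E : ℝ) - 2)) * ofR (τ ^ (-1 : ℝ)) := by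
    rw [← ENNReal.ofReal_mul (by positivity), ← ENNReal.ofReal_mul (by positivity)]
    congr 1
    have : τ ^ 2 * τ ^ (-3 : ℝ) = τ ^ (-1 : ℝ) := by
      rw [← Real.rpow_natCast, ← Real.rpow_add hτ0]; norm_num
    rw [← this]; ring
  have e2 : ∫⁻ x, (v * fun x => κ x ^ 2) x = ∫⁻ x, v x * κ x ^ 2 := rfl
  rw [e2, hD, Cf]
  calc _ = (ofR (4 * c0 E * τ ^ 2) * ofR (2 ^ ((dimR E : ℝ) - 2) * τ ^ (-3 : ℝ))) *
        (wd E ^ (1 - 1 / p) * N * 2 * ∫⁻ x, v x * κ x ^ 2) := by ring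
    _ = _ := by rw [e1]; ring

theorem cn_ind (J : E × ℝ → ℂ) (S : Set E) (x : E) :
    cn (fun z => S.indicator (fun x => J (x, z.2)) z.1) x = S.indicator (cn J) x := by
  unfold cn
  by_cases h : x ∈ S <;> simp [h]

theorem near_lemI (e a τ : ℝ) (he : |e| = 1) (ha : 0 < a) (hτ0 : 0 < τ) (U : Set ℝ) (hU : MeasurableSet U)
    (hτ : ∀ u ∈ U, |u| < τ) (hlo : ∀ u ∈ U, τ / 2 ≤ max a |u|) (hn : 3 ≤ dimR E) (p : ℝ) (hp : 1 < p)
    (v κ : E → ℝ≥0∞) (hv : Measurable v) (hvf : ∀ x, v x ≠ ⊤) (hκ : Measurable κ) (J : E × ℝ → ℂ) (hJ : Gd J)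
    (hc : ∀ x, cn J x = v x * κ x) (B₁ B₂ : Set E) (hB₁ : MeasurableSet B₁) (hB₂ : MeasurableSet B₂) :
    ‖∫ q in B₁ ×ˢ B₂, PS e a U J J q ∂(volume.prod volume)‖ₑ ≤
      CI (1 / p) * (ofR (2 * τ) ^ (1 - 1 / p) * (ofR (2 * Real.pi * c0 E * (τ / 2) ^ (-((dimR E : ℝ) - 1) / 2) *
      a ^ (-((dimR E : ℝ) - 1) / 2)) * (∫⁻ x in B₁, v x ^ p) ^ (1 / 2 : ℝ) * (∫⁻ x in B₂, v x ^ p) ^ (1 / 2 : ℝ)) ^ (1 / p)) *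
      (∫⁻ x in B₁, v x * κ x ^ 2) ^ (1 / 2 : ℝ) * (∫⁻ x in B₂, v x * κ x ^ 2) ^ (1 / 2 : ℝ) := by
  have hp0 : 0 < p := by linarith
  have h0 : 0 < 1 / p := by positivity
  have h1 : 1 / p < 1 := by rw [div_lt_one hp0]; exact hp
  set H : Set E → E → ℝ≥0∞ := fun B => B.indicator fun x => v x ^ (1 / 2 : ℝ) * κ x with hH
  set W : Set E → E → ℝ≥0∞ := fun B => B.indicator fun x => v x ^ (p / 2) with hW
  have hHW : ∀ B x, H B x * W B x ^ (1 / p) = B.indicator (cn J) x := fun B x => by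
    simp only [hH, hW]
    by_cases hx : x ∈ B
    · rw [Set.indicator_of_mem hx, Set.indicator_of_mem hx, Set.indicator_of_mem hx, hc, ← rpow_mul,
        show p / 2 * (1 / p) = 1 / 2 by field_simp, mul_right_comm, ennreal_sqrt_mul_self]
    · simp [hx]
  have hHm : ∀ B, MeasurableSet B → Measurable (H B) := fun B hB => ((hv.pow_const _).mul hκ).indicator hB
  have hWm : ∀ B, MeasurableSet B → Measurable (W B) := fun B hB => (hv.pow_const _).indicator hB
  have hWf : ∀ B x, W B x ≠ ⊤ := fun B x => by
    simp only [hW]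
    by_cases hx : x ∈ B
    · rw [Set.indicator_of_mem hx]; exact rpow_ne_top_of_nonneg (by positivity) (hvf x)
    · simp [hx]
  have hH2 : ∀ B, MeasurableSet B → ∫⁻ x, H B x ^ 2 = ∫⁻ x in B, v x * κ x ^ 2 := fun B hB => by
    rw [← lintegral_indicator hB]
    refine lintegral_congr fun x => ?_
    simp only [hH]
    by_cases hx : x ∈ B
    · rw [Set.indicator_of_mem hx, Set.indicator_of_mem hx, mul_pow, ennreal_sqrt_sq]
    · simp [hx]
  have hW2 : ∀ B, MeasurableSet B → ∫⁻ x, W B x ^ 2 = ∫⁻ x in B, v x ^ p := fun B hB => by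
    rw [← lintegral_indicator hB]
    refine lintegral_congr fun x => ?_
    simp only [hW]
    by_cases hx : x ∈ B
    · rw [Set.indicator_of_mem hx, Set.indicator_of_mem hx, ← ENNReal.rpow_natCast, ← rpow_mul]
      congr 1; push_cast; ring
    · simp [hx]
  set J₁ : E × ℝ → ℂ := fun z => B₁.indicator (fun x => J (x, z.2)) z.1 with hJ₁
  set J₂ : E × ℝ → ℂ := fun z => B₂.indicator (fun x => J (x, z.2)) z.1 with hJ₂
  have g₁ : Gd J₁ := hJ.indicator hB₁
  have g₂ : Gd J₂ := hJ.indicator hB₂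
  have hres : ∫ q in B₁ ×ˢ B₂, PS e a U J J q ∂((volume : Measure E).prod volume) =
      ∫ q, PS e a U J₁ J₂ q ∂((volume : Measure E).prod volume) := by
    rw [← integral_indicator (hB₁.prod hB₂)]
    exact integral_congr_ae (of_forall fun q => PS_ind e a U J J B₁ B₂ q)
  rw [hres, ← hH2 B₁ hB₁, ← hH2 B₂ hB₂, ← hW2 B₁ hB₁, ← hW2 B₂ hB₂]
  refine lemI volume volume (1 / p) h0 h1 _ (PS_int e a ha U hU J₁ J₂ g₁ g₂) (H B₁) (W B₁) (H B₂) (W B₂) (hHm _ hB₁) (hWm _ hB₁)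
    (hHm _ hB₂) (hWm _ hB₂) (hWf _) (hWf _) _ _ ?_ ofReal_ne_top ?_ ?_
  · simpa using hτ0
  · intro S S' hS hS'
    have e1 : ∫ q in S ×ˢ S', PS e a U J₁ J₂ q ∂((volume : Measure E).prod volume) =
        ∫ q, PS e a U (fun z => S.indicator (fun x => J₁ (x, z.2)) z.1) (fun z => S'.indicator (fun x => J₂ (x, z.2)) z.1) q
          ∂((volume : Measure E).prod volume) := by
      rw [← integral_indicator (hS.prod hS')]
      exact integral_congr_ae (of_forall fun q => PS_ind e a U J₁ J₂ S S' q)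
    rw [e1]
    refine (PS_block e a τ ha U hU hτ _ _ (g₁.indicator hS) (g₂.indicator hS')).trans (le_of_eq ?_)
    have e2 : ∀ (J' : E × ℝ → ℂ) (S : Set E), MeasurableSet S → ∫⁻ x, cn (fun z => S.indicator (fun x => J' (x, z.2)) z.1) x ^ 2 =
        ∫⁻ x in S, cn J' x ^ 2 := fun J' S hS => by
      rw [← lintegral_indicator hS]
      refine lintegral_congr fun x => ?_
      rw [cn_ind]
      by_cases hx : x ∈ S <;> simp [hx]
    rw [e2 _ _ hS, e2 _ _ hS']
    have e3 : ∀ x, cn J₁ x = H B₁ x * W B₁ x ^ (1 / p) := fun x => by rw [hHW, hJ₁, cn_ind]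
    have e4 : ∀ x, cn J₂ x = H B₂ x * W B₂ x ^ (1 / p) := fun x => by rw [hHW, hJ₂, cn_ind]
    simp_rw [e3, e4]
  · intro q
    rw [hHW, hHW, ← cn_ind, ← cn_ind]
    exact (PS_point e a τ U hU hτ J₁ J₂ g₁.1 g₂.1 q).trans (mul_le_mul' (KT_near e a τ he ha hτ0 U hU hlo hn _) le_rfl)
end SB
section SC

theorem meas_ball_int (m : E → ℝ≥0∞) (hm : Measurable m) (ρ : ℝ) : Measurable fun c : E => ∫⁻ x in ball c ρ, m x := by
  have : (fun c : E => ∫⁻ x in ball c ρ, m x) = fun c => ∫⁻ x, {q : E × E | dist q.2 q.1 < ρ}.indicator (fun q => m q.2) (c, x) := by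
    funext c
    rw [← lintegral_indicator measurableSet_ball]
    rfl
  rw [this]
  refine Measurable.lintegral_prod_right' (f := fun q : E × E => {q : E × E | dist q.2 q.1 < ρ}.indicator (fun q => m q.2) q) ?_
  exact (hm.comp measurable_snd).indicator (measurableSet_lt (measurable_snd.dist measurable_fst) measurable_const)

theorem near_const (τ a p d c : ℝ) (hτ : 0 < τ) (ha : 0 < a) (hp : 1 < p) (hc : 0 ≤ c) :
    (2 * τ) ^ (1 - 1 / p) * (2 * Real.pi * c * (τ / 2) ^ (-(d - 1) / 2) * a ^ (-(d - 1) / 2)) ^ (1 / p) *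
      ((τ ^ (d / p - 2)) ^ (1 / 2 : ℝ) * ((2 * τ) ^ (d / p - 2)) ^ (1 / 2 : ℝ)) =
    (2 ^ (1 - 1 / p) * (2 * Real.pi * c) ^ (1 / p) * 2 ^ ((d - 1) / (2 * p)) * 2 ^ ((d / p - 2) / 2)) *
      (τ ^ ((d - 1) / (2 * p) - 1) * a ^ (-((d - 1) / (2 * p)))) := by
  have hp0 : 0 < p := by linarith
  rw [Real.mul_rpow (by positivity) (by positivity), Real.mul_rpow (by positivity) (by positivity),
    Real.mul_rpow (by positivity) (by positivity), ← Real.rpow_mul (by positivity), ← Real.rpow_mul ha.le,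
    ← Real.rpow_mul hτ.le, ← Real.rpow_mul (by positivity), Real.mul_rpow (by positivity) hτ.le (z := (d / p - 2) * (1 / 2)),
    Real.div_rpow hτ.le (by norm_num)]
  have e1 : τ ^ ((d - 1) / (2 * p) - 1) = τ ^ (1 - 1 / p) * τ ^ (-(d - 1) / 2 * (1 / p)) * (τ ^ ((d / p - 2) * (1 / 2)) * τ ^ ((d / p - 2) * (1 / 2))) := by
    rw [← Real.rpow_add hτ, ← Real.rpow_add hτ, ← Real.rpow_add hτ]
    congr 1; field_simp; ring
  have e2 : (2 : ℝ) ^ ((d - 1) / (2 * p)) = ((2 : ℝ) ^ (-(d - 1) / 2 * (1 / p)))⁻¹ := by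
    rw [← Real.rpow_neg (by norm_num)]; congr 1; field_simp
  rw [e1, e2, show -(d - 1) / 2 * (1 / p) = -((d - 1) / (2 * p)) by field_simp,
    show (d / p - 2) * (1 / 2) = (d / p - 2) / 2 by ring]
  ring

/-- near constant -/
def Cn (E : Type*) [NormedAddCommGroup E] [InnerProductSpace ℝ E] [FiniteDimensional ℝ E]
  [MeasurableSpace E] [BorelSpace E] (p : ℝ) : ℝ :=
  2 ^ (1 - 1 / p) * (2 * Real.pi * c0 E) ^ (1 / p) * 2 ^ (((dimR E : ℝ) - 1) / (2 * p)) *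
    2 ^ (((dimR E : ℝ) / p - 2) / 2)

theorem near_bound (e a τ : ℝ) (he : |e| = 1) (ha : 0 < a) (hτ0 : 0 < τ) (U : Set ℝ) (hU : MeasurableSet U)
    (hτ : ∀ u ∈ U, |u| < τ) (hlo : ∀ u ∈ U, τ / 2 ≤ max a |u|) (hn : 3 ≤ dimR E) (p : ℝ) (hp : 1 < p)
    (N : ℝ≥0∞) (hN : N ≠ ⊤)
    (v κ : E → ℝ≥0∞) (hv : Measurable v) (hvf : ∀ x, v x ≠ ⊤) (hκ : Measurable κ) (h : FP p N v) (J : E × ℝ → ℂ) (hJ : Gd J)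
    (hc : ∀ x, cn J x = v x * κ x) :
    (volume (ball (0 : E) τ))⁻¹ * (∫⁻ c : E, ‖∫ q in ball c τ ×ˢ ball c (2 * τ), PS e a U J J q ∂(volume.prod volume)‖ₑ) ≤
      CI (1 / p) * ofR (2 ^ ((dimR E : ℝ) / 2)) * ofR (Cn E p) *
        ofR (τ ^ (((dimR E : ℝ) - 1) / (2 * p) - 1) * a ^ (-(((dimR E : ℝ) - 1) / (2 * p)))) * N *
        ∫⁻ x, v x * κ x ^ 2 := by
  have hp0 : 0 < p := by linarith
  have hc0 := c0_nonneg (E := E)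
  have h0 : 0 < 1 / p := by positivity
  have h1 : 1 / p < 1 := by rw [div_lt_one hp0]; exact hp
  set d : ℝ := (dimR E : ℝ) with hd
  set m : E → ℝ≥0∞ := fun x => v x * κ x ^ 2 with hm
  have hmm : Measurable m := hv.mul (hκ.pow_const 2)
  set K : ℝ := 2 * Real.pi * c0 E * (τ / 2) ^ (-(d - 1) / 2) * a ^ (-(d - 1) / 2) with hK
  have hK0 : 0 ≤ K := by positivity
  have hmid : ∀ c : E, ofR (2 * τ) ^ (1 - 1 / p) * (ofR K * (∫⁻ x in ball c τ, v x ^ p) ^ (1 / 2 : ℝ) *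
      (∫⁻ x in ball c (2 * τ), v x ^ p) ^ (1 / 2 : ℝ)) ^ (1 / p) ≤
      ofR (Cn E p) * ofR (τ ^ ((d - 1) / (2 * p) - 1) * a ^ (-((d - 1) / (2 * p)))) * N := by
    intro c
    have g : ∀ r : ℝ, 0 < r → ((∫⁻ x in ball c r, v x ^ p) ^ (1 / 2 : ℝ)) ^ (1 / p) ≤ N ^ (1 / 2 : ℝ) * ofR ((r ^ (d / p - 2)) ^ (1 / 2 : ℝ)) := by
      intro r hr
      rw [← rpow_mul, mul_comm (1 / 2 : ℝ), rpow_mul, ← ofReal_rpow_of_nonneg (by positivity) (by norm_num),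
        ← mul_rpow_of_nonneg _ _ (by norm_num)]
      exact rpow_le_rpow (h c r hr) (by norm_num)
    rw [mul_rpow_of_nonneg _ _ h0.le, mul_rpow_of_nonneg _ _ h0.le, ofReal_rpow_of_nonneg hK0 h0.le,
      ofReal_rpow_of_nonneg (by positivity) (by linarith)]
    refine (mul_le_mul' le_rfl (mul_le_mul' (mul_le_mul' le_rfl (g τ hτ0)) (g (2 * τ) (by positivity)))).trans (le_of_eq ?_)
    have e1 := near_const τ a p d (c0 E) hτ0 ha hp hc0
    rw [← hK] at e1
    have e2 : Cn E p = 2 ^ (1 - 1 / p) * (2 * Real.pi * c0 E) ^ (1 / p) * 2 ^ ((d - 1) / (2 * p)) * 2 ^ ((d / p - 2) / 2) := rfl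
    rw [← ENNReal.ofReal_mul (by rw [e2]; positivity), e2, ← e1, ENNReal.ofReal_mul (by positivity), ENNReal.ofReal_mul (by positivity),
      ENNReal.ofReal_mul (by positivity)]
    conv_rhs => rw [← ennreal_sqrt_mul_self N]
    ring
  set Cc := CI (1 / p) * (ofR (Cn E p) * ofR (τ ^ ((d - 1) / (2 * p) - 1) * a ^ (-((d - 1) / (2 * p)))) * N) with hCc
  have hCt : Cc ≠ ⊤ := mul_ne_top (CI_ne_top _ h0 h1) (mul_ne_top (mul_ne_top ofReal_ne_top ofReal_ne_top) hN)
  have hpc : ∀ c : E, ‖∫ q in ball c τ ×ˢ ball c (2 * τ), PS e a U J J q ∂(volume.prod volume)‖ₑ ≤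
      Cc * ((∫⁻ x in ball c τ, m x) ^ (1 / 2 : ℝ) * (∫⁻ x in ball c (2 * τ), m x) ^ (1 / 2 : ℝ)) := fun c => by
    refine (near_lemI e a τ he ha hτ0 U hU hτ hlo hn p hp v κ hv hvf hκ J hJ hc _ _ measurableSet_ball measurableSet_ball).trans ?_
    refine le_of_le_of_eq ?_ (mul_assoc _ _ _)
    exact mul_le_mul' (mul_le_mul' (mul_le_mul' le_rfl (hmid c)) le_rfl) le_rfl
  have hI : (∫⁻ c : E, ‖∫ q in ball c τ ×ˢ ball c (2 * τ), PS e a U J J q ∂(volume.prod volume)‖ₑ) ≤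
      Cc * ((volume (ball (0 : E) τ) * ∫⁻ x, m x) ^ (1 / 2 : ℝ) * (volume (ball (0 : E) (2 * τ)) * ∫⁻ x, m x) ^ (1 / 2 : ℝ)) := by
    refine (lintegral_mono hpc).trans ?_
    rw [lintegral_const_mul' _ _ hCt]
    refine mul_le_mul' le_rfl ?_
    have := lintegral_mul_norm_pow_le (μ := (volume : Measure E)) (meas_ball_int m hmm τ).aemeasurable (meas_ball_int m hmm (2 * τ)).aemeasurable
      (p := 1 / 2) (q := 1 / 2) (by norm_num) (by norm_num) (by norm_num)
    rw [ball_avg m hmm, ball_avg m hmm] at this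
    exact this
  have hb : volume (ball (0 : E) (2 * τ)) = ofR (2 ^ d) * volume (ball (0 : E) τ) := by
    rw [vol_ball (by omega) _ _ (by positivity), vol_ball (by omega) _ _ hτ0, Real.mul_rpow (by norm_num) hτ0.le,
      ENNReal.ofReal_mul (by positivity), mul_assoc]
  have hb0 : volume (ball (0 : E) τ) ≠ 0 := (measure_ball_pos _ _ hτ0).ne'
  have hbt : volume (ball (0 : E) τ) ≠ ⊤ := measure_ball_lt_top.ne
  refine (mul_le_mul' le_rfl hI).trans (le_of_eq ?_)
  rw [hb, mul_assoc (ofR (2 ^ d)), mul_rpow_of_nonneg (ofR (2 ^ d)) _ (by norm_num),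
    ofReal_rpow_of_nonneg (by positivity) (by norm_num), ← Real.rpow_mul (by norm_num), show d * (1 / 2) = d / 2 by ring]
  set X := volume (ball (0 : E) τ) * ∫⁻ x, m x with hX
  calc _ = (volume (ball (0 : E) τ))⁻¹ * Cc * ofR (2 ^ (d / 2)) * (X ^ (1 / 2 : ℝ) * X ^ (1 / 2 : ℝ)) := by ring
    _ = ((volume (ball (0 : E) τ))⁻¹ * volume (ball (0 : E) τ)) * (Cc * ofR (2 ^ (d / 2)) * ∫⁻ x, m x) := by
        rw [ennreal_sqrt_mul_self, hX]; ring
    _ = _ := by rw [ENNReal.inv_mul_cancel hb0 hbt, one_mul, hCc]; ring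

/-- dyadic time shells -/
def Uj (a : ℝ) (j : ℕ) : Set ℝ := {u | |u| < a * 2 ^ j} \ {u | |u| < a * 2 ^ j / 2 ∧ j ≠ 0}

theorem Uj_meas (a : ℝ) (j : ℕ) : MeasurableSet (Uj a j) := by
  refine MeasurableSet.diff (measurableSet_lt (by fun_prop) measurable_const) ?_
  by_cases h : j = 0
  · simp [h]
  · simp only [h, ne_eq, not_false_eq_true, and_true]
    exact measurableSet_lt (by fun_prop) measurable_const

theorem Uj_cover (a : ℝ) (ha : 0 < a) : ⋃ j, Uj a j = Set.univ := by
  rw [Set.eq_univ_iff_forall]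
  intro u
  have hex : ∃ j : ℕ, |u| < a * 2 ^ j := by
    obtain ⟨j, hj⟩ := pow_unbounded_of_one_lt (|u| / a) (by norm_num : (1 : ℝ) < 2)
    exact ⟨j, by rw [div_lt_iff₀ ha] at hj; linarith⟩
  classical
  refine Set.mem_iUnion.2 ⟨Nat.find hex, Nat.find_spec hex, ?_⟩
  rintro ⟨h1, h2⟩
  obtain ⟨k, hk⟩ := Nat.exists_eq_succ_of_ne_zero h2
  have := Nat.find_min hex (m := k) (by omega)
  rw [hk] at h1
  apply this
  rw [Nat.succ_eq_add_one, pow_succ] at h1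
  linarith

theorem Uj_disj (a : ℝ) (ha : 0 < a) : Pairwise (Function.onFun Disjoint (Uj a)) := by
  have key : ∀ i j, i < j → Disjoint (Uj a i) (Uj a j) := by
    intro i j hij
    rw [Set.disjoint_left]
    rintro u ⟨h1, -⟩ ⟨-, h2⟩
    apply h2
    refine ⟨lt_of_lt_of_le h1 ?_, by omega⟩
    have : (2 : ℝ) ^ (i + 1) ≤ 2 ^ j := pow_le_pow_right₀ (by norm_num) (by omega)
    rw [pow_succ] at this
    rw [le_div_iff₀ (by norm_num), mul_assoc]
    exact mul_le_mul_of_nonneg_left this ha.le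
  intro i j hij
  rcases lt_or_gt_of_ne hij with h | h
  · exact key i j h
  · exact (key j i h).symm

/-- shell constant -/
def CQ (E : Type*) [NormedAddCommGroup E] [InnerProductSpace ℝ E] [FiniteDimensional ℝ E]
  [MeasurableSpace E] [BorelSpace E] (p : ℝ) : ℝ≥0∞ :=
  CI (1 / p) * ofR (2 ^ ((dimR E : ℝ) / 2)) * ofR (Cn E p) + Cf E p

theorem CQ_ne_top (p : ℝ) (hp : 1 < p) : CQ E p ≠ ⊤ := by
  have hp0 : 0 < p := by linarith
  have h0 : 0 < 1 / p := by positivity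
  have h1 : 1 / p < 1 := by rw [div_lt_one hp0]; exact hp
  unfold CQ Cf
  refine ENNReal.add_ne_top.2 ⟨mul_ne_top (mul_ne_top (CI_ne_top _ h0 h1) ofReal_ne_top) ofReal_ne_top,
    mul_ne_top (mul_ne_top ofReal_ne_top (rpow_ne_top_of_nonneg (by linarith) wd_ne_top)) (by norm_num)⟩

theorem shell_bound (e a : ℝ) (he : |e| = 1) (ha : 0 < a) (hn : 3 ≤ dimR E) (p : ℝ) (hp : 1 < p)
    (N : ℝ≥0∞) (hN : N ≠ ⊤)
    (v κ : E → ℝ≥0∞) (hv : Measurable v) (hvf : ∀ x, v x ≠ ⊤) (hκ : Measurable κ) (h : FP p N v) (J : E × ℝ → ℂ) (hJ : Gd J)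
    (hc : ∀ x, cn J x = v x * κ x) (j : ℕ) :
    ‖∫ q, PS e a (Uj a j) J J q ∂(volume.prod volume)‖ₑ ≤
      CQ E p * N * (∫⁻ x, v x * κ x ^ 2) * ofR a⁻¹ *
        ofR ((2 ^ (((dimR E : ℝ) - 1) / (2 * p) - 1)) ^ j) := by
  have hp0 : 0 < p := by linarith
  set d : ℝ := (dimR E : ℝ) with hd
  have hd3 : (3 : ℝ) ≤ d := by rw [hd]; exact_mod_cast hn
  set ν := (d - 1) / (2 * p) with hν
  have hν0 : 0 < ν := by rw [hν]; apply div_pos <;> linarith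
  set τ := a * 2 ^ j with hτd
  have hτ0 : 0 < τ := by positivity
  have haτ : a ≤ τ := by rw [hτd]; exact le_mul_of_one_le_right ha.le (one_le_pow₀ (by norm_num))
  have hτ : ∀ u ∈ Uj a j, |u| < τ := fun u hu => hu.1
  have hlo : ∀ u ∈ Uj a j, τ / 2 ≤ max a |u| := fun u hu => by
    by_cases hj : j = 0
    · rw [hτd, hj]; refine le_max_of_le_left ?_; simp; linarith
    · refine le_max_of_le_right ?_
      by_contra hh
      exact hu.2 ⟨not_le.1 hh, hj⟩
  refine (near_far _ (PS_int e a ha _ (Uj_meas a j) J J hJ hJ) τ hτ0).trans ?_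
  refine (add_le_add (near_bound e a τ he ha hτ0 _ (Uj_meas a j) hτ hlo hn p hp N hN v κ hv hvf hκ h J hJ hc)
    (far_bound e a τ he ha haτ _ (Uj_meas a j) hτ hn p hp N v κ hv hκ h J hJ hc)).trans ?_
  have e1 : τ ^ (ν - 1) * a ^ (-ν) = a⁻¹ * (2 ^ (ν - 1)) ^ j := by
    rw [hτd, Real.mul_rpow ha.le (by positivity), ← Real.rpow_natCast 2 j, ← Real.rpow_natCast _ j, ← Real.rpow_mul (by norm_num),
      ← Real.rpow_mul (by norm_num), mul_comm (j : ℝ), mul_right_comm, ← Real.rpow_add ha, ← Real.rpow_neg_one a]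
    congr 2; ring
  have e2 : τ ^ (-1 : ℝ) ≤ a⁻¹ * (2 ^ (ν - 1)) ^ j := by
    rw [Real.rpow_neg_one, hτd, mul_inv, ← inv_pow]
    refine mul_le_mul_of_nonneg_left (pow_le_pow_left₀ (by norm_num) ?_ j) (by positivity)
    rw [← Real.rpow_neg_one]
    exact Real.rpow_le_rpow_of_exponent_le (by norm_num) (by linarith)
  rw [e1]
  refine (add_le_add le_rfl (mul_le_mul' (mul_le_mul' (mul_le_mul' le_rfl (ofReal_le_ofReal e2)) le_rfl) le_rfl)).trans (le_of_eq ?_)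
  rw [CQ, ENNReal.ofReal_mul (by positivity), ← hd]
  ring

/-- weighted constant -/
def CW (E : Type*) [NormedAddCommGroup E] [InnerProductSpace ℝ E] [FiniteDimensional ℝ E]
  [MeasurableSpace E] [BorelSpace E] (p : ℝ) : ℝ≥0∞ :=
  CQ E p * ∑' j : ℕ, ofR ((2 ^ (((dimR E : ℝ) - 1) / (2 * p) - 1)) ^ j)

theorem CW_ne_top (hn : 3 ≤ dimR E) (p : ℝ) (hp : ((dimR E : ℝ) - 1) / 2 < p) : CW E p ≠ ⊤ := by
  have hd3 : (3 : ℝ) ≤ dimR E := by exact_mod_cast hn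
  have hp1 : 1 < p := by linarith
  refine mul_ne_top (CQ_ne_top p hp1) ?_
  have hlt : (2 : ℝ) ^ (((dimR E : ℝ) - 1) / (2 * p) - 1) < 1 := by
    apply Real.rpow_lt_one_of_one_lt_of_neg (by norm_num)
    rw [sub_neg, div_lt_one (by linarith)]; linarith
  rw [← ENNReal.ofReal_tsum_of_nonneg (fun i => by positivity) (summable_geometric_of_lt_one (by positivity) hlt)]
  exact ofReal_ne_top

theorem Qf_wt (e a : ℝ) (he : |e| = 1) (ha : 0 < a) (hn : 3 ≤ dimR E) (p : ℝ) (hp : 1 < p)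
    (N : ℝ≥0∞) (hN : N ≠ ⊤)
    (v κ : E → ℝ≥0∞) (hv : Measurable v) (hvf : ∀ x, v x ≠ ⊤) (hκ : Measurable κ) (h : FP p N v) (J : E × ℝ → ℂ) (hJ : Gd J)
    (hc : ∀ x, cn J x = v x * κ x) :
    Qf e a J ≤ CW E p * N * ofR a⁻¹ * ∫⁻ x, v x * κ x ^ 2 := by
  rw [Qf_eq e a ha J hJ.2.1 hJ.1]
  have e0 : (∫ p, J p.1 * (starRingEnd ℂ) (J p.2) * ker (a - (e * p.1.2 - e * p.2.2 : ℝ) * I) (p.1.1 - p.2.1)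
          ∂((volume : Measure (E × ℝ)).prod (volume : Measure (E × ℝ)))) =
      ∫ p, bs e a Set.univ J J p ∂(((volume : Measure ℝ).prod volume).prod ((volume : Measure E).prod volume)) := by
    have := (reord_mp (volume : Measure E) (volume : Measure ℝ) (volume : Measure E) (volume : Measure ℝ)).integral_comp
      reord.measurableEmbedding (bg e a J J)
    rw [Measure.volume_eq_prod E ℝ]
    refine Eq.trans ?_ (this.symm.trans ?_)
    · refine integral_congr_ae (of_forall fun p => ?_)
      simp only [bg, mul_sub]
    · refine integral_congr_ae (of_forall fun p => ?_)
      simp [bs, reord]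
  rw [e0]
  set μ := ((volume : Measure ℝ).prod (volume : Measure ℝ)).prod ((volume : Measure E).prod (volume : Measure E)) with hμ
  set S : ℕ → Set ((ℝ × ℝ) × (E × E)) := fun j => (fun p => p.1.1 - p.1.2) ⁻¹' (Uj a j) with hS
  have hSm : ∀ j, MeasurableSet (S j) := fun j => (by fun_prop : Measurable fun p : (ℝ × ℝ) × (E × E) => p.1.1 - p.1.2) (Uj_meas a j)
  have hSd : Pairwise (Function.onFun Disjoint S) := fun i j hij => (Uj_disj a ha hij).preimage _
  have hSu : ⋃ j, S j = Set.univ := by rw [hS, ← Set.preimage_iUnion, Uj_cover a ha, Set.preimage_univ]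
  have hb := bs_int e a ha Set.univ MeasurableSet.univ J J hJ hJ
  have hsum := hasSum_integral_iUnion hSm hSd hb.integrableOn
  rw [hSu, setIntegral_univ] at hsum
  have hj : ∀ j, ∫ p in S j, bs e a Set.univ J J p ∂μ = ∫ q, PS e a (Uj a j) J J q ∂((volume : Measure E).prod volume) := fun j => by
    rw [← integral_indicator (hSm j)]
    have e1 : (S j).indicator (bs e a Set.univ J J) = bs e a (Uj a j) J J := by
      funext p
      by_cases hp : p.1.1 - p.1.2 ∈ Uj a j
      · rw [Set.indicator_of_mem (by exact hp)]; simp [bs, hp]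
      · rw [Set.indicator_of_notMem (by exact hp)]; simp [bs, hp]
    rw [e1, hμ, integral_prod_symm _ (bs_int e a ha _ (Uj_meas a j) J J hJ hJ)]
    rfl
  rw [← hsum.tsum_eq]
  refine (enorm_tsum_le_tsum_enorm).trans ?_
  refine (ENNReal.tsum_le_tsum fun j => (le_of_eq (congrArg enorm (hj j))).trans (shell_bound e a he ha hn p hp N hN v κ hv hvf hκ h J hJ hc j)).trans ?_
  rw [ENNReal.tsum_mul_left, CW]
  apply le_of_eq; ring
end SC
section SD

/-- time pieces -/
def AKt (k : ℤ) (g : E × ℝ → ℂ) (z : E × ℝ) : ℂ := AK k (fun t => g (z.1, t)) z.2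

theorem AKt_meas (k : ℤ) (g : E × ℝ → ℂ) (hg : Measurable g) : Measurable (AKt k g) := by
  have h : ∀ s : ℝ, Measurable fun z : E × ℝ => PC s (fun t => g (z.1, t)) z.2 := fun s => by
    have h1 : Measurable fun q : (E × ℝ) × ℝ => (gk s q.2 : ℂ) * g (q.1.1, q.1.2 - q.2) := by
      refine (measurable_ofReal.comp ((gk_meas s).comp measurable_snd)).mul (hg.comp ?_)
      exact (measurable_fst.comp measurable_fst).prodMk
        ((measurable_snd.comp measurable_fst).sub measurable_snd)
    exact (h1.stronglyMeasurable.integral_prod_right (ν := (volume : Measure ℝ))).measurable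
  exact (h _).sub (h _)

theorem AKt_int (k : ℤ) (g : E × ℝ → ℂ) (hg : Nice g) : Integrable (AKt k g) := by
  refine ⟨(AKt_meas k g hg.1).aestronglyMeasurable, ?_⟩
  rw [hasFiniteIntegral_iff_enorm, Measure.volume_eq_prod,
    lintegral_prod _ (AKt_meas k g hg.1).enorm.aemeasurable]
  calc _ ≤ ∫⁻ x, 2 * ∫⁻ s, ‖g (x, s)‖ₑ := lintegral_mono fun x =>
        AK_l1 k (fun s => g (x, s)) (hg.slice' x).1
    _ = 2 * ∫⁻ z : E × ℝ, ‖g z‖ₑ := by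
        rw [lintegral_const_mul' _ _ (by norm_num), Measure.volume_eq_prod,
          lintegral_prod _ hg.1.enorm.aemeasurable]
    _ < ⊤ := mul_lt_top (by norm_num)
        (hasFiniteIntegral_iff_enorm.1 (hg.intOn (volume : Measure (E × ℝ))).2)

theorem PC_sup (s : ℝ) (hs : 0 < s) (g : E → ℂ) (B : ℝ) (hB : ∀ x, ‖g x‖ ≤ B) (x : E) : ‖PC s g x‖ ≤ B := by
  unfold PC
  have hi : Integrable fun y : E => gk s y * B := (gk_int s hs).mul_const B
  refine (norm_integral_le_of_norm_le hi (of_forall fun y => ?_)).trans (le_of_eq ?_)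
  · rw [norm_mul, norm_real, Real.norm_of_nonneg (gk_nonneg s hs y)]
    exact mul_le_mul_of_nonneg_left (hB _) (gk_nonneg s hs y)
  · rw [integral_mul_const, gk_integral s hs, one_mul]

theorem AKt_slice (k : ℤ) (g : E × ℝ → ℂ) (hg : Nice g) (t : ℝ) : Nice fun x => AKt k g (x, t) := by
  obtain ⟨hm, ⟨B, hB⟩, R, hR⟩ := hg
  refine ⟨(AKt_meas k g hm).comp (measurable_id.prodMk measurable_const), ⟨B + B, fun x => ?_⟩, R, fun x hx => ?_⟩
  · exact (norm_sub_le _ _).trans (add_le_add (PC_sup _ (by positivity) _ B (fun _ => hB _) _) (PC_sup _ (by positivity) _ B (fun _ => hB _) _))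
  · have : ∀ t, g (x, t) = 0 := by
      intro t; apply hR; exact lt_of_lt_of_le hx (norm_fst_le (x, t))
    simp [AKt, this, AK, PC]

theorem AKt_Gd (k : ℤ) (g : E × ℝ → ℂ) (hg : Nice g) : Gd (AKt k g) :=
  ⟨AKt_meas k g hg.1, AKt_int k g hg, fun t => (AKt_slice k g hg t).intOn _⟩

theorem am_eq' (e : ℝ) (g : E × ℝ → ℂ) (hi : Integrable g) (ξ : E) :
    am e g ξ = ∫ x : E, ph x ξ * ft (fun s : ℝ => g (x, s)) (e * ‖ξ‖ / (2 * Real.pi) : ℝ) := by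
  unfold am amp
  have hi2 : Integrable (fun z : E × ℝ => g z * pw z.1 (e * z.2) ξ) := by
    refine hi.mul_bdd (c := 1) ?_ (of_forall fun z => (norm_pw _ _ _).le)
    exact (meas_pw measurable_fst (measurable_const.mul measurable_snd) measurable_const).aestronglyMeasurable
  rw [Measure.volume_eq_prod] at hi2 ⊢
  rw [integral_prod _ hi2]
  refine integral_congr_ae (of_forall fun x => ?_)
  simp only [ft]
  rw [← integral_const_mul]
  refine integral_congr_ae (of_forall fun s => ?_)
  simp only [pw, ph]
  rw [mul_left_comm, ← Complex.exp_add]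
  congr 2
  have : (inner ℝ s (e * ‖ξ‖ / (2 * Real.pi)) : ℝ) = s * (e * ‖ξ‖ / (2 * Real.pi)) := by
    simp [mul_comm]
  rw [this, show 2 * Real.pi * (s * (e * ‖ξ‖ / (2 * Real.pi))) = e * s * ‖ξ‖ by field_simp]
  push_cast; ring

theorem am_AKt (e : ℝ) (k : ℤ) (g : E × ℝ → ℂ) (hg : Nice g) (ξ : E) :
    am e (AKt k g) ξ = (mlt k (e * ‖ξ‖ / (2 * Real.pi) : ℝ) : ℂ) * am e g ξ := by
  rw [am_eq' e _ (AKt_int k g hg), am_eq' e _ (hg.intOn _), ← integral_const_mul]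
  refine integral_congr_ae (of_forall fun x => ?_)
  have := AK_ft k (fun s => g (x, s)) (hg.slice' x).1 ((hg.slice' x).intOn _) (e * ‖ξ‖ / (2 * Real.pi))
  simp only [AKt]
  rw [show (fun s => AK k (fun t => g (x, t)) s) = AK k (fun t => g (x, t)) from rfl, this]
  ring

theorem am_sum_t (e : ℝ) (he : |e| = 1) (hn : 0 < dimR E) (g : E × ℝ → ℂ) (hg : Nice g) :
    ofR (cm * (2 * Real.pi)) * ∫⁻ ξ : E, ofR (‖ξ‖ ^ (-1 : ℝ)) * ‖am e g ξ‖ₑ ^ 2 ≤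
      ∑' k : ℤ, ofR ((2 : ℝ) ^ k) * Qf e (2 ^ k / (2 * Real.pi)) (AKt k g) := by
  have : Nontrivial E := Module.finrank_pos_iff.1 hn
  simp_rw [Qf, ← lintegral_const_mul' _ _ ofReal_ne_top]
  rw [← lintegral_tsum]
  · refine lintegral_mono_ae ?_
    have : ∀ᵐ ξ : E, ξ ≠ 0 := by
      rw [ae_iff]; simp
    filter_upwards [this] with ξ hξ
    have hx : 0 < ‖ξ‖ := norm_pos_iff.2 hξ
    have he0 : e ≠ 0 := by intro h; rw [h] at he; simp at he
    have hη : (e * ‖ξ‖ / (2 * Real.pi) : ℝ) ≠ 0 := by have := Real.pi_pos; positivity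
    obtain ⟨k, hk⟩ := freq_dec 1 (by norm_num) _ hη
    have hno : ‖(e * ‖ξ‖ / (2 * Real.pi) : ℝ)‖ = ‖ξ‖ / (2 * Real.pi) := by
      rw [Real.norm_eq_abs, abs_div, abs_mul, he, one_mul, abs_of_pos hx, abs_of_pos (by have := Real.pi_pos; positivity)]
    rw [hno, Real.rpow_one] at hk
    refine le_trans ?_ (ENNReal.le_tsum k)
    rw [am_AKt e k g hg, enorm_mul, mul_pow]
    simp only [← mul_assoc]
    refine mul_le_mul' ?_ le_rfl
    rw [← ENNReal.ofReal_mul (by have := cm_pos; positivity), ← ENNReal.ofReal_mul (by positivity), ← ofReal_norm, norm_real,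
      ← ENNReal.ofReal_pow (norm_nonneg _), ← ENNReal.ofReal_mul (by positivity)]
    refine ofReal_le_ofReal ?_
    rw [Real.norm_eq_abs, sq_abs]
    refine le_trans (le_of_eq ?_) (hk.trans (le_of_eq ?_))
    · rw [Real.rpow_neg_one, Real.rpow_neg_one]; have := Real.pi_pos; field_simp
    · congr 3; ring
  · intro k
    exact ((by fun_prop : Measurable fun ξ : E => ofR (2 ^ k) * ofR (Real.exp (-(2 ^ k / (2 * Real.pi)) * ‖ξ‖))).mul
      ((am_meas e _ (AKt_meas k g hg.1)).enorm.pow_const 2)).aemeasurable.congr (of_forall fun ξ => mul_assoc _ _ _)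

theorem AKt_smul (k : ℤ) (v : E → ℝ) (K : E × ℝ → ℂ) (z : E × ℝ) :
    AKt k (fun z => (v z.1 : ℂ) * K z) z = (v z.1 : ℂ) * AKt k K z := by
  simp only [AKt, AK, PC]
  rw [mul_sub, ← integral_const_mul, ← integral_const_mul]
  congr 1 <;>
  · refine integral_congr_ae (of_forall fun x => ?_)
    simp only; ring

theorem cn_smul (v : E → ℝ) (hv : ∀ x, 0 ≤ v x) (K : E × ℝ → ℂ) (x : E) :
    cn (fun z => (v z.1 : ℂ) * K z) x = ofR (v x) * cn K x := by
  unfold cn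
  have : ∀ t, ‖(v x : ℂ) * K (x, t)‖ₑ ^ 2 = ofR (v x) ^ 2 * ‖K (x, t)‖ₑ ^ 2 := fun t => by
    rw [enorm_mul, mul_pow, ← ofReal_norm (v x : ℂ), norm_real, Real.norm_of_nonneg (hv x)]
  simp only [this]
  rw [lintegral_const_mul' _ _ (ENNReal.pow_ne_top ofReal_ne_top), mul_rpow_of_nonneg _ _ (by norm_num),
    ← ENNReal.rpow_natCast, ← rpow_mul]
  norm_num

theorem cn_sq (K : E × ℝ → ℂ) (x : E) : cn K x ^ 2 = ∫⁻ t, ‖K (x, t)‖ₑ ^ 2 := by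
  unfold cn; rw [ennreal_sqrt_sq]

theorem cn_cot (K : E × ℝ → ℂ) (hK : Nice K) (x : E) : ∑' k : ℤ, cn (AKt k K) x ^ 2 ≤ CC ℝ 2 * cn K x ^ 2 := by
  simp only [cn_sq]
  obtain ⟨hm, ⟨B, hB⟩, -⟩ := hK.slice' x
  have := cot 2 (by norm_num) le_rfl _ hm B hB
  have e1 : ∀ a : ℝ≥0∞, a ^ ((2 : ℝ) / 2) = a := fun a => by norm_num
  have e2 : ∀ a : ℝ≥0∞, a ^ (2 : ℝ) = a ^ 2 := fun a => by norm_cast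
  simp only [e1, e2] at this
  exact this

theorem Nice.wmul {K : E × ℝ → ℂ} (hK : Nice K) (v : E → ℝ) (hv : Measurable v) (M : ℝ) (hM : ∀ x, |v x| ≤ M) :
    Nice fun z => (v z.1 : ℂ) * K z := by
  obtain ⟨hm, ⟨B, hB⟩, R, hR⟩ := hK
  refine ⟨(measurable_ofReal.comp (hv.comp measurable_fst)).mul hm, ⟨M * B, fun z => ?_⟩, R, fun z hz => by simp [hR z hz]⟩
  rw [norm_mul, norm_real, Real.norm_eq_abs]
  exact mul_le_mul (hM _) (hB _) (norm_nonneg _) ((abs_nonneg _).trans (hM z.1))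

/-- weighted dual constant -/
def CD (E : Type*) [NormedAddCommGroup E] [InnerProductSpace ℝ E] [FiniteDimensional ℝ E]
  [MeasurableSpace E] [BorelSpace E] (p : ℝ) : ℝ≥0∞ := ofR cm⁻¹ * (CW E p * CC ℝ 2)

theorem CD_ne_top (hn : 3 ≤ dimR E) (p : ℝ) (hp : ((dimR E : ℝ) - 1) / 2 < p) : CD E p ≠ ⊤ :=
  mul_ne_top ofReal_ne_top (mul_ne_top (CW_ne_top hn p hp) (CC_ne_top 2 (by norm_num) le_rfl))

theorem dual_wt (e : ℝ) (he : |e| = 1) (hn : 3 ≤ dimR E) (p : ℝ) (hp : 1 < p)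
    (N : ℝ≥0∞) (hN : N ≠ ⊤) (v : E → ℝ) (hv : Measurable v) (hv0 : ∀ x, 0 ≤ v x) (M : ℝ) (hM : ∀ x, |v x| ≤ M)
    (h : FP p N fun x => ofR (v x)) (K : E × ℝ → ℂ) (hK : Nice K) :
    ∫⁻ ξ : E, ofR (‖ξ‖ ^ (-1 : ℝ)) * ‖am e (fun z => (v z.1 : ℂ) * K z) ξ‖ₑ ^ 2 ≤
      CD E p * N * ∫⁻ x, ofR (v x) * cn K x ^ 2 := by
  have hg := hK.wmul v hv M hM
  have hpi := Real.pi_pos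
  have h1 := am_sum_t e he (by omega) _ hg
  have hk : ∀ k : ℤ, ofR ((2 : ℝ) ^ k) * Qf e (2 ^ k / (2 * Real.pi)) (AKt k fun z => (v z.1 : ℂ) * K z) ≤
      CW E p * N * ofR (2 * Real.pi) * ∫⁻ x, ofR (v x) * cn (AKt k K) x ^ 2 := fun k => by
    have h2 := Qf_wt e (2 ^ k / (2 * Real.pi)) he (by positivity) hn p hp N hN (fun x => ofR (v x)) (cn (AKt k K))
      hv.ennreal_ofReal (fun x => ofReal_ne_top) (cn_meas _ (AKt_meas k K hK.1)) h (AKt k fun z => (v z.1 : ℂ) * K z)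
      (AKt_Gd k _ hg) (fun x => by
        rw [← cn_smul v hv0]; congr 1; funext z; exact AKt_smul k v K z)
    refine (mul_le_mul' le_rfl h2).trans (le_of_eq ?_)
    have e1 : ofR ((2 : ℝ) ^ k) * ofR (2 ^ k / (2 * Real.pi))⁻¹ = ofR (2 * Real.pi) := by
      rw [← ENNReal.ofReal_mul (by positivity)]; congr 1; field_simp
    rw [← e1]; ring
  have h3 := h1.trans (ENNReal.tsum_le_tsum hk)
  have hmk : ∀ k : ℤ, AEMeasurable (fun x => ofR (v x) * cn (AKt k K) x ^ 2) volume := fun k =>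
    (hv.ennreal_ofReal.mul ((cn_meas _ (AKt_meas k K hK.1)).pow_const 2)).aemeasurable
  rw [ENNReal.tsum_mul_left, ← lintegral_tsum hmk] at h3
  have h4 : ∫⁻ x, ∑' k : ℤ, ofR (v x) * cn (AKt k K) x ^ 2 ≤ CC ℝ 2 * ∫⁻ x, ofR (v x) * cn K x ^ 2 := by
    rw [← lintegral_const_mul' _ _ (CC_ne_top 2 (by norm_num) le_rfl)]
    refine lintegral_mono fun x => ?_
    simp only
    rw [ENNReal.tsum_mul_left, mul_left_comm]
    exact mul_le_mul' le_rfl (cn_cot K hK x)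
  have h5 := h3.trans (mul_le_mul' le_rfl h4)
  have hc : ofR (cm⁻¹ * (2 * Real.pi)⁻¹) * ofR (cm * (2 * Real.pi)) = 1 := by
    have := cm_pos
    rw [← ENNReal.ofReal_mul (by positivity), ← ENNReal.ofReal_one]; congr 1; field_simp
  have hc2 : ofR (cm⁻¹ * (2 * Real.pi)⁻¹) * ofR (2 * Real.pi) = ofR cm⁻¹ := by
    have := cm_pos
    rw [← ENNReal.ofReal_mul (by positivity)]; congr 1; field_simp
  calc _ = ofR (cm⁻¹ * (2 * Real.pi)⁻¹) * (ofR (cm * (2 * Real.pi)) *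
        ∫⁻ ξ : E, ofR (‖ξ‖ ^ (-1 : ℝ)) * ‖am e (fun z => (v z.1 : ℂ) * K z) ξ‖ₑ ^ 2) := by
        rw [← mul_assoc, hc, one_mul]
    _ ≤ _ := mul_le_mul' le_rfl h5
    _ = _ := by rw [CD, ← hc2]; ring
end SD
section SE

/-- wave extension -/
def ex (e : ℝ) (c : E → ℂ) (z : E × ℝ) : ℂ := ∫ ξ, c ξ * (starRingEnd ℂ) (pw z.1 (e * z.2) ξ)

theorem ex_meas (e : ℝ) (c : E → ℂ) (hc : Measurable c) : Measurable (ex e c) := by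
  have h1 : Measurable fun q : (E × ℝ) × E => c q.2 * (starRingEnd ℂ) (pw q.1.1 (e * q.1.2) q.2) := by
    refine (hc.comp measurable_snd).mul (Complex.continuous_conj.measurable.comp (meas_pw ?_ ?_ ?_)) <;> fun_prop
  exact (h1.stronglyMeasurable.integral_prod_right (ν := (volume : Measure E))).measurable

theorem ex_le (e : ℝ) (c : E → ℂ) (z : E × ℝ) : ‖ex e c z‖ ≤ ∫ ξ, ‖c ξ‖ := by
  refine (norm_integral_le_integral_norm _).trans (le_of_eq ?_)
  refine integral_congr_ae (of_forall fun ξ => ?_)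
  simp only [norm_mul, RCLike.norm_conj, norm_pw, mul_one]

theorem hom_ball (e : ℝ) (he : |e| = 1) (hn : 3 ≤ dimR E) (p : ℝ) (hp : 1 < p)
    (N : ℝ≥0∞) (hN : N ≠ ⊤) (v : E → ℝ) (hv : Measurable v) (hv0 : ∀ x, 0 ≤ v x) (M : ℝ) (hM : ∀ x, |v x| ≤ M)
    (h : FP p N fun x => ofR (v x)) (c : E → ℂ) (hc : Measurable c) (hci : Integrable c) (R : ℝ) :
    ∫⁻ z in ball (0 : E × ℝ) R, ofR (v z.1) * ‖ex e c z‖ₑ ^ 2 ≤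
      CD E p * N * ∫⁻ ξ, ofR ‖ξ‖ * ‖c ξ‖ₑ ^ 2 := by
  have hn0 : 0 < dimR E := by omega
  have : Nontrivial E := Module.finrank_pos_iff.1 hn0
  set u := ex e c with hu
  have hum := ex_meas e c hc
  set K : E × ℝ → ℂ := (ball (0 : E × ℝ) R).indicator u with hK
  have hKn : Nice K := by
    refine ⟨hum.indicator measurableSet_ball, ⟨∫ ξ, ‖c ξ‖, fun z => ?_⟩, R, fun z hz => ?_⟩
    · by_cases hz : z ∈ ball (0 : E × ℝ) R
      · rw [hK, Set.indicator_of_mem hz]; exact ex_le e c z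
      · rw [hK, Set.indicator_of_notMem hz, norm_zero]; exact integral_nonneg fun _ => norm_nonneg _
    · rw [hK, Set.indicator_of_notMem]; simpa using hz.le
  have hJ := hKn.wmul v hv M hM
  set J : E × ℝ → ℂ := fun z => (v z.1 : ℂ) * K z with hJd
  have hJi : Integrable J := hJ.intOn _
  set I := ∫⁻ z in ball (0 : E × ℝ) R, ofR (v z.1) * ‖u z‖ₑ ^ 2 with hI
  have hd := dual_wt e he hn p hp N hN v hv hv0 M hM h K hKn
  -- the right side is `I`
  have hpt : ∀ z, ofR (v z.1) * ‖K z‖ₑ ^ 2 = (ball (0 : E × ℝ) R).indicator (fun z => ofR (v z.1) * ‖u z‖ₑ ^ 2) z := fun z => by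
    by_cases hz : z ∈ ball (0 : E × ℝ) R
    · rw [hK, Set.indicator_of_mem hz, Set.indicator_of_mem hz]
    · rw [hK, Set.indicator_of_notMem hz, Set.indicator_of_notMem hz]; simp
  have hmeas : AEMeasurable (fun z : E × ℝ => ofR (v z.1) * ‖K z‖ₑ ^ 2) (volume.prod volume) :=
    ((hv.comp measurable_fst).ennreal_ofReal.mul (hKn.1.enorm.pow_const 2)).aemeasurable
  have hI2 : ∫⁻ x, ofR (v x) * cn K x ^ 2 = I := by
    rw [hI, ← lintegral_indicator measurableSet_ball, ← lintegral_congr hpt, Measure.volume_eq_prod,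
      lintegral_prod _ hmeas]
    refine lintegral_congr fun x => ?_
    simp only [Pi.mul_apply, Function.comp]
    rw [lintegral_const_mul' _ _ ofReal_ne_top, cn_sq]
  rw [hI2] at hd
  -- duality identity
  have hmm : Measurable fun q : E × (E × ℝ) => c q.1 * (starRingEnd ℂ) (J q.2 * pw q.2.1 (e * q.2.2) q.1) := by
    refine (hc.comp measurable_fst).mul (Complex.continuous_conj.measurable.comp ((hJ.1.comp measurable_snd).mul (meas_pw ?_ ?_ ?_))) <;> fun_prop
  have hIntg : Integrable (fun q : E × (E × ℝ) => c q.1 * (starRingEnd ℂ) (J q.2 * pw q.2.1 (e * q.2.2) q.1)) (volume.prod volume) := by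
    refine (hci.norm.mul_prod hJi.norm).mono' hmm.aestronglyMeasurable (of_forall fun q => ?_)
    simp only [norm_mul, RCLike.norm_conj, norm_pw, mul_one, le_refl]
  have hdual : ∫ ξ, c ξ * (starRingEnd ℂ) (am e J ξ) = ∫ z, (starRingEnd ℂ) (J z) * u z := by
    have hsw := integral_integral_swap (f := fun ξ (z : E × ℝ) => c ξ * (starRingEnd ℂ) (J z * pw z.1 (e * z.2) ξ)) hIntg
    have e1 : ∀ ξ, c ξ * (starRingEnd ℂ) (am e J ξ) = ∫ z : E × ℝ, c ξ * (starRingEnd ℂ) (J z * pw z.1 (e * z.2) ξ) := fun ξ => by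
      rw [integral_const_mul, integral_conj]; rfl
    have e2 : ∀ z : E × ℝ, (starRingEnd ℂ) (J z) * u z = ∫ ξ : E, c ξ * (starRingEnd ℂ) (J z * pw z.1 (e * z.2) ξ) := fun z => by
      rw [hu, ex, ← integral_const_mul]
      refine integral_congr_ae (of_forall fun ξ => ?_)
      simp only [map_mul]; ring
    simp_rw [e1, e2]
    exact hsw
  have hre : ∀ z, (starRingEnd ℂ) (J z) * u z = ((((ball (0 : E × ℝ) R).indicator (fun z => v z.1 * ‖u z‖ ^ 2) z : ℝ)) : ℂ) := fun z => by
    by_cases hz : z ∈ ball (0 : E × ℝ) R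
    · rw [hJd, hK]
      simp only
      rw [Set.indicator_of_mem hz, Set.indicator_of_mem hz, map_mul, conj_ofReal, mul_assoc, conj_mul']
      push_cast; ring
    · rw [hJd, hK]; simp only; rw [Set.indicator_of_notMem hz, Set.indicator_of_notMem hz]; simp
  have h0 : ∀ z, 0 ≤ (ball (0 : E × ℝ) R).indicator (fun z => v z.1 * ‖u z‖ ^ 2) z := fun z =>
    Set.indicator_nonneg (fun z _ => mul_nonneg (hv0 _) (by positivity)) z
  have hmr : Measurable ((ball (0 : E × ℝ) R).indicator (fun z => v z.1 * ‖u z‖ ^ 2)) :=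
    ((hv.comp measurable_fst).mul (hum.norm.pow_const 2)).indicator measurableSet_ball
  have hirr : Integrable ((ball (0 : E × ℝ) R).indicator (fun z => v z.1 * ‖u z‖ ^ 2)) := by
    have : Integrable fun z => (starRingEnd ℂ) (J z) * u z := by
      refine Integrable.mul_bdd (c := ∫ ξ, ‖c ξ‖) ?_ hum.aestronglyMeasurable (of_forall fun z => ex_le e c z)
      exact Complex.conjLIE.toContinuousLinearEquiv.integrable_comp_iff.2 hJi
    simp_rw [hre] at this
    exact (by simpa using this.re)
  have hIeq : I = ‖∫ ξ, c ξ * (starRingEnd ℂ) (am e J ξ)‖ₑ := by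
    rw [hdual]
    simp_rw [hre]
    rw [integral_complex_ofReal, ← ofReal_norm, norm_real, Real.norm_of_nonneg (integral_nonneg h0),
      ofReal_integral_eq_lintegral_ofReal hirr (of_forall h0), hI, ← lintegral_indicator measurableSet_ball]
    refine lintegral_congr fun z => ?_
    by_cases hz : z ∈ ball (0 : E × ℝ) R
    · rw [Set.indicator_of_mem hz, Set.indicator_of_mem hz, ENNReal.ofReal_mul (hv0 _), ENNReal.ofReal_pow (norm_nonneg _), ofReal_norm]
    · rw [Set.indicator_of_notMem hz, Set.indicator_of_notMem hz, ENNReal.ofReal_zero]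
  have hIt : I ≠ ⊤ := by rw [hIeq]; exact enorm_ne_top
  have hI3 : I ≤ (∫⁻ ξ, ofR ‖ξ‖ * ‖c ξ‖ₑ ^ 2) ^ (1 / 2 : ℝ) * (CD E p * N * I) ^ (1 / 2 : ℝ) := by
    conv_lhs => rw [hIeq]
    refine (enorm_integral_le_lintegral_enorm _).trans ?_
    have hl := lcs volume (fun ξ : E => ofR ‖ξ‖ ^ (1 / 2 : ℝ) * ‖c ξ‖ₑ) (fun ξ => ofR (‖ξ‖ ^ (-1 : ℝ)) ^ (1 / 2 : ℝ) * ‖am e J ξ‖ₑ)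
      (((by fun_prop : Measurable fun ξ : E => ofR ‖ξ‖ ^ (1 / 2 : ℝ))).mul hc.enorm).aemeasurable
      (((by fun_prop : Measurable fun ξ : E => ofR (‖ξ‖ ^ (-1 : ℝ)) ^ (1 / 2 : ℝ))).mul (am_meas e J hJ.1).enorm).aemeasurable
    simp only [mul_pow, ennreal_sqrt_sq] at hl
    refine le_trans ?_ (hl.trans (mul_le_mul' le_rfl (rpow_le_rpow hd (by norm_num))))
    refine lintegral_mono_ae ?_
    have : ∀ᵐ ξ : E, ξ ≠ 0 := by
      rw [ae_iff]; simp
    filter_upwards [this] with ξ hξ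
    have hx : 0 < ‖ξ‖ := norm_pos_iff.2 hξ
    have e1 : ofR ‖ξ‖ ^ (1 / 2 : ℝ) * ofR (‖ξ‖ ^ (-1 : ℝ)) ^ (1 / 2 : ℝ) = 1 := by
      rw [← mul_rpow_of_nonneg _ _ (by norm_num), ← ENNReal.ofReal_mul hx.le, Real.rpow_neg_one, mul_inv_cancel₀ hx.ne']
      simp
    rw [enorm_mul, RCLike.enorm_conj]
    apply le_of_eq
    calc _ = (1 : ℝ≥0∞) * (‖c ξ‖ₑ * ‖am e J ξ‖ₑ) := (one_mul _).symm
      _ = _ := by rw [← e1]; ring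
  set X := ∫⁻ ξ, ofR ‖ξ‖ * ‖c ξ‖ₑ ^ 2 with hX
  rw [← mul_rpow_of_nonneg _ _ (by norm_num)] at hI3
  have h4 : I * I ≤ (CD E p * N * X) * I := by
    have := mul_le_mul' hI3 hI3
    rw [ennreal_sqrt_mul_self] at this
    refine this.trans (le_of_eq (by ring))
  by_cases hI0 : I = 0
  · rw [hI0]; exact bot_le
  · exact (ENNReal.mul_le_mul_iff_left hI0 hIt).1 h4

theorem hom_wt (e : ℝ) (he : |e| = 1) (hn : 3 ≤ dimR E) (p : ℝ) (hp : 1 < p)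
    (N : ℝ≥0∞) (hN : N ≠ ⊤) (v : E → ℝ) (hv : Measurable v) (hv0 : ∀ x, 0 ≤ v x) (M : ℝ) (hM : ∀ x, |v x| ≤ M)
    (h : FP p N fun x => ofR (v x)) (c : E → ℂ) (hc : Measurable c) (hci : Integrable c) :
    ∫⁻ z : E × ℝ, ofR (v z.1) * ‖ex e c z‖ₑ ^ 2 ≤
      CD E p * N * ∫⁻ ξ, ofR ‖ξ‖ * ‖c ξ‖ₑ ^ 2 := by
  have hU : ⋃ R : ℕ, ball (0 : E × ℝ) R = Set.univ := iUnion_ball_nat 0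
  rw [← setLIntegral_univ, ← hU, setLIntegral_iUnion_of_directed _ (Monotone.directed_le fun a b hab => ball_subset_ball (by exact_mod_cast hab))]
  exact iSup_le fun R => hom_ball e he hn p hp N hN v hv hv0 M hM h c hc hci R

/-- abstract Christ-Kiselev bisection -/
theorem ck_abs (ψ : ℝ → ℝ) (hψ : Continuous ψ) (hmono : Monotone ψ) (q : ℝ) (hq0 : 0 < q) (hq2 : q < 2)
    (ρ : ℝ → ℝ → ℝ≥0∞) (C : ℝ) (hC : 0 ≤ C) (D : ℝ) (hD : 0 ≤ D)
    (hapr : ∀ α β, α ≤ β → ρ α β ≤ ofR (D * (ψ β - ψ α) ^ (1 / q)))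
    (hsplit : ∀ α μ β, α ≤ μ → μ ≤ β → ρ α β ≤ (ρ α μ ^ 2 + ρ μ β ^ 2) ^ (1 / 2 : ℝ) + ofR (C * (ψ μ - ψ α) ^ (1 / q)))
    (α β : ℝ) (hαβ : α ≤ β) :
    ρ α β ≤ ofR (C / (1 - 2 ^ (1 / 2 - 1 / q : ℝ)) * (ψ β - ψ α) ^ (1 / q)) := by
  set l : ℝ := 2 ^ (1 / 2 - 1 / q : ℝ) with hl
  have hl0 : 0 < l := by positivity
  have hl1 : l < 1 := by
    apply Real.rpow_lt_one_of_one_lt_of_neg (by norm_num)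
    have : 1 / 2 < 1 / q := one_div_lt_one_div_of_lt hq0 hq2
    linarith
  have key : ∀ n : ℕ, ∀ α β, α ≤ β → ρ α β ≤ ofR ((l ^ n * D + C / (1 - l)) * (ψ β - ψ α) ^ (1 / q)) := by
    intro n
    induction n with
    | zero =>
      intro α β h
      refine (hapr α β h).trans (ofReal_le_ofReal ?_)
      refine mul_le_mul_of_nonneg_right ?_ (Real.rpow_nonneg (sub_nonneg.2 (hmono h)) _)
      have : 0 ≤ C / (1 - l) := div_nonneg hC (by linarith)
      simp; linarith
    | succ n ih =>
      intro α β h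
      set Δ := ψ β - ψ α with hΔ
      have hΔ0 : 0 ≤ Δ := sub_nonneg.2 (hmono h)
      obtain ⟨μ, ⟨h1, h2⟩, hμ⟩ := intermediate_value_Icc h hψ.continuousOn (show (ψ α + ψ β) / 2 ∈ Set.Icc (ψ α) (ψ β) by
        have := hmono h; constructor <;> linarith)
      have e1 : ψ μ - ψ α = Δ / 2 := by rw [hμ, hΔ]; ring
      have e2 : ψ β - ψ μ = Δ / 2 := by rw [hμ, hΔ]; ring
      set Dn := l ^ n * D + C / (1 - l) with hDn
      have hDn0 : 0 ≤ Dn := by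
        have : 0 ≤ C / (1 - l) := div_nonneg hC (by linarith)
        positivity
      have i1 := ih α μ h1
      have i2 := ih μ β h2
      rw [e1] at i1
      rw [e2] at i2
      have i3 := hsplit α μ β h1 h2
      rw [e1] at i3
      refine i3.trans ?_
      have h5 : (ρ α μ ^ 2 + ρ μ β ^ 2) ^ (1 / 2 : ℝ) ≤ ofR (l * Dn * Δ ^ (1 / q)) := by
        have : ρ α μ ^ 2 + ρ μ β ^ 2 ≤ ofR ((l * Dn * Δ ^ (1 / q)) ^ 2) := by
          refine (add_le_add (pow_le_pow_left' i1 2) (pow_le_pow_left' i2 2)).trans (le_of_eq ?_)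
          rw [← ENNReal.ofReal_pow (by positivity), ← ENNReal.ofReal_add (by positivity) (by positivity)]
          congr 1
          rw [Real.div_rpow hΔ0 (by norm_num)]
          have e3 : l ^ 2 = 2 * ((2 : ℝ) ^ (1 / q))⁻¹ ^ 2 := by
            rw [hl, Real.rpow_sub (by norm_num), div_pow, ← Real.sqrt_eq_rpow, Real.sq_sqrt (by norm_num)]; ring
          rw [mul_pow (l * Dn), mul_pow l, e3]; ring
        refine (rpow_le_rpow this (by norm_num)).trans (le_of_eq ?_)
        rw [ofReal_rpow_of_nonneg (by positivity) (by norm_num), ← Real.sqrt_eq_rpow, Real.sqrt_sq (by positivity)]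
      refine (add_le_add h5 le_rfl).trans ?_
      rw [← ENNReal.ofReal_add (by positivity) (by positivity)]
      refine ofReal_le_ofReal ?_
      have e4 : l ^ (n + 1) * D + C / (1 - l) = l * Dn + C := by
        rw [hDn]; have : 1 - l ≠ 0 := by linarith
        field_simp; ring
      rw [e4, add_mul]
      refine add_le_add le_rfl (mul_le_mul_of_nonneg_left (Real.rpow_le_rpow (by positivity) (by linarith) (by positivity)) hC)
  have hlim : Filter.Tendsto (fun n : ℕ => ofR ((l ^ n * D + C / (1 - l)) * (ψ β - ψ α) ^ (1 / q))) Filter.atTop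
      (nhds (ofR ((0 * D + C / (1 - l)) * (ψ β - ψ α) ^ (1 / q)))) := by
    refine ENNReal.tendsto_ofReal ((((tendsto_pow_atTop_nhds_zero_of_lt_one hl0.le hl1).mul_const D).add_const _).mul_const _)
  have := ge_of_tendsto' hlim fun n => key n α β hαβ
  simpa using this
end SE
section SE

/-- Minkowski in `L²` -/
theorem mink2 {X : Type*} [MeasurableSpace X] (μ : Measure X) (f g : X → ℝ≥0∞) (hf : AEMeasurable f μ)
    (hg : AEMeasurable g μ) : (∫⁻ x, (f x + g x) ^ 2 ∂μ) ^ (1 / 2 : ℝ) ≤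
      (∫⁻ x, f x ^ 2 ∂μ) ^ (1 / 2 : ℝ) + (∫⁻ x, g x ^ 2 ∂μ) ^ (1 / 2 : ℝ) := by
  have := ENNReal.lintegral_Lp_add_le hf hg (p := 2) (by norm_num)
  simpa only [ENNReal.rpow_two, Pi.add_apply] using this

theorem hold_fin {X : Type*} [MeasurableSpace X] (μ : Measure X) (f : X → ℝ≥0∞) (hf : AEMeasurable f μ) (ρ : ℝ)
    (h1 : 1 ≤ ρ) : ∫⁻ x, f x ∂μ ≤ (∫⁻ x, f x ^ ρ ∂μ) ^ (1 / ρ) * μ Set.univ ^ (1 - 1 / ρ) := by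
  have h0 : 0 < ρ := by linarith
  have h2 : 1 / ρ ≤ 1 := by rw [div_le_one h0]; exact h1
  have := lintegral_mul_norm_pow_le (μ := μ) (hf.pow_const ρ) (aemeasurable_const (b := (1 : ℝ≥0∞)))
    (show 0 ≤ 1 / ρ by positivity) (show 0 ≤ 1 - 1 / ρ by linarith) (by ring)
  simpa only [ENNReal.one_rpow, mul_one, lintegral_one, ← rpow_mul, mul_one_div_cancel h0.ne', ENNReal.rpow_one] using this

/-- time cutoff -/
def cutg (α β : ℝ) (g : E × ℝ → ℂ) : E × ℝ → ℂ := (Prod.snd ⁻¹' Set.Ioc α β).indicator g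

theorem cutg_nice (α β : ℝ) (g : E × ℝ → ℂ) (hg : Nice g) : Nice (cutg α β g) :=
  hg.indicator (measurable_snd measurableSet_Ioc)

theorem cutg_add (α μ β : ℝ) (h1 : α ≤ μ) (h2 : μ ≤ β) (g : E × ℝ → ℂ) (z : E × ℝ) :
    cutg α β g z = cutg α μ g z + cutg μ β g z := by
  unfold cutg
  rw [← Set.Ioc_union_Ioc_eq_Ioc h1 h2, Set.preimage_union, Set.indicator_union_of_disjoint]
  exact Disjoint.preimage _ (Set.Ioc_disjoint_Ioc_of_le le_rfl)

theorem am_int (e : ℝ) (g : E × ℝ → ℂ) (hg : Integrable g) (ξ : E) :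
    Integrable fun z : E × ℝ => g z * pw z.1 (e * z.2) ξ := by
  refine hg.mul_bdd (c := 1) ?_ (of_forall fun z => (norm_pw _ _ _).le)
  exact (meas_pw measurable_fst (measurable_const.mul measurable_snd) measurable_const).aestronglyMeasurable

theorem am_le (e : ℝ) (g : E × ℝ → ℂ) (ξ : E) : ‖am e g ξ‖ₑ ≤ ∫⁻ z, ‖g z‖ₑ := by
  refine (enorm_integral_le_lintegral_enorm _).trans (le_of_eq (lintegral_congr fun z => ?_))
  rw [enorm_mul, ← ofReal_norm (pw _ _ _), norm_pw]; simp

theorem am_cutg_add (e α μ β : ℝ) (h1 : α ≤ μ) (h2 : μ ≤ β) (g : E × ℝ → ℂ) (hg : Nice g) (ξ : E) :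
    am e (cutg α β g) ξ = am e (cutg α μ g) ξ + am e (cutg μ β g) ξ := by
  unfold am amp
  rw [← integral_add (am_int e _ ((cutg_nice α μ g hg).intOn _) ξ) (am_int e _ ((cutg_nice μ β g hg).intOn _) ξ)]
  refine integral_congr_ae (of_forall fun z => ?_)
  simp only [cutg_add α μ β h1 h2 g z]; ring

/-- retarded wave extension -/
def RU (e : ℝ) (m : E → ℂ) (g : E × ℝ → ℂ) (α β : ℝ) (z : E × ℝ) : ℂ :=
  ex e (fun ξ => m ξ * am e (cutg α (min β z.2) g) ξ) z

theorem RU_meas (e : ℝ) (m : E → ℂ) (hm : Measurable m) (g : E × ℝ → ℂ) (hg : Measurable g) (α β : ℝ) :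
    Measurable (RU e m g α β) := by
  have h1 : Measurable fun q : ((E × ℝ) × E) × (E × ℝ) => cutg α (min β q.1.1.2) g q.2 * pw q.2.1 (e * q.2.2) q.1.2 := by
    have hS : MeasurableSet {q : ((E × ℝ) × E) × (E × ℝ) | α < q.2.2 ∧ q.2.2 ≤ min β q.1.1.2} :=
      (measurableSet_lt (f := fun _ => α) (g := fun q : ((E × ℝ) × E) × (E × ℝ) => q.2.2) (by fun_prop) (by fun_prop)).inter
        (measurableSet_le (f := fun q : ((E × ℝ) × E) × (E × ℝ) => q.2.2) (g := fun q => min β q.1.1.2) (by fun_prop) (by fun_prop))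
    have : Measurable fun q : ((E × ℝ) × E) × (E × ℝ) => cutg α (min β q.1.1.2) g q.2 := by
      have e1 : (fun q : ((E × ℝ) × E) × (E × ℝ) => cutg α (min β q.1.1.2) g q.2) =
          {q : ((E × ℝ) × E) × (E × ℝ) | α < q.2.2 ∧ q.2.2 ≤ min β q.1.1.2}.indicator (fun q => g q.2) := by
        ext q; rfl
      rw [e1]
      exact (hg.comp measurable_snd).indicator hS
    refine this.mul (meas_pw ?_ ?_ ?_) <;> fun_prop
  have h2 : Measurable fun q : (E × ℝ) × E => am e (cutg α (min β q.1.2) g) q.2 :=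
    (h1.stronglyMeasurable.integral_prod_right (ν := (volume : Measure (E × ℝ)))).measurable
  have h3 : Measurable fun q : (E × ℝ) × E => (m q.2 * am e (cutg α (min β q.1.2) g) q.2) * (starRingEnd ℂ) (pw q.1.1 (e * q.1.2) q.2) := by
    refine ((hm.comp measurable_snd).mul h2).mul (Complex.continuous_conj.measurable.comp (meas_pw ?_ ?_ ?_)) <;> fun_prop
  exact (h3.stronglyMeasurable.integral_prod_right (ν := (volume : Measure E))).measurable

theorem mam_int (e : ℝ) (m : E → ℂ) (hmi : Integrable m) (g : E × ℝ → ℂ) (hg : Nice g) :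
    Integrable fun ξ => m ξ * am e g ξ := by
  refine hmi.mul_bdd (c := ∫ z, ‖g z‖) (am_meas e g hg.1).aestronglyMeasurable (of_forall fun ξ => ?_)
  exact norm_amp_le _ _ _ _ _

theorem ex_int (e : ℝ) (c : E → ℂ) (hc : Integrable c) (z : E × ℝ) :
    Integrable fun ξ => c ξ * (starRingEnd ℂ) (pw z.1 (e * z.2) ξ) := by
  refine hc.mul_bdd (c := 1) ?_ (of_forall fun ξ => by rw [RCLike.norm_conj, norm_pw])
  refine (Complex.continuous_conj.measurable.comp (meas_pw ?_ ?_ ?_)).aestronglyMeasurable <;> fun_prop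

theorem ex_enorm_le (e : ℝ) (m : E → ℂ) (hm : Measurable m) (g : E × ℝ → ℂ) (z : E × ℝ) :
    ‖ex e (fun ξ => m ξ * am e g ξ) z‖ₑ ≤ (∫⁻ ξ, ‖m ξ‖ₑ) * ∫⁻ z, ‖g z‖ₑ := by
  refine (enorm_integral_le_lintegral_enorm _).trans ?_
  refine (lintegral_mono fun ξ => ?_ : _ ≤ ∫⁻ ξ, (∫⁻ z, ‖g z‖ₑ) * ‖m ξ‖ₑ).trans ?_
  · rw [enorm_mul, enorm_mul, RCLike.enorm_conj, ← ofReal_norm (pw _ _ _), norm_pw, ENNReal.ofReal_one, mul_one, mul_comm]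
    exact mul_le_mul' (am_le _ _ _) le_rfl
  · rw [lintegral_const_mul _ hm.enorm, mul_comm]
end SE
section SE

theorem sl_cutg (ρ : ℝ) (hρ : 0 < ρ) (g : E × ℝ → ℂ) (α β s : ℝ) :
    sl ρ (cutg α β g) s = (Set.Ioc α β).indicator (sl ρ g) s := by
  unfold sl cutg
  by_cases h : s ∈ Set.Ioc α β
  · rw [Set.indicator_of_mem h]
    congr 1
    refine lintegral_congr fun x => ?_
    rw [Set.indicator_of_mem (by exact h)]
  · rw [Set.indicator_of_notMem h]
    have : ∀ x : E, ‖(Prod.snd ⁻¹' Set.Ioc α β).indicator g (x, s)‖ₑ ^ ρ = 0 := fun x => by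
      rw [Set.indicator_of_notMem (by exact h)]; simp [hρ]
    simp only [this, lintegral_zero]
    rw [zero_rpow_of_pos (by positivity)]

theorem sl_supp (ρ : ℝ) (hρ : 0 < ρ) (g : E × ℝ → ℂ) (R : ℝ) (hR : ∀ z, R < ‖z‖ → g z = 0) (s : ℝ) (hs : R < |s|) :
    sl ρ g s = 0 := by
  unfold sl
  have : ∀ x : E, ‖g (x, s)‖ₑ ^ ρ = 0 := fun x => by
    rw [hR _ (hs.trans_le (le_max_right _ _))]; simp [hρ]
  simp only [this, lintegral_zero]
  rw [zero_rpow_of_pos (by positivity)]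

theorem lint_supp {X : Type*} [MeasurableSpace X] (μ : Measure X) (f : X → ℝ≥0∞) (S : Set X) (h : ∀ x, x ∉ S → f x = 0) :
    ∫⁻ x, f x ∂μ = ∫⁻ x in S, f x ∂μ := by
  refine (setLIntegral_eq_of_support_subset fun x hx => ?_).symm
  by_contra hc
  exact hx (h x hc)

theorem nice_l1 (ρ q : ℝ) (hρ : 1 ≤ ρ) (hq : 1 ≤ q) (R : ℝ) : ∃ K : ℝ≥0∞, K ≠ ⊤ ∧ ∀ g : E × ℝ → ℂ, Measurable g →
    (∀ z, R < ‖z‖ → g z = 0) → ∫⁻ z, ‖g z‖ₑ ≤ K * (∫⁻ s, sl ρ g s ^ q) ^ (1 / q) := by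
  have hρ0 : 0 < ρ := by linarith
  have hq0 : 0 < q := by linarith
  have a1 : 1 / ρ ≤ 1 := by rw [div_le_one hρ0]; exact hρ
  have a2 : 1 / q ≤ 1 := by rw [div_le_one hq0]; exact hq
  refine ⟨volume (closedBall (0 : E) R) ^ (1 - 1 / ρ) * volume (closedBall (0 : ℝ) R) ^ (1 - 1 / q),
    mul_ne_top (rpow_ne_top_of_nonneg (by linarith) measure_closedBall_lt_top.ne)
      (rpow_ne_top_of_nonneg (by linarith) measure_closedBall_lt_top.ne), fun g hg hR => ?_⟩
  have hm : AEMeasurable (fun z : E × ℝ => ‖g z‖ₑ) (volume.prod volume) := hg.enorm.aemeasurable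
  rw [Measure.volume_eq_prod, lintegral_prod_symm _ hm]
  have h1 : ∀ s : ℝ, ∫⁻ x : E, ‖g (x, s)‖ₑ ≤ volume (closedBall (0 : E) R) ^ (1 - 1 / ρ) * sl ρ g s := fun s => by
    rw [lint_supp _ _ (closedBall (0 : E) R)]
    · refine (hold_fin _ _ ?_ ρ hρ).trans ?_
      · exact (hg.comp (measurable_id.prodMk measurable_const)).enorm.aemeasurable
      · rw [Measure.restrict_apply_univ, mul_comm]
        exact mul_le_mul' le_rfl (rpow_le_rpow (setLIntegral_le_lintegral _ _) (by positivity))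
    · intro x hx
      rw [hR _ (lt_of_lt_of_le (by simpa using hx) (le_max_left _ _)), enorm_zero]
  refine (lintegral_mono h1).trans ?_
  rw [lintegral_const_mul' _ _ (rpow_ne_top_of_nonneg (by linarith) measure_closedBall_lt_top.ne), mul_assoc]
  refine mul_le_mul' le_rfl ?_
  rw [lint_supp _ _ (closedBall (0 : ℝ) R)]
  · refine (hold_fin _ _ (sl_meas ρ g hg).aemeasurable q hq).trans ?_
    rw [Measure.restrict_apply_univ, mul_comm]
    exact mul_le_mul' le_rfl (rpow_le_rpow (setLIntegral_le_lintegral _ _) (by positivity))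
  · intro s hs
    exact sl_supp ρ hρ0 g R hR s (by simpa using hs)

theorem sl_bd (ρ : ℝ) (hρ : 0 < ρ) (g : E × ℝ → ℂ) (hg : Nice g) : ∃ K : ℝ≥0∞, K ≠ ⊤ ∧ ∀ s, sl ρ g s ≤ K := by
  obtain ⟨hm, ⟨B, hB⟩, R, hR⟩ := hg
  refine ⟨(ofR B ^ ρ * volume (closedBall (0 : E) R)) ^ (1 / ρ), rpow_ne_top_of_nonneg (by positivity)
    (mul_ne_top (rpow_ne_top_of_nonneg hρ.le ofReal_ne_top) measure_closedBall_lt_top.ne), fun s => ?_⟩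
  refine rpow_le_rpow ?_ (by positivity)
  rw [lint_supp _ _ (closedBall (0 : E) R)]
  · refine (lintegral_mono fun x => ?_ : _ ≤ ∫⁻ x in closedBall (0 : E) R, ofR B ^ ρ).trans (le_of_eq (by rw [setLIntegral_const]))
    refine rpow_le_rpow ?_ hρ.le
    rw [← ofReal_norm]; exact ofReal_le_ofReal (hB _)
  · intro x hx
    rw [hR _ (lt_of_lt_of_le (by simpa using hx) (le_max_left _ _)), enorm_zero, zero_rpow_of_pos hρ]

/-- Christ-Kiselev for a finite measure -/
theorem ck_gen (μ : Measure (E × ℝ)) [IsFiniteMeasure μ] (e : ℝ) (m : E → ℂ) (hm : Measurable m) (hmi : Integrable m)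
    (ρ l : ℝ) (hρ : 1 ≤ ρ) (hl0 : 0 < l) (hl1 : l < 1) (A : ℝ) (hA : 0 ≤ A)
    (hom : ∀ g : E × ℝ → ℂ, Nice g → (∫⁻ z, ‖ex e (fun ξ => m ξ * am e g ξ) z‖ₑ ^ 2 ∂μ) ^ (1 / 2 : ℝ) ≤
      ofR A * (∫⁻ s, sl ρ g s ^ (2 / (2 - l))) ^ ((2 - l) / 2)) (g : E × ℝ → ℂ) (hg : Nice g) (α β : ℝ) (hαβ : α ≤ β) :
    (∫⁻ z, ‖RU e m g α β z‖ₑ ^ 2 ∂μ) ^ (1 / 2 : ℝ) ≤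
      ofR (A / (1 - 2 ^ (1 / 2 - (2 - l) / 2 : ℝ))) * (∫⁻ s, sl ρ g s ^ (2 / (2 - l))) ^ ((2 - l) / 2) := by
  set q : ℝ := 2 / (2 - l) with hq
  have hq1 : 1 ≤ q := by rw [hq, le_div_iff₀ (by linarith)]; linarith
  have hq2 : q < 2 := by rw [hq, div_lt_iff₀ (by linarith)]; linarith
  have hq0 : 0 < q := by linarith
  have hqi : (2 - l) / 2 = 1 / q := by rw [hq, one_div_div]
  simp only [hqi] at hom ⊢
  have hρ0 : 0 < ρ := by linarith
  obtain ⟨K, hK, hsb⟩ := sl_bd ρ hρ0 g hg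
  obtain ⟨hgm, ⟨B, hB⟩, R, hR⟩ := id hg
  have hslm := sl_meas ρ g hgm
  have hfin : ∫⁻ s, sl ρ g s ^ q ≠ ⊤ := by
    rw [lint_supp _ _ (closedBall (0 : ℝ) R)]
    · refine ne_top_of_le_ne_top ?_ (lintegral_mono fun s => rpow_le_rpow (hsb s) hq0.le)
      rw [setLIntegral_const]
      exact mul_ne_top (rpow_ne_top_of_nonneg hq0.le hK) measure_closedBall_lt_top.ne
    · intro s hs
      rw [sl_supp ρ hρ0 g R hR s (by simpa using hs), zero_rpow_of_pos hq0]
  have hfm : Measurable fun s => sl ρ g s ^ q := hslm.pow_const q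
  have hfi : Integrable fun s => (sl ρ g s ^ q).toReal := integrable_toReal_of_lintegral_ne_top hfm.aemeasurable hfin
  set ψ : ℝ → ℝ := fun b => ∫ s in (0 : ℝ)..b, (sl ρ g s ^ q).toReal with hψ
  have hψd : ∀ a b, ψ b - ψ a = ∫ s in a..b, (sl ρ g s ^ q).toReal := fun a b =>
    intervalIntegral.integral_interval_sub_left hfi.intervalIntegrable hfi.intervalIntegrable
  have hψc : Continuous ψ := intervalIntegral.continuous_primitive (fun a b => hfi.intervalIntegrable) 0
  have hψm : Monotone ψ := fun a b hab => by
    rw [← sub_nonneg, hψd]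
    exact intervalIntegral.integral_nonneg_of_forall hab fun _ => ENNReal.toReal_nonneg
  have hψe : ∀ a b, a ≤ b → ∫⁻ s, sl ρ (cutg a b g) s ^ q = ofR (ψ b - ψ a) := fun a b hab => by
    rw [hψd, intervalIntegral.integral_of_le hab, ofReal_integral_eq_lintegral_ofReal hfi.integrableOn (of_forall fun _ => ENNReal.toReal_nonneg),
      ← lintegral_indicator measurableSet_Ioc]
    refine lintegral_congr fun s => ?_
    rw [sl_cutg ρ hρ0]
    by_cases h : s ∈ Set.Ioc a b
    · rw [Set.indicator_of_mem h, Set.indicator_of_mem h, ENNReal.ofReal_toReal (rpow_ne_top_of_nonneg hq0.le (sl_fin ρ hρ0 g hg s))]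
    · rw [Set.indicator_of_notMem h, Set.indicator_of_notMem h, zero_rpow_of_pos hq0]
  have hψe2 : ∀ a b, a ≤ b → (∫⁻ s, sl ρ (cutg a b g) s ^ q) ^ (1 / q) = ofR ((ψ b - ψ a) ^ (1 / q)) := fun a b hab => by
    rw [hψe a b hab, ofReal_rpow_of_nonneg (sub_nonneg.2 (hψm hab)) (by positivity)]
  obtain ⟨L, hL, hLb⟩ := nice_l1 (E := E) ρ q hρ hq1 R
  set M1 := ∫⁻ ξ, ‖m ξ‖ₑ with hM1
  have hM1t : M1 ≠ ⊤ := hmi.2.ne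
  set W := μ Set.univ ^ (1 / 2 : ℝ) with hW
  have hWt : W ≠ ⊤ := rpow_ne_top_of_nonneg (by norm_num) (measure_ne_top _ _)
  have hcs : ∀ a b z, R < ‖z‖ → cutg a b g z = 0 := fun a b z hz => by
    unfold cutg; rw [Set.indicator_apply_eq_zero]; intro _; exact hR z hz
  have hck := ck_abs ψ hψc hψm q hq0 hq2 (fun a b => (∫⁻ z, ‖RU e m g a b z‖ₑ ^ 2 ∂μ) ^ (1 / 2 : ℝ)) A hA (M1 * L * W).toReal ENNReal.toReal_nonneg ?_ ?_ α β hαβ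
  · refine hck.trans ?_
    have hc0 : 0 ≤ A / (1 - 2 ^ (1 / 2 - 1 / q : ℝ)) := by
      refine div_nonneg hA (sub_nonneg.2 ?_)
      refine Real.rpow_le_one_of_one_le_of_nonpos (by norm_num) ?_
      have : 1 / 2 < 1 / q := one_div_lt_one_div_of_lt hq0 hq2
      linarith
    rw [ENNReal.ofReal_mul hc0, ← hψe2 α β hαβ]
    refine mul_le_mul' le_rfl (rpow_le_rpow (lintegral_mono fun s => rpow_le_rpow ?_ hq0.le) (by positivity))
    rw [sl_cutg ρ hρ0]
    exact Set.indicator_le_self _ _ s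
  · intro a b hab
    rw [ENNReal.ofReal_mul ENNReal.toReal_nonneg, ENNReal.ofReal_toReal (mul_ne_top (mul_ne_top hM1t hL) hWt), ← hψe2 a b hab]
    have hpt : ∀ z, ‖RU e m g a b z‖ₑ ≤ M1 * (L * (∫⁻ s, sl ρ (cutg a b g) s ^ q) ^ (1 / q)) := fun z => by
      refine (ex_enorm_le e m hm _ z).trans (mul_le_mul' le_rfl ?_)
      refine le_trans (lintegral_mono fun y => ?_) (hLb _ (cutg_nice a b g hg).1 (hcs a b))
      unfold cutg
      by_cases h : y.2 ∈ Set.Ioc a (min b z.2)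
      · rw [Set.indicator_of_mem (by exact h), Set.indicator_of_mem (by exact ⟨h.1, h.2.trans (min_le_left _ _)⟩)]
      · rw [Set.indicator_of_notMem (by exact h)]; simp
    refine (rpow_le_rpow (lintegral_mono fun z => pow_le_pow_left' (hpt z) 2) (by norm_num)).trans (le_of_eq ?_)
    rw [lintegral_const, ennreal_sq_mul_sqrt]
    ring
  · intro a b c hab hbc
    have hX := hom (cutg a b g) (cutg_nice a b g hg)
    rw [hψe2 a b hab, ← ENNReal.ofReal_mul hA] at hX
    refine le_trans ?_ (add_le_add le_rfl hX)
    simp only [ennreal_sqrt_sq]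
    set X := fun z : E × ℝ => ‖ex e (fun ξ => m ξ * am e (cutg a b g) ξ) z‖ₑ with hXd
    have hXm : Measurable X := (ex_meas e _ (hm.mul (am_meas e _ (cutg_nice a b g hg).1))).enorm
    have m1 := (RU_meas e m hm g hgm a b).enorm
    have m2 := (RU_meas e m hm g hgm b c).enorm
    set Y := fun z : E × ℝ => if z.2 ≤ b then ‖RU e m g a b z‖ₑ else ‖RU e m g b c z‖ₑ with hY
    have hYm : Measurable Y := Measurable.ite (measurableSet_le measurable_snd measurable_const) m1 m2
    refine le_trans ?_ ((mink2 μ Y X hYm.aemeasurable hXm.aemeasurable).trans (add_le_add (rpow_le_rpow ?_ (by norm_num)) le_rfl))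
    · refine rpow_le_rpow (lintegral_mono fun z => pow_le_pow_left' ?_ 2) (by norm_num)
      by_cases hz : z.2 ≤ b
      · simp only [hY, if_pos hz]
        refine le_trans (le_of_eq ?_) le_self_add
        unfold RU
        rw [min_eq_right (hz.trans hbc), min_eq_right hz]
      · simp only [hY, if_neg hz]
        push Not at hz
        have : RU e m g a c z = RU e m g b c z + ex e (fun ξ => m ξ * am e (cutg a b g) ξ) z := by
          unfold RU ex
          rw [← integral_add (ex_int e _ (mam_int e m hmi _ (cutg_nice _ _ g hg)) z) (ex_int e _ (mam_int e m hmi _ (cutg_nice _ _ g hg)) z)]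
          refine integral_congr_ae (of_forall fun ξ => ?_)
          simp only [am_cutg_add e a b (min c z.2) hab (le_min hbc hz.le) g hg ξ]; ring
        rw [this]
        exact enorm_add_le _ _
    · rw [← lintegral_add_left (m1.pow_const 2)]
      refine lintegral_mono fun z => ?_
      by_cases hz : z.2 ≤ b
      · simp only [hY, if_pos hz]; exact le_self_add
      · simp only [hY, if_neg hz]; exact le_add_self
end SE
section SE

theorem ft_damp (a : ℝ) (ha : 0 < a) (F : E → ℂ) (hm : Measurable F) (hi : Integrable F) (ρ : ℝ) (h1 : 1 < ρ) (h2 : ρ < 2) :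
    ∫⁻ ξ, ofR (Real.exp (-a * ‖ξ‖)) * ‖ft F ξ‖ₑ ^ 2 ≤
      CI (2 / ρ - 1) * ofR (a⁻¹ ^ dimR E * c0 E) ^ (2 / ρ - 1) * ((∫⁻ x, ‖F x‖ₑ ^ ρ) ^ (1 / ρ)) ^ 2 := by
  have t0 : 0 < 2 / ρ - 1 := by rw [sub_pos, lt_div_iff₀ (by linarith)]; linarith
  have t1 : 2 / ρ - 1 < 1 := by rw [sub_lt_iff_lt_add, div_lt_iff₀ (by linarith)]; linarith
  have h := form_ker (E := E) (volume : Measure E) (volume : Measure E) F F hi hi id id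
    (fun z => 0) (fun z => 0) measurable_id measurable_id measurable_const measurable_const (a : ℂ) (by simpa using ha)
  rw [← ft_eq_amp] at h
  have e1 : ∀ ξ : E, cexp (-(a : ℂ) * (‖ξ‖ : ℝ)) * (ft F ξ * (starRingEnd ℂ) (ft F ξ)) =
      ((Real.exp (-a * ‖ξ‖) * ‖ft F ξ‖ ^ 2 : ℝ) : ℂ) := fun ξ => by
    rw [mul_conj, normSq_eq_norm_sq]; push_cast; rfl
  simp_rw [e1] at h
  rw [integral_complex_ofReal] at h
  have h0 : ∀ ξ : E, 0 ≤ Real.exp (-a * ‖ξ‖) * ‖ft F ξ‖ ^ 2 := fun ξ => by positivity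
  have hIntg : Integrable fun ξ : E => Real.exp (-a * ‖ξ‖) * ‖ft F ξ‖ ^ 2 := by
    refine (int_exp_norm a ha).mul_bdd (c := (∫ z, ‖F z‖) ^ 2) ?_ (of_forall fun ξ => ?_)
    · exact ((meas_ft F hm).norm.pow_const 2).aestronglyMeasurable
    · rw [Real.norm_of_nonneg (by positivity)]
      exact pow_le_pow_left₀ (norm_nonneg _) (norm_ft_le _ _) 2
  have e2 : ∫⁻ ξ, ofR (Real.exp (-a * ‖ξ‖)) * ‖ft F ξ‖ₑ ^ 2 =
      ‖((∫ ξ, Real.exp (-a * ‖ξ‖) * ‖ft F ξ‖ ^ 2 : ℝ) : ℂ)‖ₑ := by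
    rw [← ofReal_norm, norm_real, Real.norm_of_nonneg (integral_nonneg h0),
      ofReal_integral_eq_lintegral_ofReal hIntg (of_forall h0)]
    refine lintegral_congr fun ξ => ?_
    rw [ENNReal.ofReal_mul (Real.exp_pos _).le, ENNReal.ofReal_pow (norm_nonneg _), ofReal_norm]
  rw [e2, h]
  have hS : ∀ x : E, ‖ker (a : ℂ) x‖ₑ ≤ ofR (a⁻¹ ^ dimR E * c0 E) := fun x => by
    rw [← ofReal_norm]
    exact ofReal_le_ofReal (by simpa [c0] using ker_le (a : ℂ) (by simpa using ha) x)
  have := form_Lp (a : ℂ) (by simpa using ha) F F hm hm hi hi ρ (2 / ρ - 1) t0 t1 rfl (by linarith) _ hS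
  simp only [sub_self, ofReal_zero, zero_mul, sub_zero, id]
  rw [pow_two, ← mul_assoc]
  exact this

theorem wt_lower (d : ℕ) (X : ℝ) (hX : 0 ≤ X) : ofR ((1 + X)⁻¹ ^ (d + 1)) ≤
    ofR (Real.exp 1 * (d + 1)) * ∫⁻ a in Set.Ioc (0 : ℝ) 1, ofR (a ^ d * Real.exp (-a * X)) := by
  set b := (1 + X)⁻¹ with hb
  have hb0 : 0 < b := by positivity
  have hb1 : b ≤ 1 := inv_le_one_of_one_le₀ (by linarith)
  have h1 : ofR (Real.exp (-1) * (b ^ (d + 1) / (d + 1))) ≤ ∫⁻ a in Set.Ioc (0 : ℝ) 1, ofR (a ^ d * Real.exp (-a * X)) := by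
    refine le_trans ?_ (lintegral_mono_set (Set.Ioc_subset_Ioc_right hb1))
    have h2 : Real.exp (-1) * (b ^ (d + 1) / (d + 1)) = ∫ a in Set.Ioc (0 : ℝ) b, Real.exp (-1) * a ^ d := by
      rw [← intervalIntegral.integral_of_le hb0.le, intervalIntegral.integral_const_mul, integral_pow]; simp
    rw [h2, ofReal_integral_eq_lintegral_ofReal]
    · refine setLIntegral_mono' measurableSet_Ioc fun a ha => ofReal_le_ofReal ?_
      rw [mul_comm]
      refine mul_le_mul_of_nonneg_left (Real.exp_le_exp.2 ?_) (pow_nonneg ha.1.le _)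
      have : a * X ≤ b * (1 + X) := mul_le_mul ha.2 (by linarith) hX hb0.le
      rw [hb, inv_mul_cancel₀ (by linarith)] at this
      linarith
    · exact (Continuous.integrableOn_Icc (by fun_prop)).mono_set Set.Ioc_subset_Icc_self
    · refine (ae_restrict_iff' measurableSet_Ioc).2 (of_forall fun a ha => ?_)
      exact mul_nonneg (Real.exp_pos _).le (pow_nonneg ha.1.le _)
  refine le_trans (le_of_eq ?_) (mul_le_mul' le_rfl h1)
  rw [← ENNReal.ofReal_mul (by positivity)]
  congr 1
  have : Real.exp 1 * Real.exp (-1) = 1 := by rw [← Real.exp_add]; simp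
  calc b ^ (d + 1) = (Real.exp 1 * Real.exp (-1)) * b ^ (d + 1) := by rw [this, one_mul]
    _ = _ := by field_simp

/-- constant of the polynomial weight bound -/
def CP (E : Type*) [NormedAddCommGroup E] [InnerProductSpace ℝ E] [FiniteDimensional ℝ E]
  [MeasurableSpace E] [BorelSpace E] (ρ : ℝ) : ℝ≥0∞ :=
  ofR (Real.exp 1 * (dimR E + 1)) * (CI (2 / ρ - 1) * ofR (c0 E) ^ (2 / ρ - 1))

theorem CP_ne_top (ρ : ℝ) (h1 : 1 < ρ) (h2 : ρ < 2) : CP E ρ ≠ ⊤ := by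
  have t0 : 0 < 2 / ρ - 1 := by rw [sub_pos, lt_div_iff₀ (by linarith)]; linarith
  have t1 : 2 / ρ - 1 < 1 := by rw [sub_lt_iff_lt_add, div_lt_iff₀ (by linarith)]; linarith
  exact mul_ne_top ofReal_ne_top (mul_ne_top (CI_ne_top _ t0 t1) (rpow_ne_top_of_nonneg t0.le ofReal_ne_top))

theorem ft_wt (F : E → ℂ) (hm : Measurable F) (hi : Integrable F) (ρ : ℝ) (h1 : 1 < ρ) (h2 : ρ < 2) :
    ∫⁻ ξ, ofR ((1 + ‖ξ‖)⁻¹ ^ (dimR E + 1)) * ‖ft F ξ‖ₑ ^ 2 ≤ CP E ρ * ((∫⁻ x, ‖F x‖ₑ ^ ρ) ^ (1 / ρ)) ^ 2 := by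
  set d := dimR E with hd
  have t0 : 0 < 2 / ρ - 1 := by rw [sub_pos, lt_div_iff₀ (by linarith)]; linarith
  have t1 : 2 / ρ - 1 < 1 := by rw [sub_lt_iff_lt_add, div_lt_iff₀ (by linarith)]; linarith
  have hmf := meas_ft F hm
  have hm2 : Measurable fun q : E × ℝ => ofR (q.2 ^ d * Real.exp (-q.2 * ‖q.1‖)) * ‖ft F q.1‖ₑ ^ 2 :=
    Measurable.mul (by fun_prop) ((hmf.comp measurable_fst).enorm.pow_const 2)
  calc _ ≤ ∫⁻ ξ : E, ofR (Real.exp 1 * (d + 1)) * ∫⁻ a in Set.Ioc (0 : ℝ) 1, ofR (a ^ d * Real.exp (-a * ‖ξ‖)) * ‖ft F ξ‖ₑ ^ 2 := by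
        refine lintegral_mono fun ξ => ?_
        rw [lintegral_mul_const' _ _ (by simp), ← mul_assoc]
        exact mul_le_mul' (wt_lower d ‖ξ‖ (norm_nonneg _)) le_rfl
    _ = ofR (Real.exp 1 * (d + 1)) * ∫⁻ a in Set.Ioc (0 : ℝ) 1, ∫⁻ ξ : E, ofR (a ^ d * Real.exp (-a * ‖ξ‖)) * ‖ft F ξ‖ₑ ^ 2 := by
        rw [lintegral_const_mul' _ _ ofReal_ne_top, lintegral_lintegral_swap hm2.aemeasurable]
    _ ≤ ofR (Real.exp 1 * (d + 1)) * ∫⁻ a in Set.Ioc (0 : ℝ) 1, (CI (2 / ρ - 1) * ofR (c0 E) ^ (2 / ρ - 1)) * ((∫⁻ x, ‖F x‖ₑ ^ ρ) ^ (1 / ρ)) ^ 2 := by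
        refine mul_le_mul' le_rfl (setLIntegral_mono' measurableSet_Ioc fun a ha => ?_)
        have e1 : ∀ ξ : E, ofR (a ^ d * Real.exp (-a * ‖ξ‖)) * ‖ft F ξ‖ₑ ^ 2 = ofR (a ^ d) * (ofR (Real.exp (-a * ‖ξ‖)) * ‖ft F ξ‖ₑ ^ 2) := fun ξ => by
          rw [ENNReal.ofReal_mul (pow_nonneg ha.1.le _), mul_assoc]
        simp_rw [e1]
        rw [lintegral_const_mul' _ _ ofReal_ne_top]
        refine (mul_le_mul' le_rfl (ft_damp a ha.1 F hm hi ρ h1 h2)).trans ?_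
        rw [← mul_assoc]
        refine mul_le_mul' ?_ le_rfl
        rw [mul_left_comm]
        refine mul_le_mul' le_rfl ?_
        rw [ENNReal.ofReal_mul (pow_nonneg (inv_nonneg.2 ha.1.le) _), mul_rpow_of_nonneg _ _ t0.le, ← mul_assoc]
        refine (mul_le_mul' ?_ le_rfl).trans (one_mul _).le
        rw [ofReal_rpow_of_nonneg (pow_nonneg (inv_nonneg.2 ha.1.le) _) t0.le, ← ENNReal.ofReal_mul (pow_nonneg ha.1.le _)]
        refine ENNReal.ofReal_le_one.2 ?_
        have hb : 1 ≤ a⁻¹ ^ d := one_le_pow₀ ((one_le_inv₀ ha.1).2 ha.2)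
        have : (a⁻¹ ^ d) ^ (2 / ρ - 1) ≤ a⁻¹ ^ d := by
          conv_rhs => rw [← Real.rpow_one (a⁻¹ ^ d)]
          exact Real.rpow_le_rpow_of_exponent_le hb t1.le
        refine (mul_le_mul_of_nonneg_left this (pow_nonneg ha.1.le _)).trans (le_of_eq ?_)
        rw [← mul_pow, mul_inv_cancel₀ ha.1.ne', one_pow]
    _ = _ := by
        rw [setLIntegral_const]; simp only [Real.volume_Ioc, sub_zero, ENNReal.ofReal_one, mul_one]
        unfold CP; rw [← hd]; ring

/-- constant of the retarded estimate -/
def CT (E : Type*) [NormedAddCommGroup E] [InnerProductSpace ℝ E] [FiniteDimensional ℝ E]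
  [MeasurableSpace E] [BorelSpace E] (p ρ l : ℝ) : ℝ≥0∞ :=
  ofR ((1 - 2 ^ (1 / 2 - (2 - l) / 2 : ℝ))⁻¹) ^ 2 * (CD E p * CS E ρ l)

theorem CT_ne_top (hn : 3 ≤ dimR E) (p ρ l : ℝ) (hp : ((dimR E : ℝ) - 1) / 2 < p) (h1 : 1 < ρ) (h2 : ρ < 2) :
    CT E p ρ l ≠ ⊤ :=
  mul_ne_top (ENNReal.pow_ne_top ofReal_ne_top) (mul_ne_top (CD_ne_top hn p hp) (CS_ne_top ρ l h1 h2))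

theorem ck_wt (e : ℝ) (he : |e| = 1) (hn : 3 ≤ dimR E) (p : ℝ) (hp : ((dimR E : ℝ) - 1) / 2 < p)
    (N : ℝ≥0∞) (hN : N ≠ ⊤) (v : E → ℝ) (hv : Measurable v) (hv0 : ∀ x, 0 ≤ v x) (M : ℝ) (hM : ∀ x, |v x| ≤ M)
    (h : FP p N fun x => ofR (v x)) (ρ l : ℝ) (hρ1 : 1 < ρ) (hρ2 : ρ < 2)
    (hl0 : 0 < l) (hl1 : l < 1) (hl : l ≤ ((dimR E : ℝ) - 1) * (2 / ρ - 1) / 2)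
    (m : E → ℂ) (hm : Measurable m) (hmi : Integrable m)
    (hmb : ∀ ξ, ofR ‖ξ‖ * ‖m ξ‖ₑ ^ 2 ≤ ofR (‖ξ‖ ^ (-((dimR E : ℝ) * (2 / ρ - 1) - l))))
    (g : E × ℝ → ℂ) (hg : Nice g) (α β : ℝ) (hαβ : α ≤ β) :
    ∫⁻ z : E × ℝ, ofR (v z.1) * ‖RU e m g α β z‖ₑ ^ 2 ≤
      CT E p ρ l * N * (∫⁻ s, sl ρ g s ^ (2 / (2 - l))) ^ (2 - l) := by
  have hp1 : 1 < p := by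
    have : (3 : ℝ) ≤ dimR E := by exact_mod_cast hn
    linarith
  have hw : Measurable fun z : E × ℝ => ofR (v z.1) := (hv.comp measurable_fst).ennreal_ofReal
  have hU : ⋃ R : ℕ, ball (0 : E × ℝ) R = Set.univ := iUnion_ball_nat 0
  rw [← setLIntegral_univ, ← hU, setLIntegral_iUnion_of_directed _ (Monotone.directed_le fun a b hab => ball_subset_ball (by exact_mod_cast hab))]
  refine iSup_le fun R => ?_
  set μ := ((volume : Measure (E × ℝ)).restrict (ball 0 R)).withDensity (fun z => ofR (v z.1)) with hμ
  have : IsFiniteMeasure μ := by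
    refine ⟨?_⟩
    rw [hμ, withDensity_apply _ MeasurableSet.univ, Measure.restrict_univ]
    refine lt_of_le_of_lt (lintegral_mono fun z => ofReal_le_ofReal ((le_abs_self _).trans (hM z.1))) ?_
    rw [setLIntegral_const]
    exact mul_lt_top ofReal_lt_top measure_ball_lt_top
  have hμi : ∀ f : E × ℝ → ℝ≥0∞, Measurable f → ∫⁻ z, f z ∂μ = ∫⁻ z in ball (0 : E × ℝ) R, ofR (v z.1) * f z := fun f hf => by
    rw [hμ, lintegral_withDensity_eq_lintegral_mul _ hw hf]; rfl
  set T := CD E p * N * CS E ρ l with hT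
  have hTt : T ≠ ⊤ := mul_ne_top (mul_ne_top (CD_ne_top hn p hp) hN) (CS_ne_top ρ l hρ1 hρ2)
  have hTt2 : T ^ (1 / 2 : ℝ) ≠ ⊤ := rpow_ne_top_of_nonneg (by norm_num) hTt
  have key := ck_gen μ e m hm hmi ρ l hρ1.le hl0 hl1 (T ^ (1 / 2 : ℝ)).toReal ENNReal.toReal_nonneg ?_ g hg α β hαβ
  · have k2 := pow_le_pow_left' key 2
    rw [ennreal_sqrt_sq, hμi _ ((RU_meas e m hm g hg.1 α β).enorm.pow_const 2)] at k2
    refine k2.trans (le_of_eq ?_)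
    rw [mul_pow, div_eq_mul_inv, ENNReal.ofReal_mul ENNReal.toReal_nonneg, ENNReal.ofReal_toReal hTt2, mul_pow, ennreal_sqrt_sq,
      ← ENNReal.rpow_natCast _ 2, ← ENNReal.rpow_natCast _ 2, ← rpow_mul]
    unfold CT
    rw [show (2 - l) / 2 * ((2 : ℕ) : ℝ) = 2 - l by push_cast; ring, ENNReal.rpow_natCast, hT]
    ring
  · intro g hg
    rw [ENNReal.ofReal_toReal hTt2, show (2 - l) / 2 = (2 - l) * (1 / 2) by ring, rpow_mul, ← mul_rpow_of_nonneg _ _ (by norm_num)]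
    refine rpow_le_rpow ?_ (by norm_num)
    have hc : Measurable fun ξ => m ξ * am e g ξ := hm.mul (am_meas e g hg.1)
    rw [hμi _ ((ex_meas e _ hc).enorm.pow_const 2)]
    refine (setLIntegral_le_lintegral _ _).trans ((hom_wt e he hn p hp1 N hN v hv hv0 M hM h _ hc (mam_int e m hmi g hg)).trans ?_)
    rw [hT, mul_assoc (CD E p * N)]
    refine mul_le_mul' le_rfl (le_trans (lintegral_mono fun ξ => ?_) (dual_str e he hn ρ l hρ1 hρ2 hl0 hl1 hl g hg))
    simp only [enorm_mul]
    rw [mul_pow, ← mul_assoc]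
    exact mul_le_mul' (hmb ξ) le_rfl
end SE
section SE

/-- polynomial weight -/
def WW (ξ : E) : ℝ≥0∞ := ofR ((1 + ‖ξ‖)⁻¹ ^ (dimR E + 1))

theorem WW_meas : Measurable (WW : E → ℝ≥0∞) := by unfold WW; fun_prop

theorem WW_pos (ξ : E) : WW ξ ≠ 0 := by
  unfold WW; exact (ENNReal.ofReal_pos.2 (by positivity)).ne'

theorem WW_ne_top (ξ : E) : WW ξ ≠ ⊤ := ofReal_ne_top

theorem WW_int : ∫⁻ ξ : E, WW ξ ≠ ⊤ := by
  have := (integrable_one_add_norm (E := E) (μ := volume) (r := (dimR E + 1 : ℕ)) (by push_cast; linarith)).2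
  rw [hasFiniteIntegral_iff_enorm] at this
  refine (lt_of_eq_of_lt (lintegral_congr fun ξ => ?_) this).ne
  have h0 : 0 ≤ 1 + ‖ξ‖ := by positivity
  rw [← ofReal_norm, Real.norm_of_nonneg (Real.rpow_nonneg h0 _), Real.rpow_neg h0, Real.rpow_natCast, ← inv_pow]; rfl

/-- constant -/
def CU (E : Type*) [NormedAddCommGroup E] [InnerProductSpace ℝ E] [FiniteDimensional ℝ E]
  [MeasurableSpace E] [BorelSpace E] (ρ : ℝ) : ℝ≥0∞ := (∫⁻ ξ : E, WW ξ) ^ (1 / 2 : ℝ) * CP E ρ ^ (1 / 2 : ℝ)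

theorem CU_ne_top (ρ : ℝ) (h1 : 1 < ρ) (h2 : ρ < 2) : CU E ρ ≠ ⊤ :=
  mul_ne_top (rpow_ne_top_of_nonneg (by norm_num) WW_int) (rpow_ne_top_of_nonneg (by norm_num) (CP_ne_top ρ h1 h2))

theorem ft_w1 (F : E → ℂ) (hm : Measurable F) (hi : Integrable F) (ρ : ℝ) (h1 : 1 < ρ) (h2 : ρ < 2) :
    ∫⁻ ξ, WW ξ * ‖ft F ξ‖ₑ ≤ CU E ρ * (∫⁻ x, ‖F x‖ₑ ^ ρ) ^ (1 / ρ) := by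
  have hs : ∀ a : ℝ≥0∞, a ^ (1 / 2 : ℝ) * a ^ (1 / 2 : ℝ) = a := fun a => by
    rw [← pow_two, ennreal_sqrt_sq]
  have hW : Measurable fun ξ : E => WW ξ ^ (1 / 2 : ℝ) := WW_meas.pow_const _
  have := lcs (volume : Measure E) (fun ξ => WW ξ ^ (1 / 2 : ℝ)) (fun ξ => WW ξ ^ (1 / 2 : ℝ) * ‖ft F ξ‖ₑ)
    hW.aemeasurable (hW.mul (meas_ft F hm).enorm).aemeasurable
  simp only [mul_pow, ennreal_sqrt_sq, ← mul_assoc, hs] at this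
  refine this.trans ?_
  unfold CU
  rw [mul_assoc]
  refine mul_le_mul' le_rfl ((rpow_le_rpow (ft_wt F hm hi ρ h1 h2) (by norm_num)).trans (le_of_eq ?_))
  rw [mul_rpow_of_nonneg _ _ (by norm_num), ← ENNReal.rpow_natCast _ 2, ← rpow_mul]
  norm_num

theorem ftg_meas (G : E × ℝ → ℂ) (hG : Measurable G) : Measurable fun q : E × ℝ => ft (fun x => G (x, q.2)) q.1 := by
  have h : Measurable fun q : (E × ℝ) × E => G (q.2, q.1.2) * ph q.2 q.1.1 := by
    refine (hG.comp (by fun_prop)).mul ?_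
    unfold ph
    exact (Continuous.measurable (by fun_prop))
  exact (h.stronglyMeasurable.integral_prod_right (ν := (volume : Measure E))).measurable

/-- class of admissible sources -/
structure Good (ρ : ℝ) (G : E × ℝ → ℂ) : Prop where
  meas : Measurable G
  int : ∀ s, Integrable fun x => G (x, s)
  fin : ∫⁻ s, sl ρ G s ≠ ⊤

theorem Good.sm {ρ : ℝ} {G : E × ℝ → ℂ} (h : Good ρ G) (s : ℝ) : Measurable fun x => G (x, s) :=
  h.meas.comp (measurable_id.prodMk measurable_const)

theorem ftg_l1 (ρ : ℝ) (h1 : 1 < ρ) (h2 : ρ < 2) (G : E × ℝ → ℂ) (hG : Good ρ G) :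
    ∫⁻ ξ, WW ξ * ∫⁻ s, ‖ft (fun x => G (x, s)) ξ‖ₑ ≤ CU E ρ * ∫⁻ s, sl ρ G s := by
  have hm : Measurable fun q : E × ℝ => WW q.1 * ‖ft (fun x => G (x, q.2)) q.1‖ₑ :=
    (WW_meas.comp measurable_fst).mul (ftg_meas G hG.meas).enorm
  calc _ = ∫⁻ ξ : E, ∫⁻ s, WW ξ * ‖ft (fun x => G (x, s)) ξ‖ₑ := lintegral_congr fun ξ => by
        rw [lintegral_const_mul' _ _ (WW_ne_top ξ)]
    _ = ∫⁻ s, ∫⁻ ξ : E, WW ξ * ‖ft (fun x => G (x, s)) ξ‖ₑ := lintegral_lintegral_swap hm.aemeasurable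
    _ ≤ ∫⁻ s, CU E ρ * sl ρ G s := lintegral_mono fun s => ft_w1 _ (hG.sm s) (hG.int s) ρ h1 h2
    _ = _ := lintegral_const_mul' _ _ (CU_ne_top ρ h1 h2)

theorem ftg_ae (ρ : ℝ) (h1 : 1 < ρ) (h2 : ρ < 2) (G : E × ℝ → ℂ) (hG : Good ρ G) :
    ∀ᵐ ξ : E, Integrable fun s => ft (fun x => G (x, s)) ξ := by
  have hm : Measurable fun ξ : E => WW ξ * ∫⁻ s, ‖ft (fun x => G (x, s)) ξ‖ₑ :=
    WW_meas.mul (ftg_meas G hG.meas).enorm.lintegral_prod_right'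
  have := ae_lt_top hm (((ftg_l1 ρ h1 h2 G hG).trans_lt (mul_lt_top (CU_ne_top ρ h1 h2).lt_top hG.fin.lt_top)).ne)
  filter_upwards [this] with ξ h
  refine ⟨((ftg_meas G hG.meas).comp (measurable_const.prodMk measurable_id)).aestronglyMeasurable, ?_⟩
  rw [hasFiniteIntegral_iff_enorm]
  by_contra hc
  rw [not_lt, top_le_iff] at hc
  rw [hc, ENNReal.mul_top (WW_pos ξ)] at h
  exact lt_irrefl _ h

/-- Duhamel term on the Fourier side -/
def Hs (G : E × ℝ → ℂ) (t : ℝ) (ξ : E) : ℂ :=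
  ∫ s in Set.Iic t, ((Real.sin ((t - s) * ‖ξ‖) : ℝ) : ℂ) * ft (fun x => G (x, s)) ξ

theorem Hs_meas (G : E × ℝ → ℂ) (hG : Measurable G) : Measurable fun z : E × ℝ => Hs G z.2 z.1 := by
  have hS : MeasurableSet {q : (E × ℝ) × ℝ | q.2 ≤ q.1.2} :=
    measurableSet_le (f := fun q : (E × ℝ) × ℝ => q.2) (g := fun q => q.1.2) (by fun_prop) (by fun_prop)
  have h : Measurable ({q : (E × ℝ) × ℝ | q.2 ≤ q.1.2}.indicator fun q => ((Real.sin ((q.1.2 - q.2) * ‖q.1.1‖) : ℝ) : ℂ) * ft (fun x => G (x, q.2)) q.1.1) := by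
    refine Measurable.indicator ?_ hS
    exact Measurable.mul (by fun_prop) ((ftg_meas G hG).comp (f := fun q : (E × ℝ) × ℝ => (q.1.1, q.2)) (by fun_prop))
  have := (h.stronglyMeasurable.integral_prod_right' (ν := (volume : Measure ℝ))).measurable
  convert this using 2 with z
  unfold Hs
  rw [← integral_indicator measurableSet_Iic]
  exact integral_congr_ae (of_forall fun s => rfl)

theorem Hs_le (G : E × ℝ → ℂ) (t : ℝ) (ξ : E) : ‖Hs G t ξ‖ₑ ≤ ∫⁻ s, ‖ft (fun x => G (x, s)) ξ‖ₑ := by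
  refine (enorm_integral_le_lintegral_enorm _).trans ((setLIntegral_le_lintegral _ _).trans (lintegral_mono fun s => ?_))
  rw [enorm_mul]
  refine (mul_le_mul' ?_ le_rfl).trans (one_mul _).le
  rw [← ofReal_norm, norm_real, Real.norm_eq_abs]
  exact ENNReal.ofReal_le_one.2 (Real.abs_sin_le_one _)

theorem sin_mul_int (f : ℝ → ℂ) (hf : Integrable f) (t X : ℝ) (S : Set ℝ) :
    IntegrableOn (fun s => ((Real.sin ((t - s) * X) : ℝ) : ℂ) * f s) S := by
  refine (hf.bdd_mul (c := 1) (by fun_prop) (of_forall fun s => ?_)).integrableOn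
  rw [norm_real, Real.norm_eq_abs]; exact Real.abs_sin_le_one _

theorem ft_sub' (F F' : E → ℂ) (h : Integrable F) (h' : Integrable F') (ξ : E) :
    ft (fun x => F x - F' x) ξ = ft F ξ - ft F' ξ := by
  have hh : ∀ F : E → ℂ, Integrable F → Integrable fun x => F x * ph x ξ := fun F h => by
    refine h.mul_bdd (c := 1) ?_ (of_forall fun x => (norm_ph _ _).le)
    unfold ph
    exact Continuous.aestronglyMeasurable (by fun_prop)
  unfold ft
  rw [← integral_sub (hh F h) (hh F' h')]
  simp only [sub_mul]

theorem Hs_sub (ρ : ℝ) (h1 : 1 < ρ) (h2 : ρ < 2) (G G' : E × ℝ → ℂ) (hG : Good ρ G) (hG' : Good ρ G') :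
    ∀ᵐ ξ : E, ∀ t, Hs (fun z => G z - G' z) t ξ = Hs G t ξ - Hs G' t ξ := by
  filter_upwards [ftg_ae ρ h1 h2 G hG, ftg_ae ρ h1 h2 G' hG'] with ξ i1 i2 t
  unfold Hs
  rw [← integral_sub (sin_mul_int _ i1 _ _ _) (sin_mul_int _ i2 _ _ _)]
  refine integral_congr_ae (of_forall fun s => ?_)
  simp only [ft_sub' _ _ (hG.int s) (hG'.int s) ξ]; ring

/-- frequency-truncated Duhamel term -/
def SU (m : E → ℂ) (G : E × ℝ → ℂ) (z : E × ℝ) : ℂ :=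
  ∫ ξ, m ξ * (starRingEnd ℂ) (ph z.1 ξ) * Hs G z.2 ξ

theorem SU_meas1 (m : E → ℂ) (hm : Measurable m) (G : E × ℝ → ℂ) (hG : Measurable G) :
    Measurable fun q : (E × ℝ) × E => m q.2 * (starRingEnd ℂ) (ph q.1.1 q.2) * Hs G q.1.2 q.2 := by
  refine ((hm.comp measurable_snd).mul ?_).mul ((Hs_meas G hG).comp (f := fun q : (E × ℝ) × E => (q.2, q.1.2)) (by fun_prop))
  unfold ph
  exact Complex.continuous_conj.measurable.comp (Continuous.measurable (by fun_prop))

theorem SU_meas (m : E → ℂ) (hm : Measurable m) (G : E × ℝ → ℂ) (hG : Measurable G) : Measurable (SU m G) :=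
  ((SU_meas1 m hm G hG).stronglyMeasurable.integral_prod_right (ν := (volume : Measure E))).measurable

theorem SU_bd (K : ℝ≥0∞) (m : E → ℂ) (hmK : ∀ ξ, ‖m ξ‖ₑ ≤ K * WW ξ) (hK : K ≠ ⊤) (ρ : ℝ) (h1 : 1 < ρ) (h2 : ρ < 2) (G : E × ℝ → ℂ) (hG : Good ρ G) (z : E × ℝ) :
    ∫⁻ ξ, ‖m ξ * (starRingEnd ℂ) (ph z.1 ξ) * Hs G z.2 ξ‖ₑ ≤ K * (CU E ρ * ∫⁻ s, sl ρ G s) := by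
  refine le_trans ?_ (mul_le_mul' le_rfl (ftg_l1 ρ h1 h2 G hG))
  rw [← lintegral_const_mul' _ _ hK]
  refine lintegral_mono fun ξ => ?_
  rw [enorm_mul, enorm_mul, RCLike.enorm_conj, ← ofReal_norm (ph _ _), norm_ph, ENNReal.ofReal_one, mul_one, ← mul_assoc]
  exact mul_le_mul' (hmK ξ) (Hs_le _ _ _)

theorem SU_int (K : ℝ≥0∞) (m : E → ℂ) (hm : Measurable m) (hmK : ∀ ξ, ‖m ξ‖ₑ ≤ K * WW ξ) (hK : K ≠ ⊤) (ρ : ℝ) (h1 : 1 < ρ) (h2 : ρ < 2) (G : E × ℝ → ℂ) (hG : Good ρ G) (z : E × ℝ) :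
    Integrable fun ξ => m ξ * (starRingEnd ℂ) (ph z.1 ξ) * Hs G z.2 ξ := by
  refine ⟨((SU_meas1 m hm G hG.meas).comp (measurable_const.prodMk measurable_id) (f := fun ξ => (z, ξ))).aestronglyMeasurable, ?_⟩
  rw [hasFiniteIntegral_iff_enorm]
  exact (SU_bd K m hmK hK ρ h1 h2 G hG z).trans_lt
    (mul_lt_top hK.lt_top (mul_lt_top (CU_ne_top ρ h1 h2).lt_top hG.fin.lt_top))

theorem SU_sub (K : ℝ≥0∞) (m : E → ℂ) (hm : Measurable m) (hmK : ∀ ξ, ‖m ξ‖ₑ ≤ K * WW ξ) (hK : K ≠ ⊤) (ρ : ℝ) (h1 : 1 < ρ) (h2 : ρ < 2) (G G' : E × ℝ → ℂ) (hG : Good ρ G) (hG' : Good ρ G')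
    (hD : Good ρ fun z => G z - G' z) (z : E × ℝ) :
    ‖SU m G z - SU m G' z‖ₑ ≤ K * (CU E ρ * ∫⁻ s, sl ρ (fun z => G z - G' z) s) := by
  unfold SU
  rw [← integral_sub (SU_int K m hm hmK hK ρ h1 h2 G hG z) (SU_int K m hm hmK hK ρ h1 h2 G' hG' z)]
  refine (enorm_integral_le_lintegral_enorm _).trans (le_trans (le_of_eq (lintegral_congr_ae ?_)) (SU_bd K m hmK hK ρ h1 h2 _ hD z))
  filter_upwards [Hs_sub ρ h1 h2 G G' hG hG'] with ξ h
  rw [h z.2]; congr 1; ring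

theorem am_cut_eq (e : ℝ) (g : E × ℝ → ℂ) (hg : Nice g) (B : ℝ) (hB : ∀ z : E × ℝ, B ≤ |z.2| → g z = 0) (t : ℝ) (ξ : E) :
    am e (cutg (-B) (min B t) g) ξ = ∫ s in Set.Iic t, ft (fun x => g (x, s)) ξ * cexp ((e * s * ‖ξ‖ : ℝ) * I) := by
  rw [am_eq e _ ((cutg_nice _ _ _ hg).intOn _), ← integral_indicator measurableSet_Iic]
  refine integral_congr_ae (of_forall fun s => ?_)
  have h0 : ft (fun x : E => (0 : ℂ)) ξ = 0 := by simp [ft]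
  by_cases hs : s ≤ t
  · rw [Set.indicator_of_mem (by exact hs)]
    have : (fun x => cutg (-B) (min B t) g (x, s)) = fun x => g (x, s) := by
      ext x
      by_cases hb : B ≤ |s|
      · unfold cutg; rw [hB (x, s) hb]
        exact Set.indicator_apply_eq_zero.2 fun _ => hB (x, s) hb
      · have := abs_lt.1 (not_le.1 hb)
        unfold cutg
        exact Set.indicator_of_mem (show (x, s) ∈ Prod.snd ⁻¹' Set.Ioc (-B) (min B t) from ⟨this.1, le_min this.2.le hs⟩) _
    simp only [this]
  · rw [Set.indicator_of_notMem (by exact hs)]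
    have : (fun x => cutg (-B) (min B t) g (x, s)) = fun x => 0 := by
      ext x
      unfold cutg
      exact Set.indicator_of_notMem (fun h : (x, s) ∈ Prod.snd ⁻¹' Set.Ioc (-B) (min B t) => hs (h.2.trans (min_le_right _ _))) _
    simp only [this, h0, zero_mul]

theorem SU_eq (m : E → ℂ) (hm : Measurable m) (hmi : Integrable m) (g : E × ℝ → ℂ) (hg : Nice g) (B : ℝ) (hB : ∀ z : E × ℝ, B ≤ |z.2| → g z = 0) (z : E × ℝ) :
    SU m g z = (RU 1 m g (-B) B z - RU (-1) m g (-B) B z) * (I / 2) := by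
  unfold SU RU ex
  rw [← integral_sub (ex_int 1 _ (mam_int 1 m hmi _ (cutg_nice _ _ _ hg)) z) (ex_int (-1) _ (mam_int (-1) m hmi _ (cutg_nice _ _ _ hg)) z),
    ← integral_mul_const]
  refine integral_congr_ae (of_forall fun ξ => ?_)
  simp only
  rw [am_cut_eq 1 g hg B hB, am_cut_eq (-1) g hg B hB]
  have hf : Integrable fun s => ft (fun x => g (x, s)) ξ := by
    have := am_int 0 g (hg.intOn _) ξ
    rw [Measure.volume_eq_prod] at this
    refine this.integral_prod_right.congr (of_forall fun s => ?_)
    simp only [ft, pw_split]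
    refine integral_congr_ae (of_forall fun x => ?_)
    simp
  have hi : ∀ e : ℝ, IntegrableOn (fun s => ft (fun x => g (x, s)) ξ * cexp ((e * s * ‖ξ‖ : ℝ) * I)) (Set.Iic z.2) := fun e => by
    refine (hf.mul_bdd (c := 1) (by fun_prop) (of_forall fun s => ?_)).integrableOn
    rw [norm_exp_ofReal_mul_I]
  have hc : ∀ X : ℝ, (starRingEnd ℂ) (cexp ((X : ℂ) * I)) = cexp ((-X : ℝ) * I) := fun X => by
    rw [← Complex.exp_conj]; simp
  have hH : Hs g z.2 ξ = ((∫ s in Set.Iic z.2, ft (fun x => g (x, s)) ξ * cexp ((1 * s * ‖ξ‖ : ℝ) * I)) * (starRingEnd ℂ) (cexp ((1 * z.2 * ‖ξ‖ : ℝ) * I)) -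
      (∫ s in Set.Iic z.2, ft (fun x => g (x, s)) ξ * cexp ((-1 * s * ‖ξ‖ : ℝ) * I)) * (starRingEnd ℂ) (cexp ((-1 * z.2 * ‖ξ‖ : ℝ) * I))) * (I / 2) := by
    rw [← integral_mul_const, ← integral_mul_const, ← integral_sub ((hi 1).mul_const _) ((hi (-1)).mul_const _), ← integral_mul_const]
    refine integral_congr_ae (of_forall fun s => ?_)
    simp only [hc]
    rw [ofReal_sin, Complex.sin, mul_assoc (ft _ _), mul_assoc (ft _ _), ← Complex.exp_add, ← Complex.exp_add, ← mul_sub]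
    rw [show -(((z.2 - s) * ‖ξ‖ : ℝ) : ℂ) * I = ((1 * s * ‖ξ‖ : ℝ) : ℂ) * I + ((-(1 * z.2 * ‖ξ‖) : ℝ) : ℂ) * I by push_cast; ring,
      show (((z.2 - s) * ‖ξ‖ : ℝ) : ℂ) * I = ((-1 * s * ‖ξ‖ : ℝ) : ℂ) * I + ((-(-1 * z.2 * ‖ξ‖) : ℝ) : ℂ) * I by push_cast; ring]
    ring
  rw [hH]
  simp only [pw_split, map_mul]
  ring

theorem SU_wt (hn : 3 ≤ dimR E) (p : ℝ) (hp : ((dimR E : ℝ) - 1) / 2 < p)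
    (N : ℝ≥0∞) (hN : N ≠ ⊤) (v : E → ℝ) (hv : Measurable v) (hv0 : ∀ x, 0 ≤ v x) (M : ℝ) (hM : ∀ x, |v x| ≤ M)
    (h : FP p N fun x => ofR (v x)) (ρ l : ℝ) (hρ1 : 1 < ρ) (hρ2 : ρ < 2)
    (hl0 : 0 < l) (hl1 : l < 1) (hl : l ≤ ((dimR E : ℝ) - 1) * (2 / ρ - 1) / 2)
    (m : E → ℂ) (hm : Measurable m) (hmi : Integrable m)
    (hmb : ∀ ξ, ofR ‖ξ‖ * ‖m ξ‖ₑ ^ 2 ≤ ofR (‖ξ‖ ^ (-((dimR E : ℝ) * (2 / ρ - 1) - l))))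
    (g : E × ℝ → ℂ) (hg : Nice g) :
    ∫⁻ z : E × ℝ, ofR (v z.1) * ‖SU m g z‖ₑ ^ 2 ≤
      CT E p ρ l * N * (∫⁻ s, sl ρ g s ^ (2 / (2 - l))) ^ (2 - l) := by
  obtain ⟨R, hR⟩ := hg.2.2
  set B := |R| + 1 with hBd
  have hB : ∀ z : E × ℝ, B ≤ |z.2| → g z = 0 := fun z hz => hR z (by
    have h1 : |z.2| ≤ ‖z‖ := norm_snd_le z
    have h2 := le_abs_self R
    linarith)
  have hB0 : -B ≤ B := by have := abs_nonneg R; linarith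
  have hw : Measurable fun z : E × ℝ => ofR (v z.1) := (hv.comp measurable_fst).ennreal_ofReal
  have k1 := ck_wt 1 (by simp) hn p hp N hN v hv hv0 M hM h ρ l hρ1 hρ2 hl0 hl1 hl m hm hmi hmb g hg (-B) B hB0
  have k2 := ck_wt (-1) (by simp) hn p hp N hN v hv hv0 M hM h ρ l hρ1 hρ2 hl0 hl1 hl m hm hmi hmb g hg (-B) B hB0
  set Q := CT E p ρ l * N * (∫⁻ s, sl ρ g s ^ (2 / (2 - l))) ^ (2 - l)
  have hpt : ∀ z : E × ℝ, ofR (v z.1) * ‖SU m g z‖ₑ ^ 2 ≤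
      2⁻¹ * (ofR (v z.1) * ‖RU 1 m g (-B) B z‖ₑ ^ 2 + ofR (v z.1) * ‖RU (-1) m g (-B) B z‖ₑ ^ 2) := fun z => by
    rw [← mul_add, mul_left_comm]
    refine mul_le_mul' le_rfl ?_
    rw [SU_eq m hm hmi g hg B hB z]
    set a := RU 1 m g (-B) B z
    set b := RU (-1) m g (-B) B z
    rw [← ofReal_norm, ← ofReal_norm a, ← ofReal_norm b, ← ENNReal.ofReal_pow (norm_nonneg _), ← ENNReal.ofReal_pow (norm_nonneg _),
      ← ENNReal.ofReal_pow (norm_nonneg _), ← ENNReal.ofReal_add (by positivity) (by positivity),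
      show (2⁻¹ : ℝ≥0∞) = ofR 2⁻¹ by rw [ENNReal.ofReal_inv_of_pos (by norm_num)]; norm_num, ← ENNReal.ofReal_mul (by norm_num)]
    refine ofReal_le_ofReal ?_
    rw [norm_mul, norm_div, norm_I]
    have := norm_sub_le a b
    have h0 := norm_nonneg (a - b)
    have : ‖a - b‖ ^ 2 ≤ (‖a‖ + ‖b‖) ^ 2 := pow_le_pow_left₀ h0 this 2
    norm_num
    nlinarith [sq_nonneg (‖a‖ - ‖b‖)]
  refine (lintegral_mono hpt).trans ?_
  have hm1 : Measurable fun z : E × ℝ => ofR (v z.1) * ‖RU 1 m g (-B) B z‖ₑ ^ 2 :=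
    hw.mul ((RU_meas 1 m hm g hg.1 _ _).enorm.pow_const 2)
  rw [lintegral_const_mul' _ _ (by simp), lintegral_add_left hm1]
  refine (mul_le_mul' le_rfl (add_le_add k1 k2)).trans (le_of_eq ?_)
  rw [← two_mul, ← mul_assoc, ENNReal.inv_mul_cancel (by norm_num) (by norm_num), one_mul]
end SE
section SE

/-- sources of the main theorem -/
structure Src (ρ l S : ℝ) (G : E × ℝ → ℂ) : Prop where
  meas : Measurable G
  int : ∀ s, Integrable fun x => G (x, s)
  loc : ∀ R : ℝ, ∃ B : ℝ, ∀ z : E × ℝ, ‖z.1‖ ≤ R → ‖G z‖ ≤ B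
  supp : ∀ z : E × ℝ, S < |z.2| → G z = 0
  fin : ∫⁻ s, sl ρ G s ^ (2 / (2 - l)) ≠ ⊤

theorem sl_mono (ρ : ℝ) (hρ : 0 < ρ) (g G : E × ℝ → ℂ) (h : ∀ z, ‖g z‖ₑ ≤ ‖G z‖ₑ) (s : ℝ) : sl ρ g s ≤ sl ρ G s :=
  rpow_le_rpow (lintegral_mono fun x => rpow_le_rpow (h _) hρ.le) (by positivity)

theorem Src.good {ρ l S : ℝ} {G : E × ℝ → ℂ} (h : Src ρ l S G) (hρ : 0 < ρ) (hl0 : 0 < l) (hl1 : l < 1) : Good ρ G := by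
  refine ⟨h.meas, h.int, ?_⟩
  set q := 2 / (2 - l) with hq
  have hq1 : 1 ≤ q := by rw [hq, le_div_iff₀ (by linarith)]; linarith
  have h1 : ∀ s, s ∉ closedBall (0 : ℝ) S → sl ρ G s = 0 := fun s hs => by
    rw [mem_closedBall_zero_iff, not_le] at hs
    unfold sl
    simp only [fun x => h.supp (x, s) hs, enorm_zero, zero_rpow_of_pos hρ, lintegral_zero]
    exact zero_rpow_of_pos (by positivity)
  rw [lint_supp volume _ _ h1]
  refine ((hold_fin (volume.restrict (closedBall (0 : ℝ) S)) _ (sl_meas ρ G h.meas).aemeasurable q hq1).trans_lt ?_).ne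
  refine mul_lt_top (ENNReal.rpow_lt_top_of_nonneg (by positivity) ?_) (ENNReal.rpow_lt_top_of_nonneg ?_ ?_)
  · exact ((setLIntegral_le_lintegral _ _).trans_lt h.fin.lt_top).ne
  · rw [sub_nonneg, div_le_one (by linarith)]; exact hq1
  · rw [Measure.restrict_apply_univ]; exact measure_closedBall_lt_top.ne

/-- space cutoff -/
def ctx (k : ℕ) (G : E × ℝ → ℂ) : E × ℝ → ℂ := {z : E × ℝ | ‖z.1‖ ≤ k}.indicator G

theorem ctx_set (k : ℕ) : MeasurableSet {z : E × ℝ | ‖z.1‖ ≤ k} :=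
  measurableSet_le (f := fun z : E × ℝ => ‖z.1‖) (g := fun _ => (k : ℝ)) (by fun_prop) (by fun_prop)

theorem ctx_le (k : ℕ) (G : E × ℝ → ℂ) (z : E × ℝ) : ‖ctx k G z‖ₑ ≤ ‖G z‖ₑ := by
  unfold ctx Set.indicator; split_ifs <;> simp

theorem ctx_sub_le (k : ℕ) (G : E × ℝ → ℂ) (z : E × ℝ) : ‖G z - ctx k G z‖ₑ ≤ ‖G z‖ₑ := by
  unfold ctx Set.indicator; split_ifs <;> simp

theorem ctx_nice {ρ l S : ℝ} {G : E × ℝ → ℂ} (h : Src ρ l S G) (k : ℕ) : Nice (ctx k G) := by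
  obtain ⟨B, hB⟩ := h.loc k
  refine ⟨h.meas.indicator (ctx_set k), ⟨max B 0, fun z => ?_⟩, max k S, fun z hz => ?_⟩
  · unfold ctx Set.indicator
    split_ifs with hh
    · exact (hB z hh).trans (le_max_left _ _)
    · simp
  · unfold ctx Set.indicator
    split_ifs with hh
    · refine h.supp z ?_
      by_contra hc
      exact absurd hz (not_lt.2 (max_le_max hh (not_lt.1 hc)))
    · rfl

theorem good_of_le {ρ : ℝ} (hρ : 0 < ρ) {G : E × ℝ → ℂ} (hG : Good ρ G) (g : E × ℝ → ℂ) (hg : Measurable g) (h : ∀ z, ‖g z‖ₑ ≤ ‖G z‖ₑ) : Good ρ g := by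
  refine ⟨hg, fun s => ?_, ((lintegral_mono (sl_mono ρ hρ g G h)).trans_lt hG.fin.lt_top).ne⟩
  refine (hG.int s).mono (hg.comp (measurable_id.prodMk measurable_const)).aestronglyMeasurable (of_forall fun x => ?_)
  have := h (x, s)
  rwa [enorm_le_iff_norm_le] at this

theorem ctx_tendsto (ρ : ℝ) (hρ : 0 < ρ) (G : E × ℝ → ℂ) (hG : Good ρ G) :
    Filter.Tendsto (fun k : ℕ => ∫⁻ s, sl ρ (fun z => G z - ctx k G z) s) Filter.atTop (nhds 0) := by
  have hm : ∀ k, Measurable fun z => G z - ctx k G z := fun k => hG.meas.sub (hG.meas.indicator (ctx_set k))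
  have := tendsto_lintegral_of_dominated_convergence' (μ := volume) (F := fun (k : ℕ) s => sl ρ (fun z => G z - ctx k G z) s) (f := fun _ => 0)
    (sl ρ G) (fun k => (sl_meas ρ _ (hm k)).aemeasurable) (fun k => of_forall fun s => sl_mono ρ hρ _ _ (ctx_sub_le k G) s) hG.fin ?_
  · simpa using this
  filter_upwards [ae_lt_top (sl_meas ρ G hG.meas) hG.fin] with s hs
  have hs2 : ∫⁻ x, ‖G (x, s)‖ₑ ^ ρ ≠ ⊤ := fun hc => by
    unfold sl at hs
    rw [hc, ENNReal.top_rpow_of_pos (by positivity)] at hs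
    exact lt_irrefl _ hs
  have hsm : ∀ g : E × ℝ → ℂ, Measurable g → Measurable fun x => ‖g (x, s)‖ₑ ^ ρ := fun g hg =>
    (hg.comp (measurable_id.prodMk measurable_const)).enorm.pow_const _
  have h1 := tendsto_lintegral_of_dominated_convergence' (μ := volume) (F := fun (k : ℕ) x => ‖G (x, s) - ctx k G (x, s)‖ₑ ^ ρ) (f := fun _ => 0)
    (fun x => ‖G (x, s)‖ₑ ^ ρ) (fun k => (hsm _ (hm k)).aemeasurable)
    (fun k => of_forall fun x => rpow_le_rpow (ctx_sub_le k G _) hρ.le) hs2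
    (of_forall fun x => ?_)
  · rw [lintegral_zero] at h1
    have h2 := (ENNReal.continuous_rpow_const (y := 1 / ρ)).tendsto 0 |>.comp h1
    rw [zero_rpow_of_pos (by positivity)] at h2
    exact h2
  · refine tendsto_const_nhds.congr' ?_
    filter_upwards [Filter.eventually_ge_atTop ⌈‖x‖⌉₊] with k hk
    have : ctx k G (x, s) = G (x, s) := Set.indicator_of_mem (show (x, s) ∈ {z : E × ℝ | ‖z.1‖ ≤ k} from Nat.ceil_le.1 hk) _
    rw [this, sub_self, enorm_zero, zero_rpow_of_pos hρ]

theorem SU_main (hn : 3 ≤ dimR E) (p : ℝ) (hp : ((dimR E : ℝ) - 1) / 2 < p)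
    (N : ℝ≥0∞) (hN : N ≠ ⊤) (V : E → ℂ) (hV : Measurable V)
    (h : FP p N fun x => ‖V x‖ₑ) (ρ l S : ℝ) (hρ1 : 1 < ρ) (hρ2 : ρ < 2)
    (hl0 : 0 < l) (hl1 : l < 1) (hl : l ≤ ((dimR E : ℝ) - 1) * (2 / ρ - 1) / 2)
    (m : E → ℂ) (hm : Measurable m) (hmi : Integrable m) (K : ℝ≥0∞) (hmK : ∀ ξ, ‖m ξ‖ₑ ≤ K * WW ξ) (hK : K ≠ ⊤)
    (hmb : ∀ ξ, ofR ‖ξ‖ * ‖m ξ‖ₑ ^ 2 ≤ ofR (‖ξ‖ ^ (-((dimR E : ℝ) * (2 / ρ - 1) - l))))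
    (G : E × ℝ → ℂ) (hG : Src ρ l S G) :
    ∫⁻ z : E × ℝ, ‖V z.1‖ₑ * ‖SU m G z‖ₑ ^ 2 ≤
      CT E p ρ l * N * (∫⁻ s, sl ρ G s ^ (2 / (2 - l))) ^ (2 - l) := by
  have hρ0 : 0 < ρ := by linarith
  have hp0 : 0 < p := by
    have : (3 : ℝ) ≤ dimR E := by exact_mod_cast hn
    linarith
  have hgood := hG.good hρ0 hl0 hl1
  have hcm : ∀ k, Measurable (ctx k G) := fun k => hG.meas.indicator (ctx_set k)
  set Q := CT E p ρ l * N * (∫⁻ s, sl ρ G s ^ (2 / (2 - l))) ^ (2 - l)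
  have hT : ∀ z, Filter.Tendsto (fun k : ℕ => ‖SU m (ctx k G) z‖ₑ) Filter.atTop (nhds ‖SU m G z‖ₑ) := fun z => by
    refine (continuous_enorm.tendsto _).comp ?_
    rw [tendsto_iff_edist_tendsto_0]
    have h1 := ctx_tendsto ρ hρ0 G hgood
    have h2 : Filter.Tendsto (fun k : ℕ => K * (CU E ρ * ∫⁻ s, sl ρ (fun z => G z - ctx k G z) s)) Filter.atTop (nhds 0) := by
      have := ENNReal.Tendsto.const_mul (ENNReal.Tendsto.const_mul h1 (Or.inr (CU_ne_top (E := E) ρ hρ1 hρ2))) (Or.inr hK)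
      simpa using this
    refine tendsto_of_tendsto_of_tendsto_of_le_of_le tendsto_const_nhds h2 (fun _ => bot_le) fun k => ?_
    simp only
    rw [edist_comm, edist_eq_enorm_sub]
    exact SU_sub K m hm hmK hK ρ hρ1 hρ2 G _ hgood (good_of_le hρ0 hgood _ (hcm k) (ctx_le k G))
      (good_of_le hρ0 hgood _ (hG.meas.sub (hcm k)) (ctx_sub_le k G)) z
  set v : ℕ → E → ℝ := fun k x => min ‖V x‖ k with hvd
  have hv : ∀ k, Measurable (v k) := fun k => hV.norm.min measurable_const
  have hv0 : ∀ k x, 0 ≤ v k x := fun k x => le_min (norm_nonneg _) (Nat.cast_nonneg _)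
  have hvV : ∀ k x, ofR (v k x) ≤ ‖V x‖ₑ := fun k x => by
    rw [← ofReal_norm]; exact ofReal_le_ofReal (min_le_left _ _)
  have hFP : ∀ k, FP p N fun x => ofR (v k x) := fun k x r hr =>
    (rpow_le_rpow (lintegral_mono fun y => rpow_le_rpow (hvV k y) hp0.le) (by positivity)).trans (h x r hr)
  have hb : ∀ k, ∫⁻ z : E × ℝ, ofR (v k z.1) * ‖SU m (ctx k G) z‖ₑ ^ 2 ≤ Q := fun k => by
    refine (SU_wt hn p hp N hN (v k) (hv k) (hv0 k) k (fun x => ?_) (hFP k) ρ l hρ1 hρ2 hl0 hl1 hl m hm hmi hmb _ (ctx_nice hG k)).trans ?_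
    · rw [abs_of_nonneg (hv0 k x)]; exact min_le_right _ _
    · refine mul_le_mul' le_rfl (rpow_le_rpow (lintegral_mono fun s => rpow_le_rpow (sl_mono ρ hρ0 _ _ (ctx_le k G) s) ?_) (by linarith))
      exact div_nonneg (by norm_num) (by linarith)
  have hpt : ∀ z : E × ℝ, ‖V z.1‖ₑ * ‖SU m G z‖ₑ ^ 2 = Filter.liminf (fun k : ℕ => ofR (v k z.1) * ‖SU m (ctx k G) z‖ₑ ^ 2) Filter.atTop := fun z => by
    refine (Filter.Tendsto.liminf_eq ?_).symm
    have h1 : Filter.Tendsto (fun k : ℕ => ‖SU m (ctx k G) z‖ₑ ^ 2) Filter.atTop (nhds (‖SU m G z‖ₑ ^ 2)) := (ENNReal.continuous_pow 2).tendsto _ |>.comp (hT z)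
    refine (ENNReal.Tendsto.const_mul h1 (Or.inr enorm_ne_top)).congr' ?_
    filter_upwards [Filter.eventually_ge_atTop ⌈‖V z.1‖⌉₊] with k hk
    rw [hvd]
    simp only
    rw [min_eq_left (Nat.ceil_le.1 hk), ofReal_norm]
  rw [lintegral_congr hpt]
  refine (lintegral_liminf_le fun k => ?_).trans ?_
  · exact ((hv k).comp measurable_fst).ennreal_ofReal.mul ((SU_meas m hm _ (hcm k)).enorm.pow_const 2)
  · exact Filter.liminf_le_of_frequently_le' (Filter.Frequently.of_forall hb)
end SE
section SE

theorem ph_comm (x y : E) : ph x y = ph y x := by unfold ph; rw [real_inner_comm]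

theorem ph_meas (y : E) : Measurable fun ξ : E => ph y ξ := by
  unfold ph; exact Continuous.measurable (by fun_prop)

theorem cph_meas (y : E) : Measurable fun ξ : E => (starRingEnd ℂ) (ph y ξ) :=
  Complex.continuous_conj.measurable.comp (ph_meas y)

theorem cph_int (y : E) (c : E → ℂ) (hc : Integrable c) : Integrable fun ξ => (starRingEnd ℂ) (ph y ξ) * c ξ :=
  hc.bdd_mul (c := 1) (cph_meas y).aestronglyMeasurable (of_forall fun ξ => by rw [RCLike.norm_conj, norm_ph])

theorem wav_ker (z : ℂ) (hz : 0 < z.re) (F : E → ℂ) (hm : Measurable F) (hi : Integrable F) (y : E) :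
    ∫ ξ, (starRingEnd ℂ) (ph y ξ) * (cexp (-z * (‖ξ‖ : ℝ)) * ft F ξ) = ∫ x, F x * ker z (x - y) := by
  have h := form_ker (E := E) (volume : Measure E) (Measure.dirac ()) F (fun _ => 1) hi (integrable_const _) id (fun _ => y)
    (fun z => 0) (fun z => 0) measurable_id measurable_const measurable_const measurable_const z hz
  rw [← ft_eq_amp] at h
  have h2 : ∀ ξ : E, amp (Measure.dirac ()) (fun _ => (1 : ℂ)) (fun _ => y) (fun _ => 0) ξ = ph y ξ := fun ξ => by
    unfold amp; rw [integral_dirac, pw_split]; simp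
  simp only [h2] at h
  have h3 : Measurable fun x : E => ker z (x - y) := meas_ker.comp (f := fun x : E => (z, x - y)) (by fun_prop)
  rw [Measure.prod_dirac, integral_map (by fun_prop)] at h
  · refine Eq.trans (integral_congr_ae (of_forall fun ξ => ?_)) (h.trans ?_)
    · simp only; ring
    · simp
  · simp only [sub_self, ofReal_zero, zero_mul, sub_zero, id, map_one, mul_one]
    exact Measurable.aestronglyMeasurable ((hm.mul h3).comp measurable_fst)

/-- damped wave -/
def wa (a τ : ℝ) (F : E → ℂ) (y : E) : ℂ :=
  ∫ ξ, (starRingEnd ℂ) (ph y ξ) * (((Real.exp (-a * ‖ξ‖) * Real.sin (τ * ‖ξ‖) : ℝ) : ℂ) * ft F ξ)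

theorem damp_int (z : ℂ) (hz : 0 < z.re) (F : E → ℂ) (hm : Measurable F) : Integrable fun ξ => cexp (-z * (‖ξ‖ : ℝ)) * ft F ξ := by
  refine Integrable.mul_bdd (c := ∫ x, ‖F x‖) ?_ (meas_ft F hm).aestronglyMeasurable (of_forall fun ξ => norm_ft_le _ _)
  refine (int_exp_norm z.re hz).mono' ?_ ?_
  · apply Continuous.aestronglyMeasurable; fun_prop
  · exact of_forall fun ξ => by rw [Complex.norm_exp]; simp

theorem damp_eq (a τ X : ℝ) : ((Real.exp (-a * X) * Real.sin (τ * X) : ℝ) : ℂ) =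
    (cexp (-(a + τ * I) * X) - cexp (-(a - τ * I) * X)) * (I / 2) := by
  rw [ofReal_mul, ofReal_sin, Complex.sin, ofReal_exp, show -((a : ℂ) + τ * I) * X = ((-a * X : ℝ) : ℂ) + -((τ * X : ℝ) : ℂ) * I by push_cast; ring,
    show -((a : ℂ) - τ * I) * X = ((-a * X : ℝ) : ℂ) + ((τ * X : ℝ) : ℂ) * I by push_cast; ring, Complex.exp_add, Complex.exp_add]
  ring

theorem wac_int (a τ : ℝ) (ha : 0 < a) (F : E → ℂ) (hm : Measurable F) :
    Integrable fun ξ => ((Real.exp (-a * ‖ξ‖) * Real.sin (τ * ‖ξ‖) : ℝ) : ℂ) * ft F ξ := by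
  have h := ((damp_int (a + τ * I) (by simpa using ha) F hm).sub (damp_int (a - τ * I) (by simpa using ha) F hm)).mul_const (I / 2)
  refine h.congr (of_forall fun ξ => ?_)
  simp only [damp_eq, Pi.sub_apply]; ring

theorem wa_ker (a τ : ℝ) (ha : 0 < a) (F : E → ℂ) (hm : Measurable F) (hi : Integrable F) (y : E) :
    wa a τ F y = ((∫ x, F x * ker (a + τ * I) (x - y)) - ∫ x, F x * ker (a - τ * I) (x - y)) * (I / 2) := by
  rw [← wav_ker _ (by simpa using ha) F hm hi, ← wav_ker _ (by simpa using ha) F hm hi,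
    ← integral_sub (cph_int y _ (damp_int _ (by simpa using ha) F hm)) (cph_int y _ (damp_int _ (by simpa using ha) F hm)), ← integral_mul_const]
  unfold wa
  refine integral_congr_ae (of_forall fun ξ => ?_)
  simp only [damp_eq]; ring

theorem wa_meas (a τ : ℝ) (F : E → ℂ) (hm : Measurable F) : Measurable (wa a τ F) := by
  have h : Measurable fun q : E × E => (starRingEnd ℂ) (ph q.1 q.2) * (((Real.exp (-a * ‖q.2‖) * Real.sin (τ * ‖q.2‖) : ℝ) : ℂ) * ft F q.2) := by
    refine (Complex.continuous_conj.measurable.comp ?_).mul (Measurable.mul (by fun_prop) ((meas_ft F hm).comp measurable_snd))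
    unfold ph; exact Continuous.measurable (by fun_prop)
  exact (h.stronglyMeasurable.integral_prod_right (ν := (volume : Measure E))).measurable

theorem wa_l2 (a τ : ℝ) (ha : 0 < a) (F : E → ℂ) (hm : Measurable F) (hi : Integrable F) :
    ∫⁻ y, ‖wa a τ F y‖ₑ ^ 2 ≤ ∫⁻ x, ‖F x‖ₑ ^ 2 := by
  set c : E → ℂ := fun ξ => (starRingEnd ℂ) (((Real.exp (-a * ‖ξ‖) * Real.sin (τ * ‖ξ‖) : ℝ) : ℂ) * ft F ξ) with hc
  have hcm : Measurable c := Complex.continuous_conj.measurable.comp (Measurable.mul (by fun_prop) (meas_ft F hm))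
  have hci : Integrable c := (Complex.conjLIE.toContinuousLinearEquiv.integrable_comp_iff).2 (wac_int a τ ha F hm)
  have h1 : ∀ y, ‖wa a τ F y‖ₑ = ‖ft c y‖ₑ := fun y => by
    rw [← RCLike.enorm_conj]
    congr 1
    unfold wa
    rw [show ft c y = ∫ ξ, c ξ * ph ξ y from rfl, ← integral_conj]
    refine integral_congr_ae (of_forall fun ξ => ?_)
    simp only [hc]
    rw [map_mul, Complex.conj_conj, ph_comm y ξ, mul_comm]
  simp only [h1]
  refine (bessel c hcm hci).trans ((lintegral_mono fun ξ => ?_).trans (bessel F hm hi))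
  refine pow_le_pow_left' ?_ 2
  simp only [hc]
  rw [RCLike.enorm_conj, enorm_mul]
  refine (mul_le_mul' ?_ le_rfl).trans (one_mul _).le
  rw [← ofReal_norm, norm_real, norm_mul, Real.norm_of_nonneg (Real.exp_pos _).le]
  refine ENNReal.ofReal_le_one.2 (mul_le_one₀ (Real.exp_le_one_iff.2 ?_) (norm_nonneg _) (Real.abs_sin_le_one _))
  have := norm_nonneg ξ
  nlinarith

theorem wa_far (hn : 0 < dimR E) (a τ T R : ℝ) (ha : 0 < a) (ha1 : a ≤ 1) (hτ : 0 ≤ τ) (hT : τ ≤ T) (hR : 0 ≤ R) (F : E → ℂ) (hm : Measurable F) (hi : Integrable F)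
    (h0 : ∀ x, ‖x‖ ≤ 2 * R + 2 + T → F x = 0) (y : E) (hy : ‖y‖ < R) :
    ‖wa a τ F y‖ₑ ≤ ofR (c0 E * (1 + T) * 4 ^ (dimR E + 1)) * ∫⁻ x, ‖F x‖ₑ * WW x := by
  set K := c0 E * (1 + T) * 4 ^ (dimR E + 1) with hK
  have hT0 : 0 ≤ T := hτ.trans hT
  have key : ∀ z : ℂ, 0 < z.re → ‖z‖ ≤ 1 + T → ‖∫ x, F x * ker z (x - y)‖ₑ ≤ ofR K * ∫⁻ x, ‖F x‖ₑ * WW x := fun z hz hzT => by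
    rw [← lintegral_const_mul' _ _ ofReal_ne_top]
    refine (enorm_integral_le_lintegral_enorm _).trans (lintegral_mono fun x => ?_)
    rw [enorm_mul]
    by_cases hx : ‖x‖ ≤ 2 * R + 2 + T
    · rw [h0 x hx]; simp
    push Not at hx
    rw [mul_left_comm]
    refine mul_le_mul' le_rfl ?_
    unfold WW
    rw [← ofReal_norm, ← ENNReal.ofReal_mul (by have := c0_nonneg (E := E); positivity)]
    refine ofReal_le_ofReal ?_
    have h1 : ‖x‖ - ‖y‖ ≤ ‖x - y‖ := norm_sub_norm_le x y
    have h2 : ‖x‖ / 2 ≤ ‖x - y‖ := by linarith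
    have hpi := Real.pi_gt_three
    have hxy : 1 + T / 2 ≤ ‖x - y‖ := by linarith
    refine (ker_K3 z hz (x - y) hn ?_).trans ?_
    · have : 3 * (1 + T / 2) ≤ Real.pi * ‖x - y‖ := mul_le_mul hpi.le hxy (by positivity) (by positivity)
      linarith
    · rw [hK, mul_assoc (c0 E * (1 + T)), ← mul_pow]
      refine mul_le_mul (mul_le_mul_of_nonneg_left hzT c0_nonneg) (pow_le_pow_left₀ (by positivity) ?_ _) (by positivity) (mul_nonneg c0_nonneg (by linarith))
      rw [inv_le_comm₀ (by linarith) (by positivity), mul_inv, inv_inv]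
      have := norm_nonneg x
      linarith
  rw [wa_ker a τ ha F hm hi, enorm_mul, show ‖I / 2‖ₑ = (2⁻¹ : ℝ≥0∞) by
    rw [← ofReal_norm, norm_div, norm_I]; simp [ENNReal.ofReal_inv_of_pos]]
  have b1 : ∀ s : ℝ, |s| ≤ τ → ‖(a : ℂ) + s * I‖ ≤ 1 + T := fun s hs => by
    refine (norm_add_le _ _).trans ?_
    rw [norm_mul, norm_I, norm_real, norm_real, Real.norm_eq_abs, Real.norm_eq_abs, abs_of_pos ha]
    linarith
  have k1 := key (a + τ * I) (by simpa using ha) (b1 τ (abs_of_nonneg hτ).le)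
  have k2 := key (a - τ * I) (by simpa using ha) (by simpa [sub_eq_add_neg] using b1 (-τ) (by rw [abs_neg, abs_of_nonneg hτ]))
  refine (mul_le_mul' (enorm_sub_le.trans (add_le_add k1 k2)) le_rfl).trans (le_of_eq ?_)
  rw [← two_mul, mul_comm 2, mul_assoc, ENNReal.mul_inv_cancel (by norm_num) (by norm_num), mul_one]

theorem WW_le_one (x : E) : WW x ≤ 1 := by
  unfold WW
  refine ENNReal.ofReal_le_one.2 (pow_le_one₀ (by positivity) (inv_le_one_of_one_le₀ ?_))
  linarith [norm_nonneg x]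

theorem WW_hold (ρ : ℝ) (h1 : 1 ≤ ρ) (F : E → ℂ) (hm : Measurable F) :
    ∫⁻ x, ‖F x‖ₑ * WW x ≤ (∫⁻ x, ‖F x‖ₑ ^ ρ) ^ (1 / ρ) * (∫⁻ x : E, WW x) ^ (1 - 1 / ρ) := by
  have := hold_fin (volume.withDensity (WW : E → ℝ≥0∞)) (fun x => ‖F x‖ₑ) hm.enorm.aemeasurable ρ h1
  rw [lintegral_withDensity_eq_lintegral_mul _ WW_meas hm.enorm, lintegral_withDensity_eq_lintegral_mul _ WW_meas (hm.enorm.pow_const ρ),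
    withDensity_apply _ MeasurableSet.univ, Measure.restrict_univ] at this
  simp only [Pi.mul_apply] at this
  simp only [mul_comm _ (WW _)]
  refine this.trans (mul_le_mul' (rpow_le_rpow (lintegral_mono fun x => ?_) (by positivity)) le_rfl)
  exact (mul_le_mul' (WW_le_one x) le_rfl).trans (one_mul _).le

theorem wave_loc (hn : 0 < dimR E) (ρ : ℝ) (h1 : 1 ≤ ρ) (R T B : ℝ) (hR : 0 ≤ R) :
    ∃ C1 C2 : ℝ≥0∞, C1 ≠ ⊤ ∧ C2 ≠ ⊤ ∧ ∀ τ, 0 ≤ τ → τ ≤ T → ∀ F : E → ℂ, Measurable F → Integrable F → Integrable (ft F) →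
      (∀ x, ‖x‖ ≤ 2 * R + 2 + T → ‖F x‖ ≤ B) →
      ∫⁻ y in ball 0 R, ‖∫ ξ, (starRingEnd ℂ) (ph y ξ) * (((Real.sin (τ * ‖ξ‖) : ℝ) : ℂ) * ft F ξ)‖ₑ ≤ C1 + C2 * (∫⁻ x, ‖F x‖ₑ ^ ρ) ^ (1 / ρ) := by
  set R' := 2 * R + 2 + T
  set D := closedBall (0 : E) R'
  set v := volume (ball (0 : E) R)
  have hv : v ≠ ⊤ := measure_ball_lt_top.ne
  set K := ofR (c0 E * (1 + T) * 4 ^ (dimR E + 1))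
  set J := (∫⁻ x : E, WW x) ^ (1 - 1 / ρ)
  have hJ : J ≠ ⊤ := rpow_ne_top_of_nonneg (by rw [sub_nonneg, div_le_one (by linarith)]; exact h1) WW_int
  refine ⟨v ^ (1 / 2 : ℝ) * (ofR B ^ 2 * volume D) ^ (1 / 2 : ℝ), K * J * v, ?_, ?_, ?_⟩
  · exact mul_ne_top (rpow_ne_top_of_nonneg (by norm_num) hv) (rpow_ne_top_of_nonneg (by norm_num)
      (mul_ne_top (ENNReal.pow_ne_top ofReal_ne_top) measure_closedBall_lt_top.ne))
  · exact mul_ne_top (mul_ne_top ofReal_ne_top hJ) hv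
  intro τ hτ hT F hm hi hfi hB
  have hD : MeasurableSet D := measurableSet_closedBall
  set F1 := D.indicator F with hF1
  set F2 := Dᶜ.indicator F with hF2
  have m1 : Measurable F1 := hm.indicator hD
  have m2 : Measurable F2 := hm.indicator hD.compl
  have i1 : Integrable F1 := hi.indicator hD
  have i2 : Integrable F2 := hi.indicator hD.compl
  have hsplit : ∀ a, 0 < a → ∀ y, wa a τ F y = wa a τ F1 y + wa a τ F2 y := fun a ha y => by
    unfold wa
    rw [← integral_add (cph_int y _ (wac_int a τ ha F1 m1)) (cph_int y _ (wac_int a τ ha F2 m2))]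
    refine integral_congr_ae (of_forall fun ξ => ?_)
    have : ft F ξ = ft F1 ξ + ft F2 ξ := by
      have e : F = fun x => F1 x - (- F2 x) := by
        ext x; rw [sub_neg_eq_add]; exact (Set.indicator_self_add_compl_apply D F x).symm
      have e2 : ft (fun x => - F2 x) ξ = - ft F2 ξ := by unfold ft; simp only [neg_mul, integral_neg]
      conv_lhs => rw [e]
      rw [ft_sub' F1 (fun x => - F2 x) i1 i2.neg ξ, e2, sub_neg_eq_add]
    simp only [this]; ring
  have hbd : ∀ a, 0 < a → a ≤ 1 → ∫⁻ y in ball 0 R, ‖wa a τ F y‖ₑ ≤ v ^ (1 / 2 : ℝ) * (ofR B ^ 2 * volume D) ^ (1 / 2 : ℝ) + K * J * v * (∫⁻ x, ‖F x‖ₑ ^ ρ) ^ (1 / ρ) := by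
    intro a ha ha1
    refine (lintegral_mono fun y => (?_ : _ ≤ ‖wa a τ F1 y‖ₑ + ‖wa a τ F2 y‖ₑ)).trans ?_
    · rw [hsplit a ha y]; exact enorm_add_le _ _
    rw [lintegral_add_left (wa_meas a τ F1 m1).enorm]
    refine add_le_add ?_ ?_
    · have := lcs (volume.restrict (ball (0 : E) R)) (fun _ => 1) (fun y => ‖wa a τ F1 y‖ₑ) aemeasurable_const (wa_meas a τ F1 m1).enorm.aemeasurable
      simp only [one_mul, one_pow, lintegral_one, Measure.restrict_apply_univ] at this
      refine this.trans (mul_le_mul' le_rfl (rpow_le_rpow ?_ (by norm_num)))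
      refine (setLIntegral_le_lintegral _ _).trans ((wa_l2 a τ ha F1 m1 i1).trans ?_)
      rw [← setLIntegral_const, ← lintegral_indicator hD]
      refine lintegral_mono fun x => ?_
      by_cases hx : x ∈ D
      · simp only [hF1, Set.indicator_of_mem hx]
        refine pow_le_pow_left' ?_ 2
        rw [← ofReal_norm]
        exact ofReal_le_ofReal (hB x (mem_closedBall_zero_iff.1 hx))
      · simp [hF1, Set.indicator_of_notMem hx]
    · refine (setLIntegral_mono' measurableSet_ball fun y hy => wa_far hn a τ T R ha ha1 hτ hT hR F2 m2 i2 (fun x hx => ?_) y (mem_ball_zero_iff.1 hy)).trans ?_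
      · exact Set.indicator_of_notMem (fun h : x ∈ Dᶜ => h (mem_closedBall_zero_iff.2 hx)) _
      rw [setLIntegral_const]
      refine (mul_le_mul' (mul_le_mul' le_rfl ((WW_hold ρ h1 F2 m2).trans (mul_le_mul' (rpow_le_rpow (lintegral_mono fun x => rpow_le_rpow (?_ : _ ≤ ‖F x‖ₑ) (by linarith)) (by positivity)) le_rfl))) le_rfl).trans (le_of_eq ?_)
      · simp only [hF2]; unfold Set.indicator; split_ifs <;> simp
      · ring
  set ak : ℕ → ℝ := fun k => 1 / ((k : ℝ) + 1) with hak
  have hak0 : ∀ k, 0 < ak k := fun k => by rw [hak]; positivity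
  have hak1 : ∀ k, ak k ≤ 1 := fun k => by rw [hak]; simp only; rw [div_le_one (by positivity)]; linarith [Nat.cast_nonneg (α := ℝ) k]
  have hlim : ∀ y : E, ‖∫ ξ, (starRingEnd ℂ) (ph y ξ) * (((Real.sin (τ * ‖ξ‖) : ℝ) : ℂ) * ft F ξ)‖ₑ = Filter.liminf (fun k => ‖wa (ak k) τ F y‖ₑ) Filter.atTop := fun y => by
    refine (Filter.Tendsto.liminf_eq ((continuous_enorm.tendsto _).comp ?_)).symm
    refine tendsto_integral_of_dominated_convergence (fun ξ => ‖ft F ξ‖) (fun k => (cph_int y _ (wac_int _ τ (hak0 k) F hm)).1) hfi.norm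
      (fun k => of_forall fun ξ => ?_) (of_forall fun ξ => ?_)
    · rw [norm_mul, norm_mul, RCLike.norm_conj, norm_ph, one_mul, norm_real, norm_mul, Real.norm_of_nonneg (Real.exp_pos _).le]
      refine mul_le_of_le_one_left (norm_nonneg _) (mul_le_one₀ (Real.exp_le_one_iff.2 ?_) (norm_nonneg _) (Real.abs_sin_le_one _))
      have := norm_nonneg ξ
      nlinarith [hak0 k]
    · have h3 : Filter.Tendsto ak Filter.atTop (nhds 0) := tendsto_one_div_add_atTop_nhds_zero_nat
      have h4 : Continuous fun a : ℝ => (starRingEnd ℂ) (ph y ξ) * (((Real.exp (-a * ‖ξ‖) * Real.sin (τ * ‖ξ‖) : ℝ) : ℂ) * ft F ξ) := by fun_prop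
      have := (h4.tendsto 0).comp h3
      simpa [Function.comp_def] using this
  rw [lintegral_congr hlim]
  refine (lintegral_liminf_le fun k => (wa_meas (ak k) τ F hm).enorm).trans ?_
  exact Filter.liminf_le_of_frequently_le' (Filter.Frequently.of_forall fun k => hbd _ (hak0 k) (hak1 k))
end SE
section SE

theorem four_ph (f : E → ℂ) (w : E) : 𝓕 f w = ∫ v, (starRingEnd ℂ) (ph v w) * f v := by
  rw [Real.fourier_eq']
  refine integral_congr_ae (of_forall fun v => ?_)
  simp only [ph, smul_eq_mul, ← Complex.exp_conj, map_mul, conj_I, conj_ofReal]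
  congr 2
  push_cast; ring

theorem finv_ph (f : E → ℂ) (w : E) : 𝓕⁻ f w = ft f w := by
  rw [Real.fourierInv_eq']
  refine integral_congr_ae (of_forall fun v => ?_)
  simp only [ph, smul_eq_mul, mul_comm]

theorem conj_ph_sub (y a b : E) (R : ℝ) : (starRingEnd ℂ) (ph y (a - R • b)) = (starRingEnd ℂ) (ph y a) * ph b (R • y) := by
  unfold ph
  rw [← Complex.exp_conj, ← Complex.exp_conj, ← Complex.exp_add]
  congr 1
  simp only [map_mul, conj_I, conj_ofReal, inner_sub_right, inner_smul_right, real_inner_comm b y]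
  push_cast; ring

theorem schw_dec (g : 𝓢(E, ℂ)) (k : ℕ) : ∃ C, 0 ≤ C ∧ ∀ x, ‖g x‖ ≤ C * (1 + ‖x‖)⁻¹ ^ k := by
  refine ⟨2 ^ k * ((Finset.Iic ((k, 0) : ℕ × ℕ)).sup fun m => SchwartzMap.seminorm ℝ m.1 m.2) g, mul_nonneg (by positivity) (apply_nonneg _ _), fun x => ?_⟩
  have := SchwartzMap.one_add_le_sup_seminorm_apply (𝕜 := ℝ) (m := (k, 0)) le_rfl le_rfl g x
  rw [norm_iteratedFDeriv_zero] at this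
  rw [inv_pow, ← div_eq_mul_inv, le_div_iff₀ (by positivity), mul_comm]
  exact this

theorem psi_form (θ g : 𝓢(E, ℂ)) (R : ℝ) (ξ : E) :
    𝓕 (fun y => θ (R • y) * 𝓕⁻ (g : E → ℂ) y) ξ = ∫ ζ, 𝓕 (θ : E → ℂ) ζ * g (ξ - R • ζ) := by
  rw [four_ph]
  have i1 : Integrable (𝓕 (θ : E → ℂ)) := by rw [← SchwartzMap.fourier_coe]; exact SchwartzMap.integrable _
  have i2 : Integrable (𝓕⁻ (g : E → ℂ)) := by rw [← SchwartzMap.fourierInv_coe]; exact SchwartzMap.integrable _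
  have e1 : ∀ x, θ x = ft (𝓕 (θ : E → ℂ)) x := fun x => by
    rw [← finv_ph, ← SchwartzMap.fourier_coe, ← SchwartzMap.fourierInv_coe, FourierTransform.fourierInv_fourier_eq]
  have e2 : ∀ x, g x = ∫ v, (starRingEnd ℂ) (ph v x) * 𝓕⁻ (g : E → ℂ) v := fun x => by
    rw [← four_ph, ← SchwartzMap.fourierInv_coe, ← SchwartzMap.fourier_coe, FourierTransform.fourier_fourierInv_eq]
  have hm : Measurable fun q : E × E => (starRingEnd ℂ) (ph q.1 ξ) * ph q.2 (R • q.1) := by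
    unfold ph; exact Continuous.measurable (by fun_prop)
  calc _ = ∫ y, ∫ ζ, ((starRingEnd ℂ) (ph y ξ) * ph ζ (R • y)) * (𝓕⁻ (g : E → ℂ) y * 𝓕 (θ : E → ℂ) ζ) := by
        refine integral_congr_ae (of_forall fun y => ?_)
        simp only
        rw [e1]; unfold ft
        rw [← mul_assoc, mul_comm, ← mul_assoc, ← integral_const_mul]
        refine integral_congr_ae (of_forall fun ζ => ?_)
        simp only; ring
    _ = ∫ ζ, ∫ y, ((starRingEnd ℂ) (ph y ξ) * ph ζ (R • y)) * (𝓕⁻ (g : E → ℂ) y * 𝓕 (θ : E → ℂ) ζ) := by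
        refine integral_integral_swap (f := fun y ζ => ((starRingEnd ℂ) (ph y ξ) * ph ζ (R • y)) * (𝓕⁻ (g : E → ℂ) y * 𝓕 (θ : E → ℂ) ζ)) ?_
        refine (i2.mul_prod i1).bdd_mul (c := 1) hm.aestronglyMeasurable (of_forall fun q => ?_)
        rw [norm_mul, RCLike.norm_conj, norm_ph, norm_ph, one_mul]
    _ = _ := by
        refine integral_congr_ae (of_forall fun ζ => ?_)
        simp only
        rw [e2, ← integral_const_mul]
        refine integral_congr_ae (of_forall fun y => ?_)
        simp only
        rw [conj_ph_sub]; ring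

theorem psi_bd (θ g : 𝓢(E, ℂ)) : ∃ C : ℝ, 0 ≤ C ∧ ∃ b : E → ℝ, Integrable b ∧ ∀ R : ℝ, 0 ≤ R → R ≤ 1 → ∀ ξ ζ : E,
    ‖𝓕 (θ : E → ℂ) ζ * g (ξ - R • ζ)‖ ≤ b ζ * (C * (1 + ‖ξ‖)⁻¹ ^ (dimR E + 1)) := by
  obtain ⟨Cg, hCg, hg⟩ := schw_dec g (dimR E + 1)
  obtain ⟨Ct, hCt, ht⟩ := schw_dec (𝓕 θ) (dimR E + 1 + (dimR E + 1))
  refine ⟨Cg, hCg, fun ζ => Ct * (1 + ‖ζ‖)⁻¹ ^ (dimR E + 1), ?_, fun R h0 h1 ξ ζ => ?_⟩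
  · refine Integrable.const_mul ?_ _
    have := (integrable_one_add_norm (E := E) (μ := volume) (r := (dimR E + 1 : ℕ)) (by push_cast; linarith))
    refine this.congr (of_forall fun ξ => ?_)
    have h0 : 0 ≤ 1 + ‖ξ‖ := by positivity
    simp only
    rw [Real.rpow_neg h0, Real.rpow_natCast, ← inv_pow]
  · rw [norm_mul, ← SchwartzMap.fourier_coe]
    have h2 : (1 + ‖ξ - R • ζ‖)⁻¹ ≤ (1 + ‖ζ‖) * (1 + ‖ξ‖)⁻¹ := by
      rw [← div_eq_mul_inv, inv_eq_one_div, div_le_div_iff₀ (by positivity) (by positivity)]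
      have h3 : ‖ξ‖ ≤ ‖ξ - R • ζ‖ + ‖ζ‖ := by
        have := norm_add_le (ξ - R • ζ) (R • ζ)
        rw [sub_add_cancel, norm_smul, Real.norm_of_nonneg h0] at this
        nlinarith [norm_nonneg ζ]
      nlinarith [norm_nonneg ζ, norm_nonneg (ξ - R • ζ), mul_nonneg (norm_nonneg ζ) (norm_nonneg (ξ - R • ζ))]
    calc _ ≤ (Ct * (1 + ‖ζ‖)⁻¹ ^ (dimR E + 1 + (dimR E + 1))) * (Cg * ((1 + ‖ζ‖) * (1 + ‖ξ‖)⁻¹) ^ (dimR E + 1)) :=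
          mul_le_mul (ht ζ) ((hg _).trans (mul_le_mul_of_nonneg_left (pow_le_pow_left₀ (by positivity) h2 _) hCg)) (norm_nonneg _) (by positivity)
      _ = _ := by
          have : (1 + ‖ζ‖)⁻¹ ^ (dimR E + 1) * (1 + ‖ζ‖) ^ (dimR E + 1) = 1 := by
            rw [← mul_pow, inv_mul_cancel₀ (by positivity), one_pow]
          rw [pow_add, mul_pow]
          linear_combination (Ct * (1 + ‖ζ‖)⁻¹ ^ (dimR E + 1) * Cg * (1 + ‖ξ‖)⁻¹ ^ (dimR E + 1)) * this

theorem exists_theta (E : Type*) [NormedAddCommGroup E] [InnerProductSpace ℝ E] [FiniteDimensional ℝ E]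
    [MeasurableSpace E] [BorelSpace E] : ∃ θ : 𝓢(E, ℂ), HasCompactSupport θ ∧ θ 0 = 1 := by
  let f : ContDiffBump (0 : E) := ⟨1, 2, one_pos, one_lt_two⟩
  have h1 : HasCompactSupport fun x => ((f x : ℝ) : ℂ) := f.hasCompactSupport.comp_left (g := fun x : ℝ => (x : ℂ)) (by simp)
  have h2 : ContDiff ℝ ((⊤ : ℕ∞) : WithTop ℕ∞) fun x => ((f x : ℝ) : ℂ) := Complex.ofRealCLM.contDiff.comp f.contDiff
  refine ⟨h1.toSchwartzMap h2, h1, ?_⟩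
  change ((f 0 : ℝ) : ℂ) = 1
  rw [f.one_of_mem_closedBall (by simp [f]), ofReal_one]

theorem WW_dom (D : E → ℂ) (hDm : AEStronglyMeasurable D) (hD : ∫⁻ ξ, WW ξ * ‖D ξ‖ₑ ≠ ⊤) :
    Integrable fun ξ => (1 + ‖ξ‖)⁻¹ ^ (dimR E + 1) * ‖D ξ‖ := by
  refine ⟨Measurable.aestronglyMeasurable (by fun_prop) |>.mul hDm.norm, ?_⟩
  rw [hasFiniteIntegral_iff_enorm]
  refine lt_of_eq_of_lt (lintegral_congr fun ξ => ?_) hD.lt_top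
  rw [enorm_mul, enorm_norm, Real.enorm_of_nonneg (by positivity)]; rfl

theorem test_zero (D : E → ℂ) (hDm : AEStronglyMeasurable D) (hD : ∫⁻ ξ, WW ξ * ‖D ξ‖ₑ ≠ ⊤)
    (h : ∀ φ : 𝓢(E, ℂ), HasCompactSupport φ → ∫ ξ, D ξ * 𝓕 (φ : E → ℂ) ξ = 0) : ∀ᵐ ξ, D ξ = 0 := by
  have hdi := WW_dom D hDm hD
  have hloc : LocallyIntegrable D := by
    have hc : Continuous fun ξ : E => (1 + ‖ξ‖) ^ (dimR E + 1) := by fun_prop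
    refine (hdi.locallyIntegrable.mul_continuous hc).mono hDm (of_forall fun ξ => le_of_eq ?_)
    rw [mul_right_comm, ← mul_pow, inv_mul_cancel₀ (by positivity), one_pow, one_mul, norm_norm]
  refine ae_eq_zero_of_integral_contDiff_smul_eq_zero hloc fun g0 hg1 hg2 => ?_
  have k1 : HasCompactSupport fun x => ((g0 x : ℝ) : ℂ) := hg2.comp_left (g := fun x : ℝ => (x : ℂ)) (by simp)
  have k2 : ContDiff ℝ ((⊤ : ℕ∞) : WithTop ℕ∞) fun x => ((g0 x : ℝ) : ℂ) := Complex.ofRealCLM.contDiff.comp hg1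
  set g : 𝓢(E, ℂ) := k1.toSchwartzMap k2
  obtain ⟨θ, hθ, hθ0⟩ := exists_theta E
  obtain ⟨C, hC, b, hb, hbd⟩ := psi_bd θ g
  set ak : ℕ → ℝ := fun k => 1 / ((k : ℝ) + 1) with hak
  have hak0 : ∀ k, 0 < ak k := fun k => by rw [hak]; positivity
  have hak1 : ∀ k, ak k ≤ 1 := fun k => by rw [hak]; simp only; rw [div_le_one (by positivity)]; linarith [Nat.cast_nonneg (α := ℝ) k]
  have hak2 : Filter.Tendsto ak Filter.atTop (nhds 0) := tendsto_one_div_add_atTop_nhds_zero_nat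
  have ct : Continuous (𝓕 (θ : E → ℂ)) := by rw [← SchwartzMap.fourier_coe]; exact SchwartzMap.continuous _
  have hz : ∀ k, ∫ ξ, D ξ * (∫ ζ, 𝓕 (θ : E → ℂ) ζ * g (ξ - ak k • ζ)) = 0 := fun k => by
    have c1 : HasCompactSupport fun y => θ (ak k • y) * 𝓕⁻ (g : E → ℂ) y :=
      (hθ.comp_smul (hak0 k).ne').mul_right
    have c2 : ContDiff ℝ ((⊤ : ℕ∞) : WithTop ℕ∞) fun y => θ (ak k • y) * 𝓕⁻ (g : E → ℂ) y := by
      refine ContDiff.mul ((θ.smooth ⊤).comp (contDiff_const_smul _)) ?_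
      rw [← SchwartzMap.fourierInv_coe]; exact SchwartzMap.smooth _ ⊤
    rw [← h (c1.toSchwartzMap c2) c1]
    refine integral_congr_ae (of_forall fun ξ => ?_)
    simp only
    rw [← psi_form]; rfl
  have hl : Filter.Tendsto (fun k => ∫ ξ, D ξ * (∫ ζ, 𝓕 (θ : E → ℂ) ζ * g (ξ - ak k • ζ))) Filter.atTop (nhds (∫ ξ, g0 ξ • D ξ)) := by
    have im : ∀ k, Continuous fun q : E × E => 𝓕 (θ : E → ℂ) q.2 * g (q.1 - ak k • q.2) := fun k =>
      (ct.comp continuous_snd).mul (g.continuous.comp (by fun_prop))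
    refine tendsto_integral_of_dominated_convergence (fun ξ => (C * ∫ ζ, b ζ) * ((1 + ‖ξ‖)⁻¹ ^ (dimR E + 1) * ‖D ξ‖))
      (fun k => hDm.mul ((im k).stronglyMeasurable.integral_prod_right' (ν := (volume : Measure E))).aestronglyMeasurable) (hdi.const_mul _)
      (fun k => of_forall fun ξ => ?_) (of_forall fun ξ => ?_)
    · have := norm_integral_le_of_norm_le (hb.mul_const (C * (1 + ‖ξ‖)⁻¹ ^ (dimR E + 1))) (of_forall (hbd (ak k) (hak0 k).le (hak1 k) ξ))
      rw [integral_mul_const] at this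
      rw [norm_mul]
      refine (mul_le_mul_of_nonneg_left this (norm_nonneg _)).trans (le_of_eq ?_)
      ring
    · have e0 : g0 ξ • D ξ = D ξ * ∫ ζ, 𝓕 (θ : E → ℂ) ζ * g ξ := by
        rw [integral_mul_const, show (∫ ζ, 𝓕 (θ : E → ℂ) ζ) = 1 from ?_, one_mul, mul_comm]
        · rfl
        · have e1 : ft (𝓕 (θ : E → ℂ)) 0 = 1 := by
            rw [← finv_ph, ← SchwartzMap.fourier_coe, ← SchwartzMap.fourierInv_coe, FourierTransform.fourierInv_fourier_eq, hθ0]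
          rw [← e1]; unfold ft ph; simp
      rw [e0]
      refine Filter.Tendsto.const_mul _ ?_
      refine tendsto_integral_of_dominated_convergence _ (fun k => Continuous.aestronglyMeasurable ((im k).comp (f := fun ζ => (ξ, ζ)) (by fun_prop)))
        (hb.mul_const (C * (1 + ‖ξ‖)⁻¹ ^ (dimR E + 1))) (fun k => of_forall (hbd (ak k) (hak0 k).le (hak1 k) ξ)) (of_forall fun ζ => ?_)
      have h4 : Continuous fun a : ℝ => 𝓕 (θ : E → ℂ) ζ * g (ξ - a • ζ) := continuous_const.mul (g.continuous.comp (by fun_prop))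
      have := (h4.tendsto 0).comp hak2
      simpa [Function.comp_def] using this
  simp only [hz] at hl
  exact (tendsto_nhds_unique hl tendsto_const_nhds)
end SE
section SE

theorem ft_swap (F ψ : E → ℂ) (hF : Integrable F) (hψ : Integrable ψ) : ∫ ξ, ft F ξ * ψ ξ = ∫ x, F x * ft ψ x := by
  have hm : Measurable fun q : E × E => ph q.2 q.1 := by unfold ph; exact Continuous.measurable (by fun_prop)
  calc _ = ∫ ξ, ∫ x, ph x ξ * (ψ ξ * F x) := by
        refine integral_congr_ae (of_forall fun ξ => ?_)
        simp only [ft]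
        rw [← integral_mul_const]
        refine integral_congr_ae (of_forall fun x => ?_)
        simp only; ring
    _ = ∫ x, ∫ ξ, ph x ξ * (ψ ξ * F x) := by
        refine integral_integral_swap (f := fun ξ x => ph x ξ * (ψ ξ * F x)) ?_
        exact (hψ.mul_prod hF).bdd_mul (c := 1) hm.aestronglyMeasurable (of_forall fun q => (norm_ph _ _).le)
    _ = _ := by
        refine integral_congr_ae (of_forall fun x => ?_)
        simp only [ft]
        rw [← integral_const_mul]
        refine integral_congr_ae (of_forall fun ξ => ?_)
        simp only [ph_comm ξ x]; ring

/-- sine propagator applied to a slice -/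
def vv (G : E × ℝ → ℂ) (t s : ℝ) (y : E) : ℂ :=
  ∫ ξ, (starRingEnd ℂ) (ph y ξ) * (((Real.sin ((t - s) * ‖ξ‖) : ℝ) : ℂ) * ft (fun x => G (x, s)) ξ)

/-- Duhamel term -/
def hh (G : E × ℝ → ℂ) (t : ℝ) (y : E) : ℂ := ∫ s in Set.Iic t, vv G t s y

theorem vv_meas (G : E × ℝ → ℂ) (hG : Measurable G) (t : ℝ) : Measurable fun q : ℝ × E => vv G t q.1 q.2 := by
  have h : Measurable fun q : (ℝ × E) × E => (starRingEnd ℂ) (ph q.1.2 q.2) * (((Real.sin ((t - q.1.1) * ‖q.2‖) : ℝ) : ℂ) * ft (fun x => G (x, q.1.1)) q.2) := by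
    refine (Complex.continuous_conj.measurable.comp ?_).mul (Measurable.mul (by fun_prop) ((ftg_meas G hG).comp (f := fun q : (ℝ × E) × E => (q.2, q.1.1)) (by fun_prop)))
    unfold ph; exact Continuous.measurable (by fun_prop)
  exact (h.stronglyMeasurable.integral_prod_right (ν := (volume : Measure E))).measurable

theorem hh_meas (G : E × ℝ → ℂ) (hG : Measurable G) (t : ℝ) : Measurable (hh G t) :=
  (((vv_meas G hG t).comp measurable_swap).stronglyMeasurable.integral_prod_right' (ν := volume.restrict (Set.Iic t))).measurable

theorem vv_loc (hn : 0 < dimR E) (ρ l S : ℝ) (hρ1 : 1 < ρ) (hl0 : 0 < l) (hl1 : l < 1)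
    (G : E × ℝ → ℂ) (hG : Src ρ l S G) (hft : ∀ s, Integrable (ft fun x => G (x, s))) (t : ℝ) (φ : E → ℂ) (hφ : Continuous φ) (hφc : HasCompactSupport φ) :
    Integrable (fun q : ℝ × E => φ q.2 * vv G t q.1 q.2) ((volume.restrict (Set.Iic t)).prod volume) := by
  have hm : Measurable fun q : ℝ × E => φ q.2 * vv G t q.1 q.2 := (hφ.measurable.comp measurable_snd).mul (vv_meas G hG.meas t)
  have hgood := hG.good (by linarith) hl0 hl1
  refine ⟨hm.aestronglyMeasurable, ?_⟩
  rw [hasFiniteIntegral_iff_enorm, lintegral_prod _ hm.enorm.aemeasurable]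
  obtain ⟨M, hM⟩ := hφ.bounded_above_of_compact_support hφc
  obtain ⟨R0, hR0⟩ := hφc.isCompact.isBounded.subset_ball (0 : E)
  set R := max R0 0
  have hR : tsupport φ ⊆ ball 0 R := hR0.trans (ball_subset_ball (le_max_left _ _))
  obtain ⟨B, hB⟩ := hG.loc (2 * R + 2 + (t + S))
  obtain ⟨C1, C2, hC1, hC2, hw⟩ := wave_loc hn ρ hρ1.le R (t + S) B (le_max_right _ _)
  have hbd : ∀ s ∈ Set.Iic t, ∫⁻ y, ‖φ y * vv G t s y‖ₑ ≤ (Set.Icc (-S) t).indicator (fun _ => ofR M * C1) s + ofR M * C2 * sl ρ G s := by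
    intro s hs
    by_cases hsS : s ∈ Set.Icc (-S) t
    · rw [Set.indicator_of_mem hsS]
      calc _ ≤ ∫⁻ y, (ball 0 R).indicator (fun y => ofR M * ‖vv G t s y‖ₑ) y := by
            refine lintegral_mono fun y => ?_
            by_cases hy : y ∈ ball (0 : E) R
            · rw [Set.indicator_of_mem hy, enorm_mul]
              refine mul_le_mul' ?_ le_rfl
              rw [← ofReal_norm]; exact ofReal_le_ofReal (hM y)
            · rw [image_eq_zero_of_notMem_tsupport (fun h => hy (hR h))]; simp
        _ = ofR M * ∫⁻ y in ball 0 R, ‖vv G t s y‖ₑ := by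
            rw [lintegral_indicator measurableSet_ball, lintegral_const_mul' _ _ ofReal_ne_top]
        _ ≤ ofR M * (C1 + C2 * sl ρ G s) := by
            refine mul_le_mul' le_rfl ?_
            exact hw (t - s) (by linarith [hsS.2]) (by linarith [hsS.1]) (fun x => G (x, s)) (hgood.sm s) (hG.int s) (hft s) fun x hx => hB (x, s) hx
        _ = _ := by ring
    · have hz : ∀ y, vv G t s y = 0 := fun y => by
        have h0 : ∀ x : E, G (x, s) = 0 := fun x => hG.supp (x, s) (by
          have : s < -S := by by_contra h; exact hsS ⟨by linarith, hs⟩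
          exact lt_of_lt_of_le (by linarith) (neg_le_abs s))
        unfold vv ft
        simp [h0]
      simp [hz]
  refine (setLIntegral_mono' measurableSet_Iic hbd).trans_lt ((setLIntegral_le_lintegral _ _).trans_lt ?_)
  rw [lintegral_add_left (measurable_const.indicator measurableSet_Icc), lintegral_indicator measurableSet_Icc, setLIntegral_const, lintegral_const_mul' _ _ (mul_ne_top ofReal_ne_top hC2)]
  refine ENNReal.add_lt_top.2 ⟨mul_lt_top (mul_lt_top ofReal_lt_top hC1.lt_top) (by simp [Real.volume_Icc]), mul_lt_top (mul_lt_top ofReal_lt_top hC2.lt_top) hgood.fin.lt_top⟩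

theorem four_swap (c φ : E → ℂ) (hc : Integrable c) (hφ : Integrable φ) :
    ∫ ξ, c ξ * 𝓕 φ ξ = ∫ y, φ y * ∫ ξ, (starRingEnd ℂ) (ph y ξ) * c ξ := by
  have hm : Measurable fun q : E × E => (starRingEnd ℂ) (ph q.2 q.1) := by unfold ph; exact Continuous.measurable (by fun_prop)
  calc _ = ∫ ξ, ∫ y, (starRingEnd ℂ) (ph y ξ) * (c ξ * φ y) := by
        refine integral_congr_ae (of_forall fun ξ => ?_)
        simp only
        rw [four_ph, ← integral_const_mul]
        refine integral_congr_ae (of_forall fun x => ?_)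
        simp only; ring
    _ = ∫ y, ∫ ξ, (starRingEnd ℂ) (ph y ξ) * (c ξ * φ y) := by
        refine integral_integral_swap (f := fun ξ y => (starRingEnd ℂ) (ph y ξ) * (c ξ * φ y)) ?_
        exact (hc.mul_prod hφ).bdd_mul (c := 1) hm.aestronglyMeasurable (of_forall fun q => by rw [RCLike.norm_conj, norm_ph])
    _ = _ := by
        refine integral_congr_ae (of_forall fun y => ?_)
        simp only
        rw [← integral_const_mul]
        refine integral_congr_ae (of_forall fun ξ => ?_)
        simp only; ring

theorem Hs_wt (ρ l S : ℝ) (hρ1 : 1 < ρ) (hρ2 : ρ < 2) (G : E × ℝ → ℂ) (hG : Good ρ G) (t : ℝ) : ∫⁻ ξ, WW ξ * ‖Hs G t ξ‖ₑ ≠ ⊤ :=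
  ((lintegral_mono fun ξ => mul_le_mul' le_rfl (Hs_le G t ξ)).trans_lt ((ftg_l1 ρ hρ1 hρ2 G hG).trans_lt (mul_lt_top (CU_ne_top ρ hρ1 hρ2).lt_top hG.fin.lt_top))).ne

theorem schw_WW (g : 𝓢(E, ℂ)) : ∃ C : ℝ≥0∞, C ≠ ⊤ ∧ ∀ ξ, ‖g ξ‖ₑ ≤ C * WW ξ := by
  obtain ⟨C, hC, h⟩ := schw_dec g (dimR E + 1)
  refine ⟨ofR C, ofReal_ne_top, fun ξ => ?_⟩
  rw [WW, ← ENNReal.ofReal_mul hC, ← ofReal_norm]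
  exact ofReal_le_ofReal (h ξ)

theorem Hs_swap (hn : 0 < dimR E) (ρ l S : ℝ) (hρ1 : 1 < ρ) (hρ2 : ρ < 2) (hl0 : 0 < l) (hl1 : l < 1)
    (G : E × ℝ → ℂ) (hG : Src ρ l S G) (hft : ∀ s, Integrable (ft fun x => G (x, s))) (t : ℝ) (φ : 𝓢(E, ℂ)) (hφc : HasCompactSupport φ) :
    ∫ ξ, Hs G t ξ * 𝓕 (φ : E → ℂ) ξ = ∫ y, hh G t y * φ y := by
  have hgood := hG.good (by linarith) hl0 hl1
  obtain ⟨C, hC, hCW⟩ := schw_WW (𝓕 φ)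
  rw [SchwartzMap.fourier_coe] at hCW
  have ct : Continuous (𝓕 (φ : E → ℂ)) := by rw [← SchwartzMap.fourier_coe]; exact SchwartzMap.continuous _
  have hm : Measurable fun q : E × ℝ => (((Real.sin ((t - q.2) * ‖q.1‖) : ℝ) : ℂ) * ft (fun x => G (x, q.2)) q.1) * 𝓕 (φ : E → ℂ) q.1 :=
    Measurable.mul (Measurable.mul (by fun_prop) (ftg_meas G hG.meas)) (ct.measurable.comp measurable_fst)
  have hsin : ∀ a : ℝ, ‖((Real.sin a : ℝ) : ℂ)‖ ≤ 1 := fun a => by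
    rw [norm_real, Real.norm_eq_abs]; exact Real.abs_sin_le_one _
  calc _ = ∫ ξ, ∫ s in Set.Iic t, (((Real.sin ((t - s) * ‖ξ‖) : ℝ) : ℂ) * ft (fun x => G (x, s)) ξ) * 𝓕 (φ : E → ℂ) ξ := by
        refine integral_congr_ae (of_forall fun ξ => ?_)
        simp only [Hs]
        rw [← integral_mul_const]
    _ = ∫ s in Set.Iic t, ∫ ξ, (((Real.sin ((t - s) * ‖ξ‖) : ℝ) : ℂ) * ft (fun x => G (x, s)) ξ) * 𝓕 (φ : E → ℂ) ξ := by
        refine integral_integral_swap (f := fun ξ s => (((Real.sin ((t - s) * ‖ξ‖) : ℝ) : ℂ) * ft (fun x => G (x, s)) ξ) * 𝓕 (φ : E → ℂ) ξ) ⟨hm.aestronglyMeasurable, ?_⟩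
        rw [hasFiniteIntegral_iff_enorm]
        refine lt_of_eq_of_lt (lintegral_prod _ hm.enorm.aemeasurable) ?_
        refine lt_of_le_of_lt (b := C * ∫⁻ ξ, WW ξ * ∫⁻ s, ‖ft (fun x => G (x, s)) ξ‖ₑ) ?_ (mul_lt_top hC.lt_top ((ftg_l1 ρ hρ1 hρ2 G hgood).trans_lt (mul_lt_top (CU_ne_top ρ hρ1 hρ2).lt_top hgood.fin.lt_top)))
        rw [← lintegral_const_mul' _ _ hC]
        refine lintegral_mono fun ξ => (setLIntegral_le_lintegral _ _).trans ?_
        rw [← mul_assoc, ← lintegral_const_mul' _ _ (mul_ne_top hC (WW_ne_top ξ))]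
        refine lintegral_mono fun s => ?_
        simp only [Function.uncurry_apply_pair]
        rw [enorm_mul, enorm_mul, mul_comm]
        refine mul_le_mul' (hCW ξ) ((mul_le_mul' ?_ le_rfl).trans (one_mul _).le)
        rw [← ofReal_norm]; exact ENNReal.ofReal_le_one.2 (hsin _)
    _ = ∫ s in Set.Iic t, ∫ y, φ y * vv G t s y := by
        refine integral_congr_ae (of_forall fun s => ?_)
        exact four_swap (fun ξ => (((Real.sin ((t - s) * ‖ξ‖) : ℝ) : ℂ) * ft (fun x => G (x, s)) ξ)) φ ((hft s).bdd_mul (c := 1) (by fun_prop) (of_forall fun ξ => hsin _)) φ.integrable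
    _ = ∫ y, ∫ s in Set.Iic t, φ y * vv G t s y :=
        integral_integral_swap (f := fun s y => φ y * vv G t s y) (vv_loc hn ρ l S hρ1 hl0 hl1 G hG hft t φ φ.continuous hφc)
    _ = _ := by
        refine integral_congr_ae (of_forall fun y => ?_)
        simp only [hh]
        rw [integral_const_mul, mul_comm]

theorem ident (hn : 0 < dimR E) (ρ l S : ℝ) (hρ1 : 1 < ρ) (hρ2 : ρ < 2) (hl0 : 0 < l) (hl1 : l < 1)
    (G : E × ℝ → ℂ) (hG : Src ρ l S G) (hft : ∀ s, Integrable (ft fun x => G (x, s))) (t : ℝ) (hi : Integrable (hh G t)) :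
    ∀ᵐ ξ, ft (hh G t) ξ = Hs G t ξ := by
  have hgood := hG.good (by linarith) hl0 hl1
  have m1 : Measurable (ft (hh G t)) := meas_ft _ (hh_meas G hG.meas t)
  have m2 : Measurable (Hs G t) := (Hs_meas G hG.meas).comp (f := fun ξ : E => (ξ, t)) (by fun_prop)
  have w1 : ∫⁻ ξ, WW ξ * ‖ft (hh G t) ξ‖ₑ ≠ ⊤ := by
    refine (lt_of_le_of_lt (lintegral_mono fun ξ => mul_le_mul' le_rfl (?_ : _ ≤ ofR (∫ x, ‖hh G t x‖))) ?_).ne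
    · rw [← ofReal_norm]; exact ofReal_le_ofReal (norm_ft_le _ _)
    · rw [lintegral_mul_const' _ _ ofReal_ne_top]; exact mul_lt_top WW_int.lt_top ofReal_lt_top
  have w2 := Hs_wt ρ l S hρ1 hρ2 G hgood t
  have hI : ∀ D : E → ℂ, Measurable D → ∫⁻ ξ, WW ξ * ‖D ξ‖ₑ ≠ ⊤ → ∀ φ : 𝓢(E, ℂ), Integrable fun ξ => D ξ * 𝓕 (φ : E → ℂ) ξ := by
    intro D hD hw φ
    obtain ⟨C, hC, hCW⟩ := schw_WW (𝓕 φ)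
    rw [← SchwartzMap.fourier_coe]
    refine ⟨hD.aestronglyMeasurable.mul (SchwartzMap.continuous _).aestronglyMeasurable, ?_⟩
    rw [hasFiniteIntegral_iff_enorm]
    refine lt_of_le_of_lt (lintegral_mono fun ξ => (?_ : _ ≤ C * (WW ξ * ‖D ξ‖ₑ))) ?_
    · rw [enorm_mul, mul_comm, ← mul_assoc]; exact mul_le_mul' (hCW ξ) le_rfl
    · rw [lintegral_const_mul' _ _ hC]; exact mul_lt_top hC.lt_top hw.lt_top
  have := test_zero (fun ξ => ft (hh G t) ξ - Hs G t ξ) (m1.sub m2).aestronglyMeasurable ?_ fun φ hφ => ?_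
  · filter_upwards [this] with ξ h using sub_eq_zero.1 h
  · refine (lt_of_le_of_lt (lintegral_mono fun ξ => (?_ : _ ≤ WW ξ * ‖ft (hh G t) ξ‖ₑ + WW ξ * ‖Hs G t ξ‖ₑ)) ?_).ne
    · rw [← mul_add]; exact mul_le_mul' le_rfl (enorm_sub_le)
    · rw [lintegral_add_left (show Measurable fun ξ => WW ξ * ‖ft (hh G t) ξ‖ₑ from WW_meas.mul m1.enorm)]; exact ENNReal.add_lt_top.2 ⟨w1.lt_top, w2.lt_top⟩
  · simp only [sub_mul]
    rw [integral_sub (hI _ m1 w1 φ) (hI _ m2 w2 φ), Hs_swap hn ρ l S hρ1 hρ2 hl0 hl1 G hG hft t φ hφ,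
      ft_swap _ _ hi (by rw [← SchwartzMap.fourier_coe]; exact SchwartzMap.integrable _), sub_eq_zero]
    refine integral_congr_ae (of_forall fun x => ?_)
    simp only
    rw [← finv_ph, ← SchwartzMap.fourier_coe, ← SchwartzMap.fourierInv_coe, FourierTransform.fourierInv_fourier_eq]
end SE
section SE

theorem mult_eq (m : ℝ → ℂ) (h : E → ℂ) (x : E) :
    𝓕⁻ (fun ξ : E => m ‖ξ‖ * 𝓕 h ξ) x = ∫ ξ, (starRingEnd ℂ) (ph x ξ) * (m ‖ξ‖ * ft h ξ) := by
  have hc : ∀ a b : E, ph (-a) b = (starRingEnd ℂ) (ph b a) := fun a b => by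
    unfold ph
    rw [← Complex.exp_conj, inner_neg_left, real_inner_comm, map_mul, conj_I, conj_ofReal]
    congr 1
    push_cast; ring
  rw [finv_ph, ft, ← integral_neg_eq_self]
  refine integral_congr_ae (of_forall fun ξ => ?_)
  simp only [norm_neg, four_ph, ft]
  rw [hc, mul_comm]
  congr 2
  refine integral_congr_ae (of_forall fun v => ?_)
  simp only
  rw [ph_comm, hc, Complex.conj_conj, mul_comm]

/-- the shell -/
def shl (k : ℕ) : Set E := {ξ | 1 / ((k : ℝ) + 1) ≤ ‖ξ‖} ∩ {ξ | ‖ξ‖ ≤ (k : ℝ) + 1}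

/-- truncated power -/
def pwk (a : ℝ) (k : ℕ) : E → ℂ := (shl k).indicator fun ξ => ((‖ξ‖ ^ a : ℝ) : ℂ)

theorem mk_meas (a : ℝ) (k : ℕ) : Measurable (pwk a k : E → ℂ) := by
  refine Measurable.indicator (by fun_prop) (MeasurableSet.inter ?_ ?_)
  · exact measurableSet_le (f := fun _ : E => 1 / ((k : ℝ) + 1)) (g := fun ξ => ‖ξ‖) (by fun_prop) (by fun_prop)
  · exact measurableSet_le (f := fun ξ : E => ‖ξ‖) (g := fun _ => (k : ℝ) + 1) (by fun_prop) (by fun_prop)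

theorem mk_le (a : ℝ) (ha : a < 0) (k : ℕ) (ξ : E) :
    ‖pwk a k ξ‖ₑ ≤ ofR ((1 / ((k : ℝ) + 1)) ^ a * ((k : ℝ) + 2) ^ (dimR E + 1)) * WW ξ := by
  by_cases h : ξ ∈ (shl k : Set E)
  · rw [pwk, Set.indicator_of_mem h, WW, ← ENNReal.ofReal_mul (by positivity), ← ofReal_norm, norm_real, Real.norm_of_nonneg (by positivity)]
    refine ofReal_le_ofReal ?_
    have h1 : ‖ξ‖ ^ a ≤ (1 / ((k : ℝ) + 1)) ^ a := Real.rpow_le_rpow_of_nonpos (by positivity) h.1 ha.le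
    have h2 : 1 ≤ (((k : ℝ) + 2) * (1 + ‖ξ‖)⁻¹) ^ (dimR E + 1) := by
      refine one_le_pow₀ ?_
      rw [← div_eq_mul_inv, one_le_div (by positivity)]
      have := h.2; change ‖ξ‖ ≤ (k : ℝ) + 1 at this; linarith
    rw [mul_pow] at h2
    rw [mul_assoc]
    exact h1.trans (le_mul_of_one_le_right (by positivity) h2)
  · rw [pwk, Set.indicator_of_notMem h]; simp

theorem mk_int (a : ℝ) (ha : a < 0) (k : ℕ) : Integrable (pwk a k : E → ℂ) := by
  refine ⟨(mk_meas a k).aestronglyMeasurable, ?_⟩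
  rw [hasFiniteIntegral_iff_enorm]
  refine (lintegral_mono (mk_le a ha k)).trans_lt ?_
  rw [lintegral_const_mul' _ _ ofReal_ne_top]
  exact mul_lt_top ofReal_lt_top WW_int.lt_top

theorem mk_sq (a b : ℝ) (hab : b = 1 + 2 * a) (k : ℕ) (ξ : E) :
    ofR ‖ξ‖ * ‖pwk a k ξ‖ₑ ^ 2 ≤ ofR (‖ξ‖ ^ b) := by
  by_cases h : ξ ∈ (shl k : Set E)
  · have h0 : 0 < ‖ξ‖ := lt_of_lt_of_le (by positivity) h.1
    rw [pwk, Set.indicator_of_mem h, ← ofReal_norm, norm_real, Real.norm_of_nonneg (by positivity), ← ENNReal.ofReal_pow (by positivity), ← ENNReal.ofReal_mul h0.le, hab, Real.rpow_add h0, Real.rpow_one, mul_comm 2 a, Real.rpow_mul h0.le, Real.rpow_two]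
  · rw [pwk, Set.indicator_of_notMem h]; simp

theorem lim_or (hn : 0 < dimR E) (ρ l S : ℝ) (hρ1 : 1 < ρ) (hρ2 : ρ < 2) (hl0 : 0 < l) (hl1 : l < 1)
    (G : E × ℝ → ℂ) (hG : Src ρ l S G) (hft : ∀ s, Integrable (ft fun x => G (x, s))) (a : ℝ) (ha : a < 0) (t : ℝ) (x : E) :
    (∫ ξ, (starRingEnd ℂ) (ph x ξ) * (((‖ξ‖ ^ a : ℝ) : ℂ) * ft (hh G t) ξ)) = 0 ∨
    Filter.Tendsto (fun k => SU (pwk a k) G (x, t)) Filter.atTop (nhds (∫ ξ, (starRingEnd ℂ) (ph x ξ) * (((‖ξ‖ ^ a : ℝ) : ℂ) * ft (hh G t) ξ))) := by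
  by_cases hi : Integrable (hh G t)
  swap
  · left
    have h0 : ∀ ξ, ft (hh G t) ξ = 0 := fun ξ => by
      refine integral_undef fun h => hi ?_
      have := h.mul_bdd (c := 1) (f := fun x => hh G t x * ph x ξ) (g := fun x => (starRingEnd ℂ) (ph ξ x)) (cph_meas ξ).aestronglyMeasurable (of_forall fun x => by rw [RCLike.norm_conj, norm_ph])
      refine this.congr (of_forall fun x => ?_)
      simp only
      rw [ph_comm ξ x, mul_assoc, Complex.mul_conj, Complex.normSq_eq_norm_sq, norm_ph]; simp
    simp [h0]
  have hid := ident hn ρ l S hρ1 hρ2 hl0 hl1 G hG hft t hi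
  have e : (∫ ξ, (starRingEnd ℂ) (ph x ξ) * (((‖ξ‖ ^ a : ℝ) : ℂ) * ft (hh G t) ξ)) = ∫ ξ, (starRingEnd ℂ) (ph x ξ) * (((‖ξ‖ ^ a : ℝ) : ℂ) * Hs G t ξ) :=
    integral_congr_ae (hid.mono fun ξ h => by simp only [h])
  rw [e]
  by_cases hI : Integrable fun ξ => (starRingEnd ℂ) (ph x ξ) * (((‖ξ‖ ^ a : ℝ) : ℂ) * Hs G t ξ)
  swap
  · exact Or.inl (integral_undef hI)
  right
  refine tendsto_integral_of_dominated_convergence _ (fun k => ((SU_meas1 (pwk a k) (mk_meas a k) G hG.meas).comp (f := fun ξ : E => ((x, t), ξ)) (by fun_prop)).aestronglyMeasurable) hI.norm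
    (fun k => of_forall fun ξ => ?_) (of_forall fun ξ => ?_)
  · rw [norm_mul, norm_mul, norm_mul, norm_mul, mul_comm ‖pwk a k ξ‖, mul_assoc]
    refine mul_le_mul_of_nonneg_left (mul_le_mul_of_nonneg_right ?_ (norm_nonneg _)) (norm_nonneg _)
    exact norm_indicator_le_norm_self (fun ξ : E => ((‖ξ‖ ^ a : ℝ) : ℂ)) ξ
  · refine tendsto_const_nhds.congr' ?_
    by_cases h0 : ξ = 0
    · refine of_forall fun k => ?_
      have : pwk a k ξ = 0 := by
        simp only [pwk, Set.indicator]; split_ifs <;> simp [h0, Real.zero_rpow ha.ne]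
      simp only [this]; simp [h0, Real.zero_rpow ha.ne]
    · obtain ⟨k0, hk0⟩ := exists_nat_ge (max ‖ξ‖ (1 / ‖ξ‖))
      filter_upwards [Filter.eventually_ge_atTop k0] with k hk
      have hk' : (k0 : ℝ) ≤ k := by exact_mod_cast hk
      have h1 : 0 < ‖ξ‖ := norm_pos_iff.2 h0
      have h2 := (le_max_left _ _).trans hk0
      have h3 := (le_max_right _ _).trans hk0
      have : ξ ∈ (shl k : Set E) := by
        refine ⟨?_, ?_⟩
        · change 1 / ((k : ℝ) + 1) ≤ ‖ξ‖
          rw [div_le_iff₀ (by positivity)]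
          rw [div_le_iff₀ h1] at h3
          nlinarith
        · change ‖ξ‖ ≤ (k : ℝ) + 1
          linarith
      rw [pwk, Set.indicator_of_mem this]; ring

theorem fin_E (hn : 3 ≤ dimR E) (p : ℝ) (hp : ((dimR E : ℝ) - 1) / 2 < p)
    (N : ℝ≥0∞) (hN : N ≠ ⊤) (V : E → ℂ) (hV : Measurable V)
    (h : FP p N fun x => ‖V x‖ₑ) (ρ l S a : ℝ) (hρ1 : 1 < ρ) (hρ2 : ρ < 2)
    (hl0 : 0 < l) (hl1 : l < 1) (hl : l ≤ ((dimR E : ℝ) - 1) * (2 / ρ - 1) / 2) (ha : a < 0)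
    (hab : -((dimR E : ℝ) * (2 / ρ - 1) - l) = 1 + 2 * a)
    (G : E × ℝ → ℂ) (hG : Src ρ l S G) (hft : ∀ s, Integrable (ft fun x => G (x, s))) :
    ∫⁻ t, ∫⁻ x, ‖∫ ξ, (starRingEnd ℂ) (ph x ξ) * (((‖ξ‖ ^ a : ℝ) : ℂ) * ft (hh G t) ξ)‖ₑ ^ 2 * ‖V x‖ₑ ≤
      CT E p ρ l * N * (∫⁻ s, sl ρ G s ^ (2 / (2 - l))) ^ (2 - l) := by
  have hm : ∀ k, Measurable fun z : E × ℝ => ‖V z.1‖ₑ * ‖SU (pwk a k) G z‖ₑ ^ 2 := fun k =>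
    (hV.comp measurable_fst).enorm.mul ((SU_meas (pwk a k) (mk_meas a k) G hG.meas).enorm.pow_const 2)
  have hlm : Measurable fun z : E × ℝ => Filter.liminf (fun k => ‖V z.1‖ₑ * ‖SU (pwk a k) G z‖ₑ ^ 2) Filter.atTop := Measurable.liminf hm
  calc _ ≤ ∫⁻ t, ∫⁻ x, Filter.liminf (fun k => ‖V x‖ₑ * ‖SU (pwk a k) G (x, t)‖ₑ ^ 2) Filter.atTop := by
        refine lintegral_mono fun t => lintegral_mono fun x => ?_
        rcases lim_or (by omega) ρ l S hρ1 hρ2 hl0 hl1 G hG hft a ha t x with h0 | h0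
        · simp only [h0]; simp
        · have h1 : Filter.Tendsto (fun k => ‖V x‖ₑ * ‖SU (pwk a k) G (x, t)‖ₑ ^ 2) Filter.atTop (nhds (‖V x‖ₑ * ‖∫ ξ, (starRingEnd ℂ) (ph x ξ) * (((‖ξ‖ ^ a : ℝ) : ℂ) * ft (hh G t) ξ)‖ₑ ^ 2)) :=
            ENNReal.Tendsto.const_mul ((ENNReal.continuous_pow 2).tendsto _ |>.comp ((continuous_enorm.tendsto _).comp h0)) (Or.inr enorm_ne_top)
          rw [h1.liminf_eq, mul_comm]
    _ = ∫⁻ z : E × ℝ, Filter.liminf (fun k => ‖V z.1‖ₑ * ‖SU (pwk a k) G z‖ₑ ^ 2) Filter.atTop := by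
        rw [Measure.volume_eq_prod, lintegral_prod_symm _ hlm.aemeasurable]
    _ ≤ Filter.liminf (fun k => ∫⁻ z : E × ℝ, ‖V z.1‖ₑ * ‖SU (pwk a k) G z‖ₑ ^ 2) Filter.atTop := lintegral_liminf_le hm
    _ ≤ _ := Filter.liminf_le_of_frequently_le' (Filter.Frequently.of_forall fun k =>
        SU_main hn p hp N hN V hV h ρ l S hρ1 hρ2 hl0 hl1 hl (pwk a k) (mk_meas a k) (mk_int a ha k) _ (mk_le a ha k) ofReal_ne_top (mk_sq a _ hab k) G hG)
end SE

/-- Weighted space-time `L²` estimate for the retarded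
inhomogeneous wave term. -/
theorem weighted_L2_retarded (n : ℕ) (hn : 3 ≤ n) (p q r q' r' σ : ℝ)
    (hp : ((n : ℝ) - 1) / 2 < p) (hq : 2 < q) (hr : 2 ≤ r)
    (hadm : 2 / q + ((n : ℝ) - 1) / r ≤ ((n : ℝ) - 1) / 2)
    (hσ : σ = 1 / q + (n : ℝ) / r - ((n : ℝ) - 1) / 2)
    (hq' : 1 / q + 1 / q' = 1) (hr' : 1 / r + 1 / r' = 1) :
    ∃ C > (0 : ℝ), ∀ V : EuclideanSpace ℝ (Fin n) → ℂ, Measurable V →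
      fpNorm n p V < ⊤ →
      ∀ G : EuclideanSpace ℝ (Fin n) → ℝ → ℂ,
        (∀ s : ℝ, IsSchwartz (fun x => G x s)) →
        Continuous (fun z : EuclideanSpace ℝ (Fin n) × ℝ => G z.1 z.2) →
        (∃ R : ℝ, ∀ x, ∀ s : ℝ, R < |s| → G x s = 0) →
        wtNorm n (fun x => (‖V x‖₊ : ℝ≥0∞))
            (fun x t => mOp n (powMult (σ - 1))
              (fun y => ∫ s in Set.Iic t, mOp n (sinMult (t - s)) (fun z => G z s) y) x) ≤
          ENNReal.ofReal C * fpNorm n p V ^ ((1 : ℝ) / 2) * mixedNorm n q' r' G := by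
  have hn3 : (3 : ℝ) ≤ n := by exact_mod_cast hn
  have hp0 : 0 < p := by linarith
  have hq0 : 0 < 1 / q := by positivity
  have hq2 : 1 / q < 1 / 2 := one_div_lt_one_div_of_lt (by norm_num) hq
  have hr0 : 0 < 1 / r := by positivity
  have hadm2 : 2 * (1 / q) + ((n : ℝ) - 1) * (1 / r) ≤ ((n : ℝ) - 1) / 2 := by
    rw [mul_one_div, mul_one_div]; exact hadm
  have hσ2 : σ = 1 / q + (n : ℝ) * (1 / r) - ((n : ℝ) - 1) / 2 := by rw [mul_one_div]; exact hσ
  have hr2 : 1 / r < 1 / 2 := by nlinarith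
  have hq1 : 1 / q' = 1 - 1 / q := by linarith
  have hr1 : 1 / r' = 1 - 1 / r := by linarith
  have hq'0 : 0 < q' := by rw [← one_div_pos]; linarith
  have hr'0 : 0 < r' := by rw [← one_div_pos]; linarith
  have hr'1 : 1 < r' := by
    have : 1 / r' < 1 := by linarith
    rwa [div_lt_one hr'0] at this
  have hr'2 : r' < 2 := by
    have : 1 / 2 < 1 / r' := by linarith
    exact (one_div_lt_one_div (by norm_num) hr'0).1 this
  set l : ℝ := 2 * (1 / q) with hl
  have hθ : 2 / r' - 1 = 1 - 2 * (1 / r) := by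
    rw [show 2 / r' = 2 * (1 / r') by ring, hr1]; ring
  have hl2 : 2 / (2 - l) = q' := by
    have : 2 - l = 2 * (1 / q') := by rw [hq1, hl]; ring
    rw [this]; field_simp
  have hl3 : 1 / q' = (2 - l) / 2 := by rw [hq1, hl]; ring
  have hd : dimR (EuclideanSpace ℝ (Fin n)) = n := finrank_euclideanSpace_fin
  set T := CT (EuclideanSpace ℝ (Fin n)) p r' l with hT
  have hTt : T ^ ((1 : ℝ) / 2) ≠ ⊤ := rpow_ne_top_of_nonneg (by norm_num) (CT_ne_top (by rw [hd]; exact hn) p r' l (by rw [hd]; exact hp) hr'1 hr'2)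
  refine ⟨(T ^ ((1 : ℝ) / 2)).toReal + 1, by positivity, fun V hV hVN G hGs hGc hGS => ?_⟩
  obtain ⟨S, hS⟩ := hGS
  set N := fpNorm n p V with hN
  have hC : T ^ ((1 : ℝ) / 2) ≤ ofR ((T ^ ((1 : ℝ) / 2)).toReal + 1) := by
    rw [ENNReal.ofReal_add (by positivity) zero_le_one, ENNReal.ofReal_toReal hTt]; exact le_self_add
  have hsup : ∀ (x : EuclideanSpace ℝ (Fin n)) (R : ℝ), 0 < R → ofR (R ^ (2 - n / p)) * (∫⁻ y in ball x R, ‖V y‖ₑ ^ p) ^ (1 / p) ≤ N := by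
    intro x R hR
    have : ofR (R ^ (2 - n / p)) * (∫⁻ y in ball x R, ofR (‖V y‖ ^ p)) ^ (1 / p) ≤ N :=
      le_iSup_of_le x (le_iSup_of_le R (le_iSup_of_le hR le_rfl))
    simp only [← ofReal_rpow_of_nonneg (norm_nonneg _) hp0.le, ofReal_norm] at this
    exact this
  have hFP : FP p N fun x => ‖V x‖ₑ := by
    intro x R hR
    rw [hd]
    have h1 : ofR (R ^ (2 - n / p)) * ofR (R ^ ((n : ℝ) / p - 2)) = 1 := by
      rw [← ENNReal.ofReal_mul (by positivity), ← Real.rpow_add hR]; simp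
    calc _ = (ofR (R ^ (2 - n / p)) * (∫⁻ y in ball x R, ‖V y‖ₑ ^ p) ^ (1 / p)) * ofR (R ^ ((n : ℝ) / p - 2)) := by
          rw [mul_right_comm, h1, one_mul]
      _ ≤ _ := mul_le_mul' (hsup x R hR) le_rfl
  set G' : EuclideanSpace ℝ (Fin n) × ℝ → ℂ := fun z => G z.1 z.2 with hG'
  have hmix : mixedNorm n q' r' G = (∫⁻ s, sl r' G' s ^ (2 / (2 - l))) ^ (1 / q') := by
    unfold mixedNorm sl
    rw [hl2]
    simp only [← rpow_mul, one_div_mul_eq_div]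
    rfl
  have hw : ∀ t x, mOp n (powMult (σ - 1)) (fun y => ∫ s in Set.Iic t, mOp n (sinMult (t - s)) (fun z => G z s) y) x =
      ∫ ξ, (starRingEnd ℂ) (ph x ξ) * (((‖ξ‖ ^ (σ - 1) : ℝ) : ℂ) * ft (hh G' t) ξ) := by
    intro t x
    have : (fun y => ∫ s in Set.Iic t, mOp n (sinMult (t - s)) (fun z => G z s) y) = hh G' t := by
      funext y
      unfold hh
      refine integral_congr_ae (of_forall fun s => ?_)
      exact mult_eq (sinMult (t - s)) (fun z => G z s) y
    rw [this]
    exact mult_eq (powMult (σ - 1)) (hh G' t) x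
  unfold wtNorm
  simp only [hw]
  by_cases hfin : ∫⁻ s, sl r' G' s ^ (2 / (2 - l)) = ⊤
  · by_cases hN0 : N = 0
    · have hV0 : ∀ᵐ y, V y = 0 := by
        have h1 : ∀ k : ℕ, ∀ᵐ y, y ∈ ball (0 : EuclideanSpace ℝ (Fin n)) ((k : ℝ) + 1) → V y = 0 := by
          intro k
          have h2 := hFP 0 ((k : ℝ) + 1) (by positivity)
          rw [hN0, zero_mul, nonpos_iff_eq_zero, ENNReal.rpow_eq_zero_iff_of_pos (by positivity), lintegral_eq_zero_iff (hV.enorm.pow_const p)] at h2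
          rw [← ae_restrict_iff' measurableSet_ball]
          filter_upwards [h2] with y hy
          simpa [ENNReal.rpow_eq_zero_iff_of_pos hp0] using hy
        filter_upwards [ae_all_iff.2 h1] with y hy
        obtain ⟨k, hk⟩ := exists_nat_ge ‖y‖
        exact hy k (mem_ball_zero_iff.2 (by linarith))
      refine le_of_eq_of_le (b := (0:ℝ≥0∞)) ?_ bot_le
      rw [ENNReal.rpow_eq_zero_iff_of_pos (by norm_num)]
      refine (lintegral_congr fun t => ?_).trans lintegral_zero
      refine (lintegral_congr_ae (hV0.mono fun y hy => ?_)).trans lintegral_zero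
      simp [hy]
    · refine le_of_le_of_eq le_top ?_
      rw [hmix, hfin, ENNReal.top_rpow_of_pos (by positivity), ENNReal.mul_top]
      refine mul_ne_zero (ENNReal.ofReal_pos.2 (by positivity)).ne' ?_
      rw [Ne, ENNReal.rpow_eq_zero_iff_of_pos (by norm_num)]; exact hN0
  · choose φ hφ using hGs
    have hφ' : ∀ s, (fun x => G x s) = φ s := fun s => funext (hφ s)
    have hSrc : Src r' l S G' := by
      refine ⟨hGc.measurable, fun s => ?_, fun R => ?_, fun z hz => hS _ _ hz, hfin⟩
      · change Integrable fun x => G x s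
        rw [hφ' s]; exact (φ s).integrable
      · obtain ⟨B, hB⟩ := ((isCompact_closedBall (0 : EuclideanSpace ℝ (Fin n)) R).prod (isCompact_Icc (a := -S) (b := S))).exists_bound_of_continuousOn hGc.continuousOn
        refine ⟨max B 0, fun z hz => ?_⟩
        by_cases h : S < |z.2|
        · rw [show G' z = 0 from hS _ _ h, norm_zero]; exact le_max_right _ _
        · exact (hB z ⟨mem_closedBall_zero_iff.2 hz, abs_le.1 (not_lt.1 h)⟩).trans (le_max_left _ _)
    have hft : ∀ s, Integrable (ft fun x => G' (x, s)) := fun s => by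
      have : ft (fun x => G' (x, s)) = 𝓕⁻ (φ s : EuclideanSpace ℝ (Fin n) → ℂ) := by
        funext w
        rw [finv_ph, ← hφ' s]
      rw [this, ← SchwartzMap.fourierInv_coe]; exact SchwartzMap.integrable _
    have key := fin_E (by rw [hd]; exact hn) p (by rw [hd]; exact hp) N hVN.ne V hV hFP r' l S (σ - 1) hr'1 hr'2 (by linarith) (by linarith)
      (by rw [hd, hθ]; nlinarith) (by nlinarith) (by rw [hd, hθ, hσ2, hl]; ring) G' hSrc hft
    rw [hmix, hl3]
    calc _ ≤ (T * N * (∫⁻ s, sl r' G' s ^ (2 / (2 - l))) ^ (2 - l)) ^ ((1 : ℝ) / 2) := by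
          refine rpow_le_rpow (le_of_eq_of_le ?_ key) (by norm_num)
          refine lintegral_congr fun t => lintegral_congr fun x => ?_
          rw [ENNReal.rpow_two]; rfl
      _ = T ^ ((1 : ℝ) / 2) * N ^ ((1 : ℝ) / 2) * (∫⁻ s, sl r' G' s ^ (2 / (2 - l))) ^ ((2 - l) / 2) := by
          rw [mul_rpow_of_nonneg _ _ (by norm_num), mul_rpow_of_nonneg _ _ (by norm_num), ← rpow_mul, mul_one_div]
      _ ≤ _ := mul_le_mul' (mul_le_mul' hC le_rfl) le_rfl

end
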